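/- Let K = ℚ(√−7) with ring of integers 𝒪_K = ℤ[(1+√−7)/2], and let λ = (1+√−7)/2 ∈ 𝒪_K, which has norm 2. There exist symmetric Hermitian modular forms g₄, g₆, g₈, g₁₀, g₁₁, g₁₂ for 𝒪_K of weights 4, 6, 8, 10, 11, 12 such that for every symmetric Hermitian modular form F for 𝒪_K there is a polynomial P ∈ ℂ[X₁,…,X₆] with (F − P(g₄, g₆, g₈, g₁₀, g₁₁, g₁₂)) ∘ φ_λ ≡ 0, i.e., F − P(g₄,…,g₁₂) vanishes on the Heegner divisor ℋ₂. -/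

import Mathlib

noncomputable section

open Matrix Filter Topology
open scoped ComplexOrder

attribute [local instance] Matrix.normedAddCommGroup Matrix.normedSpace

/-- The algebraic number (1 + √(-d))/2 = (1 + i·√d)/2 , viewed in ℂ. -/
def omg (d : ℕ) : ℂ := (1 + Complex.I * (Real.sqrt d : ℝ)) / 2

/-- The ring of integers ℤ[(1+√(-d))/2] of ℚ(√(-d)) (for d ≡ 3 mod 4), as a subset of ℂ. -/
def ringInts (d : ℕ) : Set ℂ := {z | ∃ a b : ℤ, z = (a : ℂ) + (b : ℂ) * omg d}

/-- The Hermitian upper half-space of degree two: 2×2 complex matrices τ such that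
(τ - conj(τ)ᵀ)/(2i) is positive definite. -/
def HH2 : Set (Matrix (Fin 2) (Fin 2) ℂ) :=
  {τ | (Matrix.of fun i j => (τ i j - (starRingEnd ℂ) (τ j i)) / (2 * Complex.I)).PosDef}

/-- The matrix J = [[0, -I₂],[I₂, 0]]. -/
def Jmat : Matrix (Fin 4) (Fin 4) ℂ :=
  !![0,0,-1,0; 0,0,0,-1; 1,0,0,0; 0,1,0,0]

/-- Upper-left 2×2 block. -/
def blkA (M : Matrix (Fin 4) (Fin 4) ℂ) : Matrix (Fin 2) (Fin 2) ℂ :=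
  !![M 0 0, M 0 1; M 1 0, M 1 1]
/-- Upper-right 2×2 block. -/
def blkB (M : Matrix (Fin 4) (Fin 4) ℂ) : Matrix (Fin 2) (Fin 2) ℂ :=
  !![M 0 2, M 0 3; M 1 2, M 1 3]
/-- Lower-left 2×2 block. -/
def blkC (M : Matrix (Fin 4) (Fin 4) ℂ) : Matrix (Fin 2) (Fin 2) ℂ :=
  !![M 2 0, M 2 1; M 3 0, M 3 1]
/-- Lower-right 2×2 block. -/
def blkD (M : Matrix (Fin 4) (Fin 4) ℂ) : Matrix (Fin 2) (Fin 2) ℂ :=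
  !![M 2 2, M 2 3; M 3 2, M 3 3]

/-- Membership in SU_{2,2}(𝒪_K): entries in 𝒪_K, determinant 1, and Mᵀ·J·conj(M) = J. -/
def inSU (d : ℕ) (M : Matrix (Fin 4) (Fin 4) ℂ) : Prop :=
  (∀ i j, M i j ∈ ringInts d) ∧ M.det = 1 ∧
    Mᵀ * Jmat * M.map (starRingEnd ℂ) = Jmat

/-- Möbius action M·τ = (aτ+b)(cτ+d)⁻¹. -/
def moebius (M : Matrix (Fin 4) (Fin 4) ℂ) (τ : Matrix (Fin 2) (Fin 2) ℂ) :
    Matrix (Fin 2) (Fin 2) ℂ :=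
  (blkA M * τ + blkB M) * (blkC M * τ + blkD M)⁻¹

/-- A Hermitian modular form of weight k for 𝒪_K, K = ℚ(√(-d)): a holomorphic function on
𝐇₂ satisfying F(M·τ) = det(cτ+d)^k·F(τ) for all M ∈ SU_{2,2}(𝒪_K). -/
def IsHMF (d k : ℕ) (F : Matrix (Fin 2) (Fin 2) ℂ → ℂ) : Prop :=
  DifferentiableOn ℂ F HH2 ∧
    ∀ M, inSU d M → ∀ τ ∈ HH2,
      F (moebius M τ) = (blkC M * τ + blkD M).det ^ k * F τ

/-- A symmetric Hermitian modular form: F(τᵀ) = (-1)^k F(τ). -/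
def IsSymHMF (d k : ℕ) (F : Matrix (Fin 2) (Fin 2) ℂ → ℂ) : Prop :=
  IsHMF d k F ∧ ∀ τ ∈ HH2, F τᵀ = (-1) ^ k * F τ

/-- A skew-symmetric Hermitian modular form: F(τᵀ) = -(-1)^k F(τ). -/
def IsSkewHMF (d k : ℕ) (F : Matrix (Fin 2) (Fin 2) ℂ → ℂ) : Prop :=
  IsHMF d k F ∧ ∀ τ ∈ HH2, F τᵀ = -((-1) ^ k * F τ)

/-- The embedding φ_λ of the Siegel upper half-space into 𝐇₂ given by
[[τ, z],[z, w]] ↦ [[τ, conj(λ)z],[λz, ℓw]] with ℓ = λ·conj(λ). -/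
def phiLam (lam : ℂ) (τ : Matrix (Fin 2) (Fin 2) ℂ) : Matrix (Fin 2) (Fin 2) ℂ :=
  !![τ 0 0, (starRingEnd ℂ) lam * τ 0 1;
     lam * τ 0 1, (lam * (starRingEnd ℂ) lam) * τ 1 1]

lemma sqrt_seven_sq : ((Real.sqrt (7 : ℕ) : ℝ) : ℂ) ^ 2 = 7 := by
  rw [← Complex.ofReal_pow, Real.sq_sqrt (by norm_num)]; norm_num

lemma omg_sq : omg 7 ^ 2 = omg 7 - 2 := by
  have h := sqrt_seven_sq
  unfold omg
  linear_combination (1 / 4 * Complex.I ^ 2) * h + 7 / 4 * Complex.I_sq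

lemma conj_omg : (starRingEnd ℂ) (omg 7) = 1 - omg 7 := by
  unfold omg
  simp only [map_div₀, map_add, map_mul, map_one, Complex.conj_I, Complex.conj_ofReal, map_ofNat]
  ring

lemma omg_mul_conj : omg 7 * (starRingEnd ℂ) (omg 7) = 2 := by
  rw [conj_omg]; linear_combination -omg_sq

lemma omg_re : (omg 7).re = 1 / 2 := by
  simp [omg]

lemma omg_im : (omg 7).im = Real.sqrt 7 / 2 := by
  simp [omg]

lemma intCast_mem_ringInts (n : ℤ) : (n : ℂ) ∈ ringInts 7 := ⟨n, 0, by simp⟩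

lemma zero_mem_ringInts : (0 : ℂ) ∈ ringInts 7 := ⟨0, 0, by simp⟩

lemma one_mem_ringInts : (1 : ℂ) ∈ ringInts 7 := ⟨1, 0, by simp⟩

lemma omg_mem_ringInts : omg 7 ∈ ringInts 7 := ⟨0, 1, by simp⟩

lemma add_mem_ringInts {x y : ℂ} (hx : x ∈ ringInts 7) (hy : y ∈ ringInts 7) :
    x + y ∈ ringInts 7 := by
  obtain ⟨a, b, rfl⟩ := hx
  obtain ⟨c, d, rfl⟩ := hy
  exact ⟨a + c, b + d, by push_cast; ring⟩

lemma neg_mem_ringInts {x : ℂ} (hx : x ∈ ringInts 7) : -x ∈ ringInts 7 := by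
  obtain ⟨a, b, rfl⟩ := hx
  exact ⟨-a, -b, by push_cast; ring⟩

lemma sub_mem_ringInts {x y : ℂ} (hx : x ∈ ringInts 7) (hy : y ∈ ringInts 7) :
    x - y ∈ ringInts 7 := by
  rw [sub_eq_add_neg]; exact add_mem_ringInts hx (neg_mem_ringInts hy)

lemma mul_mem_ringInts {x y : ℂ} (hx : x ∈ ringInts 7) (hy : y ∈ ringInts 7) :
    x * y ∈ ringInts 7 := by
  obtain ⟨a, b, rfl⟩ := hx
  obtain ⟨c, d, rfl⟩ := hy
  exact ⟨a * c - 2 * b * d, a * d + b * c + b * d, by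
    push_cast; linear_combination (b : ℂ) * d * omg_sq⟩

lemma conj_mem_ringInts {x : ℂ} (hx : x ∈ ringInts 7) : (starRingEnd ℂ) x ∈ ringInts 7 := by
  obtain ⟨a, b, rfl⟩ := hx
  exact ⟨a + b, -b, by simp [conj_omg]; ring⟩

/-- The real elements of the ring of integers are the rational integers. -/
lemma eq_int_of_conj_eq {x : ℂ} (hx : x ∈ ringInts 7) (h : (starRingEnd ℂ) x = x) :
    ∃ n : ℤ, x = n := by
  obtain ⟨a, b, rfl⟩ := hx
  have h2 := congrArg Complex.im h
  have h7 : Real.sqrt 7 ≠ 0 := by positivity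
  simp [omg_im] at h2
  have hb : (b : ℝ) = 0 := by
    have : (b : ℝ) * Real.sqrt 7 = 0 := by linarith
    exact (mul_eq_zero.mp this).resolve_right h7
  have hb' : b = 0 := by exact_mod_cast hb
  exact ⟨a, by simp [hb']⟩

lemma normSq_int {x : ℂ} (hx : x ∈ ringInts 7) : ∃ n : ℕ, Complex.normSq x = n := by
  obtain ⟨n, hn⟩ := eq_int_of_conj_eq (mul_mem_ringInts hx (conj_mem_ringInts hx))
    (by simp [mul_comm])
  rw [Complex.mul_conj] at hn
  have hn' : Complex.normSq x = n := by exact_mod_cast hn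
  have h0 : 0 ≤ n := by
    have := Complex.normSq_nonneg x
    rw [hn'] at this; exact_mod_cast this
  exact ⟨n.toNat, by rw [hn']; exact_mod_cast (Int.toNat_of_nonneg h0).symm⟩

/-- The ring of integers is norm-Euclidean. -/
lemma exists_euclid (z : ℂ) : ∃ q ∈ ringInts 7, Complex.normSq (z - q) < 1 := by
  set b : ℤ := round (z.im / (Real.sqrt 7 / 2)) with hb
  set a : ℤ := round (z.re - b / 2) with ha
  refine ⟨a + b * omg 7, ⟨a, b, rfl⟩, ?_⟩
  have h7 : 0 < Real.sqrt 7 := by positivity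
  have h77 : Real.sqrt 7 ^ 2 = 7 := Real.sq_sqrt (by norm_num)
  have h1 := abs_sub_round (z.im / (Real.sqrt 7 / 2))
  have h2 := abs_sub_round (z.re - b / 2)
  rw [← hb] at h1
  rw [← ha] at h2
  set u := z.im / (Real.sqrt 7 / 2) - b with hu
  set v := z.re - b / 2 - a with hv
  have e1 : (z - (a + b * omg 7)).re = v := by
    simp [omg_re, hv]; ring
  have e2 : (z - (a + b * omg 7)).im = u * (Real.sqrt 7 / 2) := by
    simp [omg_im, hu]; field_simp
  rw [Complex.normSq_apply, e1, e2]
  have hu2 : u ^ 2 ≤ 1 / 4 := by nlinarith [abs_le.mp h1]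
  have hv2 : v ^ 2 ≤ 1 / 4 := by nlinarith [abs_le.mp h2]
  nlinarith

lemma exists_euclid_div {x y : ℂ} (hy : y ≠ 0) :
    ∃ q ∈ ringInts 7, Complex.normSq (x - q * y) < Complex.normSq y := by
  obtain ⟨q, hq, h⟩ := exists_euclid (x / y)
  refine ⟨q, hq, ?_⟩
  have : x - q * y = (x / y - q) * y := by field_simp
  rw [this, Complex.normSq_mul]
  exact mul_lt_of_lt_one_left (Complex.normSq_pos.mpr hy) h

/-- Hermitian imaginary part. -/
def hIm (τ : Matrix (Fin 2) (Fin 2) ℂ) : Matrix (Fin 2) (Fin 2) ℂ :=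
  (2 * Complex.I)⁻¹ • (τ - τᴴ)

lemma mem_HH2_iff_hIm {τ : Matrix (Fin 2) (Fin 2) ℂ} : τ ∈ HH2 ↔ (hIm τ).PosDef := by
  have : (Matrix.of fun i j => (τ i j - (starRingEnd ℂ) (τ j i)) / (2 * Complex.I)) = hIm τ := by
    ext i j; simp [hIm, div_eq_inv_mul]
  unfold HH2
  rw [Set.mem_ofPred_eq, this]

lemma hIm_isHermitian (τ : Matrix (Fin 2) (Fin 2) ℂ) : (hIm τ).IsHermitian := by
  ext i j
  simp [hIm]
  ring

lemma mem_HH2_iff {τ : Matrix (Fin 2) (Fin 2) ℂ} : τ ∈ HH2 ↔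
    0 < (τ 0 0).im ∧ 0 < (τ 1 1).im ∧
      Complex.normSq (τ 0 1 - (starRingEnd ℂ) (τ 1 0)) < 4 * ((τ 0 0).im * (τ 1 1).im) := by
  have d0 : ∀ i, hIm τ i i = ((τ i i).im : ℂ) := by
    intro i
    simp only [hIm, Matrix.smul_apply, Matrix.sub_apply, conjTranspose_apply, smul_eq_mul]
    apply Complex.ext <;> simp <;> ring
  have hdet : (hIm τ).det = (((τ 0 0).im * (τ 1 1).im
      - Complex.normSq (τ 0 1 - (starRingEnd ℂ) (τ 1 0)) / 4 : ℝ) : ℂ) := by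
    rw [det_fin_two, d0, d0]
    push_cast
    rw [← Complex.mul_conj]
    simp only [hIm, Matrix.smul_apply, Matrix.sub_apply, conjTranspose_apply, smul_eq_mul, map_sub,
      Complex.conj_conj, Complex.star_def, mul_inv, Complex.inv_I]
    linear_combination (-1/4 * (τ 0 1 - (starRingEnd ℂ) (τ 1 0)) *
      (τ 1 0 - (starRingEnd ℂ) (τ 0 1))) * Complex.I_sq
  rw [mem_HH2_iff_hIm]
  constructor
  · intro h
    have h0 := h.diag_pos (i := 0)
    have h1 := h.diag_pos (i := 1)
    have h2 := h.det_pos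
    rw [d0] at h0 h1
    rw [hdet] at h2
    have h0' : 0 < (τ 0 0).im := by exact_mod_cast h0
    have h1' : 0 < (τ 1 1).im := by exact_mod_cast h1
    have h2' := Complex.zero_lt_real.mp h2
    exact ⟨h0', h1', by linarith⟩
  · rintro ⟨h0, h1, h2⟩
    refine Matrix.PosDef.of_dotProduct_mulVec_pos (hIm_isHermitian τ) ?_
    intro x hx
    set p := (τ 0 0).im with hp
    set r := (τ 1 1).im with hr
    set q := hIm τ 0 1 with hq
    have e10 : hIm τ 1 0 = (starRingEnd ℂ) q := ((hIm_isHermitian τ).apply 1 0).symm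
    have hqn : Complex.normSq q < p * r := by
      have : Complex.normSq q = p * r - (p * r - Complex.normSq (τ 0 1 - (starRingEnd ℂ) (τ 1 0)) / 4) := by
        have h3 := hdet
        rw [det_fin_two, d0, d0, e10, Complex.mul_conj] at h3
        have h4 : p * r - Complex.normSq q = p * r - Complex.normSq (τ 0 1 - (starRingEnd ℂ) (τ 1 0)) / 4 := by
          exact_mod_cast h3
        linarith
      rw [this]; linarith
    have key : star x ⬝ᵥ hIm τ *ᵥ x = ((p * Complex.normSq (x 0) + r * Complex.normSq (x 1)
        + 2 * ((starRingEnd ℂ) (x 0) * q * x 1).re : ℝ) : ℂ) := by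
      push_cast
      rw [← Complex.mul_conj, ← Complex.mul_conj, Complex.re_eq_add_conj]
      simp only [dotProduct, mulVec, Fin.sum_univ_two, d0, e10, Pi.star_apply, Complex.star_def, map_mul,
        Complex.conj_conj]
      ring
    rw [key, Complex.zero_lt_real]
    have hcs : ((starRingEnd ℂ) (x 0) * q * x 1).re ^ 2 ≤
        Complex.normSq (x 0) * Complex.normSq q * Complex.normSq (x 1) := by
      have := Complex.normSq_apply ((starRingEnd ℂ) (x 0) * q * x 1)
      rw [Complex.normSq_mul, Complex.normSq_mul, Complex.normSq_conj] at this
      nlinarith [sq_nonneg ((starRingEnd ℂ) (x 0) * q * x 1).im]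
    set c := ((starRingEnd ℂ) (x 0) * q * x 1).re
    have hA := Complex.normSq_nonneg (x 0)
    have hB := Complex.normSq_nonneg (x 1)
    set a := Complex.normSq (x 0) with ha
    set b := Complex.normSq (x 1) with hb
    by_cases hab : a * b = 0
    · have hc : c = 0 := by
        have : c ^ 2 ≤ 0 := by
          calc c ^ 2 ≤ a * Complex.normSq q * b := hcs
            _ = a * b * Complex.normSq q := by ring
            _ = 0 := by rw [hab]; ring
        exact pow_eq_zero_iff (two_ne_zero) |>.mp (le_antisymm this (sq_nonneg _))
      rw [hc]
      have : 0 < a ∨ 0 < b := by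
        by_contra hcon
        push Not at hcon
        have ha0 : a = 0 := le_antisymm hcon.1 hA
        have hb0 : b = 0 := le_antisymm hcon.2 hB
        apply hx
        ext i
        fin_cases i
        · exact Complex.normSq_eq_zero.mp ha0
        · exact Complex.normSq_eq_zero.mp hb0
      rcases this with h | h
      · have := mul_pos h0 h
        have := mul_nonneg h1.le hB
        linarith
      · have := mul_pos h1 h
        have := mul_nonneg h0.le hA
        linarith
    · have hab' : 0 < a * b := lt_of_le_of_ne (mul_nonneg hA hB) (Ne.symm hab)
      have h5 : c ^ 2 < (p * a) * (r * b) := by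
        calc c ^ 2 ≤ a * Complex.normSq q * b := hcs
          _ = a * b * Complex.normSq q := by ring
          _ < a * b * (p * r) := mul_lt_mul_of_pos_left hqn hab'
          _ = _ := by ring
      have h6 : 0 ≤ p * a := mul_nonneg h0.le hA
      have h7 : 0 ≤ r * b := mul_nonneg h1.le hB
      by_contra hcon
      push Not at hcon
      nlinarith [sq_nonneg (p * a - r * b)]

/-- The `4 × 2` matrix with blocks `Z` and `1`. -/
def stack (Z : Matrix (Fin 2) (Fin 2) ℂ) : Matrix (Fin 4) (Fin 2) ℂ :=
  !![Z 0 0, Z 0 1; Z 1 0, Z 1 1; 1, 0; 0, 1]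

/-- Upper half of a `4 × 2` matrix. -/
def upHalf (X : Matrix (Fin 4) (Fin 2) ℂ) : Matrix (Fin 2) (Fin 2) ℂ :=
  !![X 0 0, X 0 1; X 1 0, X 1 1]

/-- Lower half of a `4 × 2` matrix. -/
def loHalf (X : Matrix (Fin 4) (Fin 2) ℂ) : Matrix (Fin 2) (Fin 2) ℂ :=
  !![X 2 0, X 2 1; X 3 0, X 3 1]

lemma upper_mul_stack (M : Matrix (Fin 4) (Fin 4) ℂ) (Z : Matrix (Fin 2) (Fin 2) ℂ) :
    upHalf (M * stack Z) = blkA M * Z + blkB M := by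
  ext i j
  fin_cases i <;> fin_cases j <;>
    simp [upHalf, stack, blkA, blkB, Matrix.mul_apply, Fin.sum_univ_four, Matrix.vecMul, dotProduct]

lemma lower_mul_stack (M : Matrix (Fin 4) (Fin 4) ℂ) (Z : Matrix (Fin 2) (Fin 2) ℂ) :
    loHalf (M * stack Z) = blkC M * Z + blkD M := by
  ext i j
  fin_cases i <;> fin_cases j <;>
    simp [loHalf, stack, blkC, blkD, Matrix.mul_apply, Fin.sum_univ_four, Matrix.vecMul, dotProduct]

lemma upper_mul (X : Matrix (Fin 4) (Fin 2) ℂ) (Q : Matrix (Fin 2) (Fin 2) ℂ) :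
    upHalf (X * Q) = upHalf X * Q := by
  ext i j
  fin_cases i <;> fin_cases j <;> simp [upHalf, Matrix.mul_apply]

lemma lower_mul (X : Matrix (Fin 4) (Fin 2) ℂ) (Q : Matrix (Fin 2) (Fin 2) ℂ) :
    loHalf (X * Q) = loHalf X * Q := by
  ext i j
  fin_cases i <;> fin_cases j <;> simp [loHalf, Matrix.mul_apply]

lemma upper_stack (Z : Matrix (Fin 2) (Fin 2) ℂ) : upHalf (stack Z) = Z := by
  ext i j
  fin_cases i <;> fin_cases j <;> simp [upHalf, stack]

lemma lower_stack (Z : Matrix (Fin 2) (Fin 2) ℂ) : loHalf (stack Z) = 1 := by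
  ext i j
  fin_cases i <;> fin_cases j <;> simp [loHalf, stack]

lemma ext_halves {X Y : Matrix (Fin 4) (Fin 2) ℂ} (h1 : upHalf X = upHalf Y)
    (h2 : loHalf X = loHalf Y) : X = Y := by
  ext i j
  have a := congrFun (congrFun h1 0) j
  have b := congrFun (congrFun h1 1) j
  have c := congrFun (congrFun h2 0) j
  have d := congrFun (congrFun h2 1) j
  fin_cases i <;> fin_cases j <;> simp_all [upHalf, loHalf]

lemma transpose_mul_Jmat_mul (X : Matrix (Fin 4) (Fin 2) ℂ) :
    (Xᵀ * Jmat * X.map (starRingEnd ℂ)).map (starRingEnd ℂ) =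
      (loHalf X)ᴴ * upHalf X - (upHalf X)ᴴ * loHalf X := by
  ext i j
  fin_cases i <;> fin_cases j <;>
    simp [upHalf, loHalf, Jmat, Matrix.mul_apply, Fin.sum_univ_four] <;> ring

/-- The denominator of the action. -/
def denomM (M : Matrix (Fin 4) (Fin 4) ℂ) (Z : Matrix (Fin 2) (Fin 2) ℂ) :
    Matrix (Fin 2) (Fin 2) ℂ := blkC M * Z + blkD M

/-- The numerator of the action. -/
def numM (M : Matrix (Fin 4) (Fin 4) ℂ) (Z : Matrix (Fin 2) (Fin 2) ℂ) :
    Matrix (Fin 2) (Fin 2) ℂ := blkA M * Z + blkB M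

lemma denomM_numM {M : Matrix (Fin 4) (Fin 4) ℂ} (hM : inSU 7 M)
    (Z : Matrix (Fin 2) (Fin 2) ℂ) :
    (denomM M Z)ᴴ * numM M Z - (numM M Z)ᴴ * denomM M Z = Z - Zᴴ := by
  have h := transpose_mul_Jmat_mul (M * stack Z)
  have h2 : (M * stack Z)ᵀ * Jmat * (M * stack Z).map (starRingEnd ℂ) =
      (stack Z)ᵀ * Jmat * (stack Z).map (starRingEnd ℂ) := by
    rw [Matrix.map_mul, transpose_mul]
    conv_rhs => rw [← hM.2.2]
    simp only [Matrix.mul_assoc]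
  rw [h2, transpose_mul_Jmat_mul, upper_stack, lower_stack, upper_mul_stack, lower_mul_stack] at h
  simpa [denomM, numM] using h.symm

lemma det_denomM_ne_zero {M : Matrix (Fin 4) (Fin 4) ℂ} (hM : inSU 7 M)
    {Z : Matrix (Fin 2) (Fin 2) ℂ} (hZ : Z ∈ HH2) : (denomM M Z).det ≠ 0 := by
  intro h0
  obtain ⟨x, hx, hQ⟩ := Matrix.exists_mulVec_eq_zero_iff.mpr h0
  have hpos := (mem_HH2_iff_hIm.mp hZ).dotProduct_mulVec_pos hx
  have hz : star x ⬝ᵥ ((hIm Z) *ᵥ x) = 0 := by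
    rw [hIm, ← denomM_numM hM Z, Matrix.smul_mulVec, Matrix.sub_mulVec, ← Matrix.mulVec_mulVec,
      ← Matrix.mulVec_mulVec, hQ, Matrix.mulVec_zero, sub_zero, dotProduct_smul,
      Matrix.dotProduct_mulVec, ← Matrix.star_mulVec, hQ]
    simp
  rw [hz] at hpos
  exact lt_irrefl _ hpos

lemma moebius_mem {M : Matrix (Fin 4) (Fin 4) ℂ} (hM : inSU 7 M)
    {Z : Matrix (Fin 2) (Fin 2) ℂ} (hZ : Z ∈ HH2) : moebius M Z ∈ HH2 := by
  have hd := det_denomM_ne_zero hM hZ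
  have hu : IsUnit (denomM M Z).det := isUnit_iff_ne_zero.mpr hd
  set Q := denomM M Z with hQ
  set P := numM M Z with hP
  have hmob : moebius M Z = P * Q⁻¹ := rfl
  have h1 : hIm (moebius M Z) = (Q⁻¹)ᴴ * hIm Z * Q⁻¹ := by
    rw [hIm, hIm, ← denomM_numM hM Z, ← hQ, ← hP, hmob, Matrix.mul_smul, Matrix.smul_mul,
      Matrix.mul_sub, Matrix.sub_mul, conjTranspose_mul]
    congr 2
    · rw [← Matrix.mul_assoc, ← conjTranspose_mul, Matrix.mul_nonsing_inv Q hu]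
      simp
    · rw [Matrix.mul_assoc, Matrix.mul_assoc, Matrix.mul_nonsing_inv Q hu, Matrix.mul_one]
  rw [mem_HH2_iff_hIm, h1]
  refine (mem_HH2_iff_hIm.mp hZ).conjTranspose_mul_mul_same ?_
  have : IsUnit Q⁻¹ := by
    rw [Matrix.isUnit_nonsing_inv_iff, Matrix.isUnit_iff_isUnit_det]; exact hu
  exact Matrix.mulVec_injective_iff_isUnit.mpr this

lemma mul_stack {M : Matrix (Fin 4) (Fin 4) ℂ} (hM : inSU 7 M)
    {Z : Matrix (Fin 2) (Fin 2) ℂ} (hZ : Z ∈ HH2) :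
    M * stack Z = stack (moebius M Z) * denomM M Z := by
  have hu : IsUnit (denomM M Z).det := isUnit_iff_ne_zero.mpr (det_denomM_ne_zero hM hZ)
  apply ext_halves
  · rw [upper_mul_stack, upper_mul, upper_stack]
    change _ = numM M Z * (denomM M Z)⁻¹ * denomM M Z
    rw [Matrix.mul_assoc, Matrix.nonsing_inv_mul _ hu, Matrix.mul_one]
    rfl
  · rw [lower_mul_stack, lower_mul, lower_stack, Matrix.one_mul]
    rfl

lemma denomM_mul {M N : Matrix (Fin 4) (Fin 4) ℂ} (hN : inSU 7 N)
    {Z : Matrix (Fin 2) (Fin 2) ℂ} (hZ : Z ∈ HH2) :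
    denomM (M * N) Z = denomM M (moebius N Z) * denomM N Z := by
  have h1 := lower_mul_stack (M * N) Z
  rw [Matrix.mul_assoc, mul_stack hN hZ, ← Matrix.mul_assoc, lower_mul, lower_mul_stack] at h1
  exact h1.symm

lemma numM_mul {M N : Matrix (Fin 4) (Fin 4) ℂ} (hN : inSU 7 N)
    {Z : Matrix (Fin 2) (Fin 2) ℂ} (hZ : Z ∈ HH2) :
    numM (M * N) Z = numM M (moebius N Z) * denomM N Z := by
  have h1 := upper_mul_stack (M * N) Z
  rw [Matrix.mul_assoc, mul_stack hN hZ, ← Matrix.mul_assoc, upper_mul, upper_mul_stack] at h1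
  exact h1.symm

lemma moebius_mul {M N : Matrix (Fin 4) (Fin 4) ℂ} (hN : inSU 7 N)
    {Z : Matrix (Fin 2) (Fin 2) ℂ} (hZ : Z ∈ HH2) :
    moebius (M * N) Z = moebius M (moebius N Z) := by
  have hu : IsUnit (denomM N Z).det := isUnit_iff_ne_zero.mpr (det_denomM_ne_zero hN hZ)
  change numM (M * N) Z * (denomM (M * N) Z)⁻¹ = numM M _ * (denomM M _)⁻¹
  rw [numM_mul hN hZ, denomM_mul hN hZ, Matrix.mul_inv_rev, Matrix.mul_assoc,
    ← Matrix.mul_assoc (denomM N Z), Matrix.mul_nonsing_inv _ hu, Matrix.one_mul]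

lemma sum_mem_ringInts {ι : Type*} (s : Finset ι) {f : ι → ℂ} (h : ∀ i ∈ s, f i ∈ ringInts 7) :
    ∑ i ∈ s, f i ∈ ringInts 7 := by
  classical
  induction s using Finset.induction_on with
  | empty => simpa using zero_mem_ringInts
  | insert a s ha ih =>
    rw [Finset.sum_insert ha]
    exact add_mem_ringInts (h _ (by simp)) (ih fun i hi => h i (by simp [hi]))

lemma inSU_mul {M N : Matrix (Fin 4) (Fin 4) ℂ} (hM : inSU 7 M) (hN : inSU 7 N) :
    inSU 7 (M * N) := by
  refine ⟨fun i j => ?_, ?_, ?_⟩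
  · rw [Matrix.mul_apply]
    exact sum_mem_ringInts _ fun l _ => mul_mem_ringInts (hM.1 i l) (hN.1 l j)
  · rw [det_mul, hM.2.1, hN.2.1, one_mul]
  · rw [Matrix.map_mul, transpose_mul]
    conv_rhs => rw [← hN.2.2, ← hM.2.2]
    simp only [Matrix.mul_assoc]

/-- `F` transforms under `M` with weight `k`. -/
def TransF (k : ℕ) (F : Matrix (Fin 2) (Fin 2) ℂ → ℂ) (M : Matrix (Fin 4) (Fin 4) ℂ) : Prop :=
  ∀ τ ∈ HH2, F (moebius M τ) = (denomM M τ).det ^ k * F τ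

lemma TransF.cancel {k : ℕ} {F : Matrix (Fin 2) (Fin 2) ℂ → ℂ} {M N : Matrix (Fin 4) (Fin 4) ℂ}
    (hM : inSU 7 M) (hN : inSU 7 N) (h1 : TransF k F M) (h2 : TransF k F (M * N)) :
    TransF k F N := by
  intro τ hτ
  have e1 := h2 τ hτ
  have hm := moebius_mem hN hτ
  rw [moebius_mul hN hτ, h1 _ hm, denomM_mul hN hτ, det_mul, mul_pow, mul_assoc] at e1
  exact mul_left_cancel₀ (pow_ne_zero _ (det_denomM_ne_zero hM hm)) e1

/-- Translation by a Hermitian matrix. -/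
def genT (a : ℤ) (s : ℂ) (d : ℤ) : Matrix (Fin 4) (Fin 4) ℂ :=
  !![1, 0, a, s; 0, 1, (starRingEnd ℂ) s, d; 0, 0, 1, 0; 0, 0, 0, 1]

/-- Elementary unimodular substitution. -/
def genE (m : ℂ) : Matrix (Fin 4) (Fin 4) ℂ :=
  !![1, m, 0, 0; 0, 1, 0, 0; 0, 0, 1, 0; 0, 0, -(starRingEnd ℂ) m, 1]

/-- Signed swap of the two coordinates. -/
def genW : Matrix (Fin 4) (Fin 4) ℂ :=
  !![0, 1, 0, 0; -1, 0, 0, 0; 0, 0, 0, 1; 0, 0, -1, 0]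

/-- Inversion in the first variable. -/
def genJ : Matrix (Fin 4) (Fin 4) ℂ :=
  !![0, 0, -1, 0; 0, 1, 0, 0; 1, 0, 0, 0; 0, 0, 0, 1]

lemma SU_iff_aux {M : Matrix (Fin 4) (Fin 4) ℂ} (i j : Fin 4) :
    (Mᵀ * Jmat * M.map (starRingEnd ℂ)) i j = -(M 0 i * (starRingEnd ℂ) (M 2 j))
      - M 1 i * (starRingEnd ℂ) (M 3 j) + M 2 i * (starRingEnd ℂ) (M 0 j)
      + M 3 i * (starRingEnd ℂ) (M 1 j) := by
  simp [Jmat, Matrix.mul_apply, Fin.sum_univ_four]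
  ring

lemma inSU_rel {M : Matrix (Fin 4) (Fin 4) ℂ} (hM : inSU 7 M) (i j : Fin 4) :
    -(M 0 i * (starRingEnd ℂ) (M 2 j))
      - M 1 i * (starRingEnd ℂ) (M 3 j) + M 2 i * (starRingEnd ℂ) (M 0 j)
      + M 3 i * (starRingEnd ℂ) (M 1 j) = Jmat i j := by
  rw [← SU_iff_aux, hM.2.2]

lemma inSU_genT (a : ℤ) {s : ℂ} (hs : s ∈ ringInts 7) (d : ℤ) : inSU 7 (genT a s d) := by
  refine ⟨fun i j => ?_, ?_, ?_⟩
  · fin_cases i <;> fin_cases j <;> simp [genT, zero_mem_ringInts, one_mem_ringInts,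
      intCast_mem_ringInts, hs, conj_mem_ringInts hs]
  · simp [genT, Matrix.det_succ_row_zero, Fin.sum_univ_succ, Fin.succAbove]
  · ext i j
    rw [SU_iff_aux]
    fin_cases i <;> fin_cases j <;> simp [genT, Jmat]

lemma inSU_genE {m : ℂ} (hm : m ∈ ringInts 7) : inSU 7 (genE m) := by
  refine ⟨fun i j => ?_, ?_, ?_⟩
  · fin_cases i <;> fin_cases j <;> simp [genE, zero_mem_ringInts, one_mem_ringInts,
      hm, neg_mem_ringInts (conj_mem_ringInts hm)]
  · simp [genE, Matrix.det_succ_row_zero, Fin.sum_univ_succ, Fin.succAbove]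
  · ext i j
    rw [SU_iff_aux]
    fin_cases i <;> fin_cases j <;> simp [genE, Jmat]

lemma inSU_genW : inSU 7 genW := by
  refine ⟨fun i j => ?_, ?_, ?_⟩
  · fin_cases i <;> fin_cases j <;> simp [genW, zero_mem_ringInts, one_mem_ringInts,
      neg_mem_ringInts one_mem_ringInts]
  · simp [genW, Matrix.det_succ_row_zero, Fin.sum_univ_succ, Fin.succAbove]
  · ext i j
    rw [SU_iff_aux]
    fin_cases i <;> fin_cases j <;> simp [genW, Jmat]

lemma inSU_genJ : inSU 7 genJ := by
  refine ⟨fun i j => ?_, ?_, ?_⟩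
  · fin_cases i <;> fin_cases j <;> simp [genJ, zero_mem_ringInts, one_mem_ringInts,
      neg_mem_ringInts one_mem_ringInts]
  · simp [genJ, Matrix.det_succ_row_zero, Fin.sum_univ_succ, Fin.succAbove]
  · ext i j
    rw [SU_iff_aux]
    fin_cases i <;> fin_cases j <;> simp [genJ, Jmat]

lemma genT_mul (a : ℤ) (s : ℂ) (d : ℤ) (M : Matrix (Fin 4) (Fin 4) ℂ) (j : Fin 4) :
    (genT a s d * M) 0 j = M 0 j + a * M 2 j + s * M 3 j ∧
    (genT a s d * M) 1 j = M 1 j + (starRingEnd ℂ) s * M 2 j + d * M 3 j ∧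
    (genT a s d * M) 2 j = M 2 j ∧ (genT a s d * M) 3 j = M 3 j := by
  simp [genT, Matrix.mul_apply, Fin.sum_univ_four]

lemma genE_mul (m : ℂ) (M : Matrix (Fin 4) (Fin 4) ℂ) (j : Fin 4) :
    (genE m * M) 0 j = M 0 j + m * M 1 j ∧ (genE m * M) 1 j = M 1 j ∧
    (genE m * M) 2 j = M 2 j ∧ (genE m * M) 3 j = M 3 j - (starRingEnd ℂ) m * M 2 j := by
  simp [genE, Matrix.mul_apply, Fin.sum_univ_four]
  ring

lemma genW_mul (M : Matrix (Fin 4) (Fin 4) ℂ) (j : Fin 4) :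
    (genW * M) 0 j = M 1 j ∧ (genW * M) 1 j = -M 0 j ∧
    (genW * M) 2 j = M 3 j ∧ (genW * M) 3 j = -M 2 j := by
  simp [genW, Matrix.mul_apply, Fin.sum_univ_four]

lemma genJ_mul (M : Matrix (Fin 4) (Fin 4) ℂ) (j : Fin 4) :
    (genJ * M) 0 j = -M 2 j ∧ (genJ * M) 1 j = M 1 j ∧
    (genJ * M) 2 j = M 0 j ∧ (genJ * M) 3 j = M 3 j := by
  simp [genJ, Matrix.mul_apply, Fin.sum_univ_four]

/-- A property of matrices that holds for the generators and may be cancelled on the left. -/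
structure GenClosed (P : Matrix (Fin 4) (Fin 4) ℂ → Prop) : Prop where
  trans : ∀ a d : ℤ, ∀ s ∈ ringInts 7, P (genT a s d)
  elem : ∀ m ∈ ringInts 7, P (genE m)
  swap : P genW
  inv : P genJ
  cancel : ∀ M N, inSU 7 M → inSU 7 N → P M → P (M * N) → P N

lemma GenClosed.redT {P : Matrix (Fin 4) (Fin 4) ℂ → Prop} (hP : GenClosed P)
    {M : Matrix (Fin 4) (Fin 4) ℂ} (hM : inSU 7 M) (a d : ℤ)
    {s : ℂ} (hs : s ∈ ringInts 7) (h : inSU 7 (genT a s d * M) → P (genT a s d * M)) : P M :=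
  hP.cancel _ _ (inSU_genT a hs d) hM (hP.trans a d s hs) (h (inSU_mul (inSU_genT a hs d) hM))

lemma GenClosed.redE {P : Matrix (Fin 4) (Fin 4) ℂ → Prop} (hP : GenClosed P)
    {M : Matrix (Fin 4) (Fin 4) ℂ} (hM : inSU 7 M)
    {m : ℂ} (hm : m ∈ ringInts 7) (h : inSU 7 (genE m * M) → P (genE m * M)) : P M :=
  hP.cancel _ _ (inSU_genE hm) hM (hP.elem m hm) (h (inSU_mul (inSU_genE hm) hM))

lemma GenClosed.redW {P : Matrix (Fin 4) (Fin 4) ℂ → Prop} (hP : GenClosed P)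
    {M : Matrix (Fin 4) (Fin 4) ℂ} (hM : inSU 7 M)
    (h : inSU 7 (genW * M) → P (genW * M)) : P M :=
  hP.cancel _ _ inSU_genW hM hP.swap (h (inSU_mul inSU_genW hM))

lemma GenClosed.redJ {P : Matrix (Fin 4) (Fin 4) ℂ → Prop} (hP : GenClosed P)
    {M : Matrix (Fin 4) (Fin 4) ℂ} (hM : inSU 7 M)
    (h : inSU 7 (genJ * M) → P (genJ * M)) : P M :=
  hP.cancel _ _ inSU_genJ hM hP.inv (h (inSU_mul inSU_genJ hM))

lemma unit_ringInts {x y : ℂ} (hx : x ∈ ringInts 7) (hy : y ∈ ringInts 7)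
    (h : x * (starRingEnd ℂ) y = 1) : (x = 1 ∧ y = 1) ∨ (x = -1 ∧ y = -1) := by
  have hn : Complex.normSq x * Complex.normSq y = 1 := by
    have := congrArg Complex.normSq h
    simpa using this
  obtain ⟨m, hm⟩ := normSq_int hx
  obtain ⟨n, hn'⟩ := normSq_int hy
  rw [hm, hn'] at hn
  have hmn : m * n = 1 := by exact_mod_cast hn
  have hm1 : m = 1 := Nat.eq_one_of_mul_eq_one_right hmn
  obtain ⟨a, b, hab⟩ := hx
  have h7 : Real.sqrt 7 ^ 2 = 7 := Real.sq_sqrt (by norm_num)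
  have e : ((2 * a + b) ^ 2 + 7 * b ^ 2 : ℝ) = 4 := by
    rw [hm1, hab, Complex.normSq_apply] at hm
    simp [omg_re, omg_im] at hm
    nlinarith
  have e' : (2 * a + b) ^ 2 + 7 * b ^ 2 = 4 := by exact_mod_cast e
  have hb : b = 0 := by
    have h1 : b ≤ 0 := by nlinarith [sq_nonneg (2 * a + b)]
    have h2 : 0 ≤ b := by nlinarith [sq_nonneg (2 * a + b)]
    omega
  subst hb
  have ha : a = 1 ∨ a = -1 := by
    have : a ^ 2 = 1 := by nlinarith
    have h3 : (a - 1) * (a + 1) = 0 := by nlinarith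
    rcases mul_eq_zero.mp h3 with h4 | h4 <;> omega
  rcases ha with rfl | rfl
  · left
    have hx1 : x = 1 := by simp [hab]
    refine ⟨hx1, ?_⟩
    rw [hx1, one_mul] at h
    have := congrArg (starRingEnd ℂ) h
    simpa using this
  · right
    have hx1 : x = -1 := by simp [hab]
    refine ⟨hx1, ?_⟩
    rw [hx1] at h
    have := congrArg (starRingEnd ℂ) h
    simp at this
    linear_combination -this

/-- Division with integer quotient for elements with real ratio. -/
lemma exists_int_div {x y : ℂ} (hy : y ≠ 0)
    (h : x * (starRingEnd ℂ) y = y * (starRingEnd ℂ) x) :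
    ∃ n : ℤ, Complex.normSq (x + n * y) < Complex.normSq y := by
  have hyn : (Complex.normSq y : ℂ) ≠ 0 := by
    exact_mod_cast (Complex.normSq_pos.mpr hy).ne'
  have hr : (starRingEnd ℂ) (x / y) = x / y := by
    have hy' : (starRingEnd ℂ) y ≠ 0 := by simpa using hy
    rw [map_div₀, div_eq_div_iff hy' hy]
    linear_combination -h
  obtain ⟨t, ht⟩ := Complex.conj_eq_iff_real.mp hr
  refine ⟨-round t, ?_⟩
  have e : x + ((-round t : ℤ) : ℂ) * y = ((t - round t : ℝ) : ℂ) * y := by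
    have : x = t * y := by rw [← ht]; field_simp
    rw [this]; push_cast; ring
  rw [e, Complex.normSq_mul, Complex.normSq_ofReal]
  refine mul_lt_of_lt_one_left (Complex.normSq_pos.mpr hy) ?_
  have := abs_sub_round t
  nlinarith [abs_le.mp this]

lemma normSq_induction {x : ℂ} (hx : x ∈ ringInts 7) :
    ∃ n : ℕ, Complex.normSq x < n := by
  obtain ⟨n, hn⟩ := normSq_int hx
  exact ⟨n + 1, by rw [hn]; push_cast; linarith⟩

lemma normSq_lt_of_lt {x y : ℂ} (hx : x ∈ ringInts 7) (hy : y ∈ ringInts 7) {n : ℕ}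
    (h : Complex.normSq x < Complex.normSq y) (h2 : Complex.normSq y < (n + 1 : ℕ)) :
    Complex.normSq x < n := by
  obtain ⟨a, ha⟩ := normSq_int hx
  obtain ⟨b, hb⟩ := normSq_int hy
  rw [ha, hb] at h
  rw [hb] at h2
  rw [ha]
  have h' : a < b := by exact_mod_cast h
  have h2' : b < n + 1 := by exact_mod_cast h2
  exact_mod_cast (by omega : a < n)

lemma GenClosed.translation {P : Matrix (Fin 4) (Fin 4) ℂ → Prop} (hP : GenClosed P)
    {M : Matrix (Fin 4) (Fin 4) ℂ} (hM : inSU 7 M)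
    (h0 : M 0 0 = 1) (h1 : M 1 0 = 0) (h2 : M 2 0 = 0) (h3 : M 3 0 = 0)
    (h4 : M 0 1 = 0) (h5 : M 1 1 = 1) (h6 : M 3 1 = 0) : P M := by
  have r := inSU_rel hM
  have r02 := r 0 2
  have r01 := r 0 1
  have r03 := r 0 3
  have r12 := r 1 2
  have r13 := r 1 3
  have r11 := r 1 1
  have r22 := r 2 2
  have r33 := r 3 3
  have r23 := r 2 3
  simp [Jmat, h0, h1, h2, h3, h4, h5, h6] at r02 r01 r03 r12 r13 r11
  simp [r01] at r12 r13
  simp [r01, r02, r03, r12, r13, Jmat] at r22 r33 r23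
  have m22 : M 2 2 = 1 := by
    have := congrArg (starRingEnd ℂ) r02; simpa using this
  have m33 : M 3 3 = 1 := by
    have := congrArg (starRingEnd ℂ) r13
    simpa using this
  have m32 : M 3 2 = 0 := by simpa using r12
  simp [m22, m33, m32] at r22 r33 r23
  obtain ⟨a, ha⟩ := eq_int_of_conj_eq (hM.1 0 2) (by linear_combination r22)
  obtain ⟨d, hd⟩ := eq_int_of_conj_eq (hM.1 1 3) (by linear_combination r33)
  have : M = genT a (M 0 3) d := by
    ext i j
    fin_cases i <;> fin_cases j <;>
      simp [genT, h0, h1, h2, h3, h4, h5, h6, r01, r03, m22, m33, m32, ha, hd]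
    linear_combination -r23
  rw [this]
  exact hP.trans _ _ _ (hM.1 0 3)

lemma GenClosed.upper_triangular {P : Matrix (Fin 4) (Fin 4) ℂ → Prop} (hP : GenClosed P)
    {M : Matrix (Fin 4) (Fin 4) ℂ} (hM : inSU 7 M)
    (h0 : M 0 0 = 1) (h1 : M 1 0 = 0) (h2 : M 2 0 = 0) (h3 : M 3 0 = 0)
    (h5 : M 1 1 = 1) (h6 : M 3 1 = 0) : P M := by
  have r01 := inSU_rel hM 0 1
  simp [Jmat, h0, h1, h2, h3] at r01
  refine hP.redE hM (neg_mem_ringInts (hM.1 0 1)) fun hM' => ?_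
  have e := genE_mul (-M 0 1) M
  refine hP.translation hM' ?_ ?_ ?_ ?_ ?_ ?_ ?_
  · rw [(e 0).1, h0, h1]; ring
  · rw [(e 0).2.1, h1]
  · rw [(e 0).2.2.1, h2]
  · rw [(e 0).2.2.2, h2, h3]; ring
  · rw [(e 1).1, h5]; ring
  · rw [(e 1).2.1, h5]
  · rw [(e 1).2.2.2, r01, h6]; ring

lemma GenClosed.upper_triangular_sign {P : Matrix (Fin 4) (Fin 4) ℂ → Prop} (hP : GenClosed P)
    {M : Matrix (Fin 4) (Fin 4) ℂ} (hM : inSU 7 M)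
    (h0 : M 0 0 = 1) (h1 : M 1 0 = 0) (h2 : M 2 0 = 0) (h3 : M 3 0 = 0)
    (h6 : M 3 1 = 0) : P M := by
  have r01 := inSU_rel hM 0 1
  have r13 := inSU_rel hM 1 3
  simp [Jmat, h0, h1, h2, h3] at r01
  simp [Jmat, r01, h6] at r13
  have r03 := inSU_rel hM 0 3
  simp [Jmat, h0, h1, h2, h3] at r03
  simp [r03] at r13
  rcases unit_ringInts (hM.1 1 1) (hM.1 3 3) r13 with ⟨h5, -⟩ | ⟨h5, -⟩
  · exact hP.upper_triangular hM h0 h1 h2 h3 h5 h6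
  · refine hP.redW hM fun hM1 => hP.redJ hM1 fun hM2 => hP.redJ hM2 fun hM3 =>
      hP.redW hM3 fun hM4 => hP.redW hM4 fun hM5 => hP.redW hM5 fun hM6 => ?_
    refine hP.upper_triangular hM6 ?_ ?_ ?_ ?_ ?_ ?_ <;> simp only [(genW_mul _ _).1,
      (genW_mul _ _).2.1, (genW_mul _ _).2.2.1, (genW_mul _ _).2.2.2, (genJ_mul _ _).1,
      (genJ_mul _ _).2.1, (genJ_mul _ _).2.2.1, (genJ_mul _ _).2.2.2, h0, h1, h2, h3, h5, h6,
      neg_neg, neg_zero]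

lemma GenClosed.block_triangular {P : Matrix (Fin 4) (Fin 4) ℂ → Prop} (hP : GenClosed P)
    {M : Matrix (Fin 4) (Fin 4) ℂ} (hM : inSU 7 M)
    (h1 : M 1 0 = 0) (h2 : M 2 0 = 0) (h3 : M 3 0 = 0) (h6 : M 3 1 = 0) : P M := by
  have r02 := inSU_rel hM 0 2
  simp [Jmat, h1, h2, h3] at r02
  rcases unit_ringInts (hM.1 0 0) (hM.1 2 2) (by linear_combination r02) with ⟨h5, -⟩ | ⟨h5, -⟩
  · exact hP.upper_triangular_sign hM h5 h1 h2 h3 h6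
  · refine hP.redJ hM fun hM1 => hP.redJ hM1 fun hM2 => ?_
    refine hP.upper_triangular_sign hM2 ?_ ?_ ?_ ?_ ?_ <;> simp only [(genJ_mul _ _).1,
      (genJ_mul _ _).2.1, (genJ_mul _ _).2.2.1, (genJ_mul _ _).2.2.2, h1, h2, h3, h5, h6,
      neg_neg, neg_zero]

lemma GenClosed.first_column {P : Matrix (Fin 4) (Fin 4) ℂ → Prop} (hP : GenClosed P) (n : ℕ) :
    ∀ {M : Matrix (Fin 4) (Fin 4) ℂ}, inSU 7 M → M 1 0 = 0 → M 2 0 = 0 → M 3 0 = 0 →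
      Complex.normSq (M 3 1) < n → P M := by
  induction n with
  | zero =>
    intro M _ _ _ _ h
    exact absurd h (by simpa using Complex.normSq_nonneg _)
  | succ n ih =>
    intro M hM h1 h2 h3 hn
    by_cases hc : M 3 1 = 0
    · exact hP.block_triangular hM h1 h2 h3 hc
    have r02 := inSU_rel hM 0 2
    simp [Jmat, h1, h2, h3] at r02
    have h00 : M 0 0 ≠ 0 := fun h => by simp [h] at r02
    have r01 := inSU_rel hM 0 1
    simp [Jmat, h1, h2, h3, h00] at r01
    have r11 := inSU_rel hM 1 1
    simp [Jmat, r01] at r11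
    obtain ⟨m, hm⟩ := exists_int_div (x := M 1 1) hc (by linear_combination -r11)
    refine hP.redT hM 0 m zero_mem_ringInts fun hM1 => hP.redW hM1 fun hM2 =>
      hP.redJ hM2 fun hM3 => hP.redW hM3 fun hM4 => ih hM4 ?_ ?_ ?_ ?_ <;>
      simp only [(genT_mul _ _ _ _ _).1, (genT_mul _ _ _ _ _).2.1,
      (genT_mul _ _ _ _ _).2.2.1, (genT_mul _ _ _ _ _).2.2.2, (genW_mul _ _).1,
      (genW_mul _ _).2.1, (genW_mul _ _).2.2.1, (genW_mul _ _).2.2.2, (genJ_mul _ _).1,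
      (genJ_mul _ _).2.1, (genJ_mul _ _).2.2.1, (genJ_mul _ _).2.2.2, h1, h2, h3, r01,
      neg_neg, neg_zero, mul_zero, add_zero, Complex.normSq_neg]
    exact normSq_lt_of_lt (add_mem_ringInts (hM.1 1 1)
      (mul_mem_ringInts (intCast_mem_ringInts m) (hM.1 3 1))) (hM.1 3 1) hm hn

lemma GenClosed.lower_zero {P : Matrix (Fin 4) (Fin 4) ℂ → Prop} (hP : GenClosed P) (n : ℕ) :
    ∀ {M : Matrix (Fin 4) (Fin 4) ℂ}, inSU 7 M → M 2 0 = 0 → M 3 0 = 0 →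
      Complex.normSq (M 1 0) < n → P M := by
  induction n with
  | zero =>
    intro M _ _ _ h
    exact absurd h (by simpa using Complex.normSq_nonneg _)
  | succ n ih =>
    intro M hM h2 h3 hn
    by_cases hc : M 1 0 = 0
    · obtain ⟨l, hl⟩ := normSq_induction (hM.1 3 1)
      exact hP.first_column l hM hc h2 h3 hl
    obtain ⟨q, hq, hlt⟩ := exists_euclid_div (x := M 0 0) hc
    refine hP.redE hM (neg_mem_ringInts hq) fun hM1 => hP.redW hM1 fun hM2 => ih hM2 ?_ ?_ ?_ <;>
      simp only [(genE_mul _ _ _).1, (genE_mul _ _ _).2.1,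
      (genE_mul _ _ _).2.2.1, (genE_mul _ _ _).2.2.2, (genW_mul _ _).1,
      (genW_mul _ _).2.1, (genW_mul _ _).2.2.1, (genW_mul _ _).2.2.2, h2, h3,
      neg_neg, neg_zero, mul_zero, sub_zero, Complex.normSq_neg]
    have e : M 0 0 + -q * M 1 0 = M 0 0 - q * M 1 0 := by ring
    rw [e]
    exact normSq_lt_of_lt (sub_mem_ringInts (hM.1 0 0)
      (mul_mem_ringInts hq (hM.1 1 0))) (hM.1 1 0) hlt hn

lemma GenClosed.third_zero {P : Matrix (Fin 4) (Fin 4) ℂ → Prop} (hP : GenClosed P) (n : ℕ) :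
    ∀ {M : Matrix (Fin 4) (Fin 4) ℂ}, inSU 7 M → M 3 0 = 0 →
      Complex.normSq (M 2 0) < n → P M := by
  induction n with
  | zero =>
    intro M _ _ h
    exact absurd h (by simpa using Complex.normSq_nonneg _)
  | succ n ih =>
    intro M hM h3 hn
    by_cases hc : M 2 0 = 0
    · obtain ⟨l, hl⟩ := normSq_induction (hM.1 1 0)
      exact hP.lower_zero l hM hc h3 hl
    have r00 := inSU_rel hM 0 0
    simp [Jmat, h3] at r00
    obtain ⟨m, hm⟩ := exists_int_div (x := M 0 0) hc (by linear_combination -r00)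
    refine hP.redT hM m 0 zero_mem_ringInts fun hM1 => hP.redJ hM1 fun hM2 => ih hM2 ?_ ?_ <;>
      simp only [(genT_mul _ _ _ _ _).1, (genT_mul _ _ _ _ _).2.1,
      (genT_mul _ _ _ _ _).2.2.1, (genT_mul _ _ _ _ _).2.2.2, (genJ_mul _ _).1,
      (genJ_mul _ _).2.1, (genJ_mul _ _).2.2.1, (genJ_mul _ _).2.2.2, h3,
      mul_zero, add_zero]
    exact normSq_lt_of_lt (add_mem_ringInts (hM.1 0 0)
      (mul_mem_ringInts (intCast_mem_ringInts m) (hM.1 2 0))) (hM.1 2 0) hm hn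

lemma GenClosed.fourth_zero {P : Matrix (Fin 4) (Fin 4) ℂ → Prop} (hP : GenClosed P) (n : ℕ) :
    ∀ {M : Matrix (Fin 4) (Fin 4) ℂ}, inSU 7 M → Complex.normSq (M 2 0) < n → P M := by
  induction n with
  | zero =>
    intro M _ h
    exact absurd h (by simpa using Complex.normSq_nonneg _)
  | succ n ih =>
    intro M hM hn
    by_cases hc : M 2 0 = 0
    · refine hP.redW hM fun hM1 => ?_
      obtain ⟨l, hl⟩ := normSq_induction (hM1.1 2 0)
      exact hP.third_zero l hM1 (by rw [(genW_mul _ _).2.2.2, hc, neg_zero]) hl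
    obtain ⟨q, hq, hlt⟩ := exists_euclid_div (x := M 3 0) hc
    refine hP.redE hM (conj_mem_ringInts hq) fun hM1 => hP.redW hM1 fun hM2 => ih hM2 ?_
    simp only [(genE_mul _ _ _).2.2.2, (genW_mul _ _).2.2.1, Complex.conj_conj]
    exact normSq_lt_of_lt (sub_mem_ringInts (hM.1 3 0)
      (mul_mem_ringInts hq (hM.1 2 0))) (hM.1 2 0) hlt hn

theorem GenClosed.all {P : Matrix (Fin 4) (Fin 4) ℂ → Prop} (hP : GenClosed P)
    {M : Matrix (Fin 4) (Fin 4) ℂ} (hM : inSU 7 M) : P M := by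
  obtain ⟨l, hl⟩ := normSq_induction (hM.1 2 0)
  exact hP.fourth_zero l hM hl

lemma mk_mem_HH2 {t u v w : ℂ} : !![t, u; v, w] ∈ HH2 ↔ 0 < t.im ∧ 0 < w.im ∧
    Complex.normSq (u - (starRingEnd ℂ) v) < 4 * (t.im * w.im) := by
  rw [mem_HH2_iff]; simp

lemma genT_act (a : ℤ) (s : ℂ) (d : ℤ) (t u v w : ℂ) :
    moebius (genT a s d) !![t, u; v, w] = !![t + a, u + s; v + (starRingEnd ℂ) s, w + d] ∧
    (denomM (genT a s d) !![t, u; v, w]).det = 1 := by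
  have h : blkC (genT a s d) * !![t, u; v, w] + blkD (genT a s d) = 1 := by
    ext i j; fin_cases i <;> fin_cases j <;> simp [blkC, blkD, genT]
  refine ⟨?_, by rw [denomM, h, det_one]⟩
  rw [moebius, h, inv_one, Matrix.mul_one]
  ext i j; fin_cases i <;> fin_cases j <;> simp [blkA, blkB, genT]

lemma genE_act (m t u v w : ℂ) :
    moebius (genE m) !![t, u; v, w] = !![t + m * v + (starRingEnd ℂ) m * u
      + m * (starRingEnd ℂ) m * w, u + m * w; v + (starRingEnd ℂ) m * w, w] ∧
    (denomM (genE m) !![t, u; v, w]).det = 1 := by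
  have h : blkC (genE m) * !![t, u; v, w] + blkD (genE m) = !![1, 0; -(starRingEnd ℂ) m, 1] := by
    ext i j; fin_cases i <;> fin_cases j <;> simp [blkC, blkD, genE]
  have hi : (!![1, 0; -(starRingEnd ℂ) m, 1] : Matrix (Fin 2) (Fin 2) ℂ)⁻¹ =
      !![1, 0; (starRingEnd ℂ) m, 1] := by
    apply Matrix.inv_eq_right_inv
    ext i j; fin_cases i <;> fin_cases j <;> simp
  refine ⟨?_, by rw [denomM, h]; simp⟩
  rw [moebius, h, hi]
  ext i j; fin_cases i <;> fin_cases j <;> simp [blkA, blkB, genE] <;> ring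

lemma genW_act (t u v w : ℂ) :
    moebius genW !![t, u; v, w] = !![w, -v; -u, t] ∧
    (denomM genW !![t, u; v, w]).det = 1 := by
  have h : blkC genW * !![t, u; v, w] + blkD genW = !![0, 1; -1, 0] := by
    ext i j; fin_cases i <;> fin_cases j <;> simp [blkC, blkD, genW]
  have hi : (!![0, 1; -1, 0] : Matrix (Fin 2) (Fin 2) ℂ)⁻¹ = !![0, -1; 1, 0] := by
    apply Matrix.inv_eq_right_inv
    ext i j; fin_cases i <;> fin_cases j <;> simp
  refine ⟨?_, by rw [denomM, h]; simp⟩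
  rw [moebius, h, hi]
  ext i j; fin_cases i <;> fin_cases j <;> simp [blkA, blkB, genW]

lemma genJ_act {t : ℂ} (ht : t ≠ 0) (u v w : ℂ) :
    moebius genJ !![t, u; v, w] = !![-1 / t, u / t; v / t, w - u * v / t] ∧
    (denomM genJ !![t, u; v, w]).det = t := by
  have h : blkC genJ * !![t, u; v, w] + blkD genJ = !![t, u; 0, 1] := by
    ext i j; fin_cases i <;> fin_cases j <;> simp [blkC, blkD, genJ]
  have hi : (!![t, u; 0, 1] : Matrix (Fin 2) (Fin 2) ℂ)⁻¹ = !![1 / t, -u / t; 0, 1] := by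
    apply Matrix.inv_eq_right_inv
    ext i j; fin_cases i <;> fin_cases j <;> simp <;> field_simp
    ring
  refine ⟨?_, by rw [denomM, h]; simp⟩
  rw [moebius, h, hi]
  ext i j; fin_cases i <;> fin_cases j <;> simp [blkA, blkB, genJ] <;> ring

lemma im_pos_ne_zero {t : ℂ} (h : 0 < t.im) : t ≠ 0 := by
  rintro rfl; simp at h

/-- A criterion for Hermitian modular forms in terms of generators. -/
theorem isHMF_of_generators {k : ℕ} {F : Matrix (Fin 2) (Fin 2) ℂ → ℂ}
    (hF : DifferentiableOn ℂ F HH2)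
    (hT : ∀ a d : ℤ, ∀ s ∈ ringInts 7, ∀ t u v w : ℂ, !![t, u; v, w] ∈ HH2 →
      F !![t + a, u + s; v + (starRingEnd ℂ) s, w + d] = F !![t, u; v, w])
    (hE : ∀ m ∈ ringInts 7, ∀ t u v w : ℂ, !![t, u; v, w] ∈ HH2 →
      F !![t + m * v + (starRingEnd ℂ) m * u
      + m * (starRingEnd ℂ) m * w, u + m * w; v + (starRingEnd ℂ) m * w, w] = F !![t, u; v, w])
    (hW : ∀ t u v w : ℂ, !![t, u; v, w] ∈ HH2 → F !![w, -v; -u, t] = F !![t, u; v, w])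
    (hJ : ∀ t u v w : ℂ, !![t, u; v, w] ∈ HH2 →
      F !![-1 / t, u / t; v / t, w - u * v / t] = t ^ k * F !![t, u; v, w]) :
    IsHMF 7 k F := by
  refine ⟨hF, fun M hM => ?_⟩
  refine GenClosed.all (P := TransF k F) ⟨?_, ?_, ?_, ?_, ?_⟩ hM
  · intro a d s hs τ hτ
    rw [Matrix.eta_fin_two τ] at hτ ⊢
    rw [(genT_act _ _ _ _ _ _ _).1, (genT_act _ _ _ _ _ _ _).2, hT a d s hs _ _ _ _ hτ]
    simp
  · intro m hm τ hτ
    rw [Matrix.eta_fin_two τ] at hτ ⊢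
    rw [(genE_act _ _ _ _ _).1, (genE_act _ _ _ _ _).2, hE m hm _ _ _ _ hτ]
    simp
  · intro τ hτ
    rw [Matrix.eta_fin_two τ] at hτ ⊢
    rw [(genW_act _ _ _ _).1, (genW_act _ _ _ _).2, hW _ _ _ _ hτ]
    simp
  · intro τ hτ
    rw [Matrix.eta_fin_two τ] at hτ ⊢
    have ht := im_pos_ne_zero (mk_mem_HH2.mp hτ).1
    rw [(genJ_act ht _ _ _).1, (genJ_act ht _ _ _).2, hJ _ _ _ _ hτ]
  · intro M N hM hN h1 h2
    exact h1.cancel hM hN h2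

lemma isHMF_symmetrize {k : ℕ} {F : Matrix (Fin 2) (Fin 2) ℂ → ℂ}
    (h1 : IsHMF 7 k F) (h2 : IsHMF 7 k fun τ => F τᵀ) :
    IsSymHMF 7 k fun τ => F τ + (-1) ^ k * F τᵀ := by
  refine ⟨⟨h1.1.add (h2.1.const_mul _), fun M hM τ hτ => ?_⟩, fun τ _ => ?_⟩
  · have := h2.2 M hM τ hτ
    simp only at this ⊢
    rw [h1.2 M hM τ hτ, this]
    ring
  · simp only [transpose_transpose]
    have : ((-1 : ℂ) ^ k) * (-1) ^ k = 1 := by rw [← mul_pow]; simp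
    linear_combination -F τᵀ * this

/-- The restriction of `F` to the Heegner divisor, as a function of three variables. -/
def restr (F : Matrix (Fin 2) (Fin 2) ℂ → ℂ) (t z w : ℂ) : ℂ :=
  F !![t, (starRingEnd ℂ) (omg 7) * z; omg 7 * z, w]

/-- The domain of the restriction. -/
def dom3 (t z w : ℂ) : Prop := 0 < t.im ∧ 0 < w.im ∧ 2 * z.im ^ 2 < t.im * w.im

lemma restr_mem {t z w : ℂ} :
    !![t, (starRingEnd ℂ) (omg 7) * z; omg 7 * z, w] ∈ HH2 ↔ dom3 t z w := by
  rw [mk_mem_HH2, dom3]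
  have : Complex.normSq ((starRingEnd ℂ) (omg 7) * z - (starRingEnd ℂ) (omg 7 * z)) =
      8 * z.im ^ 2 := by
    rw [map_mul, ← mul_sub, Complex.normSq_mul, Complex.normSq_conj, Complex.sub_conj]
    have h2 : Complex.normSq (omg 7) = 2 := by
      have := omg_mul_conj
      rw [Complex.mul_conj] at this
      exact_mod_cast this
    rw [h2]
    simp [Complex.normSq_apply]
    ring
  rw [this]
  constructor <;> rintro ⟨a, b, c⟩ <;> exact ⟨a, b, by linarith⟩

/-- The matrix `diag(1, -1, 1, -1)`. -/
def genD : Matrix (Fin 4) (Fin 4) ℂ :=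
  !![1, 0, 0, 0; 0, -1, 0, 0; 0, 0, 1, 0; 0, 0, 0, -1]

lemma inSU_genD : inSU 7 genD := by
  refine ⟨fun i j => ?_, ?_, ?_⟩
  · fin_cases i <;> fin_cases j <;> simp [genD, zero_mem_ringInts, one_mem_ringInts,
      neg_mem_ringInts one_mem_ringInts]
  · simp [genD, Matrix.det_succ_row_zero, Fin.sum_univ_succ, Fin.succAbove]
  · ext i j
    rw [SU_iff_aux]
    fin_cases i <;> fin_cases j <;> simp [genD, Jmat]

lemma genD_act (t u v w : ℂ) :
    moebius genD !![t, u; v, w] = !![t, -u; -v, w] ∧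
    (denomM genD !![t, u; v, w]).det = -1 := by
  have h : blkC genD * !![t, u; v, w] + blkD genD = !![1, 0; 0, -1] := by
    ext i j; fin_cases i <;> fin_cases j <;> simp [blkC, blkD, genD]
  have hi : (!![1, 0; 0, -1] : Matrix (Fin 2) (Fin 2) ℂ)⁻¹ = !![1, 0; 0, -1] := by
    apply Matrix.inv_eq_right_inv
    ext i j; fin_cases i <;> fin_cases j <;> simp
  refine ⟨?_, by rw [denomM, h]; simp⟩
  rw [moebius, h, hi]
  ext i j; fin_cases i <;> fin_cases j <;> simp [blkA, blkB, genD]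

/-- The transformation laws of the restriction of a symmetric Hermitian modular form. -/
structure RestrLaws (k : ℕ) (G : ℂ → ℂ → ℂ → ℂ) : Prop where
  neg : ∀ t z w, dom3 t z w → G t (-z) w = (-1) ^ k * G t z w
  swap : ∀ t z w, dom3 t z w → G w z t = G t z w
  add_left : ∀ t z w, dom3 t z w → G (t + 1) z w = G t z w
  add_mid : ∀ t z w, dom3 t z w → G t (z + 1) w = G t z w
  shear : ∀ t z w, dom3 t z w → G t (z + t) (w + 4 * z + 2 * t) = G t z w
  inv : ∀ t z w, dom3 t z w → G (-1 / t) (z / t) (w - 2 * z ^ 2 / t) = t ^ k * G t z w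

lemma dom3.symm {t z w : ℂ} (h : dom3 t z w) : dom3 w z t :=
  ⟨h.2.1, h.1, by linarith [h.2.2]⟩

lemma dom3.neg {t z w : ℂ} (h : dom3 t z w) : dom3 t (-z) w :=
  ⟨h.1, h.2.1, by simpa using h.2.2⟩

theorem IsSymHMF.restrLaws {k : ℕ} {F : Matrix (Fin 2) (Fin 2) ℂ → ℂ} (hF : IsSymHMF 7 k F) :
    RestrLaws k (restr F) := by
  have hneg : ∀ t z w, dom3 t z w → restr F t (-z) w = (-1) ^ k * restr F t z w := by
    intro t z w h
    have := hF.1.2 genD inSU_genD _ (restr_mem.mpr h)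
    change _ = (denomM _ _).det ^ k * _ at this
    rw [(genD_act _ _ _ _).1, (genD_act _ _ _ _).2] at this
    simpa [restr] using this
  have hsw : ∀ t z w, dom3 t z w → restr F w z t = restr F t z w := by
    intro t z w h
    have := hF.1.2 genW inSU_genW _ (restr_mem.mpr h)
    change _ = (denomM _ _).det ^ k * _ at this
    rw [(genW_act _ _ _ _).1, (genW_act _ _ _ _).2, one_pow, one_mul] at this
    have h2 := hF.2 _ (restr_mem.mpr h.symm.neg)
    have e : (!![w, (starRingEnd ℂ) (omg 7) * -z; omg 7 * -z, t])ᵀ =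
        !![w, -(omg 7 * z); -((starRingEnd ℂ) (omg 7) * z), t] := by
      ext i j; fin_cases i <;> fin_cases j <;> simp
    rw [e, this] at h2
    have h3 := hneg w z t h.symm
    unfold restr at h3 ⊢
    rw [h2, h3, ← mul_assoc, ← mul_pow]
    simp
  have hl : ∀ t z w, dom3 t z w → restr F (t + 1) z w = restr F t z w := by
    intro t z w h
    have := hF.1.2 _ (inSU_genT 1 zero_mem_ringInts 0) _ (restr_mem.mpr h)
    change _ = (denomM _ _).det ^ k * _ at this
    rw [(genT_act _ _ _ _ _ _ _).1, (genT_act _ _ _ _ _ _ _).2] at this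
    simpa [restr] using this
  have hm : ∀ t z w, dom3 t z w → restr F t (z + 1) w = restr F t z w := by
    intro t z w h
    have := hF.1.2 _ (inSU_genT 0 (conj_mem_ringInts omg_mem_ringInts) 0) _ (restr_mem.mpr h)
    change _ = (denomM _ _).det ^ k * _ at this
    rw [(genT_act _ _ _ _ _ _ _).1, (genT_act _ _ _ _ _ _ _).2] at this
    simpa [restr, mul_add] using this
  have hE : ∀ t z w, dom3 t z w → restr F (t + 4 * z + 2 * w) (z + w) w = restr F t z w := by
    intro t z w h
    have := hF.1.2 _ (inSU_genE (conj_mem_ringInts omg_mem_ringInts)) _ (restr_mem.mpr h)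
    change _ = (denomM _ _).det ^ k * _ at this
    rw [(genE_act _ _ _ _ _).1, (genE_act _ _ _ _ _).2] at this
    simp only [Complex.conj_conj, one_pow, one_mul] at this
    unfold restr
    rw [← this]
    congr 1
    have h2 := omg_mul_conj
    ext i j; fin_cases i <;> fin_cases j <;> simp <;> try ring1
    linear_combination (-2 * z - w) * h2
  refine ⟨hneg, hsw, hl, hm, ?_, ?_⟩
  · intro t z w h
    have h2 := hE w z t h.symm
    have hd : dom3 (w + 4 * z + 2 * t) (z + t) t := by
      have := h.2.2
      refine ⟨?_, h.1, ?_⟩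
      · have h0 := h.1
        have : 0 < t.im * (w.im + 4 * z.im + 2 * t.im) := by nlinarith [sq_nonneg (z.im + t.im)]
        simpa using (mul_pos_iff_of_pos_left h0).mp this
      · simp; nlinarith
    rw [hsw _ _ _ hd, h2, hsw _ _ _ h]
  · intro t z w h
    have := hF.1.2 _ inSU_genJ _ (restr_mem.mpr h)
    change _ = (denomM _ _).det ^ k * _ at this
    have ht := im_pos_ne_zero h.1
    rw [(genJ_act ht _ _ _).1, (genJ_act ht _ _ _).2] at this
    unfold restr
    rw [← this]
    congr 1
    have h2 := omg_mul_conj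
    ext i j; fin_cases i <;> fin_cases j <;> simp <;> try ring1
    linear_combination (-z ^ 2 / t) * h2

/-- An integral over a compact interval depending holomorphically on a parameter. -/
lemma differentiableOn_intervalIntegral {U : Set ℂ} (hU : IsOpen U) {a b : ℝ} {f : ℂ → ℝ → ℂ}
    (hc : ContinuousOn (Function.uncurry f) (U ×ˢ Set.uIcc a b))
    (hd : ∀ x ∈ Set.uIcc a b, DifferentiableOn ℂ (fun z => f z x) U) :
    DifferentiableOn ℂ (fun z => ∫ x in a..b, f z x) U := by
  intro z0 hz0
  apply DifferentiableAt.differentiableWithinAt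
  obtain ⟨R, hR, hRU⟩ := Metric.isOpen_iff.mp hU z0 hz0
  set r := R / 4 with hr
  have hr0 : 0 < r := by positivity
  have hsub : Metric.closedBall z0 (2 * r) ⊆ U :=
    (Metric.closedBall_subset_ball (by linarith)).trans hRU
  have hsub' : Metric.closedBall z0 (2 * r) ×ˢ Set.uIcc a b ⊆ U ×ˢ Set.uIcc a b :=
    Set.prod_mono hsub le_rfl
  have hcomp : IsCompact (Metric.closedBall z0 (2 * r) ×ˢ Set.uIcc a b) :=
    (isCompact_closedBall _ _).prod isCompact_uIcc
  obtain ⟨C, hC⟩ := hcomp.exists_bound_of_continuousOn (hc.mono hsub')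
  have hslice : ∀ z ∈ U, ContinuousOn (f z) (Set.uIcc a b) := fun z hz =>
    hc.comp (f := fun x => (z, x)) (by fun_prop) fun x hx => ⟨hz, hx⟩
  have hmeas : ∀ z ∈ U, MeasureTheory.AEStronglyMeasurable (f z)
      (MeasureTheory.volume.restrict (Set.uIoc a b)) := fun z hz =>
    ((hslice z hz).mono Set.uIoc_subset_uIcc).aestronglyMeasurable measurableSet_uIoc
  have hball : Metric.ball z0 r ⊆ U := fun z hz => hsub (by
    rw [Metric.mem_closedBall]; have := Metric.mem_ball.mp hz; linarith)
  have hda : ∀ x ∈ Set.uIcc a b, ∀ z ∈ U, HasDerivAt (fun z => f z x)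
      (deriv (fun z => f z x) z) z := fun x hx z hz =>
    ((hd x hx).differentiableAt (hU.mem_nhds hz)).hasDerivAt
  refine (intervalIntegral.hasDerivAt_integral_of_dominated_loc_of_deriv_le
    (F' := fun z x => deriv (fun z => f z x) z) (s := Metric.ball z0 r)
    (bound := fun _ => C / r) (Metric.ball_mem_nhds _ hr0) ?_ ?_ ?_ ?_ ?_ ?_).2.differentiableAt
  · filter_upwards [hU.mem_nhds hz0] with z hz using hmeas z hz
  · exact (hslice z0 hz0).intervalIntegrable
  · have hseq : Tendsto (fun n : ℕ => z0 + ((r / (n + 1) : ℝ) : ℂ)) atTop (𝓝[≠] z0) := by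
      rw [tendsto_nhdsWithin_iff]
      constructor
      · have h1 : Tendsto (fun n : ℕ => ((r / (n + 1) : ℝ))) atTop (𝓝 0) :=
          tendsto_const_div_atTop_nhds_zero_nat r |>.comp (tendsto_add_atTop_nat 1) |>.congr
            (fun n => by simp)
        have h2 := (Complex.continuous_ofReal.tendsto 0).comp h1
        simpa using h2.const_add z0
      · refine Eventually.of_forall fun n => ?_
        have : (r / (n + 1) : ℝ) ≠ 0 := by positivity
        simpa only [Set.mem_compl_iff, Set.mem_singleton_iff, add_eq_left,
          Complex.ofReal_eq_zero] using this
    refine aestronglyMeasurable_of_tendsto_ae (u := atTop)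
      (f := fun n : ℕ => fun x => slope (fun z => f z x) z0 (z0 + ((r / (n + 1) : ℝ) : ℂ))) ?_ ?_
    · intro n
      have hm : z0 + ((r / (n + 1) : ℝ) : ℂ) ∈ U := by
        apply hsub
        rw [Metric.mem_closedBall, dist_eq_norm, add_sub_cancel_left, Complex.norm_real,
          Real.norm_of_nonneg (by positivity), div_le_iff₀ (by positivity)]
        have : (0 : ℝ) ≤ n := Nat.cast_nonneg n
        nlinarith
      simp only [slope_def_module]
      exact ((hmeas _ hm).sub (hmeas z0 hz0)).const_smul
        ((z0 + ((r / (n + 1) : ℝ) : ℂ)) - z0)⁻¹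
    · filter_upwards [MeasureTheory.ae_restrict_mem measurableSet_uIoc] with x hx
      exact (hasDerivAt_iff_tendsto_slope.mp (hda x (Set.uIoc_subset_uIcc hx) z0 hz0)).comp hseq
  · refine Eventually.of_forall fun x hx z hz => ?_
    have hx' := Set.uIoc_subset_uIcc hx
    have hs : Metric.closedBall z r ⊆ Metric.closedBall z0 (2 * r) :=
      Metric.closedBall_subset_closedBall' (by have := Metric.mem_ball.mp hz; linarith)
    refine Complex.norm_deriv_le_of_forall_mem_sphere_norm_le hr0 ?_ ?_
    · refine DifferentiableOn.diffContOnCl (((hd x hx').mono (hs.trans hsub)).mono ?_)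
      rw [closure_ball _ hr0.ne']
    · intro u hu
      exact hC (u, x) ⟨hs (Metric.sphere_subset_closedBall hu), hx'⟩
  · exact intervalIntegrable_const
  · exact Eventually.of_forall fun x hx z hz =>
      hda x (Set.uIoc_subset_uIcc hx) z (hball hz)

/-- The domain of the restriction, as a set. -/
def domSet : Set (ℂ × ℂ × ℂ) := {p | dom3 p.1 p.2.1 p.2.2}

lemma isOpen_domSet : IsOpen domSet := by
  have h1 : IsOpen {p : ℂ × ℂ × ℂ | 0 < p.1.im} := isOpen_lt (by fun_prop) (by fun_prop)
  have h2 : IsOpen {p : ℂ × ℂ × ℂ | 0 < p.2.2.im} := isOpen_lt (by fun_prop) (by fun_prop)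
  have h3 : IsOpen {p : ℂ × ℂ × ℂ | 2 * p.2.1.im ^ 2 < p.1.im * p.2.2.im} :=
    isOpen_lt (by fun_prop) (by fun_prop)
  exact h1.inter (h2.inter h3)

lemma dom3_zero {t w : ℂ} (ht : 0 < t.im) (hw : 0 < w.im) : dom3 t 0 w :=
  ⟨ht, hw, by simpa using mul_pos ht hw⟩

/-- Continuous and separately holomorphic functions on the domain of the restriction. -/
structure GoodH (H : ℂ → ℂ → ℂ → ℂ) : Prop where
  cont : ContinuousOn (fun p : ℂ × ℂ × ℂ => H p.1 p.2.1 p.2.2) domSet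
  d1 : ∀ t z w, dom3 t z w → DifferentiableAt ℂ (fun t => H t z w) t
  d2 : ∀ t z w, dom3 t z w → DifferentiableAt ℂ (fun z => H t z w) z
  d3 : ∀ t z w, dom3 t z w → DifferentiableAt ℂ (fun w => H t z w) w

lemma eventually_dom1 {t z w : ℂ} (h : dom3 t z w) : ∀ᶠ t' in 𝓝 t, dom3 t' z w :=
  (show Continuous fun t' : ℂ => (t', z, w) by fun_prop).continuousAt.eventually
    (isOpen_domSet.mem_nhds h)

lemma eventually_dom2 {t z w : ℂ} (h : dom3 t z w) : ∀ᶠ z' in 𝓝 z, dom3 t z' w :=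
  (show Continuous fun z' : ℂ => (t, z', w) by fun_prop).continuousAt.eventually
    (isOpen_domSet.mem_nhds h)

lemma eventually_dom3 {t z w : ℂ} (h : dom3 t z w) : ∀ᶠ w' in 𝓝 w, dom3 t z w' :=
  (show Continuous fun w' : ℂ => (t, z, w') by fun_prop).continuousAt.eventually
    (isOpen_domSet.mem_nhds h)

lemma dom3.of_norm_le {t z z' w : ℂ} (h : dom3 t z w) (hz : |z'.im| ≤ |z.im|) : dom3 t z' w :=
  ⟨h.1, h.2.1, by have := h.2.2; nlinarith [sq_abs z'.im, sq_abs z.im, abs_nonneg z'.im]⟩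

lemma dom3_of_norm {t z' w : ℂ} {r : ℝ} (h : dom3 t (r * Complex.I) w) (hz : ‖z'‖ ≤ r) :
    dom3 t z' w := by
  refine h.of_norm_le ?_
  simp only [Complex.mul_im, Complex.ofReal_re, Complex.I_im, mul_one, Complex.ofReal_im,
    Complex.I_re, mul_zero, add_zero]
  exact (Complex.abs_im_le_norm z').trans (hz.trans (le_abs_self r))

lemma exists_radius {t w : ℂ} (ht : 0 < t.im) (hw : 0 < w.im) :
    ∃ r : ℝ, 0 < r ∧ dom3 t (r * Complex.I) w := by
  have h : ∀ᶠ r : ℝ in 𝓝 0, dom3 t (r * Complex.I) w :=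
    (show Continuous fun r : ℝ => (t, (r : ℂ) * Complex.I, w) by fun_prop).continuousAt.eventually
      (isOpen_domSet.mem_nhds (by simpa [domSet] using dom3_zero ht hw))
  obtain ⟨ε, hε, h2⟩ := Metric.eventually_nhds_iff.mp h
  exact ⟨ε / 2, by positivity, h2 (by rw [Real.dist_eq, sub_zero, abs_of_pos] <;> linarith)⟩

/-- Division by the middle variable. -/
theorem GoodH.exists_div {H : ℂ → ℂ → ℂ → ℂ} (hH : GoodH H)
    (h0 : ∀ t w : ℂ, 0 < t.im → 0 < w.im → H t 0 w = 0) :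
    ∃ H', GoodH H' ∧ ∀ t z w, dom3 t z w → H t z w = z * H' t z w := by
  set H' : ℂ → ℂ → ℂ → ℂ := fun t z w => dslope (fun z => H t z w) 0 z with hH'
  have hne : ∀ t z w, 0 < t.im → 0 < w.im → z ≠ 0 → H' t z w = z⁻¹ * H t z w := by
    intro t z w ht hw hz
    simp [hH', dslope_of_ne _ hz, slope_def_module, h0 t w ht hw]
  have hd2 : ∀ t z w, dom3 t z w → DifferentiableAt ℂ (fun z => H' t z w) z := by
    intro t z w h
    have hs : IsOpen {z | dom3 t z w} :=
      isOpen_domSet.preimage (show Continuous fun z' : ℂ => (t, z', w) by fun_prop)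
    have := (Complex.differentiableOn_dslope (f := fun z => H t z w)
      (hs.mem_nhds (dom3_zero h.1 h.2.1))).mpr
      fun z hz => (hH.d2 t z w hz).differentiableWithinAt
    exact (this z h).differentiableAt (hs.mem_nhds h)
  have hc0 : ∀ p ∈ domSet, p.2.1 ≠ 0 →
      ContinuousAt (fun p : ℂ × ℂ × ℂ => H' p.1 p.2.1 p.2.2) p := by
    intro p hp hz
    have ha : ContinuousAt (fun p : ℂ × ℂ × ℂ => p.2.1⁻¹) p := ContinuousAt.inv₀ (by fun_prop) hz
    have h1 : ContinuousAt (fun p : ℂ × ℂ × ℂ => p.2.1⁻¹ * H p.1 p.2.1 p.2.2) p :=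
      ha.mul (hH.cont.continuousAt (isOpen_domSet.mem_nhds hp))
    refine h1.congr ?_
    have h2 : ∀ᶠ q : ℂ × ℂ × ℂ in 𝓝 p, q.2.1 ≠ 0 :=
      ContinuousAt.eventually_ne (by fun_prop) hz
    filter_upwards [isOpen_domSet.mem_nhds hp, h2] with q hq hq2
    exact (hne _ _ _ hq.1 hq.2.1 hq2).symm
  have hcont : ContinuousOn (fun p : ℂ × ℂ × ℂ => H' p.1 p.2.1 p.2.2) domSet := by
    rintro ⟨t0, z0, w0⟩ hp
    apply ContinuousAt.continuousWithinAt
    by_cases hz0 : z0 ≠ 0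
    · exact hc0 _ hp hz0
    push Not at hz0
    subst hz0
    obtain ⟨r, hr, hdr⟩ := exists_radius hp.1 hp.2.1
    have hnb : ∀ᶠ q : ℂ × ℂ in 𝓝 (t0, w0), dom3 q.1 (r * Complex.I) q.2 :=
      ((show Continuous fun q : ℂ × ℂ => (q.1, (r : ℂ) * Complex.I, q.2) by
        fun_prop).tendsto (t0, w0)).eventually (isOpen_domSet.mem_nhds hdr)
    have hsp : IsCompact (Metric.sphere (0 : ℂ) r) := isCompact_sphere _ _
    have hcs : ContinuousOn (Function.uncurry fun (q : ℂ × ℂ) (z : ℂ) => H' q.1 z q.2)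
        ({q | dom3 q.1 (r * Complex.I) q.2} ×ˢ Metric.sphere 0 r) := by
      rintro ⟨⟨t, w⟩, z⟩ ⟨hq, hz⟩
      have hzn : ‖z‖ = r := by simpa using hz
      have := hc0 (t, z, w) (dom3_of_norm hq hzn.le)
        (by rintro rfl; rw [norm_zero] at hzn; exact hr.ne hzn)
      exact (ContinuousAt.comp (f := fun x : (ℂ × ℂ) × ℂ => (x.1.1, x.2, x.1.2))
        (x := ((t, w), z)) this (by fun_prop)).continuousWithinAt
    rw [ContinuousAt, Metric.tendsto_nhds]
    intro ε hε
    have hu := hsp.mem_uniformity_of_prod hcs (q := (t0, w0)) hdr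
      (Metric.dist_mem_uniformity (half_pos hε))
    obtain ⟨v, hv, hvv⟩ := hu
    have hv' : ∀ᶠ q : ℂ × ℂ in 𝓝 (t0, w0), q ∈ v := by
      rw [nhdsWithin_eq_nhds.mpr hnb] at hv
      exact hv
    have hcz : ∀ᶠ z : ℂ in 𝓝 0, dist (H' t0 z w0) (H' t0 0 w0) < ε / 2 :=
      Metric.tendsto_nhds.mp (hd2 t0 0 w0 hp).continuousAt _ (half_pos hε)
    have e1 : ∀ᶠ p : ℂ × ℂ × ℂ in 𝓝 (t0, 0, w0), (p.1, p.2.2) ∈ v ∧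
        dom3 p.1 (r * Complex.I) p.2.2 :=
      ((show Continuous fun p : ℂ × ℂ × ℂ => (p.1, p.2.2) by fun_prop).tendsto
        (t0, 0, w0)).eventually (p := fun q : ℂ × ℂ => q ∈ v ∧ dom3 q.1 (r * Complex.I) q.2)
        (hv'.and hnb)
    have e2 : ∀ᶠ p : ℂ × ℂ × ℂ in 𝓝 (t0, 0, w0), dist (H' t0 p.2.1 w0) (H' t0 0 w0) < ε / 2 ∧
        p.2.1 ∈ Metric.ball 0 r :=
      ((show Continuous fun p : ℂ × ℂ × ℂ => p.2.1 by fun_prop).tendsto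
        (t0, 0, w0)).eventually
        (p := fun z : ℂ => dist (H' t0 z w0) (H' t0 0 w0) < ε / 2 ∧ z ∈ Metric.ball 0 r)
        (hcz.and (Metric.ball_mem_nhds _ hr))
    filter_upwards [e1, e2] with ⟨t, z, w⟩ ⟨hp1, hp2⟩ ⟨hp3, hp4⟩
    simp only at hp1 hp2 hp3 hp4 ⊢
    have hdc : DiffContOnCl ℂ (fun z => H' t z w - H' t0 z w0) (Metric.ball 0 r) := by
      apply DifferentiableOn.diffContOnCl
      rw [closure_ball _ hr.ne']
      intro z hz
      have hz' : ‖z‖ ≤ r := by simpa using hz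
      exact ((hd2 _ _ _ (dom3_of_norm hp2 hz')).sub
        (hd2 _ _ _ (dom3_of_norm hdr hz'))).differentiableWithinAt
    have hb := Complex.norm_le_of_forall_mem_frontier_norm_le Metric.isBounded_ball hdc
      (C := ε / 2) (fun z hz => by
        rw [frontier_ball _ hr.ne'] at hz
        have := hvv _ hp1 z hz
        simp only [Set.mem_ofPred_eq, dist_eq_norm] at this
        exact this.le) (subset_closure hp4)
    calc dist (H' t z w) (H' t0 0 w0) ≤ dist (H' t z w) (H' t0 z w0)
          + dist (H' t0 z w0) (H' t0 0 w0) := dist_triangle _ _ _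
      _ < ε / 2 + ε / 2 := by rw [dist_eq_norm]; exact add_lt_add_of_le_of_lt hb hp3
      _ = ε := by ring
  have key : ∀ t w : ℂ, ∀ r : ℝ, 0 < r → dom3 t (r * Complex.I) w →
      H' t 0 w = (2 * Real.pi * Complex.I : ℂ)⁻¹ •
        ∫ θ in (0 : ℝ)..2 * Real.pi, Complex.I * H' t (circleMap 0 r θ) w := by
    intro t w r hr hd
    have h1 : DiffContOnCl ℂ (fun z => H' t z w) (Metric.ball 0 r) := by
      apply DifferentiableOn.diffContOnCl
      rw [closure_ball _ hr.ne']
      intro z hz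
      exact (hd2 _ _ _ (dom3_of_norm hd (by simpa using hz))).differentiableWithinAt
    have h2 := h1.circleIntegral_sub_inv_smul (w := 0) (by simpa using hr)
    have h3 : (∮ z in C(0, r), (z - 0)⁻¹ • H' t z w) =
        ∫ θ in (0 : ℝ)..2 * Real.pi, Complex.I * H' t (circleMap 0 r θ) w := by
      rw [circleIntegral]
      congr 1
      ext θ
      have : circleMap 0 r θ ≠ 0 := circleMap_ne_center hr.ne'
      simp only [deriv_circleMap, sub_zero, smul_eq_mul]
      field_simp
    rw [h3] at h2
    rw [h2, smul_eq_mul, smul_eq_mul, ← mul_assoc, inv_mul_cancel₀, one_mul]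
    exact Complex.two_pi_I_ne_zero
  refine ⟨H', ⟨hcont, ?_, hd2, ?_⟩, ?_⟩
  · intro t z w h
    by_cases hz : z = 0
    · subst hz
      obtain ⟨r, hr, hd⟩ := exists_radius h.1 h.2.1
      have hev : ∀ᶠ t' in 𝓝 t, dom3 t' (r * Complex.I) w := eventually_dom1 hd
      have hU : IsOpen {t' | dom3 t' (r * Complex.I) w} :=
        isOpen_domSet.preimage (show Continuous fun t' : ℂ => (t', (r : ℂ) * Complex.I, w) by
          fun_prop)
      have hcm : ∀ θ, ‖circleMap 0 r θ‖ ≤ r := fun θ => by simp [abs_of_pos hr]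
      have hI := differentiableOn_intervalIntegral hU (a := 0) (b := 2 * Real.pi)
        (f := fun t' θ => Complex.I * H' t' (circleMap 0 r θ) w) ?_ ?_
      · refine DifferentiableAt.congr_of_eventuallyEq
          (((hI t hd).differentiableAt (hU.mem_nhds hd)).const_smul
          ((2 * Real.pi * Complex.I : ℂ)⁻¹)) ?_
        filter_upwards [hev] with t' ht'
        exact key t' w r hr ht'
      · refine continuousOn_const.mul (hcont.comp (f := fun x : ℂ × ℝ =>
          (x.1, circleMap 0 r x.2, w)) ?_ ?_)
        · exact (continuous_fst.prodMk (((continuous_circleMap 0 r).comp continuous_snd).prodMk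
            continuous_const)).continuousOn
        · rintro ⟨t', θ⟩ ⟨h1, -⟩
          exact dom3_of_norm h1 (hcm θ)
      · intro θ _ t' ht'
        have hzz : circleMap 0 r θ ≠ 0 := circleMap_ne_center hr.ne'
        have hdd := dom3_of_norm ht' (hcm θ)
        apply DifferentiableAt.differentiableWithinAt
        refine DifferentiableAt.const_mul ?_ _
        refine ((hH.d1 _ _ _ hdd).const_mul (circleMap 0 r θ)⁻¹).congr_of_eventuallyEq ?_
        filter_upwards [eventually_dom1 hdd] with s hs
        exact hne _ _ _ hs.1 hs.2.1 hzz
    · refine ((hH.d1 _ _ _ h).const_mul z⁻¹).congr_of_eventuallyEq ?_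
      filter_upwards [eventually_dom1 h] with s hs
      exact hne _ _ _ hs.1 hs.2.1 hz
  · intro t z w h
    by_cases hz : z = 0
    · subst hz
      obtain ⟨r, hr, hd⟩ := exists_radius h.1 h.2.1
      have hev : ∀ᶠ w' in 𝓝 w, dom3 t (r * Complex.I) w' := eventually_dom3 hd
      have hU : IsOpen {w' | dom3 t (r * Complex.I) w'} :=
        isOpen_domSet.preimage (show Continuous fun w' : ℂ => (t, (r : ℂ) * Complex.I, w') by
          fun_prop)
      have hcm : ∀ θ, ‖circleMap 0 r θ‖ ≤ r := fun θ => by simp [abs_of_pos hr]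
      have hI := differentiableOn_intervalIntegral hU (a := 0) (b := 2 * Real.pi)
        (f := fun w' θ => Complex.I * H' t (circleMap 0 r θ) w') ?_ ?_
      · refine DifferentiableAt.congr_of_eventuallyEq
          (((hI w hd).differentiableAt (hU.mem_nhds hd)).const_smul
          ((2 * Real.pi * Complex.I : ℂ)⁻¹)) ?_
        filter_upwards [hev] with w' hw'
        exact key t w' r hr hw'
      · refine continuousOn_const.mul (hcont.comp (f := fun x : ℂ × ℝ =>
          (t, circleMap 0 r x.2, x.1)) ?_ ?_)
        · exact (continuous_const.prodMk (((continuous_circleMap 0 r).comp continuous_snd).prodMk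
            continuous_fst)).continuousOn
        · rintro ⟨w', θ⟩ ⟨h1, -⟩
          exact dom3_of_norm h1 (hcm θ)
      · intro θ _ w' hw'
        have hzz : circleMap 0 r θ ≠ 0 := circleMap_ne_center hr.ne'
        have hdd := dom3_of_norm hw' (hcm θ)
        apply DifferentiableAt.differentiableWithinAt
        refine DifferentiableAt.const_mul ?_ _
        refine ((hH.d3 _ _ _ hdd).const_mul (circleMap 0 r θ)⁻¹).congr_of_eventuallyEq ?_
        filter_upwards [eventually_dom3 hdd] with s hs
        exact hne _ _ _ hs.1 hs.2.1 hzz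
    · refine ((hH.d3 _ _ _ h).const_mul z⁻¹).congr_of_eventuallyEq ?_
      filter_upwards [eventually_dom3 h] with s hs
      exact hne _ _ _ hs.1 hs.2.1 hz
  · intro t z w h
    by_cases hz : z = 0
    · subst hz; rw [h0 t w h.1 h.2.1, zero_mul]
    · rw [hne _ _ _ h.1 h.2.1 hz, mul_inv_cancel_left₀ hz]

lemma isOpen_HH2 : IsOpen HH2 := by
  have h : HH2 = {τ : Matrix (Fin 2) (Fin 2) ℂ | 0 < (τ 0 0).im} ∩ ({τ | 0 < (τ 1 1).im} ∩
      {τ | Complex.normSq (τ 0 1 - (starRingEnd ℂ) (τ 1 0)) < 4 * ((τ 0 0).im * (τ 1 1).im)}) := by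
    ext τ
    have : τ = !![τ 0 0, τ 0 1; τ 1 0, τ 1 1] := Matrix.eta_fin_two τ
    rw [this, mk_mem_HH2]
    simp
  have he : ∀ i j, Continuous fun τ : Matrix (Fin 2) (Fin 2) ℂ => τ i j := fun i j =>
    (continuous_apply j).comp (continuous_apply i)
  rw [h]
  refine (isOpen_lt continuous_const (Complex.continuous_im.comp (he 0 0))).inter
    ((isOpen_lt continuous_const (Complex.continuous_im.comp (he 1 1))).inter
    (isOpen_lt ?_ ?_))
  · exact Complex.continuous_normSq.comp
      ((he 0 1).sub (Complex.continuous_conj.comp (he 1 0)))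
  · exact continuous_const.mul ((Complex.continuous_im.comp (he 0 0)).mul
      (Complex.continuous_im.comp (he 1 1)))

lemma DifferentiableOn.line_HH2 {F : Matrix (Fin 2) (Fin 2) ℂ → ℂ} (hF : DifferentiableOn ℂ F HH2)
    (A B : Matrix (Fin 2) (Fin 2) ℂ) (s : ℂ) (h : A + s • B ∈ HH2) :
    DifferentiableAt ℂ (fun s => F (A + s • B)) s := by
  refine DifferentiableAt.comp s (hF.differentiableAt (isOpen_HH2.mem_nhds h)) ?_
  fun_prop

theorem goodH_restr {F : Matrix (Fin 2) (Fin 2) ℂ → ℂ} (hF : DifferentiableOn ℂ F HH2) :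
    GoodH (restr F) := by
  refine ⟨?_, ?_, ?_, ?_⟩
  · refine hF.continuousOn.comp (f := fun p : ℂ × ℂ × ℂ =>
      !![p.1, (starRingEnd ℂ) (omg 7) * p.2.1; omg 7 * p.2.1, p.2.2]) ?_ ?_
    · apply Continuous.continuousOn
      refine continuous_pi fun i => continuous_pi fun j => ?_
      fin_cases i <;> fin_cases j <;> simp <;> fun_prop
    · intro p hp
      exact restr_mem.mpr hp
  · intro t z w h
    have e : ∀ t : ℂ, !![t, (starRingEnd ℂ) (omg 7) * z; omg 7 * z, w] =
        !![0, (starRingEnd ℂ) (omg 7) * z; omg 7 * z, w] + t • !![1, 0; 0, 0] := fun t => by simp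
    have := hF.line_HH2 _ _ t (by rw [← e]; exact restr_mem.mpr h)
    simp only [← e] at this
    exact this
  · intro t z w h
    have e : ∀ z : ℂ, !![t, (starRingEnd ℂ) (omg 7) * z; omg 7 * z, w] =
        !![t, 0; 0, w] + z • !![0, (starRingEnd ℂ) (omg 7); omg 7, 0] := fun z => by simp [mul_comm]
    have := hF.line_HH2 _ _ z (by rw [← e]; exact restr_mem.mpr h)
    simp only [← e] at this
    exact this
  · intro t z w h
    have e : ∀ w : ℂ, !![t, (starRingEnd ℂ) (omg 7) * z; omg 7 * z, w] =
        !![t, (starRingEnd ℂ) (omg 7) * z; omg 7 * z, 0] + w • !![0, 0; 0, 1] := fun w => by simp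
    have := hF.line_HH2 _ _ w (by rw [← e]; exact restr_mem.mpr h)
    simp only [← e] at this
    exact this

lemma restr_phiLam (F : Matrix (Fin 2) (Fin 2) ℂ → ℂ) (τ : Matrix (Fin 2) (Fin 2) ℂ) :
    F (phiLam (omg 7) τ) = restr F (τ 0 0) (τ 0 1) (2 * τ 1 1) := by
  rw [phiLam, omg_mul_conj, restr]

/-- The exponential with period one. -/
def eC (z : ℂ) : ℂ := Complex.exp (2 * Real.pi * Complex.I * z)

lemma eC_add (a b : ℂ) : eC (a + b) = eC a * eC b := by
  simp only [eC, mul_add, Complex.exp_add]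

@[simp] lemma eC_zero : eC 0 = 1 := by simp [eC]

lemma eC_ne_zero (a : ℂ) : eC a ≠ 0 := Complex.exp_ne_zero _

lemma eC_neg (a : ℂ) : eC (-a) = (eC a)⁻¹ := by simp only [eC, mul_neg, Complex.exp_neg]

lemma eC_sub (a b : ℂ) : eC (a - b) = eC a / eC b := by
  rw [sub_eq_add_neg, eC_add, eC_neg, div_eq_mul_inv]

lemma eC_int (n : ℤ) : eC n = 1 := by
  rw [eC, mul_comm]; exact Complex.exp_int_mul_two_pi_mul_I n

lemma eC_one : eC 1 = 1 := by simpa using eC_int 1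

lemma eC_nat_mul (n : ℕ) (z : ℂ) : eC (n * z) = eC z ^ n := by
  rw [eC, eC, ← Complex.exp_nat_mul]; congr 1; ring

lemma eC_half : eC (1 / 2) = -1 := by
  rw [eC, ← Complex.exp_pi_mul_I]; congr 1; ring

lemma eC_eq_one_iff {z : ℂ} : eC z = 1 ↔ ∃ n : ℤ, z = n := by
  rw [eC, Complex.exp_eq_one_iff]
  refine exists_congr fun n => ?_
  rw [mul_comm]
  exact mul_left_inj' Complex.two_pi_I_ne_zero

lemma differentiable_eC : Differentiable ℂ eC := by unfold eC; fun_prop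

lemma norm_eC (z : ℂ) : ‖eC z‖ = Real.exp (-2 * Real.pi * z.im) := by
  rw [eC, Complex.norm_exp]; simp

lemma norm_eC_lt_one {t : ℂ} (ht : 0 < t.im) : ‖eC t‖ < 1 := by
  rw [norm_eC, Real.exp_lt_one_iff]
  have := mul_pos Real.pi_pos ht
  linarith

/-- The `q`-Pochhammer product as a function of its argument. -/
def thQ (q x : ℂ) : ℂ := ∏' n : ℕ, (1 + -(q ^ n * x))

lemma summable_thQ {q : ℂ} (hq : ‖q‖ < 1) (x : ℂ) : Summable fun n : ℕ => ‖-(q ^ n * x)‖ := by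
  simp only [norm_neg, norm_mul, norm_pow]
  exact (summable_geometric_of_lt_one (norm_nonneg _) hq).mul_right _

lemma thQ_step {q : ℂ} (hq : ‖q‖ < 1) (x : ℂ) : thQ q x = (1 - x) * thQ q (q * x) := by
  unfold thQ
  rw [tprod_eq_zero_mul']
  · rw [pow_zero, one_mul, ← sub_eq_add_neg]
    congr 2
    ext n
    rw [pow_succ, mul_assoc]
  · refine multipliable_one_add_of_summable ?_
    exact (summable_nat_add_iff 1).mpr (summable_thQ hq x)

lemma thQ_ne_zero {q : ℂ} (hq : ‖q‖ < 1) {x : ℂ} (h : ∀ n : ℕ, q ^ n * x ≠ 1) : thQ q x ≠ 0 := by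
  refine tprod_one_add_ne_zero_of_summable (fun n => ?_) (summable_thQ hq x)
  rw [← sub_eq_add_neg]
  exact sub_ne_zero.mpr (h n).symm

lemma differentiable_thQ {q : ℂ} (hq : ‖q‖ < 1) : Differentiable ℂ (thQ q) := by
  intro x
  have h : HasProdLocallyUniformlyOn (fun (n : ℕ) (x : ℂ) => 1 + -(q ^ n * x)) (thQ q)
      (Metric.ball 0 (‖x‖ + 1)) := by
    refine Summable.hasProdLocallyUniformlyOn_nat_one_add (u := fun n => ‖q‖ ^ n * (‖x‖ + 1))
      Metric.isOpen_ball ?_ ?_ ?_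
    · exact (summable_geometric_of_lt_one (norm_nonneg _) hq).mul_right _
    · refine Eventually.of_forall fun n y hy => ?_
      rw [norm_neg, norm_mul, norm_pow]
      gcongr
      simpa using (mem_ball_zero_iff.mp hy).le
    · intro n; fun_prop
  have h2 := h.differentiableOn (.of_forall fun _ => by
    simpa [Finset.prod_fn] using DifferentiableOn.finsetProd (fun _ _ => by fun_prop))
    Metric.isOpen_ball
  exact (h2 x (by simp)).differentiableAt (Metric.isOpen_ball.mem_nhds (by simp))

/-- The odd theta function as a product, normalized to have period one. -/
def thP (t z : ℂ) : ℂ := thQ (eC t) (eC z) * thQ (eC t) (eC t * eC (-z))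

lemma differentiable_thP {t : ℂ} (ht : 0 < t.im) : Differentiable ℂ (thP t) := by
  have h := differentiable_thQ (norm_eC_lt_one ht)
  have h2 := differentiable_eC
  unfold thP
  fun_prop

lemma thP_add_one (t z : ℂ) : thP t (z + 1) = thP t z := by
  unfold thP
  rw [neg_add, eC_add, eC_add, eC_neg 1, eC_one]; simp

lemma thP_add {t : ℂ} (ht : 0 < t.im) (z : ℂ) : thP t (z + t) = -eC (-z) * thP t z := by
  have hq := norm_eC_lt_one ht
  have e1 : eC t * eC (-(z + t)) = eC (-z) := by rw [← eC_add]; congr 1; ring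
  have e2 : eC (z + t) = eC t * eC z := by rw [eC_add, mul_comm]
  unfold thP
  rw [e1, e2, thQ_step hq (eC (-z)), thQ_step hq (eC z), eC_neg]
  have := eC_ne_zero z
  field_simp
  ring

lemma thP_eq_zero {t z : ℂ} (ht : 0 < t.im) (h : thP t z = 0) : ∃ a b : ℤ, z = a + b * t := by
  have hq := norm_eC_lt_one ht
  by_contra hne
  push Not at hne
  refine mul_ne_zero (thQ_ne_zero hq fun n hn => ?_) (thQ_ne_zero hq fun n hn => ?_) h
  · rw [← eC_nat_mul, ← eC_add, eC_eq_one_iff] at hn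
    obtain ⟨m, hm⟩ := hn
    exact hne m (-n) (by push_cast; linear_combination hm)
  · rw [← eC_nat_mul, ← eC_add, ← eC_add, eC_eq_one_iff] at hn
    obtain ⟨m, hm⟩ := hn
    exact hne (-m) (n + 1) (by push_cast; linear_combination -hm)

lemma thP_zero {t : ℂ} (ht : 0 < t.im) : thP t 0 = 0 := by
  rw [thP, eC_zero, thQ_step (norm_eC_lt_one ht)]; simp

lemma deriv_thP_zero {t : ℂ} (ht : 0 < t.im) : deriv (thP t) 0 ≠ 0 := by
  have hq := norm_eC_lt_one ht
  have e : thP t = fun z => (1 - eC z) * (thQ (eC t) (eC t * eC z) *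
      thQ (eC t) (eC t * eC (-z))) := by
    ext z; rw [thP, thQ_step hq]; ring
  have hd : Differentiable ℂ fun z => (thQ (eC t) (eC t * eC z) *
      thQ (eC t) (eC t * eC (-z))) := by
    have h := differentiable_thQ hq
    have h2 := differentiable_eC
    fun_prop
  have h1 : HasDerivAt (fun z => 1 - eC z) (-(2 * Real.pi * Complex.I)) 0 := by
    have : HasDerivAt eC (2 * Real.pi * Complex.I) 0 := by
      have := ((hasDerivAt_id (0 : ℂ)).const_mul (2 * Real.pi * Complex.I)).cexp
      simp only [id_eq, mul_zero, Complex.exp_zero, one_mul, mul_one] at this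
      exact this
    simpa using this.const_sub 1
  have h2 := h1.mul (hd 0).hasDerivAt
  rw [e]
  have h3 := h2.deriv
  change deriv _ 0 = _ at h3
  rw [show ((fun z => 1 - eC z) * fun z => (thQ (eC t) (eC t * eC z) *
      thQ (eC t) (eC t * eC (-z)))) = fun z => (1 - eC z) * (thQ (eC t) (eC t * eC z) *
      thQ (eC t) (eC t * eC (-z))) from rfl] at h3
  rw [h3]
  have hn : thQ (eC t) (eC t) ≠ 0 := thQ_ne_zero hq fun n hn => by
    rw [← pow_succ] at hn
    have : ‖eC t ^ (n + 1)‖ < 1 := by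
      rw [norm_pow]; exact pow_lt_one₀ (norm_nonneg _) hq (by simp)
    rw [hn] at this; simp at this
  simp [hn, Complex.I_ne_zero, Real.pi_ne_zero]

lemma thP_lattice {t : ℂ} (ht : 0 < t.im) (a b : ℤ) :
    thP t (a + b * t) = 0 ∧ deriv (thP t) (a + b * t) ≠ 0 := by
  have hd := differentiable_thP ht
  have s1 : ∀ z, deriv (thP t) (z + 1) = deriv (thP t) z := fun z => by
    have : (fun z => thP t (z + 1)) = thP t := funext (thP_add_one t)
    rw [← deriv_comp_add_const, this]
  have s2 : ∀ z, thP t z = 0 → deriv (thP t) (z + t) = -eC (-z) * deriv (thP t) z := fun z hz => by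
    have : (fun z => thP t (z + t)) = fun z => -eC (-z) * thP t z := funext (thP_add ht)
    rw [← deriv_comp_add_const, this]
    have hde : DifferentiableAt ℂ (fun z => -eC (-z)) z := by
      have := differentiable_eC; fun_prop
    have := (hde.hasDerivAt.mul (hd z).hasDerivAt).deriv
    rw [hz, mul_zero, zero_add] at this
    exact this
  have hb : thP t (b * t) = 0 ∧ deriv (thP t) (b * t) ≠ 0 := by
    induction b using Int.induction_on with
    | zero => simpa using ⟨thP_zero ht, deriv_thP_zero ht⟩
    | succ n ih =>
      have e : (((n : ℤ) + 1 : ℤ) : ℂ) * t = (n : ℤ) * t + t := by push_cast; ring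
      rw [e, thP_add ht, s2 _ ih.1, ih.1]
      exact ⟨by simp, mul_ne_zero (neg_ne_zero.mpr (eC_ne_zero _)) ih.2⟩
    | pred n ih =>
      have e : ((-(n : ℤ) : ℤ) : ℂ) * t = ((-(n : ℤ) - 1 : ℤ) : ℂ) * t + t := by push_cast; ring
      rw [e, thP_add ht] at ih
      have h0 := (mul_eq_zero.mp ih.1).resolve_left (neg_ne_zero.mpr (eC_ne_zero _))
      rw [s2 _ h0] at ih
      exact ⟨h0, right_ne_zero_of_mul ih.2⟩
  induction a using Int.induction_on with
  | zero => simpa using hb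
  | succ n ih =>
    have e : (((n : ℤ) + 1 : ℤ) : ℂ) + b * t = ((n : ℤ) + b * t) + 1 := by push_cast; ring
    rw [e, thP_add_one, s1]; exact ih
  | pred n ih =>
    have e : ((-(n : ℤ) : ℤ) : ℂ) + b * t = (((-(n : ℤ) - 1 : ℤ) : ℂ) + b * t) + 1 := by
      push_cast; ring
    rw [e, thP_add_one, s1] at ih; exact ih

lemma dense_thP_ne_zero {t : ℂ} (ht : 0 < t.im) (a : ℂ) : Dense {z | thP t (z - a) ≠ 0} := by
  have h : (Set.range fun p : ℤ × ℤ => (p.1 : ℂ) + p.2 * t + a).Countable :=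
    Set.countable_range _
  refine (h.dense_compl ℝ).mono fun z hz => ?_
  rw [Set.mem_ofPred_eq]
  refine fun hz0 => hz ?_
  obtain ⟨m, n, h⟩ := thP_eq_zero ht hz0
  exact ⟨(m, n), by simp only; rw [← h]; ring⟩

/-- Quasi-periodic entire functions: theta functions of degree `N`. -/
structure IsTheta (t : ℂ) (N : ℤ) (C : ℂ) (f : ℂ → ℂ) : Prop where
  diff : Differentiable ℂ f
  add_one : ∀ z, f (z + 1) = f z
  add : ∀ z, f (z + t) = C * eC (-(N * z)) * f z

lemma IsTheta.zero_lattice {t : ℂ} {N : ℤ} {C : ℂ} {f : ℂ → ℂ} (hf : IsTheta t N C f)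
    (hC : C ≠ 0) {a : ℂ} (ha : f a = 0) (m n : ℤ) : f (a + m + n * t) = 0 := by
  have h1 : ∀ z, f (z + 1) = 0 ↔ f z = 0 := fun z => by rw [hf.add_one]
  have h2 : ∀ z, f (z + t) = 0 ↔ f z = 0 := fun z => by
    rw [hf.add]; simp [hC, eC_ne_zero]
  have hm : f (a + m) = 0 := by
    induction m using Int.induction_on with
    | zero => simpa using ha
    | succ n ih =>
      rw [show a + ((n : ℤ) + 1 : ℤ) = a + (n : ℤ) + 1 by push_cast; ring, h1]; exact ih
    | pred n ih =>
      rw [← h1, show a + ((-(n : ℤ) - 1 : ℤ) : ℂ) + 1 = a + (-(n : ℤ) : ℤ) by push_cast; ring]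
      exact ih
  induction n using Int.induction_on with
  | zero => simpa using hm
  | succ n ih =>
    rw [show a + m + ((n : ℤ) + 1 : ℤ) * t = a + m + (n : ℤ) * t + t by push_cast; ring, h2]
    exact ih
  | pred n ih =>
    rw [← h2, show a + m + ((-(n : ℤ) - 1 : ℤ) : ℂ) * t + t = a + m + (-(n : ℤ) : ℤ) * t by
      push_cast; ring]
    exact ih

theorem IsTheta.exists_div {t : ℂ} (ht : 0 < t.im) {N : ℤ} {C : ℂ} {f : ℂ → ℂ}
    (hf : IsTheta t N C f) (hC : C ≠ 0) {a : ℂ} (ha : f a = 0) :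
    ∃ h, IsTheta t (N - 1) (-C * eC (-a)) h ∧ ∀ z, f z = thP t (z - a) * h z := by
  set p : ℂ → ℂ := fun z => thP t (z - a) with hp
  have hpd : Differentiable ℂ p := (differentiable_thP ht).comp (differentiable_id.sub_const a)
  have hzero : ∀ z, p z = 0 → f z = 0 ∧ deriv p z ≠ 0 := by
    intro z hz
    obtain ⟨m, n, hmn⟩ := thP_eq_zero ht hz
    constructor
    · have := hf.zero_lattice hC ha m n
      rwa [show a + m + n * t = z by linear_combination -hmn] at this
    · have := (thP_lattice ht m n).2
      rw [← hmn] at this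
      rwa [hp, deriv_comp_sub_const]
  set h : ℂ → ℂ := fun z => if p z = 0 then deriv f z / deriv p z else f z / p z with hh
  have hfac : ∀ z, f z = p z * h z := by
    intro z
    by_cases hz : p z = 0
    · rw [hz, (hzero z hz).1, zero_mul]
    · simp only [hh, if_neg hz]; field_simp
  have hdiff : Differentiable ℂ h := by
    intro z
    by_cases hz : p z = 0
    · obtain ⟨hfz, hdz⟩ := hzero z hz
      have d1 : DifferentiableAt ℂ (dslope f z) z :=
        ((Complex.differentiableOn_dslope univ_mem).mpr hf.diff.differentiableOn).differentiableAt
          univ_mem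
      have d2 : DifferentiableAt ℂ (dslope p z) z :=
        ((Complex.differentiableOn_dslope univ_mem).mpr hpd.differentiableOn).differentiableAt
          univ_mem
      have hn : dslope p z z ≠ 0 := by rwa [dslope_same]
      refine (d1.div d2 hn).congr_of_eventuallyEq ?_
      filter_upwards [d2.continuousAt.eventually_ne hn] with y hy
      by_cases hyz : y = z
      · subst hyz
        simp [hh, if_pos hz, dslope_same]
      · have e1 := sub_smul_dslope f z y
        have e2 := sub_smul_dslope p z y
        rw [hfz, sub_zero, smul_eq_mul] at e1
        rw [hz, sub_zero, smul_eq_mul] at e2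
        have hyz' := sub_ne_zero.mpr hyz
        have hpy : p y ≠ 0 := by rw [← e2]; exact mul_ne_zero hyz' hy
        simp only [hh, if_neg hpy, Pi.div_apply]
        rw [← e1, ← e2]
        field_simp
    · refine ((hf.diff z).div (hpd z) hz).congr_of_eventuallyEq ?_
      filter_upwards [(hpd z).continuousAt.eventually_ne hz] with y hy
      simp [hh, if_neg hy]
  refine ⟨h, ⟨hdiff, ?_, ?_⟩, hfac⟩
  · refine congrFun (Continuous.ext_on (dense_thP_ne_zero ht a)
      (hdiff.continuous.comp (by fun_prop))
      hdiff.continuous fun z hz => ?_)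
    have h1 := hf.add_one z
    have e : p (z + 1) = p z := by
      simp only [hp]; rw [show z + 1 - a = z - a + 1 by ring, thP_add_one]
    rw [hfac, hfac z, e] at h1
    exact mul_left_cancel₀ hz h1
  · refine congrFun (Continuous.ext_on (dense_thP_ne_zero ht a)
      (hdiff.continuous.comp (by fun_prop))
      (((differentiable_eC.comp (by fun_prop : Differentiable ℂ fun z => -(((N - 1 : ℤ) : ℂ) * z))
        ).continuous.const_smul (-C * eC (-a))).mul hdiff.continuous) fun z hz => ?_)
    have h1 := hf.add z
    have e : p (z + t) = -eC (-(z - a)) * p z := by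
      simp only [hp]; rw [show z + t - a = z - a + t by ring, thP_add ht]
    rw [hfac, hfac z, e] at h1
    have h2 : -eC (-(z - a)) * h (z + t) = C * eC (-(N * z)) * h z :=
      mul_left_cancel₀ hz (by linear_combination h1)
    have h3 : eC (-(N * z)) = eC (-(z - a)) * (eC (-a) * eC (-(((N - 1 : ℤ) : ℂ) * z))) := by
      rw [← eC_add, ← eC_add]; congr 1; push_cast; ring
    rw [h3] at h2
    have h4 := eC_ne_zero (-(z - a))
    refine mul_left_cancel₀ h4 ?_
    change _ = _ * ((-C * eC (-a)) * eC (-(((N - 1 : ℤ) : ℂ) * z)) * h z)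
    linear_combination -h2

lemma elliptic_eq_const {t : ℂ} (ht : 0 < t.im) {f : ℂ → ℂ} (hd : Differentiable ℂ f)
    (h1 : ∀ z, f (z + 1) = f z) (h2 : ∀ z, f (z + t) = f z) (z w : ℂ) : f z = f w := by
  refine hd.apply_eq_apply_of_bounded ?_ z w
  have hK : IsCompact ((fun p : ℝ × ℝ => (p.1 : ℂ) + p.2 * t) '' (Set.Icc 0 1 ×ˢ Set.Icc 0 1)) :=
    (isCompact_Icc.prod isCompact_Icc).image (by fun_prop)
  refine (hK.image hd.continuous).isBounded.subset ?_
  rintro _ ⟨z, rfl⟩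
  have p1 : Function.Periodic f 1 := h1
  have p2 : Function.Periodic f t := h2
  set y := z.im / t.im
  set x := z.re - y * t.re
  have hz : z = x + y * t := by
    apply Complex.ext
    · simp [x]
    · simp [y, ht.ne']
  refine ⟨((Int.fract x : ℝ) : ℂ) + (Int.fract y : ℝ) * t, ⟨(Int.fract x, Int.fract y),
    ⟨⟨Int.fract_nonneg _, (Int.fract_lt_one _).le⟩, ⟨Int.fract_nonneg _, (Int.fract_lt_one _).le⟩⟩,
    by simp⟩, ?_⟩
  have e : z = ((Int.fract x : ℝ) : ℂ) + (Int.fract y : ℝ) * t + ⌊x⌋ * 1 + ⌊y⌋ * t := by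
    conv_lhs => rw [hz, ← Int.fract_add_floor x, ← Int.fract_add_floor y]
    push_cast; ring
  conv_rhs => rw [e]
  rw [p2.int_mul, p1.int_mul]

lemma analyticOrderAt_thP {t : ℂ} (ht : 0 < t.im) : analyticOrderAt (thP t) 0 = 1 :=
  ((differentiable_thP ht).analyticAt 0).analyticOrderAt_eq_one_of_zero_deriv_ne_zero
    (thP_zero ht) (deriv_thP_zero ht)

/-- A theta function of degree `N` (with suitable characteristic) vanishing to order greater
than `N` at the origin is zero. -/
theorem IsTheta.eq_zero {t : ℂ} (ht : 0 < t.im) (N : ℕ) : ∀ {r : ℤ} {f : ℂ → ℂ},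
    IsTheta t N ((-1) ^ N * eC (r * t)) f → ((N + 1 : ℕ) : ℕ∞) ≤ analyticOrderAt f 0 →
    ∀ z, f z = 0 := by
  induction N with
  | zero =>
    intro r f hf ho z
    have h0 : f 0 = 0 := by
      apply apply_eq_zero_of_analyticOrderAt_ne_zero
      intro h; rw [h] at ho; simp at ho
    have hd := differentiable_eC
    have := elliptic_eq_const ht (f := fun z => eC (-(r * z)) * f z)
      (by have := hf.diff; fun_prop) (fun z => ?_) (fun z => ?_) z 0
    · simpa [h0, eC_ne_zero] using this
    · simp only [hf.add_one]
      rw [mul_add, neg_add, eC_add, mul_one, ← Int.cast_neg, eC_int, mul_one]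
    · simp only [hf.add]
      have : eC (-(r * (z + t))) * eC (r * t) = eC (-(r * z)) := by
        rw [← eC_add]; congr 1; ring
      simp only [pow_zero, one_mul, Nat.cast_zero, Int.cast_zero, zero_mul, neg_zero, eC_zero,
        mul_one]
      rw [← mul_assoc, this]
  | succ N ih =>
    intro r f hf ho z
    have h0 : f 0 = 0 := by
      apply apply_eq_zero_of_analyticOrderAt_ne_zero
      intro h; rw [h] at ho; simp at ho
    obtain ⟨h, hh, hfac⟩ := hf.exists_div ht (mul_ne_zero (by simp) (eC_ne_zero _)) h0
    simp only [sub_zero] at hfac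
    rw [hfac]
    have hh' : IsTheta t N ((-1) ^ N * eC (r * t)) h := by
      convert hh using 1
      · push_cast; ring
      · rw [neg_zero, eC_zero]; ring
    rw [ih hh' ?_ z, mul_zero]
    have hord : analyticOrderAt f 0 = 1 + analyticOrderAt h 0 := by
      rw [← analyticOrderAt_thP ht, ← analyticOrderAt_mul ((differentiable_thP ht).analyticAt 0)
        (hh.diff.analyticAt 0)]
      congr 1; ext z; exact hfac z
    rw [hord] at ho
    have : (((N + 1 + 1 : ℕ) : ℕ∞)) = 1 + ((N + 1 : ℕ) : ℕ∞) := by push_cast; ring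
    rw [this] at ho
    exact (ENat.add_le_add_iff_left (by simp)).mp ho

/-- Division at a point which is not a lattice point does not change the order at zero. -/
lemma IsTheta.exists_div_of_ne {t : ℂ} (ht : 0 < t.im) {N : ℤ} {C : ℂ} {f : ℂ → ℂ}
    (hf : IsTheta t N C f) (hC : C ≠ 0) {a : ℂ} (ha : f a = 0) (hn : thP t (0 - a) ≠ 0) :
    ∃ h, IsTheta t (N - 1) (-C * eC (-a)) h ∧ (∀ z, f z = thP t (z - a) * h z) ∧
      analyticOrderAt h 0 = analyticOrderAt f 0 := by
  obtain ⟨h, hh, hfac⟩ := hf.exists_div ht hC ha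
  refine ⟨h, hh, hfac, ?_⟩
  have hd : AnalyticAt ℂ (fun z => thP t (z - a)) 0 :=
    ((differentiable_thP ht).comp (differentiable_id.sub_const a)).analyticAt 0
  have : f = (fun z => thP t (z - a)) * h := funext hfac
  rw [this, analyticOrderAt_mul hd (hh.diff.analyticAt 0), hd.analyticOrderAt_eq_zero.mpr hn,
    zero_add]

lemma thP_half_ne_zero {t : ℂ} (ht : 0 < t.im) {p q : ℤ} (h : ¬ (Even p ∧ Even q)) {z : ℂ}
    (hz : z = p / 2 + q / 2 * t) : thP t z ≠ 0 := by
  intro h0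
  obtain ⟨a, b, hab⟩ := thP_eq_zero ht h0
  rw [hz] at hab
  have him := congrArg Complex.im hab
  have hre := congrArg Complex.re hab
  have e1 : ((p : ℂ) / 2) = ((p / 2 : ℝ) : ℂ) := by push_cast; ring
  have e2 : ((q : ℂ) / 2) = ((q / 2 : ℝ) : ℂ) := by push_cast; ring
  rw [e1, e2] at him hre
  simp only [Complex.add_im, Complex.ofReal_im, Complex.mul_im, Complex.ofReal_re, zero_mul,
    add_zero, zero_add, Complex.intCast_im, Complex.intCast_re] at him
  have hq : (q : ℝ) / 2 = b := mul_right_cancel₀ ht.ne' him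
  simp only [Complex.add_re, Complex.ofReal_im, Complex.mul_re, Complex.ofReal_re, zero_mul,
    sub_zero, Complex.intCast_im, Complex.intCast_re, hq, add_left_inj] at hre
  refine h ⟨⟨a, ?_⟩, ⟨b, ?_⟩⟩
  · have : (p : ℝ) = a + a := by linarith
    exact_mod_cast this
  · have : (q : ℝ) = b + b := by linarith
    exact_mod_cast this

theorem IsTheta.eq_zero_of_neg {t : ℂ} (ht : 0 < t.im) (N : ℕ) : ∀ {r : ℤ} {f : ℂ → ℂ},
    IsTheta t (-(N + 1 : ℕ)) ((-1) ^ (N + 1) * eC (r * t)) f → ∀ z, f z = 0 := by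
  intro r f hf
  have hP := differentiable_thP ht
  have h1 : IsTheta t (0 : ℕ) ((-1) ^ 0 * eC (r * t)) fun z => thP t z ^ (N + 1) * f z := by
    refine ⟨by have := hf.diff; fun_prop, fun z => by simp only [hf.add_one, thP_add_one],
      fun z => ?_⟩
    simp only [hf.add, thP_add ht]
    have e : eC (-(((-(N + 1 : ℕ) : ℤ) : ℂ) * z)) = (eC z) ^ (N + 1) := by
      rw [← eC_nat_mul]; congr 1; push_cast; ring
    rw [e, mul_pow, neg_pow, eC_neg]
    have h2 : (eC z)⁻¹ ^ (N + 1) * eC z ^ (N + 1) = 1 := by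
      rw [← mul_pow, inv_mul_cancel₀ (eC_ne_zero z), one_pow]
    have h3 : ((-1 : ℂ)) ^ (N + 1) * (-1) ^ (N + 1) = 1 := by rw [← mul_pow]; simp
    simp only [pow_zero, one_mul, Nat.cast_zero, Int.cast_zero, zero_mul, neg_zero, eC_zero,
      mul_one]
    linear_combination (eC (r * t) * thP t z ^ (N + 1) * f z) *
      ((eC z)⁻¹ ^ (N + 1) * eC z ^ (N + 1)) * h3 + (eC (r * t) * thP t z ^ (N + 1) * f z) * h2
  have h2 := IsTheta.eq_zero ht 0 h1 (by
    rw [zero_add, Nat.cast_one, ENat.one_le_iff_ne_zero]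
    rw [AnalyticAt.analyticOrderAt_ne_zero (h1.diff.analyticAt 0)]
    simp [thP_zero ht])
  refine congrFun (Continuous.ext_on (dense_thP_ne_zero ht 0) hf.diff.continuous
    (g := fun _ => 0) continuous_const fun z hz => ?_)
  rw [Set.mem_ofPred_eq, sub_zero] at hz
  exact (mul_eq_zero.mp (h2 z)).resolve_left (pow_ne_zero _ hz)

theorem IsTheta.eq_zero_of_odd {t : ℂ} (ht : 0 < t.im) {n : ℕ} {f : ℂ → ℂ}
    (hf : IsTheta t (4 * (n + 1) : ℕ) (eC (-(2 * (n + 1)) * t)) f) (hodd : ∀ z, f (-z) = -f z)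
    (ho : ((4 * n + 2 : ℕ) : ℕ∞) ≤ analyticOrderAt f 0) (z : ℂ) : f z = 0 := by
  have hself : ∀ x : ℂ, x = -x → x = 0 := fun x hx => by linear_combination hx / 2
  have z1 : f (1 / 2) = 0 := by
    apply hself
    rw [← hodd, ← hf.add_one (-(1 / 2))]; congr 1; ring
  have z2 : f (t / 2) = 0 := by
    apply hself
    have := hf.add (-(t / 2))
    have e : eC (-(2 * (n + 1)) * t) * eC (-(((4 * (n + 1) : ℕ) : ℤ) * -(t / 2))) = 1 := by
      rw [← eC_add]; convert eC_zero using 2; push_cast; ring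
    rw [e, one_mul, hodd] at this
    rw [← this]; congr 1; ring
  have z3 : f (1 / 2 + t / 2) = 0 := by
    apply hself
    have := hf.add (-(1 / 2 + t / 2))
    have e : eC (-(2 * (n + 1)) * t) * eC (-(((4 * (n + 1) : ℕ) : ℤ) * -(1 / 2 + t / 2))) = 1 := by
      rw [← eC_add]; convert eC_int (2 * (n + 1)) using 2; push_cast; ring
    rw [e, one_mul, hodd] at this
    rw [← this, ← hf.add_one (-(1 / 2 + t / 2) + t)]; congr 1; ring
  obtain ⟨g, hg, hfg, og⟩ := hf.exists_div_of_ne ht (eC_ne_zero _) z1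
    (thP_half_ne_zero ht (p := -1) (q := 0) (by decide) (by push_cast; ring))
  have z2g : g (t / 2) = 0 := by
    rw [hfg] at z2
    exact (mul_eq_zero.mp z2).resolve_left
      (thP_half_ne_zero ht (p := -1) (q := 1) (by decide) (by push_cast; ring))
  have z3g : g (1 / 2 + t / 2) = 0 := by
    rw [hfg] at z3
    exact (mul_eq_zero.mp z3).resolve_left
      (thP_half_ne_zero ht (p := 0) (q := 1) (by decide) (by push_cast; ring))
  have c1 := mul_ne_zero (neg_ne_zero.mpr (eC_ne_zero (-(2 * (n + 1)) * t))) (eC_ne_zero (-(1 / 2)))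
  obtain ⟨h, hh, hgh, oh⟩ := hg.exists_div_of_ne ht c1 z2g
    (thP_half_ne_zero ht (p := 0) (q := -1) (by decide) (by push_cast; ring))
  have z3h : h (1 / 2 + t / 2) = 0 := by
    rw [hgh] at z3g
    exact (mul_eq_zero.mp z3g).resolve_left
      (thP_half_ne_zero ht (p := 1) (q := 0) (by decide) (by push_cast; ring))
  have c2 := mul_ne_zero (neg_ne_zero.mpr c1) (eC_ne_zero (-(t / 2)))
  obtain ⟨u, hu, hhu, ou⟩ := hh.exists_div_of_ne ht c2 z3h
    (thP_half_ne_zero ht (p := -1) (q := -1) (by decide) (by push_cast; ring))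
  have key : IsTheta t (4 * n + 1 : ℕ)
      ((-1) ^ (4 * n + 1) * eC (((-2 * (n + 1) - 1 : ℤ) : ℂ) * t)) u := by
    convert hu using 1
    · push_cast; ring
    · rw [show ((-1 : ℂ)) ^ (4 * n + 1) = -1 by rw [pow_succ, pow_mul]; norm_num]
      have e1 : eC (((-2 * (n + 1) - 1 : ℤ) : ℂ) * t) = eC (-(2 * (n + 1)) * t) * eC (-(t / 2)) *
          eC (-(t / 2)) := by
        rw [← eC_add, ← eC_add]; congr 1; push_cast; ring
      have e2 : eC (-(1 / 2 + t / 2)) = eC (-(1 / 2)) * eC (-(t / 2)) := by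
        rw [← eC_add]; congr 1; ring
      have e3 : eC (-(1 / 2)) = -1 := by rw [eC_neg, eC_half]; norm_num
      rw [e1, e2, e3]; ring
  have hu0 := IsTheta.eq_zero ht (4 * n + 1) key (by rw [ou, oh, og]; exact ho)
  rw [hfg, hgh, hhu, hu0]; ring

/-- Vanishing of Fourier–Jacobi coefficients of high order. -/
theorem fj_eq_zero {t : ℂ} (ht : 0 < t.im) {n : ℤ} {m : ℕ} {f : ℂ → ℂ}
    (hf : IsTheta t (4 * n) (eC (-(2 * n) * t)) f) (ho : (m : ℕ∞) ≤ analyticOrderAt f 0)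
    (h : 4 * n < m ∨ ((∀ z, f (-z) = -f z) ∧ 1 ≤ m ∧ 4 * n < m + 3)) (z : ℂ) : f z = 0 := by
  have even_case : 4 * n < m → f z = 0 := by
    intro hm
    rcases le_or_gt 0 n with hn | hn
    · lift n to ℕ using hn
      refine IsTheta.eq_zero ht (4 * n) (r := -(2 * n)) ?_ (le_trans ?_ ho) z
      · convert hf using 1
        · push_cast; rfl
        · rw [pow_mul]; push_cast; norm_num
      · exact_mod_cast (by omega : 4 * n + 1 ≤ m)
    · obtain ⟨N, hN⟩ : ∃ N : ℕ, n = -(N + 1) := ⟨(-n - 1).toNat, by omega⟩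
      refine IsTheta.eq_zero_of_neg ht (4 * N + 3) (r := -(2 * n)) ?_ z
      convert hf using 1
      · subst hN; push_cast; ring
      · rw [show 4 * N + 3 + 1 = 4 * (N + 1) by ring, pow_mul]; push_cast; norm_num
  rcases h with hm | ⟨hodd, hm1, hm⟩
  · exact even_case hm
  · rcases le_or_gt n 0 with hn | hn
    · exact even_case (by omega)
    · obtain ⟨N, rfl⟩ : ∃ N : ℕ, n = N + 1 := ⟨(n - 1).toNat, by omega⟩
      refine IsTheta.eq_zero_of_odd ht (n := N) ?_ hodd (le_trans ?_ ho) z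
      · convert hf using 1
        · push_cast; rfl
        · push_cast; rfl
      · exact_mod_cast (by omega : 4 * N + 2 ≤ m)

lemma integral_line_shift {c : ℝ} {f : ℂ → ℂ} (hp : ∀ w : ℂ, c < w.im → f (w + 1) = f w)
    {w0 : ℂ} (h0 : c < w0.im) (s : ℝ) :
    ∫ x in (0 : ℝ)..1, f (w0 + s + x) = ∫ x in (0 : ℝ)..1, f (w0 + x) := by
  have hper : Function.Periodic (fun x : ℝ => f (w0 + x)) 1 := fun x => by
    simp only [Complex.ofReal_add, Complex.ofReal_one]
    rw [← add_assoc, hp _ (by simpa using h0)]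
  have h1 := hper.intervalIntegral_add_eq s 0
  have h2 := intervalIntegral.integral_comp_add_left (fun x : ℝ => f (w0 + x)) s (a := 0) (b := 1)
  rw [add_zero] at h2
  rw [zero_add] at h1
  rw [← h1, ← h2]
  congr 1; ext x; congr 1; push_cast; ring

/-- The integral of a periodic holomorphic function over a period does not depend on the
base point. -/
lemma integral_line_eq {c : ℝ} {f : ℂ → ℂ} (hd : ∀ w : ℂ, c < w.im → DifferentiableAt ℂ f w)
    (hp : ∀ w : ℂ, c < w.im → f (w + 1) = f w) {w0 w1 : ℂ} (h0 : c < w0.im) (h1 : c < w1.im) :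
    ∫ x in (0 : ℝ)..1, f (w0 + x) = ∫ x in (0 : ℝ)..1, f (w1 + x) := by
  rw [← integral_line_shift hp h0 (w1.re - w0.re)]
  set a := w1.re
  have hr := Complex.integral_boundary_rect_eq_zero_of_differentiableOn f (a + w0.im * Complex.I)
    (((a + 1 : ℝ) : ℂ) + w1.im * Complex.I) (fun w hw => by
      refine (hd w ?_).differentiableWithinAt
      have := (Complex.mem_reProdIm.mp hw).2
      simp only [Complex.add_im, Complex.ofReal_im, Complex.mul_im, Complex.ofReal_re,
        Complex.I_im, mul_one, Complex.I_re, mul_zero, add_zero, zero_add] at this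
      rw [Set.mem_uIcc] at this
      rcases this with h | h
      · exact h0.trans_le h.1
      · exact h1.trans_le h.1)
  simp only [Complex.add_im, Complex.ofReal_im, Complex.mul_im, Complex.ofReal_re,
        Complex.I_im, mul_one, Complex.I_re, mul_zero, add_zero, zero_add, Complex.add_re,
        Complex.mul_re, sub_zero, mul_one, zero_mul] at hr
  have hv : (∫ y in w0.im..w1.im, f (((a + 1 : ℝ) : ℂ) + y * Complex.I)) =
      ∫ y in w0.im..w1.im, f ((a : ℂ) + y * Complex.I) := by
    refine intervalIntegral.integral_congr fun y hy => ?_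
    have e : (((a + 1 : ℝ) : ℂ) + y * Complex.I) = (a + y * Complex.I) + 1 := by push_cast; ring
    rw [e, hp]
    · have : c < y := by
        rw [Set.mem_uIcc] at hy
        rcases hy with h | h
        · exact h0.trans_le h.1
        · exact h1.trans_le h.1
      simpa using this
  rw [hv, add_sub_cancel_right, sub_eq_zero] at hr
  have e : ∀ w : ℂ, ∫ x in a..(a + 1), f (x + w.im * Complex.I) =
      ∫ x in (0 : ℝ)..1, f ((a + w.im * Complex.I) + x) := fun w => by
    have h2 := intervalIntegral.integral_comp_add_left (fun x : ℝ => f (x + w.im * Complex.I)) a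
      (a := 0) (b := 1)
    rw [add_zero] at h2
    rw [← h2]
    congr 1; ext x; congr 1; push_cast; ring
  rw [e, e] at hr
  have e0 : w0 + ((a - w0.re : ℝ) : ℂ) = a + w0.im * Complex.I := by
    apply Complex.ext <;> simp
  have e1 : w1 = a + w1.im * Complex.I := by apply Complex.ext <;> simp [a]
  rw [e0, hr]
  conv_rhs => rw [e1]

/-- A Fourier expansion on a horizontal line. -/
lemma hasSum_of_periodic {f : ℝ → ℂ} (hc : Continuous f) (hp : ∀ x, f (x + 1) = f x)
    (hs : Summable fun n : ℤ => ∫ x in (0 : ℝ)..1, f x * eC (-(n * x))) (x : ℝ) :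
    HasSum (fun n : ℤ => (∫ x in (0 : ℝ)..1, f x * eC (-(n * x))) * eC (n * x)) (f x) := by
  have hp' : Function.Periodic f 1 := hp
  haveI : Fact ((0 : ℝ) < 1) := ⟨one_pos⟩
  let F : C(AddCircle (1 : ℝ), ℂ) := ⟨hp'.lift, continuous_coinduced_dom.mpr (by
    exact hc)⟩
  have hF : ∀ x : ℝ, F (x : AddCircle (1 : ℝ)) = f x := fun x => hp'.lift_coe x
  have hfc : ∀ n : ℤ, fourierCoeff F n = ∫ x in (0 : ℝ)..1, f x * eC (-(n * x)) := by
    intro n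
    rw [fourierCoeff_eq_intervalIntegral _ n 0]
    simp only [zero_add, div_one, one_smul, fourier_coe_apply, hF, smul_eq_mul]
    congr 1; ext x
    rw [mul_comm, eC]
    congr 2; push_cast; ring
  have := has_pointwise_sum_fourier_series_of_summable (f := F)
    (by simpa only [← hfc] using hs) (x : AddCircle (1 : ℝ))
  rw [hF] at this
  simp only [hfc, fourier_coe_apply, smul_eq_mul] at this
  convert this using 4 with n
  rw [eC]; congr 1; push_cast; ring

/-- Decay of a periodic holomorphic function on the upper half-plane whose low Fourier
coefficients vanish. -/
theorem exists_decay {f : ℂ → ℂ} (hd : ∀ w : ℂ, 0 < w.im → DifferentiableAt ℂ f w)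
    (hp : ∀ w : ℂ, 0 < w.im → f (w + 1) = f w) (j : ℤ)
    (hz : ∀ n : ℤ, n < j → ∫ x in (0 : ℝ)..1, f (Complex.I + x) * eC (-(n * (Complex.I + x))) = 0) :
    ∃ M : ℝ, ∀ w : ℂ, 2 ≤ w.im → ‖f w‖ ≤ M * Real.exp (-2 * Real.pi * j * w.im) := by
  set b : ℤ → ℂ := fun n => ∫ x in (0 : ℝ)..1, f (Complex.I + x) * eC (-(n * (Complex.I + x)))
  have hcont : ∀ w : ℂ, 0 < w.im → Continuous fun x : ℝ => f (w + x) := fun w hw =>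
    continuous_iff_continuousAt.mpr fun x => ContinuousAt.comp (g := f)
      (hd _ (by simpa using hw)).continuousAt (by fun_prop)
  have hdn : ∀ n : ℤ, ∀ w : ℂ, 0 < w.im →
      DifferentiableAt ℂ (fun w => f w * eC (-(n * w))) w := fun n w hw => by
    have := differentiable_eC
    exact (hd w hw).mul (by fun_prop)
  have hpn : ∀ n : ℤ, ∀ w : ℂ, 0 < w.im →
      f (w + 1) * eC (-(n * (w + 1))) = f w * eC (-(n * w)) := fun n w hw => by
    rw [hp w hw, mul_add, neg_add, eC_add, mul_one, ← Int.cast_neg, eC_int, mul_one]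
  obtain ⟨B, hB⟩ := (isCompact_uIcc (a := (0 : ℝ)) (b := 1)).exists_bound_of_continuousOn
    (hcont Complex.I (by simp)).continuousOn
  have hB0 : 0 ≤ B := (norm_nonneg _).trans (hB 0 (by simp))
  have hb : ∀ n : ℤ, ‖b n‖ ≤ B * Real.exp (2 * Real.pi * n) := by
    intro n
    refine (intervalIntegral.norm_integral_le_of_norm_le_const
      (C := B * Real.exp (2 * Real.pi * n)) fun x hx => ?_).trans (by simp)
    rw [norm_mul, norm_eC]
    refine mul_le_mul (hB x (Set.uIoc_subset_uIcc hx)) (le_of_eq ?_) (Real.exp_nonneg _) hB0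
    congr 1; simp
  -- the coefficients on the line through `w`
  have hcoef : ∀ w : ℂ, 0 < w.im → ∀ n : ℤ,
      ∫ x in (0 : ℝ)..1, f (w + x) * eC (-(n * x)) = b n * eC (n * w) := by
    intro w hw n
    have := integral_line_eq (f := fun w => f w * eC (-(n * w))) (hdn n) (hpn n)
      (w0 := Complex.I) (w1 := w) (by simp) hw
    simp only [b]
    rw [this, ← intervalIntegral.integral_mul_const]
    congr 1; ext x
    rw [mul_assoc, ← eC_add]; congr 2; ring
  have hbound : ∀ w : ℂ, 2 ≤ w.im → ∀ n : ℤ, ‖b n * eC (n * w)‖ ≤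
      if n < j then 0 else (B * Real.exp (-2 * Real.pi * j * w.im) * Real.exp (2 * Real.pi * j)) *
        Real.exp (-2 * Real.pi) ^ (n - j).toNat := by
    intro w hw n
    split_ifs with hn
    · simp only [b]; rw [hz n hn]; simp
    · push Not at hn
      obtain ⟨l, hl⟩ : ∃ l : ℕ, n = j + l := ⟨(n - j).toNat, by omega⟩
      subst hl
      rw [norm_mul, norm_eC]
      refine (mul_le_mul_of_nonneg_right (hb _) (Real.exp_nonneg _)).trans ?_
      rw [show (j + (l : ℤ) - j).toNat = l by simp, ← Real.exp_nat_mul, mul_assoc, mul_assoc B,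
        mul_assoc B, ← Real.exp_add, ← Real.exp_add, ← Real.exp_add]
      refine mul_le_mul_of_nonneg_left (Real.exp_le_exp.mpr ?_) hB0
      simp only [Complex.mul_im, Complex.intCast_re, Complex.intCast_im, zero_mul, add_zero]
      push_cast
      have := mul_nonneg (mul_nonneg Real.pi_pos.le (Nat.cast_nonneg (α := ℝ) l))
        (sub_nonneg.mpr hw)
      nlinarith
  have hr0 := Real.exp_nonneg (-2 * Real.pi)
  have hr1 : Real.exp (-2 * Real.pi) < 1 := by rw [Real.exp_lt_one_iff]; have := Real.pi_pos; linarith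
  generalize Real.exp (-2 * Real.pi) = r at hbound hr0 hr1
  have hsum : HasSum (fun n : ℤ => if n < j then (0 : ℝ) else r ^ (n - j).toNat) (1 - r)⁻¹ := by
    have hinj : Function.Injective fun l : ℕ => j + (l : ℤ) := fun a b h => by simpa using h
    rw [← hinj.hasSum_iff]
    · convert hasSum_geometric_of_lt_one hr0 hr1 using 2 with l
      simp
    · intro n hn
      rw [if_pos]
      by_contra h
      push Not at h
      exact hn ⟨(n - j).toNat, by simp only; omega⟩
  refine ⟨B * Real.exp (2 * Real.pi * j) * (1 - r)⁻¹, fun w hw => ?_⟩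
  have hw0 : 0 < w.im := by linarith
  have hsum2 : HasSum (fun n : ℤ => if n < j then (0 : ℝ) else
      (B * Real.exp (-2 * Real.pi * j * w.im) * Real.exp (2 * Real.pi * j)) * r ^ (n - j).toNat)
      ((B * Real.exp (-2 * Real.pi * j * w.im) * Real.exp (2 * Real.pi * j)) * (1 - r)⁻¹) := by
    have := hsum.mul_left (B * Real.exp (-2 * Real.pi * j * w.im) * Real.exp (2 * Real.pi * j))
    simpa only [mul_ite, mul_zero] using this
  have h0 : HasSum (fun n : ℤ => b n * eC (n * w)) (f w) := by
    have := hasSum_of_periodic (f := fun x : ℝ => f (w + x)) (hcont w hw0) (fun x => by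
      rw [← hp (w + x) (by simpa using hw0)]; congr 1; push_cast; ring) (by
        simp only [hcoef w hw0]
        exact Summable.of_norm_bounded hsum2.summable (hbound w hw)) 0
    simpa [hcoef w hw0] using this
  rw [← h0.tsum_eq]
  refine (tsum_of_norm_bounded hsum2 (hbound w hw)).trans (le_of_eq ?_)
  ring

lemma RestrLaws.add_right {k : ℕ} {G : ℂ → ℂ → ℂ → ℂ} (hG : RestrLaws k G) {t z w : ℂ}
    (h : dom3 t z w) : G t z (w + 1) = G t z w := by
  have h1 : dom3 t z (w + 1) := ⟨h.1, by simpa using h.2.1, by simpa using h.2.2⟩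
  rw [← hG.swap _ _ _ h1, hG.add_left _ _ _ h.symm, hG.swap _ _ _ h]

/-- The Fourier coefficient in the last variable, computed on the line through `w0`. -/
def fjCoeff (H : ℂ → ℂ → ℂ → ℂ) (n : ℤ) (t z w0 : ℂ) : ℂ :=
  ∫ x in (0 : ℝ)..1, H t z (w0 + x) * eC (-(n * (w0 + x)))

lemma dom3_iff_lt {t z w : ℂ} (ht : 0 < t.im) : dom3 t z w ↔ 2 * z.im ^ 2 / t.im < w.im := by
  rw [div_lt_iff₀ ht, dom3]
  refine ⟨fun h => by linarith [h.2.2], fun h => ⟨ht, ?_, by linarith⟩⟩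
  by_contra hw
  nlinarith [sq_nonneg z.im]

lemma dom3.add_real {t z w : ℂ} (h : dom3 t z w) (x : ℝ) : dom3 t z (w + x) :=
  ⟨h.1, by simpa using h.2.1, by simpa using h.2.2⟩

lemma fjCoeff_eq {k : ℕ} {G : ℂ → ℂ → ℂ → ℂ} (hG : RestrLaws k G) (hd : GoodH G) (n : ℤ)
    {t z w0 w1 : ℂ} (h0 : dom3 t z w0) (h1 : dom3 t z w1) :
    fjCoeff G n t z w0 = fjCoeff G n t z w1 := by
  have ht := h0.1
  refine integral_line_eq (c := 2 * z.im ^ 2 / t.im) (f := fun w => G t z w * eC (-(n * w)))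
    (fun w hw => ?_) (fun w hw => ?_) ((dom3_iff_lt ht).mp h0) ((dom3_iff_lt ht).mp h1)
  · have := differentiable_eC
    exact (hd.d3 _ _ _ ((dom3_iff_lt ht).mpr hw)).mul (by fun_prop)
  · rw [hG.add_right ((dom3_iff_lt ht).mpr hw), mul_add, neg_add, eC_add, mul_one, ← Int.cast_neg,
      eC_int, mul_one]

lemma differentiableAt_fjCoeff {H : ℂ → ℂ → ℂ → ℂ} (hd : GoodH H) (n : ℤ) {t z w0 : ℂ}
    (h : dom3 t z w0) : DifferentiableAt ℂ (fun z => fjCoeff H n t z w0) z := by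
  have hU : IsOpen {z | dom3 t z w0} :=
    isOpen_domSet.preimage (show Continuous fun z : ℂ => (t, z, w0) by fun_prop)
  have hE := differentiable_eC
  refine (differentiableOn_intervalIntegral hU
    (f := fun z x => H t z (w0 + x) * eC (-(n * (w0 + x)))) ?_ ?_).differentiableAt (hU.mem_nhds h)
  · have h1 : ContinuousOn (fun p : ℂ × ℝ => H t p.1 (w0 + p.2))
        ({z | dom3 t z w0} ×ˢ Set.uIcc 0 1) :=
      hd.cont.comp (f := fun p : ℂ × ℝ => (t, p.1, w0 + p.2))
        (by fun_prop) (fun p hp => hp.1.add_real p.2)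
    have hEc := hE.continuous
    exact h1.mul (Continuous.continuousOn (by fun_prop))
  · intro x _ z hz
    exact ((hd.d2 _ _ _ (hz.add_real x)).mul_const _).differentiableWithinAt

/-- A base point adapted to `z`. -/
def fjBase (t z : ℂ) : ℂ := (2 * z.im ^ 2 / t.im + 1 : ℝ) * Complex.I

lemma dom3_fjBase {t : ℂ} (ht : 0 < t.im) (z : ℂ) : dom3 t z (fjBase t z) := by
  rw [dom3_iff_lt ht, fjBase, Complex.mul_im, Complex.ofReal_re, Complex.ofReal_im, Complex.I_im]
  simp only [mul_one, zero_mul, add_zero]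
  linarith

theorem isTheta_fjCoeff {k : ℕ} {G : ℂ → ℂ → ℂ → ℂ} (hG : RestrLaws k G) (hd : GoodH G) (n : ℤ)
    {t : ℂ} (ht : 0 < t.im) :
    IsTheta t (4 * n) (eC (-(2 * n) * t)) fun z => fjCoeff G n t z (fjBase t z) := by
  refine ⟨fun z => ?_, fun z => ?_, fun z => ?_⟩
  · refine (differentiableAt_fjCoeff hd n (dom3_fjBase ht z)).congr_of_eventuallyEq ?_
    filter_upwards [eventually_dom2 (dom3_fjBase ht z)] with z' hz'
    exact fjCoeff_eq hG hd n (dom3_fjBase ht z') hz'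
  · have h0 := dom3_fjBase ht z
    have h1 : dom3 t (z + 1) (fjBase t z) := ⟨h0.1, h0.2.1, by simpa using h0.2.2⟩
    rw [fjCoeff_eq hG hd n (dom3_fjBase ht _) h1]
    unfold fjCoeff
    congr 1; ext x
    rw [hG.add_mid _ _ _ (h0.add_real x)]
  · have h0 := dom3_fjBase ht z
    have h1 : dom3 t (z + t) (fjBase t z + 4 * z + 2 * t) := by
      rw [dom3_iff_lt ht] at h0 ⊢
      have : 2 * (z + t).im ^ 2 / t.im = 2 * z.im ^ 2 / t.im + 4 * z.im + 2 * t.im := by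
        rw [Complex.add_im]; field_simp; ring
      rw [this]; simpa using h0
    rw [fjCoeff_eq hG hd n (dom3_fjBase ht _) h1]
    unfold fjCoeff
    rw [← intervalIntegral.integral_const_mul]
    congr 1; ext x
    rw [show fjBase t z + 4 * z + 2 * t + x = fjBase t z + x + 4 * z + 2 * t by ring,
      hG.shear _ _ _ (h0.add_real x), ← eC_add, mul_left_comm, ← eC_add]
    congr 2; push_cast; ring

lemma eq_at_zero {f g : ℂ → ℂ} (hf : ContinuousAt f 0) (hg : ContinuousAt g 0)
    (h : ∀ᶠ z in 𝓝 (0 : ℂ), z ≠ 0 → f z = g z) : f 0 = g 0 := by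
  have h1 : Tendsto f (𝓝[≠] 0) (𝓝 (f 0)) := hf.tendsto.mono_left nhdsWithin_le_nhds
  have h2 : Tendsto g (𝓝[≠] 0) (𝓝 (g 0)) := hg.tendsto.mono_left nhdsWithin_le_nhds
  refine tendsto_nhds_unique (h1.congr' ?_) h2
  exact eventually_nhdsWithin_iff.mpr h

theorem fjCoeff_eq_zero {k m : ℕ} {G H : ℂ → ℂ → ℂ → ℂ} (hG : RestrLaws k G) (hd : GoodH G)
    (hdH : GoodH H) (hGH : ∀ t z w, dom3 t z w → G t z w = z ^ m * H t z w) {n : ℤ}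
    (hn : 4 * n < m ∨ (Odd k ∧ 1 ≤ m ∧ 4 * n < m + 3)) {t w : ℂ} (ht : 0 < t.im)
    (hw : 0 < w.im) : fjCoeff H n t 0 w = 0 := by
  have hdom := dom3_zero ht hw
  have hev := eventually_dom2 hdom
  have hfac : ∀ᶠ z in 𝓝 0, fjCoeff G n t z (fjBase t z) = (z - 0) ^ m • fjCoeff H n t z w := by
    filter_upwards [hev] with z hz
    rw [fjCoeff_eq hG hd n (dom3_fjBase ht z) hz, sub_zero, smul_eq_mul]
    unfold fjCoeff
    rw [← intervalIntegral.integral_const_mul]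
    congr 1; ext x
    rw [hGH _ _ _ (hz.add_real x), mul_assoc]
  have hT := isTheta_fjCoeff hG hd n ht
  have hA : AnalyticAt ℂ (fun z => fjCoeff H n t z w) 0 := by
    rw [Complex.analyticAt_iff_eventually_differentiableAt]
    filter_upwards [hev] with z hz
    exact differentiableAt_fjCoeff hdH n hz
  have hord : (m : ℕ∞) ≤ analyticOrderAt (fun z => fjCoeff G n t z (fjBase t z)) 0 := by
    rw [natCast_le_analyticOrderAt (hT.diff.analyticAt 0)]
    exact ⟨_, hA, hfac⟩
  have h0 := fj_eq_zero ht hT hord (hn.imp id fun h => ⟨fun z => ?_, h.2⟩)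
  · refine eq_at_zero (g := fun _ => 0) hA.continuousAt continuousAt_const ?_
    filter_upwards [hfac] with z hz hz0
    rw [h0, sub_zero, smul_eq_mul, eq_comm, mul_eq_zero] at hz
    exact hz.resolve_left (pow_ne_zero _ hz0)
  · have hb := dom3_fjBase ht z
    rw [show fjBase t (-z) = fjBase t z by simp [fjBase]]
    unfold fjCoeff
    rw [← intervalIntegral.integral_neg]
    congr 1; ext x
    rw [hG.neg _ _ _ (hb.add_real x), h.1.neg_one_pow]; ring

/-- Symmetric functions of two variables, modular of weight `K` in each. -/
structure IsBimodular (K : ℕ) (g : ℂ → ℂ → ℂ) : Prop where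
  diff : ∀ t w : ℂ, 0 < t.im → 0 < w.im → DifferentiableAt ℂ (fun t => g t w) t
  swap : ∀ t w : ℂ, 0 < t.im → 0 < w.im → g w t = g t w
  add_one : ∀ t w : ℂ, 0 < t.im → 0 < w.im → g (t + 1) w = g t w
  inv : ∀ t w : ℂ, 0 < t.im → 0 < w.im → g (-1 / t) w = t ^ K * g t w

lemma GoodH.continuousAt_comp {H : ℂ → ℂ → ℂ → ℂ} (hH : GoodH H) {a b c : ℂ → ℂ} {x : ℂ}
    (ha : ContinuousAt a x) (hb : ContinuousAt b x) (hc : ContinuousAt c x)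
    (h : dom3 (a x) (b x) (c x)) : ContinuousAt (fun z => H (a z) (b z) (c z)) x :=
  ContinuousAt.comp (f := fun z => (a z, b z, c z)) (g := fun p : ℂ × ℂ × ℂ => H p.1 p.2.1 p.2.2)
    (hH.cont.continuousAt (isOpen_domSet.mem_nhds h)) (ha.prodMk (hb.prodMk hc))

lemma im_neg_inv_pos {t : ℂ} (ht : 0 < t.im) : 0 < (-1 / t).im := by
  have : t ≠ 0 := fun h => by simp [h] at ht
  rw [neg_div, one_div, Complex.neg_im, Complex.inv_im, neg_div, neg_neg]
  exact div_pos ht (Complex.normSq_pos.mpr this)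

lemma dom3.inv {t z w : ℂ} (h : dom3 t z w) : dom3 (-1 / t) (z / t) (w - 2 * z ^ 2 / t) := by
  have ht := h.1
  have hN : 0 < Complex.normSq t := Complex.normSq_pos.mpr fun h => by simp [h] at ht
  have e1 : (-1 / t).im = t.im / Complex.normSq t := by
    rw [neg_div, one_div, Complex.neg_im, Complex.inv_im, neg_div, neg_neg]
  have e2 : (z / t).im = (z.im * t.re - z.re * t.im) / Complex.normSq t := by
    rw [Complex.div_im]; ring
  have e3 : (w - 2 * z ^ 2 / t).im = w.im - 2 * ((2 * z.re * z.im * t.re -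
      (z.re ^ 2 - z.im ^ 2) * t.im) / Complex.normSq t) := by
    rw [Complex.sub_im, mul_div_assoc, Complex.mul_im, Complex.div_im]
    simp [pow_two]; ring
  rw [dom3_iff_lt (im_neg_inv_pos ht), e1, e2, e3, div_lt_iff₀ (div_pos ht hN)]
  have h2 := mul_lt_mul_of_pos_right h.2.2 hN
  rw [← sub_pos] at h2 ⊢
  have : (w.im - 2 * ((2 * z.re * z.im * t.re -
      (z.re ^ 2 - z.im ^ 2) * t.im) / Complex.normSq t)) * (t.im / Complex.normSq t) -
      2 * ((z.im * t.re - z.re * t.im) / Complex.normSq t) ^ 2 =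
      (t.im * w.im * Complex.normSq t - 2 * z.im ^ 2 * Complex.normSq t) /
        Complex.normSq t ^ 2 := by
    field_simp
    rw [Complex.normSq_apply]; ring
  rw [this]
  positivity

theorem isBimodular_of_factor {k m : ℕ} {G H : ℂ → ℂ → ℂ → ℂ} (hG : RestrLaws k G)
    (hH : GoodH H) (hGH : ∀ t z w, dom3 t z w → G t z w = z ^ m * H t z w) :
    IsBimodular (k + m) fun t w => H t 0 w := by
  refine ⟨fun t w ht hw => hH.d1 _ _ _ (dom3_zero ht hw), fun t w ht hw => ?_,
    fun t w ht hw => ?_, fun t w ht hw => ?_⟩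
  · refine eq_at_zero (f := fun z => H w z t) (g := fun z => H t z w)
      (hH.continuousAt_comp (by fun_prop) (by fun_prop) (by fun_prop) (dom3_zero hw ht))
      (hH.continuousAt_comp (by fun_prop) (by fun_prop) (by fun_prop) (dom3_zero ht hw)) ?_
    filter_upwards [eventually_dom2 (dom3_zero ht hw)] with z hz hz0
    have := hG.swap _ _ _ hz
    rw [hGH _ _ _ hz, hGH _ _ _ hz.symm] at this
    exact mul_left_cancel₀ (pow_ne_zero _ hz0) this
  · have h1 : ∀ {z}, dom3 t z w → dom3 (t + 1) z w := fun h =>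
      ⟨by simpa using h.1, h.2.1, by simpa using h.2.2⟩
    refine eq_at_zero (f := fun z => H (t + 1) z w) (g := fun z => H t z w)
      (hH.continuousAt_comp (by fun_prop) (by fun_prop) (by fun_prop) (h1 (dom3_zero ht hw)))
      (hH.continuousAt_comp (by fun_prop) (by fun_prop) (by fun_prop) (dom3_zero ht hw)) ?_
    filter_upwards [eventually_dom2 (dom3_zero ht hw)] with z hz hz0
    have := hG.add_left _ _ _ hz
    rw [hGH _ _ _ hz, hGH _ _ _ (h1 hz)] at this
    exact mul_left_cancel₀ (pow_ne_zero _ hz0) this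
  · have ht0 : t ≠ 0 := fun h => by simp [h] at ht
    have := eq_at_zero (f := fun z => H (-1 / t) (z / t) (w - 2 * z ^ 2 / t))
      (g := fun z => t ^ (k + m) * H t z w)
      (hH.continuousAt_comp (by fun_prop) (by fun_prop) (by fun_prop)
        (by simpa using dom3_zero (im_neg_inv_pos ht) hw))
      (continuousAt_const.mul
        (hH.continuousAt_comp (by fun_prop) (by fun_prop) (by fun_prop) (dom3_zero ht hw))) ?_
    · simpa using this
    filter_upwards [eventually_dom2 (dom3_zero ht hw)] with z hz hz0
    have := hG.inv _ _ _ hz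
    rw [hGH _ _ _ hz, hGH _ _ _ hz.inv] at this
    refine mul_left_cancel₀ (pow_ne_zero m (div_ne_zero hz0 ht0)) ?_
    rw [this, div_pow, pow_add]; field_simp

theorem parity_of_factor {k m : ℕ} {G H : ℂ → ℂ → ℂ → ℂ} (hG : RestrLaws k G)
    (hH : GoodH H) (hGH : ∀ t z w, dom3 t z w → G t z w = z ^ m * H t z w)
    (hkm : Odd (k + m)) {t w : ℂ} (ht : 0 < t.im) (hw : 0 < w.im) : H t 0 w = 0 := by
  have h0 := dom3_zero ht hw
  have := eq_at_zero (f := fun z => H t (-z) w) (g := fun z => -H t z w)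
      (hH.continuousAt_comp (by fun_prop) (by fun_prop) (by fun_prop) (by simpa using h0))
      (hH.continuousAt_comp (by fun_prop) (by fun_prop) (by fun_prop) h0).neg ?_
  · simp only [neg_zero] at this
    linear_combination this / 2
  filter_upwards [eventually_dom2 h0] with z hz hz0
  have := hG.neg _ _ _ hz
  rw [hGH _ _ _ hz, hGH _ _ _ hz.neg, neg_pow] at this
  refine mul_left_cancel₀ (pow_ne_zero m hz0) (mul_left_cancel₀ (pow_ne_zero m (neg_ne_zero.mpr (one_ne_zero (α := ℂ)))) ?_)
  rw [← mul_assoc, this]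
  have e : (-1 : ℂ) ^ k = -(-1) ^ m := by
    rcases Nat.even_or_odd m with h | h
    · rw [h.neg_one_pow, (Nat.odd_add.mp hkm |>.mpr h).neg_one_pow]
    · rw [h.neg_one_pow, Even.neg_one_pow]
      · simp
      · rw [Nat.odd_add] at hkm; by_contra hk
        rw [Nat.not_even_iff_odd, hkm] at hk
        exact Nat.not_even_iff_odd.mpr h hk
  rw [e]; ring

open UpperHalfPlane ModularForm MatrixGroups EisensteinSeries in
/-- The monomials of weight `K` in the two Eisenstein series, on the upper half-plane. -/
def eisMonos (K : ℤ) : Set (ℍ → ℂ) :=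
  {f | ∃ a b : ℕ, 4 * (a : ℤ) + 6 * b = K ∧ f = fun z => E₄ z ^ a * E₆ z ^ b}

open UpperHalfPlane ModularForm MatrixGroups EisensteinSeries in
lemma eisMonos_span_mul {K L : ℤ} {f g : ℍ → ℂ} (hf : f ∈ Submodule.span ℂ (eisMonos K))
    (hg : g ∈ Submodule.span ℂ (eisMonos L)) : f * g ∈ Submodule.span ℂ (eisMonos (K + L)) := by
  have := Submodule.mul_mem_mul hf hg
  rw [Submodule.span_mul_span] at this
  refine Submodule.span_mono ?_ this
  rintro _ ⟨_, ⟨a, b, h, rfl⟩, _, ⟨c, d, h', rfl⟩, rfl⟩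
  refine ⟨a + c, b + d, by push_cast; linarith, ?_⟩
  ext z
  simp only [Pi.mul_apply]; ring

open UpperHalfPlane ModularForm MatrixGroups EisensteinSeries in
lemma discriminant_mem_span : ModularForm.discriminant ∈ Submodule.span ℂ (eisMonos 12) := by
  have : ModularForm.discriminant = (1 / 1728 : ℂ) • ((fun z => E₄ z ^ 3 * E₆ z ^ 0) -
      (fun z : ℍ => E₄ z ^ 0 * E₆ z ^ 2)) := by
    ext z
    rw [discriminant_eq_E₄_cube_sub_E₆_sq]
    simp only [Pi.smul_apply, Pi.sub_apply, smul_eq_mul]; ring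
  rw [this]
  exact Submodule.smul_mem _ _ (Submodule.sub_mem _ (Submodule.subset_span ⟨3, 0, by norm_num, rfl⟩)
    (Submodule.subset_span ⟨0, 2, by norm_num, rfl⟩))

open UpperHalfPlane ModularForm MatrixGroups EisensteinSeries in
/-- The ring of level one modular forms is generated by the two Eisenstein series. -/
theorem modularForm_mem_span (K : ℕ) : ∀ (k : ℤ), k ≤ K → ∀ f : ModularForm 𝒮ℒ k,
    (f : ℍ → ℂ) ∈ Submodule.span ℂ (eisMonos k) := by
  induction K using Nat.strong_induction_on with
  | _ K ih =>
  intro k hk f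
  have hzero : (∀ g : ModularForm 𝒮ℒ k, g = 0) → (f : ℍ → ℂ) ∈ Submodule.span ℂ (eisMonos k) :=
    fun h => by rw [h f]; exact Submodule.zero_mem _
  rcases lt_or_ge k 0 with h0 | h0
  · rw [ModularFormClass.levelOne_neg_weight_eq_zero h0 f]; exact Submodule.zero_mem _
  rcases Int.even_or_odd k with he | ho
  swap
  · exact hzero (ModularForm.levelOne_odd_weight_eq_zero ho)
  rcases eq_or_ne k 2 with rfl | h2
  · exact hzero (rank_zero_iff_forall_zero.mp ModularForm.levelOne_weight_two_rank_zero)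
  obtain ⟨a, b, hab⟩ : ∃ a b : ℕ, 4 * (a : ℤ) + 6 * b = k := by
    obtain ⟨r, hr⟩ := he
    rcases Int.even_or_odd r with ⟨s, hs⟩ | ⟨s, hs⟩
    · exact ⟨s.toNat, 0, by omega⟩
    · exact ⟨(s - 1).toNat, 1, by omega⟩
  let e : ModularForm 𝒮ℒ k := ModularForm.mcast (by rw [← hab]; ring) ((E₄.pow a).mul (E₆.pow b))
  have hecoe : (e : ℍ → ℂ) = (E₄.pow a : ℍ → ℂ) * (E₆.pow b : ℍ → ℂ) := rfl
  have he : (e : ℍ → ℂ) = fun z => E₄ z ^ a * E₆ z ^ b := by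
    rw [hecoe, ModularForm.coe_pow, ModularForm.coe_pow]; rfl
  have hemem : (e : ℍ → ℂ) ∈ Submodule.span ℂ (eisMonos k) :=
    Submodule.subset_span ⟨a, b, hab, he⟩
  have he0 : (qExpansion 1 e).coeff 0 = 1 := by
    rw [show (e : ℍ → ℂ) = ((E₄.pow a).mul (E₆.pow b) : ℍ → ℂ) from rfl,
      ModularForm.qExpansion_mul one_pos one_mem_strictPeriods_SL,
      ModularForm.qExpansion_pow one_pos one_mem_strictPeriods_SL,
      ModularForm.qExpansion_pow one_pos one_mem_strictPeriods_SL]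
    have h4 := E_qExpansion_coeff_zero (k := 4) (by norm_num) ⟨2, rfl⟩
    have h6 := E_qExpansion_coeff_zero (k := 6) (by norm_num) ⟨3, rfl⟩
    rw [PowerSeries.coeff_zero_eq_constantCoeff] at *
    simp [h4, h6]
  obtain ⟨g, hg⟩ := ModularForm.sub_smul_isCuspForm f e he0
  have hgf : (f : ℍ → ℂ) = (qExpansion 1 f).coeff 0 • (e : ℍ → ℂ) +
      ModularForm.discriminant * (CuspForm.discriminantEquiv g : ℍ → ℂ) := by
    ext z
    have h1 := congrArg (fun f : ModularForm 𝒮ℒ k => f z) hg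
    have h2 := ModularForm.discriminant_mul_discriminantEquiv_apply g z
    simp only [ModularForm.sub_apply] at h1
    simp only [Pi.add_apply, Pi.mul_apply, Pi.smul_apply]
    rw [h2]
    change g z = f z - (qExpansion 1 f).coeff 0 • e z at h1
    rw [h1]; ring
  rw [hgf]
  refine Submodule.add_mem _ (Submodule.smul_mem _ _ hemem) ?_
  rcases lt_or_ge k 12 with h12 | h12
  · rw [ModularFormClass.levelOne_neg_weight_eq_zero (by omega) (CuspForm.discriminantEquiv g), mul_zero]
    exact Submodule.zero_mem _
  · have := eisMonos_span_mul discriminant_mem_span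
      (ih (K - 12) (by omega) (k - 12) (by omega) (CuspForm.discriminantEquiv g))
    rwa [show (12 : ℤ) + (k - 12) = k by ring] at this

open UpperHalfPlane ModularForm MatrixGroups in
lemma slash_T_apply (f : ℍ → ℂ) (k : ℤ) (z : ℍ) :
    (f ∣[k] ModularGroup.T) z = f ((1 : ℝ) +ᵥ z) := by
  have e : denom ModularGroup.T z = 1 := by
    change (((0 : ℤ) : ℝ) : ℂ) * z + (((1 : ℤ) : ℝ) : ℂ) = 1
    simp
  rw [ModularForm.SL_slash_apply, e, _root_.one_zpow, mul_one, modular_T_smul]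

open UpperHalfPlane ModularForm MatrixGroups in
lemma slash_S_apply_smul (f : ℍ → ℂ) (k : ℤ) (z : ℍ) :
    (f ∣[k] ModularGroup.S) z = f (ModularGroup.S • z) * (z : ℂ) ^ (-k) := by
  rw [ModularForm.SL_slash_apply, ModularGroup.denom_S]

open UpperHalfPlane ModularForm MatrixGroups EisensteinSeries in
lemma discriminant_vadd_one (z : ℍ) :
    ModularForm.discriminant (((1 : ℝ) +ᵥ z)) = ModularForm.discriminant z := by
  have := congrFun discriminant_T_invariant z
  rwa [slash_T_apply] at this

open UpperHalfPlane ModularForm MatrixGroups EisensteinSeries in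
lemma discriminant_S_smul (z : ℍ) :
    ModularForm.discriminant (ModularGroup.S • z) = (z : ℂ) ^ 12 * ModularForm.discriminant z := by
  have := congrFun discriminant_S_invariant z
  rw [slash_S_apply_smul] at this
  have hz := z.ne_zero
  rw [← this, _root_.zpow_neg]
  field_simp

open scoped Manifold in
open UpperHalfPlane ModularForm MatrixGroups EisensteinSeries in
/-- A level one function of weight `K` vanishing to order `j` at the cusp. -/
theorem div_discriminant_mem_span {K j : ℕ} {f : ℂ → ℂ}
    (hd : ∀ t : ℂ, 0 < t.im → DifferentiableAt ℂ f t)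
    (h1 : ∀ t : ℂ, 0 < t.im → f (t + 1) = f t)
    (hS : ∀ t : ℂ, 0 < t.im → f (-1 / t) = t ^ K * f t)
    (hM : ∃ M : ℝ, ∀ t : ℂ, 2 ≤ t.im → ‖f t‖ ≤ M * Real.exp (-2 * Real.pi * j * t.im)) :
    (fun z : ℍ => f z / ModularForm.discriminant z ^ j) ∈
      Submodule.span ℂ (eisMonos ((K : ℤ) - 12 * j)) := by
  set F : ℍ → ℂ := fun z => f z / ModularForm.discriminant z ^ j with hF
  have hslT : F ∣[(K : ℤ) - 12 * j] ModularGroup.T = F := by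
    ext z
    rw [slash_T_apply]
    simp only [hF, discriminant_vadd_one]
    have : f (((1 : ℝ) +ᵥ z : ℍ) : ℂ) = f z := by
      rw [← h1 z z.im_pos, coe_vadd]; push_cast; rw [add_comm]
    rw [this]
  have hslS : F ∣[(K : ℤ) - 12 * j] ModularGroup.S = F := by
    ext z
    rw [slash_S_apply_smul]
    simp only [hF, discriminant_S_smul]
    have hz := z.ne_zero
    have hD := discriminant_ne_zero z
    have : f ((ModularGroup.S • z : ℍ) : ℂ) = (z : ℂ) ^ K * f z := by
      rw [← hS z z.im_pos, modular_S_smul]; congr 1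
      simp [neg_div]
    rw [this]
    rw [neg_sub, zpow_sub₀ hz]
    have e2 : (z : ℂ) ^ (12 * (j : ℤ)) = ((z : ℂ) ^ 12) ^ j := by
      rw [← pow_mul]; exact_mod_cast zpow_natCast (z : ℂ) (12 * j)
    rw [e2, zpow_natCast, mul_pow]
    field_simp
  have hsl := SlashInvariantForm.slash_action_generators_SL2Z hslS hslT
  let q : ModularForm 𝒮ℒ ((K : ℤ) - 12 * j) :=
    { toFun := F
      slash_action_eq' := fun _ ⟨γ, hγ⟩ ↦ hγ ▸ hsl γ
      holo' := by
        have hfm : MDifferentiable 𝓘(ℂ) 𝓘(ℂ) fun z : ℍ => f z := by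
          rw [UpperHalfPlane.mdifferentiable_iff]
          refine DifferentiableOn.congr (f := f) (fun t ht => (hd t ht).differentiableWithinAt) ?_
          intro t ht
          simp [ofComplex_apply_of_im_pos ht]
        exact hfm.div (CuspForm.discriminant.holo'.pow j) (fun z => pow_ne_zero _ (discriminant_ne_zero z))
      bdd_at_cusps' := fun {c} hc => by
        rw [Subgroup.IsArithmetic.isCusp_iff_isCusp_SL2Z] at hc
        rw [OnePoint.isBoundedAt_iff_forall_SL2Z hc]
        intro γ _
        rw [hsl γ, IsBoundedAtImInfty, Filter.BoundedAtFilter]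
        obtain ⟨M, hM⟩ := hM
        have hO : (fun z : ℍ => f z) =O[atImInfty] fun z => ModularForm.discriminant z ^ j := by
          refine Asymptotics.IsBigO.trans ?_ (exp_isBigO_discriminant.pow j)
          refine Asymptotics.IsBigO.of_bound M ?_
          filter_upwards [(atImInfty_mem _).mpr ⟨2, fun z hz => hz⟩] with z hz
          refine (hM z hz).trans (le_of_eq ?_)
          rw [← Real.exp_nat_mul, Real.norm_eq_abs, abs_of_pos (Real.exp_pos _)]
          congr 2
          change _ * (z : ℂ).im = _
          rw [coe_im]; ring
        exact (Asymptotics.div_isBoundedUnder_of_isBigO hO).isBigO_one ℝ }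
  exact modularForm_mem_span ((K : ℤ) - 12 * j).toNat _ (Int.self_le_toNat _) q

/-- A kernel whose slices in both variables lie in a finite-dimensional space is a tensor. -/
lemma mem_span_tmul_of_slices {X : Type*} (V : Submodule ℂ (X → ℂ)) [FiniteDimensional ℂ V]
    {h : X → X → ℂ} (h1 : ∀ t, h t ∈ V) (h2 : ∀ w, (fun t => h t w) ∈ V) :
    h ∈ Submodule.span ℂ {p | ∃ f ∈ V, ∃ g ∈ V, p = fun t w => f t * g w} := by
  let ev : X → Module.Dual ℂ V := fun x => (LinearMap.proj x).comp V.subtype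
  have hspan : Submodule.span ℂ (Set.range ev) = ⊤ := by
    refine Submodule.span_eq_top_of_ne_zero fun z hz => ?_
    by_contra! hcon
    apply hz
    ext x
    exact hcon (ev x) ⟨x, rfl⟩
  have key : ∀ φ : Module.Dual ℂ V, (fun t => φ ⟨h t, h1 t⟩) ∈ V := by
    intro φ
    have hφ : φ ∈ Submodule.span ℂ (Set.range ev) := hspan ▸ Submodule.mem_top
    induction hφ using Submodule.span_induction with
    | mem x hx => obtain ⟨w, rfl⟩ := hx; exact h2 w
    | zero => exact V.zero_mem
    | add x y _ _ hx hy => exact V.add_mem hx hy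
    | smul a x _ hx => exact V.smul_mem a hx
  let b := Module.finBasis ℂ V
  have hsum : h = ∑ i, fun t w => b.coord i ⟨h t, h1 t⟩ * (b i : X → ℂ) w := by
    ext t w
    have := congrArg (fun v : V => (v : X → ℂ) w) (b.sum_repr ⟨h t, h1 t⟩)
    simp only [Submodule.coe_sum, Submodule.coe_smul, Finset.sum_apply, Pi.smul_apply,
      smul_eq_mul] at this
    simp only [Finset.sum_apply, Module.Basis.coord_apply]
    exact this.symm
  rw [hsum]
  exact Submodule.sum_mem _ fun i _ => Submodule.subset_span ⟨_, key _, _, (b i).2, rfl⟩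

lemma mul_mem_span_of_span {X : Type*} {S : Set (X → ℂ)} {f g : X → ℂ}
    (hf : f ∈ Submodule.span ℂ S) (hg : g ∈ Submodule.span ℂ S) :
    (fun t w => f t * g w) ∈
      Submodule.span ℂ {p : X → X → ℂ | ∃ f ∈ S, ∃ g ∈ S, p = fun t w => f t * g w} := by
  induction hf using Submodule.span_induction with
  | mem x hx =>
    induction hg using Submodule.span_induction with
    | mem y hy => exact Submodule.subset_span ⟨x, hx, y, hy, rfl⟩
    | zero => convert Submodule.zero_mem _ using 1; ext t w; simp
    | add y z _ _ hy hz => convert Submodule.add_mem _ hy hz using 1; ext t w; simp [mul_add]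
    | smul a y _ hy =>
      convert Submodule.smul_mem _ a hy using 1; ext t w; simp; ring
  | zero => convert Submodule.zero_mem _ using 1; ext t w; simp
  | add y z _ _ hy hz => convert Submodule.add_mem _ hy hz using 1; ext t w; simp [add_mul]
  | smul a y _ hy => convert Submodule.smul_mem _ a hy using 1; ext t w; simp; ring

open UpperHalfPlane ModularForm EisensteinSeries in
lemma eisMonos_finite (K : ℤ) : (eisMonos K).Finite := by
  refine ((Set.finite_Iic (K.toNat, K.toNat)).image fun p : ℕ × ℕ =>
    fun z : ℍ => E₄ z ^ p.1 * E₆ z ^ p.2).subset ?_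
  rintro _ ⟨a, b, h, rfl⟩
  exact ⟨(a, b), Prod.mk_le_mk.mpr ⟨by omega, by omega⟩, rfl⟩

open UpperHalfPlane ModularForm EisensteinSeries in
/-- The symmetric monomials of weight `K` on the product of two upper half-planes. -/
def symMonos (K : ℤ) : Set (ℍ → ℍ → ℂ) :=
  {f | ∃ a b c : ℕ, 4 * (a : ℤ) + 6 * b + 12 * c = K ∧ f = fun t w => (E₄ t * E₄ w) ^ a *
    (E₆ t * E₆ w) ^ b * (ModularForm.discriminant t * ModularForm.discriminant w) ^ c}

open UpperHalfPlane in
lemma symMonos_span_mul {K L : ℤ} {f g : ℍ → ℍ → ℂ} (hf : f ∈ Submodule.span ℂ (symMonos K))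
    (hg : g ∈ Submodule.span ℂ (symMonos L)) : f * g ∈ Submodule.span ℂ (symMonos (K + L)) := by
  have := Submodule.mul_mem_mul hf hg
  rw [Submodule.span_mul_span] at this
  refine Submodule.span_mono ?_ this
  rintro _ ⟨_, ⟨a, b, c, h, rfl⟩, _, ⟨a', b', c', h', rfl⟩, rfl⟩
  refine ⟨a + a', b + b', c + c', by push_cast; linarith, ?_⟩
  ext t w
  simp only [Pi.mul_apply]; ring

open UpperHalfPlane ModularForm EisensteinSeries in
lemma powerSum_mem_span (s : ℕ) :
    (fun t w : ℍ => (E₄ t ^ 3 * E₆ w ^ 2) ^ s + (E₆ t ^ 2 * E₄ w ^ 3) ^ s) ∈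
      Submodule.span ℂ (symMonos (12 * s)) := by
  have hmon : ∀ a b c : ℕ, ∀ K : ℤ, 4 * (a : ℤ) + 6 * b + 12 * c = K →
      (fun t w : ℍ => (E₄ t * E₄ w) ^ a * (E₆ t * E₆ w) ^ b *
        (ModularForm.discriminant t * ModularForm.discriminant w) ^ c) ∈
      Submodule.span ℂ (symMonos K) := fun a b c K h =>
    Submodule.subset_span ⟨a, b, c, h, rfl⟩
  have h1 : (fun t w : ℍ => (E₄ t ^ 3 * E₆ w ^ 2) + (E₆ t ^ 2 * E₄ w ^ 3)) ∈
      Submodule.span ℂ (symMonos 12) := by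
    convert Submodule.sub_mem _ (Submodule.add_mem _ (hmon 3 0 0 12 (by norm_num))
      (hmon 0 2 0 12 (by norm_num))) (Submodule.smul_mem _ (1728 ^ 2 : ℂ)
      (hmon 0 0 1 12 (by norm_num))) using 1
    ext t w
    simp only [Pi.sub_apply, Pi.add_apply, Pi.smul_apply, smul_eq_mul,
      discriminant_eq_E₄_cube_sub_E₆_sq]
    ring
  have h2 : (fun t w : ℍ => (E₄ t ^ 3 * E₆ w ^ 2) * (E₆ t ^ 2 * E₄ w ^ 3)) ∈
      Submodule.span ℂ (symMonos 24) := by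
    convert hmon 3 2 0 24 (by norm_num) using 1
    ext t w
    ring
  induction s using Nat.strong_induction_on with
  | _ s ih =>
  match s with
  | 0 =>
    convert Submodule.smul_mem _ (2 : ℂ) (hmon 0 0 0 0 (by norm_num)) using 1
    · simp
    · ext t w; simp; norm_num
  | 1 => simpa using h1
  | s + 2 =>
    have e1 := symMonos_span_mul h1 (ih (s + 1) (by omega))
    have e2 := symMonos_span_mul h2 (ih s (by omega))
    rw [show (12 : ℤ) + 12 * (s + 1 : ℕ) = 12 * (s + 2 : ℕ) by push_cast; ring] at e1
    rw [show (24 : ℤ) + 12 * (s : ℕ) = 12 * (s + 2 : ℕ) by push_cast; ring] at e2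
    convert Submodule.sub_mem _ e1 e2 using 1
    ext t w
    simp only [Pi.sub_apply, Pi.mul_apply]
    ring

open UpperHalfPlane in
lemma symm_mem_span {K : ℤ} {f g : ℍ → ℂ} (hf : f ∈ eisMonos K) (hg : g ∈ eisMonos K) :
    (fun t w => f t * g w + f w * g t) ∈ Submodule.span ℂ (symMonos K) := by
  obtain ⟨a, b, h, rfl⟩ := hf
  obtain ⟨c, d, h', rfl⟩ := hg
  wlog hac : c ≤ a generalizing a b c d with H
  · have := H c d h' a b h (by omega)
    convert this using 1
    ext t w; ring
  obtain ⟨s, hs⟩ : ∃ s : ℕ, a = c + 3 * s ∧ d = b + 2 * s := ⟨(a - c) / 3, by omega, by omega⟩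
  obtain ⟨rfl, rfl⟩ := hs
  have := symMonos_span_mul (Submodule.subset_span (s := symMonos (4 * c + 6 * b))
    ⟨c, b, 0, by push_cast; ring, rfl⟩) (powerSum_mem_span s)
  rw [show 4 * (c : ℤ) + 6 * b + 12 * s = K by rw [← h]; push_cast; ring] at this
  convert this using 1
  ext t w
  simp only [Pi.mul_apply]
  ring

open UpperHalfPlane in
lemma symm_mem_span_of_slices {K : ℤ} {h : ℍ → ℍ → ℂ}
    (h1 : ∀ t, h t ∈ Submodule.span ℂ (eisMonos K)) (hs : ∀ t w, h w t = h t w) :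
    h ∈ Submodule.span ℂ (symMonos K) := by
  have : FiniteDimensional ℂ (Submodule.span ℂ (eisMonos K)) :=
    FiniteDimensional.span_of_finite ℂ (eisMonos_finite K)
  have h2 := mem_span_tmul_of_slices _ h1 fun w => by
    rw [show (fun t => h t w) = h w from funext fun t => hs w t]; exact h1 w
  have h3 : ∀ p : ℍ → ℍ → ℂ, p ∈ Submodule.span ℂ {p : ℍ → ℍ → ℂ | ∃ f ∈ eisMonos K,
      ∃ g ∈ eisMonos K, p = fun t w => f t * g w} →
      (fun t w => p t w + p w t) ∈ Submodule.span ℂ (symMonos K) := by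
    intro p hp
    induction hp using Submodule.span_induction with
    | mem p hp => obtain ⟨f, hf, g, hg, rfl⟩ := hp; exact symm_mem_span hf hg
    | zero => convert Submodule.zero_mem _ using 1; ext t w; simp
    | add y z _ _ hy hz =>
      convert Submodule.add_mem _ hy hz using 1; ext t w; simp only [Pi.add_apply]; ring
    | smul a y _ hy =>
      convert Submodule.smul_mem _ a hy using 1; ext t w
      simp only [Pi.smul_apply, smul_eq_mul]; ring
  have h4 := h3 h (Submodule.span_le.mpr (by
    rintro _ ⟨f, hf, g, hg, rfl⟩; exact mul_mem_span_of_span hf hg) h2)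
  convert Submodule.smul_mem _ (1 / 2 : ℂ) h4 using 1
  ext t w
  simp only [Pi.smul_apply, smul_eq_mul, hs t w]; ring

open UpperHalfPlane in
/-- Symmetric bimodular functions vanishing to order `j` at the cusp. -/
theorem IsBimodular.mem_span {K j : ℕ} {g : ℂ → ℂ → ℂ} (hg : IsBimodular K g)
    (hM : ∀ t : ℂ, 0 < t.im → ∃ M : ℝ, ∀ w : ℂ, 2 ≤ w.im →
      ‖g t w‖ ≤ M * Real.exp (-2 * Real.pi * j * w.im)) :
    (fun t w : ℍ => g t w / (ModularForm.discriminant t * ModularForm.discriminant w) ^ j) ∈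
      Submodule.span ℂ (symMonos ((K : ℤ) - 12 * j)) := by
  refine symm_mem_span_of_slices (fun t => ?_) fun t w => ?_
  · have := div_discriminant_mem_span (K := K) (j := j) (f := fun w => g t w) ?_ ?_ ?_
      (hM t t.im_pos)
    · convert Submodule.smul_mem _ ((ModularForm.discriminant t ^ j)⁻¹) this using 1
      ext w
      simp only [Pi.smul_apply, smul_eq_mul, mul_pow]
      field_simp [ModularForm.discriminant_ne_zero]
    · intro w hw
      refine (hg.diff w t hw t.im_pos).congr_of_eventuallyEq ?_
      filter_upwards [(isOpen_lt continuous_const Complex.continuous_im).mem_nhds hw] with v hv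
      exact hg.swap v t hv t.im_pos
    · intro w hw
      rw [← hg.swap t w t.im_pos hw, ← hg.add_one w t hw t.im_pos]
      exact (hg.swap t (w + 1) t.im_pos (by simpa using hw)).symm
    · intro w hw
      rw [← hg.swap t w t.im_pos hw, ← hg.inv w t hw t.im_pos]
      exact (hg.swap t (-1 / w) t.im_pos (im_neg_inv_pos hw)).symm
  · rw [hg.swap t w t.im_pos w.im_pos, mul_comm (ModularForm.discriminant w)]

lemma GoodH.add {G H : ℂ → ℂ → ℂ → ℂ} (hG : GoodH G) (hH : GoodH H) : GoodH (G + H) :=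
  ⟨hG.cont.add hH.cont, fun t z w h => (hG.d1 t z w h).add (hH.d1 t z w h),
    fun t z w h => (hG.d2 t z w h).add (hH.d2 t z w h),
    fun t z w h => (hG.d3 t z w h).add (hH.d3 t z w h)⟩

lemma GoodH.mul {G H : ℂ → ℂ → ℂ → ℂ} (hG : GoodH G) (hH : GoodH H) : GoodH (G * H) :=
  ⟨hG.cont.mul hH.cont, fun t z w h => (hG.d1 t z w h).mul (hH.d1 t z w h),
    fun t z w h => (hG.d2 t z w h).mul (hH.d2 t z w h),
    fun t z w h => (hG.d3 t z w h).mul (hH.d3 t z w h)⟩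

lemma GoodH.smul {G : ℂ → ℂ → ℂ → ℂ} (c : ℂ) (hG : GoodH G) : GoodH (c • G) :=
  ⟨hG.cont.const_smul c, fun t z w h => (hG.d1 t z w h).const_smul c,
    fun t z w h => (hG.d2 t z w h).const_smul c,
    fun t z w h => (hG.d3 t z w h).const_smul c⟩

lemma GoodH.one : GoodH 1 :=
  ⟨continuousOn_const, fun _ _ _ _ => differentiableAt_const _,
    fun _ _ _ _ => differentiableAt_const _, fun _ _ _ _ => differentiableAt_const _⟩

lemma RestrLaws.add {k : ℕ} {G H : ℂ → ℂ → ℂ → ℂ} (hG : RestrLaws k G) (hH : RestrLaws k H) :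
    RestrLaws k (G + H) := by
  constructor <;> intro t z w h <;> simp only [Pi.add_apply]
  · rw [hG.neg t z w h, hH.neg t z w h]; ring
  · rw [hG.swap t z w h, hH.swap t z w h]
  · rw [hG.add_left t z w h, hH.add_left t z w h]
  · rw [hG.add_mid t z w h, hH.add_mid t z w h]
  · rw [hG.shear t z w h, hH.shear t z w h]
  · rw [hG.inv t z w h, hH.inv t z w h]; ring

lemma RestrLaws.mul {k l : ℕ} {G H : ℂ → ℂ → ℂ → ℂ} (hG : RestrLaws k G) (hH : RestrLaws l H) :
    RestrLaws (k + l) (G * H) := by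
  constructor <;> intro t z w h <;> simp only [Pi.mul_apply]
  · rw [hG.neg t z w h, hH.neg t z w h]; ring
  · rw [hG.swap t z w h, hH.swap t z w h]
  · rw [hG.add_left t z w h, hH.add_left t z w h]
  · rw [hG.add_mid t z w h, hH.add_mid t z w h]
  · rw [hG.shear t z w h, hH.shear t z w h]
  · rw [hG.inv t z w h, hH.inv t z w h]; ring

lemma RestrLaws.smul {k : ℕ} {G : ℂ → ℂ → ℂ → ℂ} (c : ℂ) (hG : RestrLaws k G) :
    RestrLaws k (c • G) := by
  constructor <;> intro t z w h <;> simp only [Pi.smul_apply, smul_eq_mul]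
  · rw [hG.neg t z w h]; ring
  · rw [hG.swap t z w h]
  · rw [hG.add_left t z w h]
  · rw [hG.add_mid t z w h]
  · rw [hG.shear t z w h]
  · rw [hG.inv t z w h]; ring

lemma RestrLaws.one : RestrLaws 0 1 := by
  constructor <;> intro t z w h <;> simp

/-- A function vanishing to infinite order along `z = 0` vanishes. -/
theorem GoodH.eq_zero_of_forall_factor {G : ℂ → ℂ → ℂ → ℂ} (hG : GoodH G)
    (h : ∀ m : ℕ, ∃ H, GoodH H ∧ ∀ t z w, dom3 t z w → G t z w = z ^ m * H t z w)
    {t z w : ℂ} (hd : dom3 t z w) : G t z w = 0 := by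
  have h0 := dom3_zero hd.1 hd.2.1
  have hev := eventually_dom2 h0
  have hopen : IsOpen {z | dom3 t z w} := isOpen_iff_mem_nhds.mpr fun z hz => eventually_dom2 hz
  have han : AnalyticOnNhd ℂ (fun z => G t z w) {z | dom3 t z w} :=
    DifferentiableOn.analyticOnNhd
      (fun z hz => (hG.d2 t z w hz).differentiableWithinAt) hopen
  have hconv : Convex ℝ {z : ℂ | dom3 t z w} := by
    have : {z : ℂ | dom3 t z w} = Complex.im ⁻¹' {y | 2 * y ^ 2 < t.im * w.im} := by
      ext z; exact ⟨fun h => h.2.2, fun h => ⟨hd.1, hd.2.1, h⟩⟩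
    rw [this]
    refine Convex.is_linear_preimage ?_ Complex.imLm.isLinear
    have : {y : ℝ | 2 * y ^ 2 < t.im * w.im} =
        Set.Ioo (-√(t.im * w.im / 2)) (√(t.im * w.im / 2)) := by
      ext y
      rw [Set.mem_Ioo, ← abs_lt, Real.lt_sqrt (abs_nonneg y), sq_abs, lt_div_iff₀ two_pos,
        Set.mem_ofPred_eq, mul_comm]
    rw [this]
    exact convex_Ioo _ _
  refine han.eqOn_zero_of_preconnected_of_eventuallyEq_zero hconv.isPreconnected h0 ?_ hd
  have htop : analyticOrderAt (fun z => G t z w) 0 = ⊤ := by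
    refine ENat.eq_top_iff_forall_ge.mpr fun m => ?_
    rw [natCast_le_analyticOrderAt (han 0 h0)]
    obtain ⟨H, hH, hGH⟩ := h m
    refine ⟨fun z => H t z w, ?_, ?_⟩
    · exact DifferentiableOn.analyticAt (s := {z | dom3 t z w})
        (fun z hz => (hH.d2 t z w hz).differentiableWithinAt) (hopen.mem_nhds h0)
    · filter_upwards [hev] with z hz
      rw [hGH t z w hz, sub_zero, smul_eq_mul]
  exact analyticOrderAt_eq_top.mp htop

/-- Lower bound for the vanishing order at the cusp of a leading coefficient of order `m`. -/
def leadOrder (m : ℕ) : ℕ := (m + 3) / 4 + (if m % 4 = 3 then 1 else 0)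

open UpperHalfPlane in
theorem lead_mem_span {k m : ℕ} {G H : ℂ → ℂ → ℂ → ℂ} (hG : RestrLaws k G) (hGd : GoodH G)
    (hH : GoodH H) (hGH : ∀ t z w, dom3 t z w → G t z w = z ^ m * H t z w) :
    (fun t w : ℍ => H t 0 w / (ModularForm.discriminant t * ModularForm.discriminant w) ^
      leadOrder m) ∈ Submodule.span ℂ (symMonos ((k + m : ℕ) - 12 * leadOrder m)) := by
  by_cases hodd : Odd (k + m)
  · convert Submodule.zero_mem _ using 1
    ext t w
    simp [parity_of_factor hG hH hGH hodd t.im_pos w.im_pos]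
  refine (isBimodular_of_factor hG hH hGH).mem_span fun t ht => ?_
  have hb := isBimodular_of_factor hG hH hGH
  refine exists_decay (j := leadOrder m) (fun w hw => hH.d3 t 0 w (dom3_zero ht hw))
    (fun w hw => ?_) fun n hn => ?_
  · have e1 := hb.swap t w ht hw
    have e2 := hb.add_one w t hw ht
    have e3 := hb.swap t (w + 1) ht (by simpa using hw)
    rw [← e1, ← e2, e3]
  · refine fjCoeff_eq_zero hG hGd hH hGH ?_ ht (w := Complex.I) (by simp)
    rw [Nat.not_odd_iff_even, Nat.even_iff] at hodd
    rw [Nat.odd_iff]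
    unfold leadOrder at hn
    split_ifs at hn with h3 <;> omega

/-- The functions on two upper half-planes that occur as leading coefficients of order `m` of
elements of weight `k` of an algebra `A` of functions. -/
def leads (A : Subalgebra ℂ (ℂ → ℂ → ℂ → ℂ)) (k m : ℕ) :
    Submodule ℂ (UpperHalfPlane → UpperHalfPlane → ℂ) where
  carrier := {p | ∃ G H : ℂ → ℂ → ℂ → ℂ, G ∈ A ∧ RestrLaws k G ∧ GoodH G ∧ GoodH H ∧
    (∀ t z w, dom3 t z w → G t z w = z ^ m * H t z w) ∧ ∀ t w : UpperHalfPlane, H t 0 w = p t w}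
  zero_mem' := ⟨(0 : ℂ) • 1, (0 : ℂ) • 1, A.smul_mem A.one_mem 0,
    by rw [zero_smul, ← zero_smul ℂ (0 : ℂ → ℂ → ℂ → ℂ)]; constructor <;> intros <;> simp,
    GoodH.one.smul 0, GoodH.one.smul 0, by simp, by simp⟩
  add_mem' := by
    rintro p q ⟨G, H, a, b, c, d, e, f⟩ ⟨G', H', a', b', c', d', e', f'⟩
    refine ⟨G + G', H + H', A.add_mem a a', b.add b', c.add c', d.add d', fun t z w h => ?_,
      fun t w => ?_⟩
    · simp only [Pi.add_apply]; rw [e t z w h, e' t z w h]; ring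
    · simp only [Pi.add_apply]; rw [f, f']
  smul_mem' := by
    rintro r p ⟨G, H, a, b, c, d, e, f⟩
    refine ⟨r • G, r • H, A.smul_mem a r, b.smul r, c.smul r, d.smul r, fun t z w h => ?_,
      fun t w => ?_⟩
    · simp only [Pi.smul_apply, smul_eq_mul]; rw [e t z w h]; ring
    · simp only [Pi.smul_apply, smul_eq_mul]; rw [f]

lemma leads_mul {A : Subalgebra ℂ (ℂ → ℂ → ℂ → ℂ)} {k m k' m' : ℕ}
    {p q : UpperHalfPlane → UpperHalfPlane → ℂ} (hp : p ∈ leads A k m) (hq : q ∈ leads A k' m') :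
    p * q ∈ leads A (k + k') (m + m') := by
  obtain ⟨G, H, a, b, c, d, e, f⟩ := hp
  obtain ⟨G', H', a', b', c', d', e', f'⟩ := hq
  refine ⟨G * G', H * H', A.mul_mem a a', b.mul b', c.mul c', d.mul d', fun t z w h => ?_,
    fun t w => ?_⟩
  · simp only [Pi.mul_apply]; rw [e t z w h, e' t z w h]; ring
  · simp only [Pi.mul_apply]; rw [f, f']

lemma leads_one (A : Subalgebra ℂ (ℂ → ℂ → ℂ → ℂ)) : 1 ∈ leads A 0 0 :=
  ⟨1, 1, A.one_mem, RestrLaws.one, GoodH.one, GoodH.one, by simp, by simp⟩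

lemma leads_pow {A : Subalgebra ℂ (ℂ → ℂ → ℂ → ℂ)} {k m : ℕ}
    {p : UpperHalfPlane → UpperHalfPlane → ℂ} (hp : p ∈ leads A k m) (n : ℕ) :
    p ^ n ∈ leads A (n * k) (n * m) := by
  induction n with
  | zero => simpa using leads_one A
  | succ n ih =>
    rw [pow_succ, add_mul, add_mul, one_mul, one_mul]; exact leads_mul ih hp

section
open UpperHalfPlane ModularForm EisensteinSeries

variable {A : Subalgebra ℂ (ℂ → ℂ → ℂ → ℂ)}

lemma symMonos_le_leads (h4 : (fun t w => E₄ t * E₄ w) ∈ leads A 4 0)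
    (h6 : (fun t w => E₆ t * E₆ w) ∈ leads A 6 0)
    (h12 : (fun t w => ModularForm.discriminant t * ModularForm.discriminant w) ∈ leads A 12 0)
    (K : ℕ) : Submodule.span ℂ (symMonos K) ≤ leads A K 0 := by
  refine Submodule.span_le.mpr ?_
  rintro _ ⟨a, b, c, h, rfl⟩
  have := leads_mul (leads_mul (leads_pow h4 a) (leads_pow h6 b)) (leads_pow h12 c)
  rw [show a * 4 + b * 6 + c * 12 = K by omega] at this
  simp only [mul_zero, add_zero] at this
  exact this

lemma discriminant_pow_mem_leads
    (h12 : (fun t w => ModularForm.discriminant t * ModularForm.discriminant w) ∈ leads A 12 0)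
    (h8 : (fun t w => ModularForm.discriminant t * ModularForm.discriminant w) ∈ leads A 8 4)
    (h10 : (fun t w => ModularForm.discriminant t * ModularForm.discriminant w) ∈ leads A 10 2)
    (h11 : (fun t w => ModularForm.discriminant t * ModularForm.discriminant w) ∈ leads A 11 1)
    (m : ℕ) : ∃ l : ℕ, l + m = 12 * leadOrder m ∧
    (fun t w => (ModularForm.discriminant t * ModularForm.discriminant w) ^ leadOrder m) ∈
      leads A l m := by
  have h8a := leads_pow h8 (m / 4)
  have hr : m % 4 = 0 ∨ m % 4 = 1 ∨ m % 4 = 2 ∨ m % 4 = 3 := by omega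
  rcases hr with hr | hr | hr | hr
  · have h := h8a
    rw [show m / 4 * 4 = m by omega] at h
    refine ⟨m / 4 * 8, by unfold leadOrder; split_ifs <;> omega, ?_⟩
    rw [show leadOrder m = m / 4 by unfold leadOrder; split_ifs <;> omega]
    exact h
  · have h := leads_mul h8a h11
    rw [show m / 4 * 4 + 1 = m by omega] at h
    refine ⟨m / 4 * 8 + 11, by unfold leadOrder; split_ifs <;> omega, ?_⟩
    rw [show leadOrder m = m / 4 + 1 by unfold leadOrder; split_ifs <;> omega]
    exact h
  · have h := leads_mul h8a h10
    rw [show m / 4 * 4 + 2 = m by omega] at h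
    refine ⟨m / 4 * 8 + 10, by unfold leadOrder; split_ifs <;> omega, ?_⟩
    rw [show leadOrder m = m / 4 + 1 by unfold leadOrder; split_ifs <;> omega]
    exact h
  · have h := leads_mul h8a (leads_mul h10 h11)
    rw [show m / 4 * 4 + (2 + 1) = m by omega] at h
    refine ⟨m / 4 * 8 + (10 + 11), by unfold leadOrder; split_ifs <;> omega, ?_⟩
    rw [show leadOrder m = m / 4 + 2 by unfold leadOrder; split_ifs <;> omega]
    convert h using 1
    ext t w
    simp only [Pi.mul_apply, Pi.pow_apply]; ring

lemma symMonos_eq_empty {K : ℤ} (hK : ∀ a b c : ℕ, 4 * (a : ℤ) + 6 * b + 12 * c ≠ K) :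
    symMonos K = ∅ := by
  ext f
  simp only [symMonos, Set.mem_ofPred_eq, Set.mem_empty_iff_false, iff_false]
  rintro ⟨a, b, c, h, -⟩
  exact hK a b c h

lemma lead_eq_zero {k m : ℕ}
    (hkm : ∀ a b c : ℕ, 4 * (a : ℤ) + 6 * b + 12 * c ≠ (k + m : ℕ) - 12 * leadOrder m) {G H : ℂ → ℂ → ℂ → ℂ}
    (hG : RestrLaws k G) (hGd : GoodH G) (hH : GoodH H)
    (hGH : ∀ t z w, dom3 t z w → G t z w = z ^ m * H t z w) {t w : ℂ} (ht : 0 < t.im)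
    (hw : 0 < w.im) : H t 0 w = 0 := by
  have h := lead_mem_span hG hGd hH hGH
  rw [symMonos_eq_empty hkm, Submodule.span_empty, Submodule.mem_bot] at h
  have := congrFun (congrFun h ⟨t, ht⟩) ⟨w, hw⟩
  simpa [ModularForm.discriminant_ne_zero] using this

lemma eq_zero_of_high_order {k m : ℕ} (hm : k < m) {G H : ℂ → ℂ → ℂ → ℂ} (hG : RestrLaws k G)
    (hGd : GoodH G) (hH : GoodH H) (hGH : ∀ t z w, dom3 t z w → G t z w = z ^ m * H t z w)
    {t z w : ℂ} (hd : dom3 t z w) : G t z w = 0 := by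
  have key : ∀ n, ∃ H, GoodH H ∧ ∀ t z w, dom3 t z w → G t z w = z ^ (m + n) * H t z w := by
    intro n
    induction n with
    | zero => exact ⟨H, hH, hGH⟩
    | succ n ih =>
      obtain ⟨H, hH, hGH⟩ := ih
      obtain ⟨H', hH', h'⟩ := hH.exists_div fun t w ht hw =>
        lead_eq_zero (by intro a b c; unfold leadOrder; split_ifs <;> omega) hG hGd hH hGH ht hw
      exact ⟨H', hH', fun t z w h => by rw [hGH t z w h, h' t z w h]; ring⟩
  refine hGd.eq_zero_of_forall_factor (fun n => ?_) hd
  obtain ⟨H, hH, hGH⟩ := key n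
  have hpow : ∀ n : ℕ, GoodH fun _ z _ => z ^ n := fun n =>
    ⟨by fun_prop, fun _ _ _ _ => by fun_prop, fun _ _ _ _ => by fun_prop,
      fun _ _ _ _ => by fun_prop⟩
  exact ⟨_, (hpow m).mul hH, fun t z w h => by
    rw [hGH t z w h]; simp only [Pi.mul_apply]; ring⟩

/-- Functions with the transformation laws of restrictions of symmetric Hermitian modular forms
belong to every algebra that contains enough leading coefficients. -/
theorem RestrLaws.exists_mem
    (h4 : (fun t w => E₄ t * E₄ w) ∈ leads A 4 0)
    (h6 : (fun t w => E₆ t * E₆ w) ∈ leads A 6 0)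
    (h12 : (fun t w => ModularForm.discriminant t * ModularForm.discriminant w) ∈ leads A 12 0)
    (h8 : (fun t w => ModularForm.discriminant t * ModularForm.discriminant w) ∈ leads A 8 4)
    (h10 : (fun t w => ModularForm.discriminant t * ModularForm.discriminant w) ∈ leads A 10 2)
    (h11 : (fun t w => ModularForm.discriminant t * ModularForm.discriminant w) ∈ leads A 11 1)
    {k : ℕ} {G : ℂ → ℂ → ℂ → ℂ} (hG : RestrLaws k G) (hGd : GoodH G) :
    ∃ Q ∈ A, ∀ t z w, dom3 t z w → G t z w = Q t z w := by
  have key : ∀ d m : ℕ, k + 1 ≤ m + d → ∀ G H : ℂ → ℂ → ℂ → ℂ, RestrLaws k G → GoodH G →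
      GoodH H → (∀ t z w, dom3 t z w → G t z w = z ^ m * H t z w) →
      ∃ Q ∈ A, ∀ t z w, dom3 t z w → G t z w = Q t z w := by
    intro d
    induction d with
    | zero =>
      intro m hm G H hG hGd hH hGH
      exact ⟨0, A.zero_mem, fun t z w h => by
        rw [eq_zero_of_high_order (by omega) hG hGd hH hGH h]; rfl⟩
    | succ d ih =>
      intro m hm G H hG hGd hH hGH
      have hlead : (fun t w : ℍ => H t 0 w) ∈ leads A k m := by
        rcases lt_or_ge (k + m) (12 * leadOrder m) with hlt | hge
        · convert Submodule.zero_mem _ using 1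
          ext t w
          exact lead_eq_zero (by omega) hG hGd hH hGH t.im_pos w.im_pos
        · obtain ⟨l, hl, hl'⟩ := discriminant_pow_mem_leads h12 h8 h10 h11 m
          have h1 := lead_mem_span hG hGd hH hGH
          rw [show (((k + m : ℕ) : ℤ) - 12 * leadOrder m) = ((k + m - 12 * leadOrder m : ℕ) : ℤ)
            by omega] at h1
          have h2 := leads_mul (symMonos_le_leads h4 h6 h12 _ h1) hl'
          rw [show k + m - 12 * leadOrder m + l = k by omega, zero_add] at h2
          convert h2 using 1
          ext t w
          simp only [Pi.mul_apply]
          rw [div_mul_cancel₀]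
          exact pow_ne_zero _ (mul_ne_zero (ModularForm.discriminant_ne_zero t)
            (ModularForm.discriminant_ne_zero w))
      obtain ⟨G', H', a, b, c, d', e, f⟩ := hlead
      obtain ⟨H'', hH'', h''⟩ := (hH.add (d'.smul (-1))).exists_div fun t w ht hw => by
        have := f ⟨t, ht⟩ ⟨w, hw⟩
        simp only [Pi.add_apply, Pi.smul_apply, smul_eq_mul]
        change H' t 0 w = H t 0 w at this
        rw [this]; ring
      obtain ⟨Q, hQ, hQ'⟩ := ih (m + 1) (by omega) (G + (-1 : ℂ) • G') H''
        (hG.add (b.smul _)) (hGd.add (c.smul _)) hH'' fun t z w h => by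
          have := h'' t z w h
          simp only [Pi.add_apply, Pi.smul_apply, smul_eq_mul] at this ⊢
          rw [hGH t z w h, e t z w h, pow_succ, mul_assoc, ← this]; ring
      refine ⟨Q + G', A.add_mem hQ a, fun t z w h => ?_⟩
      have := hQ' t z w h
      simp only [Pi.add_apply, Pi.smul_apply, smul_eq_mul] at this ⊢
      rw [← this]; ring
  exact key (k + 1) 0 (by omega) G G hG hGd hGd fun t z w _ => by simp

end

theorem hasSum_prod_fin {α : Type*} : ∀ {n : ℕ} (f : Fin n → α → ℂ),
    (∀ i, Summable fun a => ‖f i a‖) →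
    (Summable fun m : Fin n → α => ‖∏ i, f i (m i)‖) ∧
      HasSum (fun m : Fin n → α => ∏ i, f i (m i)) (∏ i, ∑' a, f i a)
  | 0, f, _ => by
    constructor
    · simpa using (hasSum_fintype fun _ : Fin 0 → α => (1 : ℝ)).summable
    · simpa using hasSum_fintype fun _ : Fin 0 → α => (1 : ℂ)
  | n + 1, f, hf => by
    obtain ⟨h1, h2⟩ := hasSum_prod_fin (fun i : Fin n => f i.succ) fun i => hf i.succ
    have hs := summable_mul_of_summable_norm (hf 0) h1
    have hn := Summable.mul_norm (hf 0) h1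
    have hp := ((hf 0).of_norm.hasSum.mul h2 hs)
    have e : ∀ p : α × (Fin n → α), f 0 p.1 * ∏ i, f i.succ (p.2 i) =
        ∏ i, f i ((Fin.consEquiv fun _ => α) p i) := by
      intro p
      rw [Fin.prod_univ_succ]
      simp [Fin.consEquiv]
    constructor
    · rw [← (Fin.consEquiv fun _ => α).summable_iff]
      refine hn.congr fun p => ?_
      rw [Function.comp, ← e]
    · rw [← (Fin.consEquiv fun _ => α).hasSum_iff, Fin.prod_univ_succ]
      simp only [e] at hp
      exact hp

theorem summable_exp_neg_sq {T : ℝ} (hT : 0 < T) : Summable fun k : ℤ => Real.exp (-T * (k : ℝ) ^ 2) := by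
  have h := (summable_jacobiTheta₂_term_iff 0 (Complex.I * (T / Real.pi : ℝ))).2 (by
    simp only [Complex.mul_im, Complex.I_re, Complex.I_im, Complex.ofReal_im, Complex.ofReal_re]
    have := Real.pi_pos
    rw [zero_mul, zero_add, one_mul]; positivity)
  refine h.norm.congr fun k => ?_
  rw [norm_jacobiTheta₂_term]
  congr 1
  simp only [Complex.mul_im, Complex.I_re, Complex.I_im, Complex.ofReal_im, Complex.ofReal_re, Complex.zero_im]
  have := Real.pi_pos.ne'
  field_simp
  ring

theorem summable_exp_neg_sum_sq (n : ℕ) {T : ℝ} (hT : 0 < T) :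
    Summable fun v : Fin n → ℤ => Real.exp (-T * ∑ i, (v i : ℝ) ^ 2) := by
  have h := (hasSum_prod_fin (fun (_ : Fin n) (k : ℤ) => ((Real.exp (-T * (k : ℝ) ^ 2) : ℝ) : ℂ)) fun _ => by
    simpa only [Complex.norm_real] using (summable_exp_neg_sq hT).norm).1
  refine h.congr fun v => ?_
  rw [← Complex.ofReal_prod, Complex.norm_real, ← Real.exp_sum, Finset.mul_sum, Real.norm_eq_abs, Real.abs_exp]

theorem pow_mul_exp_le (k : ℕ) {T : ℝ} (hT : 0 < T) : ∃ C : ℝ, 0 ≤ C ∧ ∀ N : ℝ, 0 ≤ N →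
    (1 + N) ^ k * Real.exp (-T * N) ≤ C * Real.exp (-(T / 2) * N) := by
  refine ⟨k.factorial / (T / 2) ^ k * Real.exp (T / 2), by positivity, fun N hN => ?_⟩
  have h := Real.pow_div_factorial_le_exp ((T / 2) * (1 + N)) (by positivity) k
  rw [mul_pow, div_le_iff₀ (by positivity)] at h
  have h2 : (1 + N) ^ k ≤ k.factorial / (T / 2) ^ k * Real.exp ((T / 2) * (1 + N)) := by
    rw [div_mul_eq_mul_div, le_div_iff₀ (by positivity)]
    linarith
  calc _ ≤ k.factorial / (T / 2) ^ k * Real.exp ((T / 2) * (1 + N)) * Real.exp (-T * N) := by gcongr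
    _ = _ := by
      rw [mul_assoc, mul_assoc, ← Real.exp_add, ← Real.exp_add]
      congr 2
      ring

/-- Twice a basis of the `E₈` lattice, in orthonormal coordinates. -/
def basisE : Matrix (Fin 8) (Fin 8) ℤ :=
  !![1, 0, 0, 0, 0, 0, 0, 0; 1, 2, 0, 0, 0, 0, 0, 0; 1, 0, 2, 0, 0, 0, 0, 0;
    1, 0, 0, 2, 0, 0, 0, 0; 1, 0, 0, 0, 2, 0, 0, 0; 1, 0, 0, 0, 0, 2, 0, 0;
    1, 0, 0, 0, 0, 0, 2, 0; 1, -2, -2, -2, -2, -2, -2, 4]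

/-- Half of the Gram matrix of the `E₈` lattice, made triangular. -/
def halfGram : Matrix (Fin 8) (Fin 8) ℤ :=
  !![1, 0, 0, 0, 0, 0, 0, 1; 0, 1, 1, 1, 1, 1, 1, -2; 0, 0, 1, 1, 1, 1, 1, -2;
    0, 0, 0, 1, 1, 1, 1, -2; 0, 0, 0, 0, 1, 1, 1, -2; 0, 0, 0, 0, 0, 1, 1, -2;
    0, 0, 0, 0, 0, 0, 1, -2; 0, 0, 0, 0, 0, 0, 0, 2]

/-- Multiplication by `(1 + √-7) / 2` on the `E₈` lattice. -/
def mulOmg : Matrix (Fin 8) (Fin 8) ℤ :=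
  !![4, 0, 0, 0, 0, 0, 0, 2; -2, 1, 1, 1, 0, 1, 0, -2; -2, 0, 1, 1, 1, 0, 1, -2;
    -2, -1, -1, 0, 0, 0, -1, 0; -2, 1, 0, 0, 1, 1, 1, -2; -2, -1, 0, -1, -1, 0, 0, 0;
    -2, 0, -1, 0, -1, -1, 0, 0; -7, 0, 0, 0, 0, 0, 0, -3]

/-- The bilinear form of the `E₈` lattice. -/
def bE (x y : Fin 8 → ℤ) : ℤ := x ⬝ᵥ (halfGram + halfGramᵀ) *ᵥ y

lemma four_bE (x y : Fin 8 → ℤ) : 4 * bE x y = (basisE *ᵥ x) ⬝ᵥ (basisE *ᵥ y) := by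
  have h : (4 : ℤ) • (halfGram + halfGramᵀ) = basisEᵀ * basisE := by decide +kernel
  rw [dotProduct_mulVec, vecMul_mulVec, ← h, bE, ← dotProduct_mulVec, smul_mulVec,
    dotProduct_smul, smul_eq_mul]

lemma bE_comm (x y : Fin 8 → ℤ) : bE x y = bE y x := by
  have h := four_bE x y
  rw [dotProduct_comm, ← four_bE] at h
  omega

lemma bE_self (x : Fin 8 → ℤ) : bE x x = 2 * (x ⬝ᵥ halfGram *ᵥ x) := by
  rw [bE, add_mulVec, dotProduct_add, mulVec_transpose, dotProduct_comm x (x ᵥ* halfGram),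
    ← dotProduct_mulVec]
  ring

lemma bE_add_left (x y z : Fin 8 → ℤ) : bE (x + y) z = bE x z + bE y z := add_dotProduct _ _ _
lemma bE_neg_left (x y : Fin 8 → ℤ) : bE (-x) y = -bE x y := neg_dotProduct _ _
lemma bE_smul_left (n : ℤ) (x y : Fin 8 → ℤ) : bE (n • x) y = n * bE x y := smul_dotProduct _ _ _

lemma bE_add_right (x y z : Fin 8 → ℤ) : bE x (y + z) = bE x y + bE x z := by
  rw [bE_comm, bE_add_left, bE_comm y, bE_comm z]
lemma bE_neg_right (x y : Fin 8 → ℤ) : bE x (-y) = -bE x y := by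
  rw [bE_comm, bE_neg_left, bE_comm y]
lemma bE_smul_right (n : ℤ) (x y : Fin 8 → ℤ) : bE x (n • y) = n * bE x y := by
  rw [bE_comm, bE_smul_left, bE_comm y]

lemma mulOmg_mulOmg (x : Fin 8 → ℤ) : mulOmg *ᵥ mulOmg *ᵥ x = mulOmg *ᵥ x + (-2 : ℤ) • x := by
  have h : mulOmg * mulOmg = mulOmg + (-2 : ℤ) • 1 := by decide +kernel
  rw [mulVec_mulVec, h, add_mulVec, smul_mulVec, one_mulVec]

lemma bE_mulOmg_left (x y : Fin 8 → ℤ) : bE (mulOmg *ᵥ x) y = bE x y - bE x (mulOmg *ᵥ y) := by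
  have h : mulOmgᵀ * (halfGram + halfGramᵀ) + (halfGram + halfGramᵀ) * mulOmg
      = halfGram + halfGramᵀ := by decide +kernel
  have h2 : bE x y = x ⬝ᵥ (mulOmgᵀ * (halfGram + halfGramᵀ) +
    (halfGram + halfGramᵀ) * mulOmg) *ᵥ y := by rw [h, bE]
  rw [h2, add_mulVec, dotProduct_add, bE, bE, ← mulVec_mulVec, ← mulVec_mulVec,
    add_sub_cancel_right, dotProduct_mulVec x mulOmgᵀ, vecMul_transpose]

lemma bE_mulOmg_mulOmg (x y : Fin 8 → ℤ) : bE (mulOmg *ᵥ x) (mulOmg *ᵥ y) = 2 * bE x y := by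
  rw [bE_mulOmg_left, mulOmg_mulOmg, bE_add_right, bE_smul_right]
  ring

lemma bE_self_mulOmg (x : Fin 8 → ℤ) : 2 * bE x (mulOmg *ᵥ x) = bE x x := by
  have := bE_mulOmg_left x x
  rw [bE_comm] at this
  omega

lemma two_omg_sub_one_ne : 2 * omg 7 - 1 ≠ 0 := by
  intro h
  have := omg_sq
  have h2 : (2 * omg 7 - 1) ^ 2 = -7 := by linear_combination 4 * this
  rw [h] at h2
  norm_num at h2

/-- The Hermitian form on the `E₈` lattice. -/
def hE (x y : Fin 8 → ℤ) : ℂ :=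
  (bE x (mulOmg *ᵥ y) - (1 - omg 7) * bE x y) / (2 * omg 7 - 1)

lemma hE_add_left (x y z : Fin 8 → ℤ) : hE (x + y) z = hE x z + hE y z := by
  simp only [hE, bE_add_left]; push_cast; ring
lemma hE_add_right (x y z : Fin 8 → ℤ) : hE x (y + z) = hE x y + hE x z := by
  simp only [hE, mulVec_add, bE_add_right]; push_cast; ring
lemma hE_neg_left (x y : Fin 8 → ℤ) : hE (-x) y = -hE x y := by
  simp only [hE, bE_neg_left]; push_cast; ring
lemma hE_neg_right (x y : Fin 8 → ℤ) : hE x (-y) = -hE x y := by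
  simp only [hE, mulVec_neg, bE_neg_right]; push_cast; ring
lemma hE_smul_left (n : ℤ) (x y : Fin 8 → ℤ) : hE (n • x) y = n * hE x y := by
  simp only [hE, bE_smul_left]; push_cast; ring
lemma hE_smul_right (n : ℤ) (x y : Fin 8 → ℤ) : hE x (n • y) = n * hE x y := by
  simp only [hE, mulVec_smul, bE_smul_right]; push_cast; ring

lemma hE_mulOmg_right (x y : Fin 8 → ℤ) : hE x (mulOmg *ᵥ y) = omg 7 * hE x y := by
  simp only [hE, mulOmg_mulOmg, bE_add_right, bE_smul_right]
  push_cast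
  rw [mul_div_assoc', div_left_inj' two_omg_sub_one_ne]
  linear_combination -bE x y * omg_sq

lemma conj_hE (x y : Fin 8 → ℤ) : (starRingEnd ℂ) (hE x y) = hE y x := by
  have h := bE_mulOmg_left x y
  rw [bE_comm _ y] at h
  simp only [hE, map_div₀, map_sub, map_mul, map_one, conj_omg, h, map_intCast, map_ofNat,
    bE_comm y x, Int.cast_sub]
  rw [div_eq_div_iff _ two_omg_sub_one_ne]
  · ring
  · intro h
    exact two_omg_sub_one_ne (by linear_combination -h)

lemma hE_self (x : Fin 8 → ℤ) : hE x x = bE x x / 2 := by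
  rw [hE, div_eq_div_iff two_omg_sub_one_ne two_ne_zero, ← bE_self_mulOmg]
  push_cast
  ring

lemma hE_self' (x : Fin 8 → ℤ) : hE x x = ((x ⬝ᵥ halfGram *ᵥ x : ℤ) : ℂ) := by
  rw [hE_self, bE_self]; push_cast; ring

lemma hE_add_conj (x y : Fin 8 → ℤ) : hE x y + (starRingEnd ℂ) (hE x y) = bE x y := by
  have h := bE_mulOmg_left x y
  rw [bE_comm _ y] at h
  rw [conj_hE, hE, hE, h, bE_comm y x]
  push_cast
  rw [← add_div, div_eq_iff two_omg_sub_one_ne]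
  ring

lemma hE_mul_trace {s : ℂ} (hs : s ∈ ringInts 7) (x y : Fin 8 → ℤ) :
    ∃ n : ℤ, hE x y * s + (starRingEnd ℂ) (hE x y) * (starRingEnd ℂ) s = n := by
  obtain ⟨a, b, rfl⟩ := hs
  refine ⟨a * bE x y + b * bE x (mulOmg *ᵥ y), ?_⟩
  have h1 := hE_add_conj x y
  have h2 := hE_add_conj x (mulOmg *ᵥ y)
  rw [hE_mulOmg_right, map_mul] at h2
  simp only [map_add, map_mul, map_intCast]
  push_cast
  linear_combination a * h1 + b * h2

/-- Coordinates of lattice vectors with respect to which `mulOmg` acts by scalars. -/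
def rhoE (j : Bool) (x : Fin 8 → ℤ) : ℂ :=
  bif j then (-x 0 + 2 * (x 2 + x 3 + x 5 - x 7)) + omg 7 * (x 0 + 2 * x 1)
  else (3 * x 0 + 2 * x 7) + omg 7 * x 0

lemma rhoE_add (j : Bool) (x y : Fin 8 → ℤ) : rhoE j (x + y) = rhoE j x + rhoE j y := by
  cases j <;> simp [rhoE] <;> ring
lemma rhoE_smul (j : Bool) (n : ℤ) (x : Fin 8 → ℤ) : rhoE j (n • x) = n * rhoE j x := by
  cases j <;> simp [rhoE] <;> ring
lemma rhoE_neg (j : Bool) (x : Fin 8 → ℤ) : rhoE j (-x) = -rhoE j x := by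
  cases j <;> simp [rhoE] <;> ring
lemma rhoE_mulOmg (j : Bool) (x : Fin 8 → ℤ) : rhoE j (mulOmg *ᵥ x) = omg 7 * rhoE j x := by
  have h := omg_sq
  cases j <;> simp [rhoE, mulOmg, mulVec, dotProduct, Fin.sum_univ_eight]
  · linear_combination -(x 0) * h
  · linear_combination -(x 0 + 2 * x 1) * h

/-- The skew form underlying the harmonic polynomials. -/
def pE (x y : Fin 8 → ℤ) : ℂ := rhoE true y * rhoE false x - rhoE false y * rhoE true x

/-- Multiplication by the element `a + b * omg 7`. -/
def mulE (a b : ℤ) (x : Fin 8 → ℤ) : Fin 8 → ℤ := a • x + b • (mulOmg *ᵥ x)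

lemma hE_mulE_right (a b : ℤ) (x y : Fin 8 → ℤ) : hE x (mulE a b y) = (a + b * omg 7) * hE x y := by
  rw [mulE, hE_add_right, hE_smul_right, hE_smul_right, hE_mulOmg_right]; ring
lemma hE_mulE_left (a b : ℤ) (x y : Fin 8 → ℤ) :
    hE (mulE a b x) y = (starRingEnd ℂ) (a + b * omg 7) * hE x y := by
  rw [← conj_hE, hE_mulE_right, map_mul, conj_hE]
lemma pE_add_mulE (a b : ℤ) (x y : Fin 8 → ℤ) : pE x (y + mulE a b x) = pE x y := by
  simp only [pE, mulE, rhoE_add, rhoE_smul, rhoE_mulOmg]; ring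
lemma pE_neg_swap (x y : Fin 8 → ℤ) : pE (-y) x = pE x y := by
  simp only [pE, rhoE_neg]; ring

/-- Four times the inverse of `basisE`. -/
def dualE : Matrix (Fin 8) (Fin 8) ℤ :=
  !![4, 0, 0, 0, 0, 0, 0, 0; -2, 2, 0, 0, 0, 0, 0, 0; -2, 0, 2, 0, 0, 0, 0, 0;
    -2, 0, 0, 2, 0, 0, 0, 0; -2, 0, 0, 0, 2, 0, 0, 0; -2, 0, 0, 0, 0, 2, 0, 0;
    -2, 0, 0, 0, 0, 0, 2, 0; -7, 1, 1, 1, 1, 1, 1, 1]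

lemma dualE_mulVec (x : Fin 8 → ℤ) : dualE *ᵥ basisE *ᵥ x = (4 : ℤ) • x := by
  have h : dualE * basisE = (4 : ℤ) • 1 := by decide +kernel
  rw [mulVec_mulVec, h, smul_mulVec, one_mulVec]

lemma basisE_injective : Function.Injective fun x : Fin 8 → ℤ => basisE *ᵥ x := by
  intro x y h
  have h2 := congrArg (dualE *ᵥ ·) h
  simp only [dualE_mulVec] at h2
  exact smul_right_injective _ (by norm_num) h2

lemma bE_self_eq (x : Fin 8 → ℤ) : (bE x x : ℝ) = 1 / 4 * ∑ i, (((basisE *ᵥ x) i : ℤ) : ℝ) ^ 2 := by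
  have h : ((4 * bE x x : ℤ) : ℝ) = ∑ i, (((basisE *ᵥ x) i : ℤ) : ℝ) ^ 2 := by
    rw [four_bE, dotProduct]; push_cast
    exact Finset.sum_congr rfl fun i _ => (sq _).symm
  rw [← h]; push_cast; ring

lemma bE_self_nonneg (x : Fin 8 → ℤ) : (0 : ℝ) ≤ bE x x := by
  rw [bE_self_eq]; positivity

lemma sq_le_bE (x : Fin 8 → ℤ) (i : Fin 8) : ((x i : ℤ) : ℝ) ^ 2 ≤ 16 * bE x x := by
  have h := congrFun (dualE_mulVec x) i
  have hc := Finset.sum_mul_sq_le_sq_mul_sq Finset.univ (fun j => (dualE i j : ℝ))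
    fun j => ((basisE *ᵥ x) j : ℝ)
  have h1 : ∑ j, (dualE i j : ℝ) * ((basisE *ᵥ x) j : ℝ) = 4 * (x i : ℝ) := by
    have : ((dualE *ᵥ basisE *ᵥ x) i : ℝ) = ((((4 : ℤ) • x) i : ℤ) : ℝ) := by rw [h]
    rw [mulVec, dotProduct] at this
    push_cast at this
    rw [this]; simp
  have h2 : ∑ j, (dualE i j : ℝ) ^ 2 ≤ 64 := by
    have : ∀ i, ∑ j, (dualE i j) ^ 2 ≤ 64 := by decide +kernel
    exact_mod_cast this i
  rw [h1] at hc
  have h3 := bE_self_eq x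
  have h4 := bE_self_nonneg x
  nlinarith

lemma eq_zero_of_bE_self {x : Fin 8 → ℤ} (h : bE x x = 0) : x = 0 := by
  ext i
  have := sq_le_bE x i
  rw [h, Int.cast_zero, mul_zero] at this
  have := pow_eq_zero_iff (two_ne_zero) |>.1 (le_antisymm this (sq_nonneg _))
  exact_mod_cast this

lemma normSq_hE_le (x y : Fin 8 → ℤ) : Complex.normSq (hE x y) ≤ bE x x * bE y y / 4 := by
  rcases eq_or_lt_of_le (bE_self_nonneg y) with h0 | h0
  · have hy : y = 0 := eq_zero_of_bE_self (by exact_mod_cast h0.symm)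
    subst hy
    simp [hE, bE]
  set a : ℤ := bE x (mulOmg *ᵥ y) - 4 * bE x y with ha
  set b : ℤ := bE x y - 2 * bE x (mulOmg *ᵥ y) with hb
  set z := (7 * bE y y) • x + mulE (2 * a) (2 * b) y with hz
  have hm : (((2 * a : ℤ) : ℂ) + (2 * b : ℤ) * omg 7) = -14 * (starRingEnd ℂ) (hE x y) := by
    have h1 : (starRingEnd ℂ) (hE x y) = -(bE x (mulOmg *ᵥ y) - omg 7 * bE x y) / (2 * omg 7 - 1) := by
      have h := hE_add_conj x y
      rw [eq_div_iff two_omg_sub_one_ne]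
      have h2 : hE x y * (2 * omg 7 - 1) = (bE x (mulOmg *ᵥ y) - (1 - omg 7) * bE x y) :=
        div_mul_cancel₀ _ two_omg_sub_one_ne
      linear_combination (2 * omg 7 - 1) * h - h2
    rw [h1, mul_div_assoc', eq_div_iff two_omg_sub_one_ne, ha, hb]
    push_cast
    linear_combination (4 * bE x y - 8 * bE x (mulOmg *ᵥ y) : ℂ) * omg_sq
  have hs : hE z z = ((49 * bE y y * (bE x x * bE y y / 2 - 2 * Complex.normSq (hE x y)) : ℝ) : ℂ) := by
    rw [hz, hE_add_left, hE_add_right, hE_add_right, hE_mulE_left, hE_mulE_left, hE_mulE_right,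
      hE_mulE_right, hm, hE_smul_left, hE_smul_left, hE_smul_right, hE_smul_right, hE_self x,
      hE_self y, ← conj_hE x y]
    push_cast
    rw [Complex.normSq_eq_conj_mul_self]
    simp only [map_mul, map_intCast, map_neg, map_ofNat, Complex.conj_conj, map_div₀]
    ring
  rw [hE_self] at hs
  have h1 : (bE z z : ℝ) / 2 = 49 * bE y y * (bE x x * bE y y / 2 - 2 * Complex.normSq (hE x y)) := by
    exact_mod_cast hs
  have h2 := bE_self_nonneg z
  have h3 : 0 ≤ (bE y y : ℝ) * (bE x x * bE y y / 2 - 2 * Complex.normSq (hE x y)) := by linarith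
  have := nonneg_of_mul_nonneg_right h3 h0
  linarith

/-- The exponent of the theta series. -/
def qE (x y : Fin 8 → ℤ) (Z : Matrix (Fin 2) (Fin 2) ℂ) : ℂ :=
  hE x x * Z 0 0 + hE x y * Z 0 1 + (starRingEnd ℂ) (hE x y) * Z 1 0 + hE y y * Z 1 1

lemma im_qE (x y : Fin 8 → ℤ) (Z : Matrix (Fin 2) (Fin 2) ℂ) :
    (qE x y Z).im = bE x x / 2 * (Z 0 0).im + bE y y / 2 * (Z 1 1).im +
      (hE x y * (Z 0 1 - (starRingEnd ℂ) (Z 1 0))).im := by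
  have h : ∀ (n : ℤ) (z : ℂ), ((n : ℂ) / 2 * z).im = n / 2 * z.im := by
    intro n z
    rw [show ((n : ℂ) / 2) = ((n / 2 : ℝ) : ℂ) by push_cast; rfl, Complex.im_ofReal_mul]
  rw [qE, hE_self, hE_self]
  simp only [Complex.add_im, h]
  simp only [Complex.mul_im, Complex.sub_im, Complex.sub_re, Complex.conj_re, Complex.conj_im]
  ring

lemma im_qE_nonneg (x y : Fin 8 → ℤ) {Z : Matrix (Fin 2) (Fin 2) ℂ} (hZ : Z ∈ HH2) :
    0 ≤ (qE x y Z).im := by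
  obtain ⟨h1, h2, h3⟩ := mem_HH2_iff.1 hZ
  rw [im_qE]
  set d := Z 0 1 - (starRingEnd ℂ) (Z 1 0)
  have hX := bE_self_nonneg x
  have hY := bE_self_nonneg y
  have hn := Complex.abs_im_le_norm (hE x y * d)
  have hsq : ‖hE x y * d‖ ^ 2 ≤ (bE x x / 2 * (Z 0 0).im + bE y y / 2 * (Z 1 1).im) ^ 2 := by
    rw [← Complex.normSq_eq_norm_sq, Complex.normSq_mul]
    calc _ ≤ (bE x x * bE y y / 4 : ℝ) * (4 * ((Z 0 0).im * (Z 1 1).im)) := by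
          gcongr
          · exact Complex.normSq_nonneg _
          · exact normSq_hE_le x y
      _ ≤ _ := by nlinarith [sq_nonneg (bE x x / 2 * (Z 0 0).im - bE y y / 2 * (Z 1 1).im)]
  have := abs_le_of_sq_le_sq hsq (by positivity)
  rw [abs_norm] at this
  have := (abs_le.1 (hn.trans this)).1
  linarith

lemma exists_im_qE_ge {Z₀ : Matrix (Fin 2) (Fin 2) ℂ} (h : Z₀ ∈ HH2) :
    ∃ ε > 0, ∀ᶠ Z in 𝓝 Z₀, ∀ x y, ε * ((bE x x : ℝ) + bE y y) ≤ (qE x y Z).im := by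
  have hc : Continuous fun p : ℝ × Matrix (Fin 2) (Fin 2) ℂ =>
      p.2 - (2 * Complex.I * p.1 : ℂ) • (1 : Matrix (Fin 2) (Fin 2) ℂ) := by fun_prop
  have hn := (hc.tendsto (0, Z₀)).eventually (p := (· ∈ HH2))
    (isOpen_HH2.mem_nhds (by simpa using h))
  rw [nhds_prod_eq] at hn
  obtain ⟨pa, ha, pb, hb, hab⟩ := eventually_prod_iff.1 hn
  obtain ⟨ε, hε, hp⟩ := ((ha.filter_mono (nhdsWithin_le_nhds (s := Set.Ioi (0 : ℝ)))).and
    self_mem_nhdsWithin).exists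
  refine ⟨ε, hp, hb.mono fun Z hZ x y => ?_⟩
  have h1 := im_qE_nonneg x y (hab hε hZ)
  rw [im_qE] at h1 ⊢
  simp at h1 ⊢
  linarith

lemma norm_rhoE_le (j : Bool) (x : Fin 8 → ℤ) : ‖rhoE j x‖ ≤ 64 * Real.sqrt (bE x x) := by
  have h : ∀ i, ‖((x i : ℤ) : ℂ)‖ ≤ 4 * Real.sqrt (bE x x) := by
    intro i
    rw [Complex.norm_intCast]
    refine abs_le_of_sq_le_sq' ?_ (by positivity) |> abs_le.2
    rw [mul_pow, Real.sq_sqrt (bE_self_nonneg x)]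
    linarith [sq_le_bE x i]
  have hw : ‖omg 7‖ ≤ 2 := by
    have h1 : ‖omg 7‖ ^ 2 = 2 := by
      have := omg_mul_conj
      rw [Complex.mul_conj, Complex.normSq_eq_norm_sq] at this
      exact_mod_cast this
    nlinarith [norm_nonneg (omg 7)]
  have e : ∀ n : ℂ, ‖omg 7 * n‖ ≤ 2 * ‖n‖ := fun n => by
    rw [norm_mul]; exact mul_le_mul_of_nonneg_right hw (norm_nonneg _)
  have e2 : ∀ n : ℂ, ‖2 * n‖ = 2 * ‖n‖ := fun n => by simp
  have e3 : ∀ n : ℂ, ‖3 * n‖ = 3 * ‖n‖ := fun n => by simp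
  have s := Real.sqrt_nonneg (bE x x : ℝ)
  cases j
  · simp only [rhoE, cond_false]
    refine (norm_add_le _ _).trans ?_
    have a1 := norm_add_le (3 * (x 0 : ℂ)) (2 * x 7)
    rw [e2, e3] at a1
    linarith [h 0, h 7, e (x 0)]
  · simp only [rhoE, cond_true]
    refine (norm_add_le _ _).trans ?_
    have a1 := norm_add_le (-x 0 : ℂ) (2 * (x 2 + x 3 + x 5 - x 7))
    have a2 := norm_add_le (x 0 : ℂ) (2 * x 1)
    have a3 := norm_sub_le (x 2 + x 3 + x 5 : ℂ) (x 7)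
    have a4 := norm_add_le (x 2 + x 3 : ℂ) (x 5)
    have a5 := norm_add_le (x 2 : ℂ) (x 3)
    rw [e2] at a1 a2
    rw [norm_neg] at a1
    linarith [h 0, h 1, h 2, h 3, h 5, h 7, e (x 0 + 2 * x 1)]

lemma norm_pE_le (x y : Fin 8 → ℤ) : ‖pE x y‖ ≤ 64 ^ 2 * ((bE x x : ℝ) + bE y y) := by
  have h := norm_sub_le (rhoE true y * rhoE false x) (rhoE false y * rhoE true x)
  rw [norm_mul, norm_mul] at h
  have m : ∀ i j, ‖rhoE i y‖ * ‖rhoE j x‖ ≤ 64 * Real.sqrt (bE y y) * (64 * Real.sqrt (bE x x)) :=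
    fun i j => mul_le_mul (norm_rhoE_le i y) (norm_rhoE_le j x) (norm_nonneg _) (by positivity)
  have s1 := Real.sq_sqrt (bE_self_nonneg x)
  have s2 := Real.sq_sqrt (bE_self_nonneg y)
  have := m true false
  have := m false true
  unfold pE
  nlinarith [sq_nonneg (Real.sqrt (bE x x : ℝ) - Real.sqrt (bE y y))]

lemma summable_exp_bE {T : ℝ} (hT : 0 < T) :
    Summable fun x : Fin 8 → ℤ => Real.exp (-T * bE x x) := by
  refine ((summable_exp_neg_sum_sq 8 (T := T / 4) (by positivity)).comp_injective
    basisE_injective).congr fun x => ?_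
  rw [bE_self_eq, Function.comp]
  congr 1
  ring

lemma summable_pow_exp_bE (k : ℕ) {T : ℝ} (hT : 0 < T) :
    Summable fun p : (Fin 8 → ℤ) × (Fin 8 → ℤ) =>
      (1 + ((bE p.1 p.1 : ℝ) + bE p.2 p.2)) ^ k *
        Real.exp (-T * ((bE p.1 p.1 : ℝ) + bE p.2 p.2)) := by
  obtain ⟨C, hC, h⟩ := pow_mul_exp_le k hT
  have hN : ∀ p : (Fin 8 → ℤ) × (Fin 8 → ℤ), 0 ≤ (bE p.1 p.1 : ℝ) + bE p.2 p.2 := fun p =>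
    add_nonneg (bE_self_nonneg _) (bE_self_nonneg _)
  have hs := summable_exp_bE (half_pos hT)
  refine Summable.of_nonneg_of_le (fun p => ?_) (fun p => h _ (hN p))
    (((hs.mul_of_nonneg hs (fun _ => by positivity) fun _ => by positivity).mul_left C).congr
      fun p => ?_)
  · have := hN p
    positivity
  · rw [mul_add, Real.exp_add]

/-- The size of a pair of lattice vectors. -/
def sizeE (p : (Fin 8 → ℤ) × (Fin 8 → ℤ)) : ℝ := bE p.1 p.1 + bE p.2 p.2

lemma sizeE_nonneg (p : (Fin 8 → ℤ) × (Fin 8 → ℤ)) : 0 ≤ sizeE p :=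
  add_nonneg (bE_self_nonneg _) (bE_self_nonneg _)

/-- The theta series of degree two of the `E₈` lattice with a harmonic coefficient. -/
def thetaE (ν : ℕ) (Z : Matrix (Fin 2) (Fin 2) ℂ) : ℂ :=
  ∑' p : (Fin 8 → ℤ) × (Fin 8 → ℤ), pE p.1 p.2 ^ ν * eC (qE p.1 p.2 Z)

lemma norm_hE_le (p : (Fin 8 → ℤ) × (Fin 8 → ℤ)) : ‖hE p.1 p.2‖ ≤ sizeE p := by
  have h := normSq_hE_le p.1 p.2
  rw [Complex.normSq_eq_norm_sq] at h
  have h1 := bE_self_nonneg p.1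
  have h2 := bE_self_nonneg p.2
  refine abs_le_of_sq_le_sq (h.trans ?_) (sizeE_nonneg p) |> (le_abs_self _).trans
  unfold sizeE
  nlinarith

lemma norm_pow_mul_eC_le (ν : ℕ) {ε : ℝ} {Z : Matrix (Fin 2) (Fin 2) ℂ}
    (p : (Fin 8 → ℤ) × (Fin 8 → ℤ)) (h : ε * sizeE p ≤ (qE p.1 p.2 Z).im) :
    ‖pE p.1 p.2 ^ ν * eC (qE p.1 p.2 Z)‖ ≤
      (64 ^ 2) ^ ν * ((1 + sizeE p) ^ ν * Real.exp (-(2 * Real.pi * ε) * sizeE p)) := by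
  have := sizeE_nonneg p
  rw [norm_mul, norm_pow, norm_eC, ← mul_assoc, ← mul_pow]
  refine mul_le_mul (pow_le_pow_left₀ (norm_nonneg _) ((norm_pE_le _ _).trans ?_) ν)
    (Real.exp_le_exp.2 ?_) (Real.exp_nonneg _) (by positivity)
  · have : (0 : ℝ) ≤ 64 ^ 2 := by positivity
    refine mul_le_mul_of_nonneg_left ?_ this
    unfold sizeE
    linarith
  · have := mul_le_mul_of_nonneg_left h Real.two_pi_pos.le
    linarith

lemma summable_thetaE (ν : ℕ) {Z : Matrix (Fin 2) (Fin 2) ℂ} (hZ : Z ∈ HH2) :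
    Summable fun p : (Fin 8 → ℤ) × (Fin 8 → ℤ) => pE p.1 p.2 ^ ν * eC (qE p.1 p.2 Z) := by
  obtain ⟨ε, hε, h⟩ := exists_im_qE_ge hZ
  exact Summable.of_norm_bounded ((summable_pow_exp_bE ν (T := 2 * Real.pi * ε)
    (by positivity)).mul_left _) fun p => norm_pow_mul_eC_le ν p (h.self_of_nhds _ _)

/-- The exponent of the theta series, as a continuous linear form. -/
def qL (x y : Fin 8 → ℤ) : (Fin 4 → ℂ) →L[ℂ] ℂ :=
  LinearMap.mkContinuous
    { toFun := fun Z => hE x x * Z 0 + hE x y * Z 1 + (starRingEnd ℂ) (hE x y) * Z 2 + hE y y * Z 3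
      map_add' := fun Z W => by simp only [Pi.add_apply]; ring
      map_smul' := fun c Z => by simp; ring }
    (3 * sizeE (x, y)) fun Z => by
      have hn : ∀ i, ‖Z i‖ ≤ ‖Z‖ := norm_le_pi_norm Z
      have h2 : ∀ n : ℤ, ‖((n : ℂ) / 2)‖ = |(n : ℝ)| / 2 := fun n => by simp
      have hh := norm_hE_le (x, y)
      have e : ∀ (a : ℂ), ∀ i, ‖a * Z i‖ ≤ ‖a‖ * ‖Z‖ := fun a i => by
        rw [norm_mul]; exact mul_le_mul_of_nonneg_left (hn i) (norm_nonneg _)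
      simp only [LinearMap.coe_mk, AddHom.coe_mk]
      have n1 := norm_add_le (hE x x * Z 0 + hE x y * Z 1 + (starRingEnd ℂ) (hE x y) * Z 2)
        (hE y y * Z 3)
      have n2 := norm_add_le (hE x x * Z 0 + hE x y * Z 1) ((starRingEnd ℂ) (hE x y) * Z 2)
      have n3 := norm_add_le (hE x x * Z 0) (hE x y * Z 1)
      have a1 := e (hE x x) 0
      have a2 := e (hE x y) 1
      have a3 := e ((starRingEnd ℂ) (hE x y)) 2
      have a4 := e (hE y y) 3
      rw [hE_self, h2, abs_of_nonneg (bE_self_nonneg _)] at a1 a4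
      rw [RCLike.norm_conj] at a3
      simp only [hE_self] at *
      have := mul_le_mul_of_nonneg_right hh (norm_nonneg Z)
      have hz := norm_nonneg Z
      have b1 := bE_self_nonneg x
      have b2 := bE_self_nonneg y
      unfold sizeE at *
      simp only at *
      nlinarith

lemma norm_qL_le (x y : Fin 8 → ℤ) : ‖qL x y‖ ≤ 3 * sizeE (x, y) :=
  LinearMap.mkContinuous_norm_le _ (mul_nonneg (by norm_num) (sizeE_nonneg _)) _

lemma differentiableOn_thetaE (ν : ℕ) : DifferentiableOn ℂ (thetaE ν) HH2 := by
  intro Z₀ hZ₀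
  obtain ⟨ε, hε, h⟩ := exists_im_qE_ge hZ₀
  let g : (Fin 4 → ℂ) → Matrix (Fin 2) (Fin 2) ℂ := fun c => !![c 0, c 1; c 2, c 3]
  let v : Matrix (Fin 2) (Fin 2) ℂ → Fin 4 → ℂ := fun Z => ![Z 0 0, Z 0 1, Z 1 0, Z 1 1]
  have hg : Continuous g := by
    refine continuous_matrix fun i j => ?_
    fin_cases i <;> fin_cases j <;> simp [g] <;> fun_prop
  have hv : Differentiable ℂ v := by
    refine differentiable_pi.2 fun i => ?_
    fin_cases i <;> simp only [v, Fin.zero_eta, Fin.mk_one, Fin.reduceFinMk, cons_val] <;> fun_prop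
  have hgv : ∀ Z, g (v Z) = Z := fun Z => (Matrix.eta_fin_two Z).symm
  have h' : ∀ᶠ c in 𝓝 (v Z₀), ∀ x y, ε * ((bE x x : ℝ) + bE y y) ≤ (qE x y (g c)).im :=
    (hg.tendsto (v Z₀)).eventually (by rw [hgv]; exact h)
  obtain ⟨r, hr, hb⟩ := Metric.eventually_nhds_iff_ball.1 h'
  have hd : ∀ (p : (Fin 8 → ℤ) × (Fin 8 → ℤ)) (c : Fin 4 → ℂ),
      HasFDerivAt (fun c => pE p.1 p.2 ^ ν * eC (qE p.1 p.2 (g c)))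
        ((pE p.1 p.2 ^ ν * eC (qE p.1 p.2 (g c))) • ((2 * Real.pi * Complex.I) • qL p.1 p.2)) c := by
    intro p c
    have h1 : HasFDerivAt (fun c => qE p.1 p.2 (g c)) (qL p.1 p.2) c := (qL p.1 p.2).hasFDerivAt
    have h2 := ((h1.const_mul (2 * Real.pi * Complex.I)).cexp).const_mul (pE p.1 p.2 ^ ν)
    rw [smul_smul] at h2
    exact h2
  have hx : v Z₀ ∈ Metric.ball (v Z₀) r := Metric.mem_ball_self hr
  have key : DifferentiableAt ℂ (fun c => thetaE ν (g c)) (v Z₀) := by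
   refine (hasFDerivAt_tsum_of_isPreconnected
    (u := fun p => (6 * Real.pi * (64 ^ 2) ^ ν) * ((1 + sizeE p) ^ (ν + 1) *
      Real.exp (-(2 * Real.pi * ε) * sizeE p)))
    ((summable_pow_exp_bE (ν + 1) (T := 2 * Real.pi * ε) (by positivity)).mul_left _)
    Metric.isOpen_ball (convex_ball (v Z₀) r).isPreconnected (fun p Z _ => hd p Z) ?_ hx
    (by simpa only [hgv] using summable_thetaE ν hZ₀) hx).differentiableAt
   intro p Z hZ
   have h1 := norm_pow_mul_eC_le ν p (hb Z hZ p.1 p.2)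
   have h2 := norm_qL_le p.1 p.2
   have h3 := sizeE_nonneg p
   rw [norm_smul, norm_smul]
   have h4 : ‖(2 * Real.pi * Complex.I : ℂ)‖ = 2 * Real.pi := by
     simp [abs_of_pos Real.pi_pos]
   rw [h4]
   calc _ ≤ ((64 ^ 2) ^ ν * ((1 + sizeE p) ^ ν * Real.exp (-(2 * Real.pi * ε) * sizeE p))) *
         (2 * Real.pi * (3 * (1 + sizeE p))) := by
         refine mul_le_mul h1 (mul_le_mul_of_nonneg_left (h2.trans ?_) Real.two_pi_pos.le)
           (by positivity) (by positivity)
         simp only [Prod.mk.eta]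
         linarith
     _ = _ := by ring
  have := key.comp Z₀ (hv Z₀)
  simp only [Function.comp_def, hgv] at this
  exact this.differentiableWithinAt

lemma thetaE_translate (ν : ℕ) {t u v w : ℂ} {a d : ℤ} {s : ℂ} (hs : s ∈ ringInts 7) :
    thetaE ν !![t + a, u + s; v + (starRingEnd ℂ) s, w + d] = thetaE ν !![t, u; v, w] := by
  refine tsum_congr fun p => ?_
  obtain ⟨n, hn⟩ := hE_mul_trace hs p.1 p.2
  congr 1
  have : qE p.1 p.2 !![t + a, u + s; v + (starRingEnd ℂ) s, w + d] = qE p.1 p.2 !![t, u; v, w] +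
      (((p.1 ⬝ᵥ halfGram *ᵥ p.1) * a + n + (p.2 ⬝ᵥ halfGram *ᵥ p.2) * d : ℤ) : ℂ) := by
    push_cast
    simp only [qE, of_apply, cons_val', cons_val_zero, cons_val_one, cons_val_fin_one]
    rw [← hn, hE_self' p.1, hE_self' p.2]
    ring
  rw [this, eC_add, eC_int, mul_one]

lemma thetaE_shear (ν : ℕ) {t u v w m : ℂ} (hm : m ∈ ringInts 7) :
    thetaE ν !![t + m * v + (starRingEnd ℂ) m * u + m * (starRingEnd ℂ) m * w, u + m * w;
      v + (starRingEnd ℂ) m * w, w] = thetaE ν !![t, u; v, w] := by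
  obtain ⟨a, b, hab⟩ := conj_mem_ringInts hm
  let e : (Fin 8 → ℤ) × (Fin 8 → ℤ) ≃ (Fin 8 → ℤ) × (Fin 8 → ℤ) :=
    { toFun := fun p => (p.1, p.2 + mulE a b p.1)
      invFun := fun p => (p.1, p.2 - mulE a b p.1)
      left_inv := fun p => by simp
      right_inv := fun p => by simp }
  have hl : ∀ x y, hE (mulE a b x) y = m * hE x y := fun x y => by
    rw [hE_mulE_left, ← hab, Complex.conj_conj]
  have hr : ∀ x y, hE x (mulE a b y) = (starRingEnd ℂ) m * hE x y := fun x y => by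
    rw [hE_mulE_right, ← hab]
  symm
  rw [thetaE, thetaE, ← e.tsum_eq]
  refine tsum_congr fun p => ?_
  simp only [e, Equiv.coe_fn_mk, pE_add_mulE]
  congr 2
  simp only [qE, of_apply, cons_val', cons_val_zero, cons_val_one, cons_val_fin_one]
  simp only [hE_add_right, hE_add_left, hl, hr, map_add, map_mul, conj_hE, Complex.conj_conj]
  ring

lemma thetaE_swap (ν : ℕ) (t u v w : ℂ) :
    thetaE ν !![w, -v; -u, t] = thetaE ν !![t, u; v, w] := by
  let e : (Fin 8 → ℤ) × (Fin 8 → ℤ) ≃ (Fin 8 → ℤ) × (Fin 8 → ℤ) :=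
    { toFun := fun p => (-p.2, p.1)
      invFun := fun p => (p.2, -p.1)
      left_inv := fun p => by simp
      right_inv := fun p => by simp }
  rw [thetaE, thetaE, ← e.tsum_eq]
  refine tsum_congr fun p => ?_
  simp only [e, Equiv.coe_fn_mk, pE_neg_swap]
  congr 2
  simp only [qE, of_apply, cons_val', cons_val_zero, cons_val_one, cons_val_fin_one,
    hE_neg_left, hE_neg_right, map_neg, conj_hE]
  ring

/-- The number `0` or `1`. -/
def bitC (c : Bool) : ℂ := bif c then 1 else 0

/-- The summand of a theta function with characteristics in `{0, 1/2}`. -/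
def charTerm (c d : Bool) (s τ : ℂ) (m : ℤ) : ℂ :=
  eC (bitC d * m / 2) * eC ((m + bitC c / 2) ^ 2 * τ / 2 + (m + bitC c / 2) * s)

/-- The theta function with characteristics in `{0, 1/2}`. -/
def charTheta (c d : Bool) (s τ : ℂ) : ℂ :=
  eC (bitC c ^ 2 * τ / 8 + bitC c * s / 2) * jacobiTheta₂ (s + bitC c * τ / 2 + bitC d / 2) τ

lemma charTerm_eq (c d : Bool) (s τ : ℂ) (m : ℤ) : charTerm c d s τ m =
    eC (bitC c ^ 2 * τ / 8 + bitC c * s / 2) *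
      jacobiTheta₂_term m (s + bitC c * τ / 2 + bitC d / 2) τ := by
  rw [charTerm, jacobiTheta₂_term, ← eC_add, eC, eC, ← Complex.exp_add]
  congr 1
  ring

lemma hasSum_charTerm (c d : Bool) (s : ℂ) {τ : ℂ} (hτ : 0 < τ.im) :
    HasSum (charTerm c d s τ) (charTheta c d s τ) := by
  rw [show charTerm c d s τ = _ from funext (charTerm_eq c d s τ)]
  exact (hasSum_jacobiTheta₂_term _ hτ).mul_left _

lemma charTheta_inversion (c d : Bool) (s : ℂ) {τ : ℂ} (hτ : 0 < τ.im) : charTheta c d s τ =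
    1 / (-Complex.I * τ) ^ (1 / 2 : ℂ) * eC (-s ^ 2 / (2 * τ) - bitC c * bitC d / 4) *
      charTheta d c (-(s / τ)) (-1 / τ) := by
  have h0 : τ ≠ 0 := by rintro rfl; simp at hτ
  have hper : jacobiTheta₂ ((s + bitC c * τ / 2 + bitC d / 2) / τ) (-1 / τ) =
      jacobiTheta₂ (-(s / τ) + bitC d * (-1 / τ) / 2 + bitC c / 2) (-1 / τ) := by
    rw [← jacobiTheta₂_neg_left]
    cases c
    · congr 1
      simp only [bitC, cond_false]
      field_simp
      ring
    · rw [← jacobiTheta₂_add_left]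
      congr 1
      simp only [bitC, cond_true]
      field_simp
      ring
  rw [charTheta, charTheta, jacobiTheta₂_functional_equation, hper]
  have he : eC (bitC c ^ 2 * τ / 8 + bitC c * s / 2) *
      Complex.exp (-Real.pi * Complex.I * (s + bitC c * τ / 2 + bitC d / 2) ^ 2 / τ) =
      eC (-s ^ 2 / (2 * τ) - bitC c * bitC d / 4) *
        eC (bitC d ^ 2 * (-1 / τ) / 8 + bitC d * -(s / τ) / 2) := by
    rw [← eC_add, eC, eC, ← Complex.exp_add]
    congr 1
    field_simp
    ring
  linear_combination 1 / (-Complex.I * τ) ^ (1 / 2 : ℂ) *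
    jacobiTheta₂ (-(s / τ) + bitC d * (-1 / τ) / 2 + bitC c / 2) (-1 / τ) * he

lemma prod_charTheta_inversion (c d : Bool) (s : Fin 8 → ℂ) {τ : ℂ} (hτ : 0 < τ.im) :
    ∏ i, charTheta c d (s i) τ = 1 / τ ^ 4 * eC (-(∑ i, s i ^ 2) / (2 * τ)) *
      ∏ i, charTheta d c (-(s i / τ)) (-1 / τ) := by
  have h0 : τ ≠ 0 := by rintro rfl; simp at hτ
  rw [Finset.prod_congr rfl fun i _ => charTheta_inversion c d (s i) hτ]
  rw [Finset.prod_mul_distrib, Finset.prod_mul_distrib, Finset.prod_const]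
  congr 2
  · rw [Finset.card_univ, Fintype.card_fin, div_pow, one_pow, ← Complex.cpow_nat_mul]
    norm_num
    rw [mul_pow, Complex.I_pow_four, one_mul]
  · have : ∀ i, eC (-s i ^ 2 / (2 * τ) - bitC c * bitC d / 4) =
        Complex.exp (2 * Real.pi * Complex.I * (-s i ^ 2 / (2 * τ) - bitC c * bitC d / 4)) := fun i => rfl
    rw [Finset.prod_congr rfl fun i _ => this i, ← Complex.exp_sum, ← Finset.mul_sum]
    change eC _ = _
    rw [Finset.sum_sub_distrib, eC_sub, Finset.sum_const, Finset.card_univ, Fintype.card_fin,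
      ← Finset.sum_div, Finset.sum_neg_distrib]
    have : eC (8 • (bitC c * bitC d / 4)) = 1 := by
      cases c <;> cases d <;> simp [bitC]
      rw [show (8 * 4⁻¹ : ℂ) = (2 : ℤ) by norm_num, eC_int]
    rw [this, div_one]

/-- The theta series of degree one of the `E₈` lattice. -/
def lineTheta (s : Fin 8 → ℂ) (τ : ℂ) : ℂ :=
  ∑' x : Fin 8 → ℤ, eC (bE x x * τ / 2 + ∑ i, ((basisE *ᵥ x) i : ℂ) * s i / 2)

/-- Residue classes of lattice vectors. -/
def classE (x : Fin 8 → ℤ) : (Fin 8 → ℤ) × Bool :=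
  (fun i => (basisE *ᵥ x) i / 2, decide (x 0 % 2 = 1))

lemma classE_spec (x : Fin 8 → ℤ) (i : Fin 8) :
    2 * (classE x).1 i + (bif (classE x).2 then 1 else 0) = (basisE *ᵥ x) i := by
  rw [classE]
  rcases Int.emod_two_eq_zero_or_one (x 0) with h | h <;> fin_cases i <;>
    simp [basisE, mulVec, dotProduct, Fin.sum_univ_eight, h] <;> omega

lemma classE_injective : Function.Injective classE := fun x y h => basisE_injective <| by
  ext i
  simp only [← classE_spec, h]

lemma even_sum_classE (x : Fin 8 → ℤ) : Even (∑ i, (classE x).1 i) := by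
  have h := classE_spec x
  have h0 : ∑ i, (basisE *ᵥ x) i = 8 * x 0 + 4 * x 7 := by
    simp [basisE, mulVec, dotProduct, Fin.sum_univ_eight]; ring
  simp only [← h, Finset.sum_add_distrib, ← Finset.mul_sum, Finset.sum_const, Finset.card_univ,
    Fintype.card_fin] at h0
  rw [Int.even_iff]
  cases hc : (classE x).2 <;> simp [hc] at h0 <;> omega

lemma mem_range_classE {p : (Fin 8 → ℤ) × Bool} (h : Even (∑ i, p.1 i)) :
    p ∈ Set.range classE := by
  obtain ⟨m, c⟩ := p
  obtain ⟨k, hk⟩ := h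
  simp only [Fin.sum_univ_eight] at hk
  refine ⟨![2 * m 0 + (bif c then 1 else 0), m 1 - m 0, m 2 - m 0, m 3 - m 0, m 4 - m 0,
    m 5 - m 0, m 6 - m 0, k - 4 * m 0], ?_⟩
  refine Prod.ext (funext fun i => ?_) ?_
  · cases c <;> fin_cases i <;>
      simp [classE, basisE, mulVec, dotProduct, Fin.sum_univ_eight] <;> omega
  · cases c <;> simp [classE]

lemma eC_half_int (n : ℤ) : eC (n / 2) = if Even n then 1 else -1 := by
  split_ifs with h
  · obtain ⟨k, rfl⟩ := h
    rw [show (((k + k : ℤ) : ℂ) / 2) = (k : ℤ) by push_cast; ring, eC_int]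
  · obtain ⟨k, rfl⟩ := Int.not_even_iff_odd.1 h
    rw [show (((2 * k + 1 : ℤ) : ℂ) / 2) = (k : ℤ) + 1 / 2 by push_cast; ring, eC_add, eC_int,
      eC_half, one_mul]

lemma eC_sum {ι : Type*} (s : Finset ι) (f : ι → ℂ) : eC (∑ i ∈ s, f i) = ∏ i ∈ s, eC (f i) := by
  simp only [eC, Finset.mul_sum, Complex.exp_sum]

lemma hasSum_lineTheta (s : Fin 8 → ℂ) {τ : ℂ} (hτ : 0 < τ.im) :
    HasSum (fun x : Fin 8 → ℤ => eC (bE x x * τ / 2 + ∑ i, ((basisE *ᵥ x) i : ℂ) * s i / 2))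
      (∑ c, ∑ d, 1 / 2 * ∏ i, charTheta c d (s i) τ) := by
  have hprod : ∀ c d, HasSum (fun m : Fin 8 → ℤ => ∏ i, charTerm c d (s i) τ (m i))
      (∏ i, charTheta c d (s i) τ) := fun c d => by
    have := (hasSum_prod_fin (fun i => charTerm c d (s i) τ) fun i =>
      (hasSum_charTerm c d (s i) hτ).summable.norm).2
    rwa [Finset.prod_congr rfl fun i _ => (hasSum_charTerm c d (s i) hτ).tsum_eq] at this
  let f : (Fin 8 → ℤ) × Bool → ℂ := fun p => ∑ d, 1 / 2 * ∏ i, charTerm p.2 d (s i) τ (p.1 i)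
  have hf : HasSum f (∑ c, ∑ d, 1 / 2 * ∏ i, charTheta c d (s i) τ) := by
    have hc : ∀ c, HasSum (fun m => f (m, c)) (∑ d, 1 / 2 * ∏ i, charTheta c d (s i) τ) :=
      fun c => hasSum_sum fun d _ => (hprod c d).mul_left _
    have hc' : ∀ c, HasSum (fun p : (Fin 8 → ℤ) × Bool => if p.2 = c then f p else 0)
        (∑ d, 1 / 2 * ∏ i, charTheta c d (s i) τ) := fun c => by
      rw [← Function.Injective.hasSum_iff (Prod.mk_left_injective c) (fun p hp => if_neg ?_)]
      · simpa [Function.comp_def] using hc c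
      · rintro rfl
        exact hp ⟨p.1, rfl⟩
    simpa using hasSum_sum fun c (_ : c ∈ Finset.univ) => hc' c
  have hval : ∀ p : (Fin 8 → ℤ) × Bool, f p = (1 / 2 + 1 / 2 * eC ((∑ i, p.1 i : ℤ) / 2)) *
      ∏ i, charTerm p.2 false (s i) τ (p.1 i) := by
    intro p
    have : ∏ i, charTerm p.2 true (s i) τ (p.1 i) =
        eC ((∑ i, p.1 i : ℤ) / 2) * ∏ i, charTerm p.2 false (s i) τ (p.1 i) := by
      rw [Int.cast_sum, Finset.sum_div, eC_sum, ← Finset.prod_mul_distrib]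
      refine Finset.prod_congr rfl fun i _ => ?_
      simp [charTerm, bitC]
    simp only [f, Fintype.sum_bool, this]
    ring
  rw [← classE_injective.hasSum_iff (f := f)] at hf
  · convert hf using 1
    funext x
    rw [Function.comp, hval, eC_half_int, if_pos (even_sum_classE x), eC_add, eC_sum]
    have hb : (bE x x : ℂ) = 1 / 4 * ∑ i, ((basisE *ᵥ x) i : ℂ) ^ 2 := by
      rw [← Complex.ofReal_intCast, bE_self_eq]; push_cast; rfl
    rw [hb, show (1 / 4 * ∑ i, ((basisE *ᵥ x) i : ℂ) ^ 2) * τ / 2 =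
      ∑ i, ((basisE *ᵥ x) i : ℂ) ^ 2 * τ / 8 by rw [← Finset.sum_div, ← Finset.sum_mul]; ring,
      eC_sum, ← Finset.prod_mul_distrib, show (1 / 2 + 1 / 2 * 1 : ℂ) = 1 by norm_num, one_mul]
    refine Finset.prod_congr rfl fun i _ => ?_
    have hs : ((basisE *ᵥ x) i : ℂ) = 2 * (classE x).1 i + bitC (classE x).2 := by
      rw [← classE_spec]
      cases (classE x).2 <;> simp [bitC]
    rw [charTerm, hs, ← eC_add, show bitC false = 0 from rfl, zero_mul, zero_div, eC_zero, one_mul]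
    congr 1
    ring
  · intro p hp
    have : ¬ Even (∑ i, p.1 i) := fun h => hp (mem_range_classE h)
    rw [hval, eC_half_int, if_neg this]
    ring

lemma lineTheta_inversion (s : Fin 8 → ℂ) {τ : ℂ} (hτ : 0 < τ.im) :
    lineTheta (fun i => s i / τ) (-1 / τ) = τ ^ 4 * eC ((∑ i, s i ^ 2) / (2 * τ)) *
      lineTheta s τ := by
  have h0 : τ ≠ 0 := by rintro rfl; simp at hτ
  have hτ' : 0 < (-1 / τ).im := by
    rw [neg_div, Complex.neg_im, one_div, Complex.inv_im, neg_div, neg_neg]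
    exact div_pos hτ (Complex.normSq_pos.2 h0)
  have hneg : lineTheta (fun i => s i / τ) (-1 / τ) = lineTheta (fun i => -(s i / τ)) (-1 / τ) := by
    rw [lineTheta, lineTheta, ← (Equiv.neg _).tsum_eq]
    refine tsum_congr fun x => ?_
    simp [mulVec_neg, bE_neg_left, bE_neg_right]
  rw [hneg, lineTheta, lineTheta, (hasSum_lineTheta _ hτ').tsum_eq, (hasSum_lineTheta _ hτ).tsum_eq]
  simp only [Fintype.sum_bool, prod_charTheta_inversion _ _ s hτ]
  have he : eC ((∑ i, s i ^ 2) / (2 * τ)) * eC (-(∑ i, s i ^ 2) / (2 * τ)) = 1 := by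
    rw [← eC_add, ← add_div, add_neg_cancel, zero_div, eC_zero]
  have h4 : τ ^ 4 * (1 / τ ^ 4) = 1 := by field_simp
  have h : τ ^ 4 * (1 / τ ^ 4) * (eC ((∑ i, s i ^ 2) / (2 * τ)) *
      eC (-(∑ i, s i ^ 2) / (2 * τ))) = 1 := by rw [h4, he, one_mul]
  generalize eC ((∑ i, s i ^ 2) / (2 * τ)) = a at *
  generalize eC (-(∑ i, s i ^ 2) / (2 * τ)) = b at *
  linear_combination -(1 / 2 *
    (∏ i, charTheta true true (-(s i / τ)) (-1 / τ) + ∏ i, charTheta true false (-(s i / τ)) (-1 / τ) +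
      ∏ i, charTheta false true (-(s i / τ)) (-1 / τ) +
      ∏ i, charTheta false false (-(s i / τ)) (-1 / τ))) * h

/-- The pairing of a lattice vector with a complex vector. -/
def wE (x : Fin 8 → ℤ) (c : Fin 8 → ℂ) : ℂ := ∑ i, ((basisE *ᵥ x) i : ℂ) * c i / 2

lemma wE_add (x : Fin 8 → ℤ) (c d : Fin 8 → ℂ) : wE x (c + d) = wE x c + wE x d := by
  simp only [wE, ← Finset.sum_add_distrib, Pi.add_apply]
  exact Finset.sum_congr rfl fun i _ => by ring

lemma wE_smul (x : Fin 8 → ℤ) (a : ℂ) (c : Fin 8 → ℂ) : wE x (a • c) = a * wE x c := by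
  simp only [wE, Finset.mul_sum, Pi.smul_apply, smul_eq_mul]
  exact Finset.sum_congr rfl fun i _ => by ring

lemma exists_norm_wE_le (c : Fin 8 → ℂ) {ε : ℝ} (hε : 0 < ε) :
    ∃ K, 0 ≤ K ∧ ∀ x, ‖wE x c‖ ≤ ε * bE x x + K := by
  refine ⟨∑ i, ‖c i‖ ^ 2 / (4 * ε), by positivity, fun x => ?_⟩
  have : ε * bE x x = ∑ i, ε * (1 / 4) * ((basisE *ᵥ x) i : ℝ) ^ 2 := by
    rw [bE_self_eq, ← Finset.mul_sum, mul_assoc]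
  rw [this, ← Finset.sum_add_distrib]
  refine norm_sum_le_of_le _ fun i _ => ?_
  rw [norm_div, norm_mul, Complex.norm_intCast, Complex.norm_ofNat, ← sub_nonneg]
  have h := sq_nonneg (ε * |((basisE *ᵥ x) i : ℝ)| - ‖c i‖)
  have : ε * (1 / 4) * ((basisE *ᵥ x) i : ℝ) ^ 2 + ‖c i‖ ^ 2 / (4 * ε) -
      |((basisE *ᵥ x) i : ℝ)| * ‖c i‖ / 2 = (ε * |((basisE *ᵥ x) i : ℝ)| - ‖c i‖) ^ 2 / (4 * ε) := by
    field_simp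
    rw [← sq_abs ((basisE *ᵥ x) i : ℝ)]
    ring
  rw [this]
  positivity

/-- The theta series of the `E₈` lattice with a polynomial coefficient. -/
def polyTheta (ν : ℕ) (c s : Fin 8 → ℂ) (τ : ℂ) : ℂ :=
  ∑' x : Fin 8 → ℤ, wE x c ^ ν * eC (bE x x * τ / 2 + wE x s)

lemma exists_norm_polyTheta_term_le (ν : ℕ) (c s : Fin 8 → ℂ) {τ : ℂ} (hτ : 0 < τ.im) :
    ∃ δ > 0, ∃ u : (Fin 8 → ℤ) → ℝ, Summable u ∧ ∀ x, ∀ ξ : ℂ, ‖ξ‖ < δ →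
      ‖wE x c ^ ν * eC (bE x x * τ / 2 + wE x (s + ξ • c))‖ ≤ u x := by
  obtain ⟨K, hK, hs⟩ := exists_norm_wE_le s (ε := τ.im / 8) (by positivity)
  obtain ⟨L, hL, hc⟩ := exists_norm_wE_le c (ε := 1) one_pos
  obtain ⟨C, hC, hexp⟩ := pow_mul_exp_le ν (T := 2 * Real.pi * (τ.im / 4)) (by positivity)
  refine ⟨τ.im / 8, by positivity, fun x => (1 + L) ^ ν * Real.exp (2 * Real.pi * (K + τ.im / 8 * L)) *
    (C * Real.exp (-(2 * Real.pi * (τ.im / 4) / 2) * bE x x)),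
    ((summable_exp_bE (by positivity)).mul_left _).mul_left _, fun x ξ hξ => ?_⟩
  have hb := bE_self_nonneg x
  have h1 : ‖wE x c‖ ≤ (1 + L) * (1 + bE x x) := (hc x).trans (by nlinarith)
  have h2 : (1 + (bE x x : ℝ)) ^ ν * Real.exp (-(2 * Real.pi * (τ.im / 4)) * bE x x) ≤ _ :=
    hexp _ hb
  have h3 : ‖wE x (s + ξ • c)‖ ≤ τ.im / 8 * bE x x + K + τ.im / 8 * (1 * bE x x + L) := by
    rw [wE_add, wE_smul]
    refine (norm_add_le _ _).trans (add_le_add (hs x) ?_)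
    rw [norm_mul]
    exact mul_le_mul hξ.le (hc x) (norm_nonneg _) (by positivity)
  have h4 := (Complex.abs_im_le_norm (wE x (s + ξ • c))).trans h3
  rw [abs_le] at h4
  rw [norm_mul, norm_pow, norm_eC]
  calc ‖wE x c‖ ^ ν * Real.exp (-2 * Real.pi * (bE x x * τ / 2 + wE x (s + ξ • c)).im)
      ≤ ((1 + L) * (1 + bE x x)) ^ ν * Real.exp (2 * Real.pi * (K + τ.im / 8 * L) +
          -(2 * Real.pi * (τ.im / 4)) * bE x x) := by
        refine mul_le_mul (pow_le_pow_left₀ (norm_nonneg _) h1 _) (Real.exp_le_exp.2 ?_)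
          (Real.exp_pos _).le (by positivity)
        have : ((bE x x : ℂ) * τ / 2 + wE x (s + ξ • c)).im =
            bE x x * τ.im / 2 + (wE x (s + ξ • c)).im := by
          rw [Complex.add_im, show (bE x x : ℂ) * τ / 2 = ((bE x x / 2 : ℝ) : ℂ) * τ by
            push_cast; ring, Complex.im_ofReal_mul]
          ring
        rw [this]
        nlinarith [Real.pi_pos, h4.1]
    _ = (1 + L) ^ ν * Real.exp (2 * Real.pi * (K + τ.im / 8 * L)) *
        ((1 + (bE x x : ℝ)) ^ ν * Real.exp (-(2 * Real.pi * (τ.im / 4)) * bE x x)) := by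
        rw [Real.exp_add, mul_pow]; ring
    _ ≤ _ := mul_le_mul_of_nonneg_left h2 (by positivity)

lemma hasDerivAt_polyTheta (ν : ℕ) (c s : Fin 8 → ℂ) {τ : ℂ} (hτ : 0 < τ.im) :
    HasDerivAt (fun ξ : ℂ => polyTheta ν c (s + ξ • c) τ)
      (2 * Real.pi * Complex.I * polyTheta (ν + 1) c s τ) 0 := by
  obtain ⟨δ, hδ, u, hu, hu'⟩ := exists_norm_polyTheta_term_le ν c s hτ
  obtain ⟨δ', hδ', u', hv, hv'⟩ := exists_norm_polyTheta_term_le (ν + 1) c s hτ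
  have key : ∀ (x : Fin 8 → ℤ) (ξ : ℂ), HasDerivAt
      (fun ξ => wE x c ^ ν * eC (bE x x * τ / 2 + wE x (s + ξ • c)))
      (2 * Real.pi * Complex.I * (wE x c ^ (ν + 1) * eC (bE x x * τ / 2 + wE x (s + ξ • c)))) ξ := by
    intro x ξ
    simp only [wE_add, wE_smul, eC]
    have h : HasDerivAt (fun ξ : ℂ => 2 * Real.pi * Complex.I *
        (bE x x * τ / 2 + (wE x s + ξ * wE x c))) (2 * Real.pi * Complex.I * (1 * wE x c)) ξ :=
      ((((hasDerivAt_id ξ).mul_const (wE x c)).const_add _).const_add _).const_mul _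
    exact (h.cexp.const_mul (wE x c ^ ν)).congr_deriv (by ring)
  have := hasDerivAt_tsum_of_isPreconnected (hv.mul_left ‖2 * Real.pi * Complex.I‖)
    (Metric.isOpen_ball (x := (0 : ℂ)) (ε := δ')) (convex_ball _ _).isPreconnected
    (fun x ξ _ => key x ξ)
    (fun x ξ hξ => by
      rw [norm_mul]
      exact mul_le_mul_of_nonneg_left (hv' x ξ (by simpa using hξ)) (norm_nonneg _))
    (Metric.mem_ball_self hδ')
    (Summable.of_norm_bounded hu fun x => hu' x 0 (by simpa using hδ))
    (Metric.mem_ball_self hδ')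
  rw [tsum_mul_left] at this
  simp only [zero_smul, add_zero] at this
  exact this

lemma polyTheta_inversion (ν : ℕ) {c : Fin 8 → ℂ} (hc : ∑ i, c i ^ 2 = 0) {τ : ℂ} (hτ : 0 < τ.im)
    {s : Fin 8 → ℂ} (hs : ∑ i, s i * c i = 0) :
    polyTheta ν c (fun i => s i / τ) (-1 / τ) = τ ^ (4 + ν) * eC ((∑ i, s i ^ 2) / (2 * τ)) *
      polyTheta ν c s τ := by
  have h0 : τ ≠ 0 := by rintro rfl; simp at hτ
  have hτ' : 0 < (-1 / τ).im := by
    rw [neg_div, Complex.neg_im, one_div, Complex.inv_im, neg_div, neg_neg]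
    exact div_pos hτ (Complex.normSq_pos.2 h0)
  induction ν generalizing s with
  | zero => simpa [polyTheta, lineTheta, wE] using lineTheta_inversion s hτ
  | succ ν ih =>
    have hl : HasDerivAt (fun ξ : ℂ => polyTheta ν c ((fun i => s i / τ) + (ξ / τ) • c) (-1 / τ))
        (2 * Real.pi * Complex.I * polyTheta (ν + 1) c (fun i => s i / τ) (-1 / τ) * (1 / τ)) 0 := by
      have h := hasDerivAt_polyTheta ν c (fun i => s i / τ) hτ'
      rw [← zero_div τ] at h
      exact HasDerivAt.comp (0 : ℂ) h ((hasDerivAt_id (0 : ℂ)).div_const τ)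
    have hr := (hasDerivAt_polyTheta ν c s hτ).const_mul
      (τ ^ (4 + ν) * eC ((∑ i, s i ^ 2) / (2 * τ)))
    have heq : (fun ξ : ℂ => polyTheta ν c ((fun i => s i / τ) + (ξ / τ) • c) (-1 / τ)) = fun ξ : ℂ =>
        τ ^ (4 + ν) * eC ((∑ i, s i ^ 2) / (2 * τ)) * polyTheta ν c (s + ξ • c) τ := by
      funext ξ
      have h1 : ∑ i, (s + ξ • c) i ^ 2 = ∑ i, s i ^ 2 := by
        have : ∀ i, (s + ξ • c) i ^ 2 = s i ^ 2 + 2 * ξ * (s i * c i) + ξ ^ 2 * c i ^ 2 :=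
          fun i => by simp; ring
        simp only [this, Finset.sum_add_distrib, ← Finset.mul_sum, hc, hs]
        ring
      have h2 : ∑ i, (s + ξ • c) i * c i = 0 := by
        have : ∀ i, (s + ξ • c) i * c i = s i * c i + ξ * c i ^ 2 := fun i => by simp; ring
        simp only [this, Finset.sum_add_distrib, ← Finset.mul_sum, hc, hs]
        ring
      rw [← h1, ← ih h2]
      congr 1
      funext i
      simp
      ring
    rw [heq] at hl
    have := hl.unique hr
    have hpi : (2 * Real.pi * Complex.I : ℂ) ≠ 0 := by simp
    field_simp at this
    rw [neg_div, this]
    ring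

lemma transpose_mk (t u v w : ℂ) : (!![t, u; v, w])ᵀ = !![t, v; u, w] := by
  ext i j; fin_cases i <;> fin_cases j <;> rfl

lemma transpose_mem_HH2 {t u v w : ℂ} (h : !![t, u; v, w] ∈ HH2) : !![t, v; u, w] ∈ HH2 := by
  rw [mk_mem_HH2] at h ⊢
  refine ⟨h.1, h.2.1, ?_⟩
  rw [← Complex.normSq_conj, map_sub, Complex.conj_conj, ← Complex.normSq_neg, neg_sub]
  exact h.2.2

lemma IsHMF.transpose {k : ℕ} {F : Matrix (Fin 2) (Fin 2) ℂ → ℂ} (hF : IsHMF 7 k F) :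
    IsHMF 7 k fun τ => F τᵀ := by
  refine isHMF_of_generators ?_ ?_ ?_ ?_ ?_
  · have hm : ∀ τ ∈ HH2, τᵀ ∈ HH2 := fun τ h => by
      rw [eta_fin_two τ] at h ⊢
      rw [transpose_mk]
      exact transpose_mem_HH2 h
    exact hF.1.comp (LinearMap.toContinuousLinearMap
      (transposeLinearEquiv (Fin 2) (Fin 2) ℂ ℂ).toLinearMap).differentiable.differentiableOn hm
  all_goals simp only [transpose_mk]
  · intro a d s hs t u v w h
    have := hF.2 _ (inSU_genT a (conj_mem_ringInts hs) d) _ (transpose_mem_HH2 h)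
    have h1 := (genT_act a ((starRingEnd ℂ) s) d t v u w).2
    rw [denomM] at h1
    rw [(genT_act _ _ _ _ _ _ _).1, h1, one_pow, one_mul, Complex.conj_conj] at this
    exact this
  · intro m hm t u v w h
    have := hF.2 _ (inSU_genE (conj_mem_ringInts hm)) _ (transpose_mem_HH2 h)
    have h1 := (genE_act ((starRingEnd ℂ) m) t v u w).2
    rw [denomM] at h1
    rw [(genE_act _ _ _ _ _).1, h1, one_pow, one_mul, Complex.conj_conj] at this
    rw [← this]
    congr 1
    ext i j; fin_cases i <;> fin_cases j <;> simp <;> ring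
  · intro t u v w h
    have := hF.2 _ inSU_genW _ (transpose_mem_HH2 h)
    have h1 := (genW_act t v u w).2
    rw [denomM] at h1
    rwa [(genW_act _ _ _ _).1, h1, one_pow, one_mul] at this
  · intro t u v w h
    have ht := im_pos_ne_zero (mk_mem_HH2.mp h).1
    have := hF.2 _ inSU_genJ _ (transpose_mem_HH2 h)
    have h1 := (genJ_act ht v u w).2
    rw [denomM] at h1
    rwa [(genJ_act ht _ _ _).1, h1, mul_comm v u] at this

lemma IsHMF.symmetrize {k : ℕ} {F : Matrix (Fin 2) (Fin 2) ℂ → ℂ} (hF : IsHMF 7 k F) :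
    IsSymHMF 7 k fun τ => F τ + (-1) ^ k * F τᵀ := isHMF_symmetrize hF hF.transpose

/-- The vectors representing the linear forms `rhoE`. -/
def rVec (j : Bool) : Fin 8 → ℂ :=
  bif j then ![-1, 2 * omg 7 - 1, 1, 1, -1, 1, -1, -1] else ![2 * omg 7 - 1, 1, 1, 1, 1, 1, 1, 1]

lemma wE_rVec (j : Bool) (x : Fin 8 → ℤ) : wE x (rVec j) = rhoE j x := by
  cases j <;> simp [wE, rVec, rhoE, basisE, mulVec, dotProduct, Fin.sum_univ_eight] <;> ring

lemma sum_rVec_mul (i j : Bool) : ∑ k, rVec i k * rVec j k = 0 := by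
  have h := omg_sq
  cases i <;> cases j <;> simp [rVec, Fin.sum_univ_eight] <;>
    first | ring1 | linear_combination 4 * h

/-- The isotropic vector attached to a lattice vector. -/
def cVec (y : Fin 8 → ℤ) : Fin 8 → ℂ := rhoE true y • rVec false + (-rhoE false y) • rVec true

lemma wE_cVec (x y : Fin 8 → ℤ) : wE x (cVec y) = pE x y := by
  rw [cVec, wE_add, wE_smul, wE_smul, wE_rVec, wE_rVec, pE]; ring

lemma sum_cVec_sq (y : Fin 8 → ℤ) : ∑ i, cVec y i ^ 2 = 0 := by
  have : ∀ i, cVec y i ^ 2 = rhoE true y ^ 2 * (rVec false i * rVec false i) +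
      (-2 * rhoE true y * rhoE false y) * (rVec false i * rVec true i) +
      rhoE false y ^ 2 * (rVec true i * rVec true i) := fun i => by simp [cVec]; ring
  simp only [this, Finset.sum_add_distrib, ← Finset.mul_sum, sum_rVec_mul]
  ring

/-- The vector with `wE x (sVec u v y) = u * hE x y + v * conj (hE x y)`. -/
def sVec (u v : ℂ) (y : Fin 8 → ℤ) : Fin 8 → ℂ := fun i =>
  (v - (1 - omg 7) * ((u - v) / (2 * omg 7 - 1))) * ((basisE *ᵥ y) i / 2) +
    (u - v) / (2 * omg 7 - 1) * ((basisE *ᵥ (mulOmg *ᵥ y)) i / 2)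

lemma sum_basisE_mul (x y : Fin 8 → ℤ) :
    ∑ i, ((basisE *ᵥ x) i : ℂ) * (basisE *ᵥ y) i = 4 * bE x y := by
  have := congrArg (fun n : ℤ => (n : ℂ)) (four_bE x y)
  simp only [dotProduct] at this
  push_cast at this
  exact this.symm

lemma wE_sVec (u v : ℂ) (x y : Fin 8 → ℤ) :
    wE x (sVec u v y) = u * hE x y + v * (starRingEnd ℂ) (hE x y) := by
  have h1 := hE_add_conj x y
  have h2 : ∀ i, ((basisE *ᵥ x) i : ℂ) * sVec u v y i / 2 =
      (v - (1 - omg 7) * ((u - v) / (2 * omg 7 - 1))) / 4 *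
        (((basisE *ᵥ x) i : ℂ) * (basisE *ᵥ y) i) +
      (u - v) / (2 * omg 7 - 1) / 4 *
        (((basisE *ᵥ x) i : ℂ) * (basisE *ᵥ (mulOmg *ᵥ y)) i) := fun i => by
    rw [sVec]; ring
  rw [wE, Finset.sum_congr rfl fun i _ => h2 i, Finset.sum_add_distrib, ← Finset.mul_sum,
    ← Finset.mul_sum, sum_basisE_mul, sum_basisE_mul, ← sub_eq_of_eq_add' h1.symm, hE]
  have h0 := two_omg_sub_one_ne
  field_simp
  ring

lemma sum_sVec_mul_cVec (u v : ℂ) (y : Fin 8 → ℤ) : ∑ i, sVec u v y i * cVec y i = 0 := by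
  have h2 : ∀ i, sVec u v y i * cVec y i =
      (v - (1 - omg 7) * ((u - v) / (2 * omg 7 - 1))) *
        (((basisE *ᵥ y) i : ℂ) * cVec y i / 2) +
      (u - v) / (2 * omg 7 - 1) *
        (((basisE *ᵥ (mulOmg *ᵥ y)) i : ℂ) * cVec y i / 2) := fun i => by
    rw [sVec]; ring
  rw [Finset.sum_congr rfl fun i _ => h2 i, Finset.sum_add_distrib, ← Finset.mul_sum,
    ← Finset.mul_sum, ← wE, ← wE, wE_cVec, wE_cVec, pE, pE, rhoE_mulOmg, rhoE_mulOmg]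
  ring

lemma sum_sVec_sq (u v : ℂ) (y : Fin 8 → ℤ) : ∑ i, sVec u v y i ^ 2 = bE y y * (u * v) := by
  obtain ⟨β, hβ⟩ : ∃ β, β = (u - v) / (2 * omg 7 - 1) := ⟨_, rfl⟩
  have hu : u = v + β * (2 * omg 7 - 1) := by
    rw [hβ, div_mul_cancel₀ _ two_omg_sub_one_ne]; ring
  have h2 : ∀ i, sVec u v y i ^ 2 =
      (v - (1 - omg 7) * β) ^ 2 / 4 * (((basisE *ᵥ y) i : ℂ) * (basisE *ᵥ y) i) +
      (v - (1 - omg 7) * β) * β / 2 * (((basisE *ᵥ y) i : ℂ) * (basisE *ᵥ (mulOmg *ᵥ y)) i) +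
      β ^ 2 / 4 * (((basisE *ᵥ (mulOmg *ᵥ y)) i : ℂ) * (basisE *ᵥ (mulOmg *ᵥ y)) i) := fun i => by
    rw [sVec, ← hβ]; ring
  have h3 : (2 * bE y (mulOmg *ᵥ y) : ℂ) = bE y y := by exact_mod_cast bE_self_mulOmg y
  rw [Finset.sum_congr rfl fun i _ => h2 i, Finset.sum_add_distrib, Finset.sum_add_distrib,
    ← Finset.mul_sum, ← Finset.mul_sum, ← Finset.mul_sum, sum_basisE_mul, sum_basisE_mul,
    sum_basisE_mul, bE_mulOmg_mulOmg, hu]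
  push_cast
  linear_combination (v - (1 - omg 7) * β) * β * h3 + bE y y * β ^ 2 * omg_sq

lemma thetaE_eq_tsum (ν : ℕ) {t u v w : ℂ} (h : !![t, u; v, w] ∈ HH2) : thetaE ν !![t, u; v, w] =
    ∑' y, eC (bE y y * w / 2) * polyTheta ν (cVec y) (sVec u v y) t := by
  have hs := summable_thetaE ν h
  rw [thetaE, ← (Equiv.prodComm _ _).tsum_eq]
  rw [← (Equiv.prodComm (Fin 8 → ℤ) (Fin 8 → ℤ)).summable_iff] at hs
  refine (hs.tsum_prod).trans (tsum_congr fun y => ?_)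
  rw [polyTheta, ← tsum_mul_left]
  refine tsum_congr fun x => ?_
  simp only [Function.comp, Equiv.prodComm_apply, Prod.fst_swap, Prod.snd_swap, wE_cVec, wE_sVec]
  rw [mul_left_comm, ← eC_add]
  congr 2
  rw [qE, hE_self, hE_self]
  simp
  ring

lemma thetaE_inversion (ν : ℕ) {t u v w : ℂ} (h : !![t, u; v, w] ∈ HH2) :
    thetaE ν !![-1 / t, u / t; v / t, w - u * v / t] = t ^ (4 + ν) * thetaE ν !![t, u; v, w] := by
  have ht := (mk_mem_HH2.mp h).1
  have ht0 := im_pos_ne_zero ht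
  have h' := moebius_mem inSU_genJ h
  rw [(genJ_act ht0 _ _ _).1] at h'
  rw [thetaE_eq_tsum ν h, thetaE_eq_tsum ν h', ← tsum_mul_left]
  refine tsum_congr fun y => ?_
  have : sVec (u / t) (v / t) y = fun i => sVec u v y i / t := by
    funext i; simp only [sVec]; ring
  rw [this, polyTheta_inversion ν (sum_cVec_sq y) ht (sum_sVec_mul_cVec u v y), sum_sVec_sq]
  have : eC (bE y y * (w - u * v / t) / 2) * eC (bE y y * (u * v) / (2 * t)) =
      eC (bE y y * w / 2) := by
    rw [← eC_add]; congr 1; field_simp; ring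
  linear_combination t ^ (4 + ν) * polyTheta ν (cVec y) (sVec u v y) t * this

theorem isHMF_thetaE (ν : ℕ) : IsHMF 7 (4 + ν) (thetaE ν) :=
  isHMF_of_generators (differentiableOn_thetaE ν)
    (fun _ _ _ hs _ _ _ _ _ => thetaE_translate ν hs)
    (fun _ hm _ _ _ _ _ => thetaE_shear ν hm)
    (fun _ _ _ _ _ => thetaE_swap ν _ _ _ _)
    (fun _ _ _ _ h => thetaE_inversion ν h)

lemma symMonos_zero_span {p : UpperHalfPlane → UpperHalfPlane → ℂ}
    (hp : p ∈ Submodule.span ℂ (symMonos 0)) : ∃ c, ∀ t w, p t w = c := by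
  induction hp using Submodule.span_induction with
  | mem f hf =>
    obtain ⟨a, b, c, h, rfl⟩ := hf
    obtain ⟨rfl, rfl, rfl⟩ : a = 0 ∧ b = 0 ∧ c = 0 := by omega
    exact ⟨1, by simp⟩
  | zero => exact ⟨0, by simp⟩
  | add f g _ _ hf hg =>
    obtain ⟨c, hc⟩ := hf
    obtain ⟨d, hd⟩ := hg
    exact ⟨c + d, by simp [hc, hd]⟩
  | smul a f _ hf =>
    obtain ⟨c, hc⟩ := hf
    exact ⟨a * c, by simp [hc]⟩

/-- `G` is divisible by `z ^ m`. -/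
def FactorsZ (m : ℕ) (G : ℂ → ℂ → ℂ → ℂ) : Prop :=
  ∃ H, GoodH H ∧ ∀ t z w, dom3 t z w → G t z w = z ^ m * H t z w

lemma FactorsZ.add {m n : ℕ} {G : ℂ → ℂ → ℂ → ℂ} (hG : RestrLaws n G) (hGd : GoodH G) {l : ℕ}
    (h : FactorsZ m G)
    (hm : ∀ i, m ≤ i → i < m + l → ∀ a b c : ℕ,
      4 * (a : ℤ) + 6 * b + 12 * c ≠ (n + i : ℕ) - 12 * leadOrder i) : FactorsZ (m + l) G := by
  induction l with
  | zero => exact h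
  | succ l ih =>
    obtain ⟨H, hH, hGH⟩ := ih fun i h1 h2 => hm i h1 (by omega)
    obtain ⟨H', hH', h'⟩ := hH.exists_div fun t w ht hw =>
      lead_eq_zero (hm _ (by omega) (by omega)) hG hGd hH hGH ht hw
    exact ⟨H', hH', fun t z w h => by rw [hGH t z w h, h' t z w h]; ring⟩

/-- The leading coefficient along `z = 0` of a nonzero form of small weight whose restriction
to `z = 0` is cuspidal. -/
theorem discriminant_mem_leads_of_cusp {A : Subalgebra ℂ (ℂ → ℂ → ℂ → ℂ)} {n m : ℕ}
    (hnm : n + m = 12) (hm : m ∈ ({1, 2, 4} : Finset ℕ)) {G : ℂ → ℂ → ℂ → ℂ} (hGA : G ∈ A)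
    (hG : RestrLaws n G) (hGd : GoodH G)
    (hcusp : (fun t w : UpperHalfPlane =>
      G t 0 w / (ModularForm.discriminant t * ModularForm.discriminant w) ^ 1) ∈
        Submodule.span ℂ (symMonos ((n : ℤ) - 12 * (1 : ℕ))))
    {t z w : ℂ} (hd : dom3 t z w) (hne : G t z w ≠ 0) :
    (fun t w => ModularForm.discriminant t * ModularForm.discriminant w) ∈ leads A n m := by
  have h1 : FactorsZ 1 G := by
    obtain ⟨H, hH, h⟩ := hGd.exists_div fun t w ht hw => by
      rw [symMonos_eq_empty (by intro a b c; simp at hm; omega), Submodule.span_empty,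
        Submodule.mem_bot] at hcusp
      have := congrFun (congrFun hcusp ⟨t, ht⟩) ⟨w, hw⟩
      simpa [ModularForm.discriminant_ne_zero] using this
    exact ⟨H, hH, by simpa using h⟩
  obtain ⟨H, hH, hGH⟩ : FactorsZ m G := by
    obtain ⟨l, rfl⟩ : ∃ l, m = 1 + l := ⟨m - 1, by simp at hm; omega⟩
    refine h1.add hG hGd fun i h1 h2 a b c => ?_
    unfold leadOrder
    simp at hm
    split_ifs <;> omega
  have hlead := lead_mem_span hG hGd hH hGH
  have hlo : leadOrder m = 1 := by
    simp at hm
    unfold leadOrder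
    split_ifs <;> omega
  rw [hlo, hnm] at hlead
  obtain ⟨c, hc⟩ := symMonos_zero_span (by simpa using hlead)
  have hHc : ∀ t w : UpperHalfPlane,
      H t 0 w = c * (ModularForm.discriminant t * ModularForm.discriminant w) := fun t w => by
    rw [← hc t w]
    field_simp [ModularForm.discriminant_ne_zero]
  have hc0 : c ≠ 0 := by
    rintro rfl
    obtain ⟨H', hH', h'⟩ := hH.exists_div fun t w ht hw => by simpa using hHc ⟨t, ht⟩ ⟨w, hw⟩
    have hF : FactorsZ (m + 1) G :=
      ⟨H', hH', fun t z w h => by rw [hGH t z w h, h' t z w h]; ring⟩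
    obtain ⟨H'', hH'', h''⟩ := hF.add (l := n) hG hGd fun i h1 h2 a b c => by
      unfold leadOrder
      simp at hm
      obtain ⟨rfl, rfl⟩ | ⟨rfl, rfl⟩ | ⟨rfl, rfl⟩ :
          m = 1 ∧ n = 11 ∨ m = 2 ∧ n = 10 ∨ m = 4 ∧ n = 8 := by omega
      all_goals interval_cases i <;> norm_num <;> omega
    exact hne (eq_zero_of_high_order (by omega) hG hGd hH'' h'' hd)
  have := (leads A n m).smul_mem c⁻¹ (x := fun t w : UpperHalfPlane => H t 0 w)
    ⟨G, H, hGA, hG, hGd, hH, hGH, fun _ _ => rfl⟩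
  convert this using 1
  ext t w
  simp [hHc, hc0]

/-- The restriction to `z = 0` of a form of weight 12 with cuspidal restriction. -/
theorem discriminant_mem_leads_zero {A : Subalgebra ℂ (ℂ → ℂ → ℂ → ℂ)}
    {G : ℂ → ℂ → ℂ → ℂ} (hGA : G ∈ A) (hG : RestrLaws 12 G) (hGd : GoodH G)
    (hcusp : (fun t w : UpperHalfPlane =>
      G t 0 w / (ModularForm.discriminant t * ModularForm.discriminant w) ^ 1) ∈
        Submodule.span ℂ (symMonos ((12 : ℕ) - 12 * (1 : ℕ))))
    {t w : ℂ} (ht : 0 < t.im) (hw : 0 < w.im) (hne : G t 0 w ≠ 0) :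
    (fun t w => ModularForm.discriminant t * ModularForm.discriminant w) ∈ leads A 12 0 := by
  obtain ⟨c, hc⟩ := symMonos_zero_span (by simpa using hcusp)
  have hGc : ∀ t w : UpperHalfPlane,
      G t 0 w = c * (ModularForm.discriminant t * ModularForm.discriminant w) := fun t w => by
    rw [← hc t w]
    field_simp [ModularForm.discriminant_ne_zero]
  have hc0 : c ≠ 0 := by
    rintro rfl
    exact hne (by simpa using hGc ⟨t, ht⟩ ⟨w, hw⟩)
  have := (leads A 12 0).smul_mem c⁻¹ (x := fun t w : UpperHalfPlane => G t 0 w)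
    ⟨G, G, hGA, hG, hGd, hGd, by simp, fun _ _ => rfl⟩
  convert this using 1
  ext t w
  simp [hGc, hc0]

/-- A form whose weight admits a single monomial has that monomial as restriction to `z = 0`. -/
theorem mem_leads_of_unique {A : Subalgebra ℂ (ℂ → ℂ → ℂ → ℂ)} {k : ℕ}
    {p : UpperHalfPlane → UpperHalfPlane → ℂ} (hp : symMonos k ⊆ {p})
    {G : ℂ → ℂ → ℂ → ℂ} (hGA : G ∈ A) (hG : RestrLaws k G) (hGd : GoodH G)
    {t w : ℂ} (ht : 0 < t.im) (hw : 0 < w.im) (hne : G t 0 w ≠ 0) : p ∈ leads A k 0 := by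
  have hlead := lead_mem_span (m := 0) hG hGd hGd (by simp)
  have h1 : (fun t w : UpperHalfPlane => G t 0 w) ∈ Submodule.span ℂ (symMonos (k : ℤ)) := by
    simpa [leadOrder] using hlead
  obtain ⟨c, hc⟩ := Submodule.mem_span_singleton.mp (Submodule.span_mono hp h1)
  have hc0 : c ≠ 0 := by
    rintro rfl
    exact hne (by simpa using (congrFun (congrFun hc ⟨t, ht⟩) ⟨w, hw⟩).symm)
  have := (leads A k 0).smul_mem c⁻¹ (x := fun t w : UpperHalfPlane => G t 0 w)
    ⟨G, G, hGA, hG, hGd, hGd, by simp, fun _ _ => rfl⟩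
  rwa [← hc, smul_smul, inv_mul_cancel₀ hc0, one_smul] at this

lemma two_le_bE_self {x : Fin 8 → ℤ} (hx : x ≠ 0) : 2 ≤ bE x x := by
  have h0 : 0 ≤ bE x x := by exact_mod_cast bE_self_nonneg x
  have h1 : bE x x ≠ 0 := fun h => hx (eq_zero_of_bE_self h)
  have := bE_self x
  omega

lemma two_le_of_pE_ne_zero {x y : Fin 8 → ℤ} (h : pE x y ≠ 0) : 2 ≤ bE x x ∧ 2 ≤ bE y y := by
  refine ⟨two_le_bE_self ?_, two_le_bE_self ?_⟩ <;> rintro rfl <;> exact h (by simp [pE, rhoE])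

/-- The symmetrized theta form. -/
def symThetaE (ν : ℕ) (τ : Matrix (Fin 2) (Fin 2) ℂ) : ℂ :=
  thetaE ν τ + (-1) ^ (4 + ν) * thetaE ν τᵀ

lemma isSymHMF_symThetaE (ν : ℕ) : IsSymHMF 7 (4 + ν) (symThetaE ν) :=
  (isHMF_thetaE ν).symmetrize

lemma norm_thetaE_le {ν : ℕ} (hν : ν ≠ 0) {t : ℂ} (ht : 0 < t.im) : ∃ M : ℝ, ∀ w : ℂ, 2 ≤ w.im →
    ‖thetaE ν !![t, 0; 0, w]‖ ≤ M * Real.exp (-2 * Real.pi * w.im) := by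
  have hmem : ∀ {w : ℂ}, 0 < w.im → !![t, 0; 0, w] ∈ HH2 := fun hw => by
    simpa using restr_mem.mpr (dom3_zero ht hw)
  have hs := (summable_thetaE ν (hmem (w := Complex.I) (by simp))).norm
  refine ⟨Real.exp (2 * Real.pi) * ∑' p : (Fin 8 → ℤ) × (Fin 8 → ℤ),
    ‖pE p.1 p.2 ^ ν * eC (qE p.1 p.2 !![t, 0; 0, Complex.I])‖, fun w hw => ?_⟩
  rw [mul_right_comm, ← tsum_mul_left]
  refine tsum_of_norm_bounded (hs.mul_left _).hasSum fun p => ?_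
  by_cases hp : pE p.1 p.2 = 0
  · simp [hp, hν]
  have h2 : (2 : ℝ) ≤ bE p.2 p.2 := by exact_mod_cast (two_le_of_pE_ne_zero hp).2
  rw [norm_mul, norm_mul, norm_eC, norm_eC, mul_left_comm, ← Real.exp_add, ← Real.exp_add, im_qE,
    im_qE]
  refine mul_le_mul_of_nonneg_left (Real.exp_le_exp.mpr ?_) (norm_nonneg _)
  simp
  nlinarith [mul_nonneg Real.pi_pos.le (mul_nonneg (sub_nonneg.mpr h2)
    (show (0 : ℝ) ≤ w.im - 1 by linarith))]

lemma restr_symThetaE_zero (ν : ℕ) (t w : ℂ) :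
    restr (symThetaE ν) t 0 w = (1 + (-1) ^ (4 + ν)) * thetaE ν !![t, 0; 0, w] := by
  rw [restr, symThetaE, transpose_mk]
  simp only [mul_zero]
  ring

lemma thetaE_transpose_diag (ν : ℕ) (t u v : ℂ) :
    thetaE ν !![t, v; u, t] = (-1) ^ ν * thetaE ν !![t, u; v, t] := by
  rw [thetaE, thetaE, ← tsum_mul_left, ← (Equiv.prodComm _ _).tsum_eq]
  refine tsum_congr fun p => ?_
  simp only [Equiv.prodComm_apply, Prod.fst_swap, Prod.snd_swap]
  rw [← mul_assoc, ← mul_pow, show pE p.2 p.1 = -1 * pE p.1 p.2 by simp only [pE]; ring]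
  congr 2
  simp only [qE, of_apply, cons_val', cons_val_zero, cons_val_one, cons_val_fin_one]
  rw [conj_hE, conj_hE]
  ring

lemma restr_symThetaE_diag (ν : ℕ) (t z : ℂ) : restr (symThetaE ν) t z t =
    2 * thetaE ν !![t, (starRingEnd ℂ) (omg 7) * z; omg 7 * z, t] := by
  rw [restr, symThetaE, transpose_mk, thetaE_transpose_diag ν t ((starRingEnd ℂ) (omg 7) * z),
    ← mul_assoc, ← pow_add, Even.neg_one_pow ⟨2 + ν, by ring⟩]
  ring

lemma symThetaE_cusp {ν : ℕ} (hν : ν ≠ 0) : (fun t w : UpperHalfPlane =>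
    restr (symThetaE ν) t 0 w / (ModularForm.discriminant t * ModularForm.discriminant w) ^ 1) ∈
      Submodule.span ℂ (symMonos ((4 + ν : ℕ) - 12 * (1 : ℕ))) := by
  have hb := isBimodular_of_factor (m := 0) (isSymHMF_symThetaE ν).restrLaws
    (goodH_restr (isSymHMF_symThetaE ν).1.1) (by simp)
  refine hb.mem_span fun t ht => ?_
  obtain ⟨M, hM⟩ := norm_thetaE_le hν ht
  refine ⟨‖(1 + (-1) ^ (4 + ν) : ℂ)‖ * M, fun w hw => ?_⟩
  rw [restr_symThetaE_zero, norm_mul, mul_assoc]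
  exact mul_le_mul_of_nonneg_left (by simpa using hM w hw) (norm_nonneg _)

lemma qE_diag (x y : Fin 8 → ℤ) (t z : ℂ) :
    qE x y !![t, (starRingEnd ℂ) (omg 7) * z; omg 7 * z, t] =
      (bE x x + bE y y) * t / 2 + bE (mulOmg *ᵥ x) y * z := by
  have h := hE_add_conj (mulOmg *ᵥ x) y
  have h1 : hE (mulOmg *ᵥ x) y = (starRingEnd ℂ) (omg 7) * hE x y := by
    rw [← conj_hE, hE_mulOmg_right, map_mul, conj_hE]
  rw [h1, map_mul, Complex.conj_conj] at h
  simp only [qE, of_apply, cons_val', cons_val_zero, cons_val_one, cons_val_fin_one, hE_self]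
  rw [← h]
  ring

/-- The leading term of the theta series on the diagonal. -/
lemma tendsto_thetaE {ν : ℕ} {c : ℤ}
    (hc : ∀ x y, pE x y ^ ν ≠ 0 → c ≤ bE x x + bE y y) (s : ℝ) :
    Tendsto (fun T : ℝ => (Real.exp (Real.pi * c * T) : ℂ) * thetaE ν
      !![T * Complex.I, (starRingEnd ℂ) (omg 7) * s; omg 7 * s, T * Complex.I]) atTop
      (𝓝 (∑' p : (Fin 8 → ℤ) × (Fin 8 → ℤ), if bE p.1 p.1 + bE p.2 p.2 = c then
        pE p.1 p.2 ^ ν * eC (bE (mulOmg *ᵥ p.1) p.2 * s) else 0)) := by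
  have hmem : !![(Complex.I : ℂ), (starRingEnd ℂ) (omg 7) * s; omg 7 * s, Complex.I] ∈ HH2 :=
    restr_mem.mpr (by simp [dom3])
  have hs := (summable_thetaE ν hmem).norm.mul_left (Real.exp (Real.pi * c))
  have hn : ∀ (p : (Fin 8 → ℤ) × (Fin 8 → ℤ)) (T : ℝ), (Real.exp (Real.pi * c * T) : ℂ) *
      (pE p.1 p.2 ^ ν * eC (qE p.1 p.2
        !![T * Complex.I, (starRingEnd ℂ) (omg 7) * s; omg 7 * s, T * Complex.I])) =
      Real.exp (-(Real.pi * (bE p.1 p.1 + bE p.2 p.2 - c) * T)) *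
        (pE p.1 p.2 ^ ν * eC (bE (mulOmg *ᵥ p.1) p.2 * s)) := fun p T => by
    rw [qE_diag, eC_add]
    suffices h : (Real.exp (Real.pi * c * T) : ℂ) * eC ((bE p.1 p.1 + bE p.2 p.2) *
        (T * Complex.I) / 2) = Real.exp (-(Real.pi * (bE p.1 p.1 + bE p.2 p.2 - c) * T)) by
      rw [← h]
      ring
    rw [eC, Complex.ofReal_exp, Complex.ofReal_exp, ← Complex.exp_add]
    congr 1
    push_cast
    linear_combination (Real.pi * (bE p.1 p.1 + bE p.2 p.2) * T : ℂ) * Complex.I_sq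
  have hnorm : ∀ (p : (Fin 8 → ℤ) × (Fin 8 → ℤ)) (T : ℝ), ‖(Real.exp (Real.pi * c * T) : ℂ) *
      (pE p.1 p.2 ^ ν * eC (qE p.1 p.2
        !![T * Complex.I, (starRingEnd ℂ) (omg 7) * s; omg 7 * s, T * Complex.I]))‖ =
      Real.exp (-(Real.pi * (bE p.1 p.1 + bE p.2 p.2 - c) * T)) * ‖pE p.1 p.2 ^ ν‖ := fun p T => by
    rw [hn, norm_mul, norm_mul, norm_eC, Complex.norm_real, Real.norm_eq_abs, Real.abs_exp]
    simp
  simp only [thetaE, ← tsum_mul_left]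
  refine tendsto_tsum_of_dominated_convergence hs (fun p => ?_) ?_
  · simp only [hn]
    split_ifs with h
    · have : (bE p.1 p.1 + bE p.2 p.2 - c : ℝ) = 0 := by rw [← h]; push_cast; ring
      simp [this]
    · by_cases hp : pE p.1 p.2 ^ ν = 0
      · simp [hp]
      have hlt : (0 : ℝ) < bE p.1 p.1 + bE p.2 p.2 - c := by
        have : c < bE p.1 p.1 + bE p.2 p.2 := lt_of_le_of_ne (hc _ _ hp) (Ne.symm h)
        have : (c : ℝ) < ((bE p.1 p.1 + bE p.2 p.2 : ℤ) : ℝ) := by exact_mod_cast this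
        push_cast at this
        linarith
      have h1 : Tendsto (fun T : ℝ => Real.exp (-(Real.pi * (bE p.1 p.1 + bE p.2 p.2 - c) * T)))
          atTop (𝓝 0) :=
        Real.tendsto_exp_neg_atTop_nhds_zero.comp
          (tendsto_id.const_mul_atTop (mul_pos Real.pi_pos hlt))
      have h2 := (Complex.continuous_ofReal.tendsto 0).comp h1
      simpa using h2.mul_const (pE p.1 p.2 ^ ν * eC (bE (mulOmg *ᵥ p.1) p.2 * s))
  · filter_upwards [eventually_ge_atTop 1] with T hT p
    have h1 := hnorm p 1
    rw [norm_mul, Complex.norm_real, Real.norm_eq_abs, Real.abs_exp] at h1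
    simp only [mul_one, Complex.ofReal_one, one_mul] at h1
    rw [hnorm, h1]
    by_cases hp : pE p.1 p.2 ^ ν = 0
    · simp [hp]
    refine mul_le_mul_of_nonneg_right (Real.exp_le_exp.mpr ?_) (norm_nonneg _)
    have : (c : ℝ) ≤ ((bE p.1 p.1 + bE p.2 p.2 : ℤ) : ℝ) := by exact_mod_cast hc _ _ hp
    push_cast at this
    nlinarith [mul_nonneg Real.pi_pos.le (mul_nonneg (sub_nonneg.mpr this) (sub_nonneg.mpr hT))]

/-- The lists of length `n` with entries in `s`. -/
def tuples (s : List ℤ) : ℕ → List (List ℤ)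
  | 0 => [[]]
  | n + 1 => s.flatMap fun a => (tuples s n).map (a :: ·)

lemma mem_tuples {s : List ℤ} {n : ℕ} {l : List ℤ} :
    l ∈ tuples s n ↔ l.length = n ∧ ∀ a ∈ l, a ∈ s := by
  induction n generalizing l with
  | zero =>
    simp only [tuples, List.mem_singleton, List.length_eq_zero_iff]
    exact ⟨fun h => by simp [h], fun h => h.1⟩
  | succ n ih =>
    simp only [tuples, List.mem_flatMap, List.mem_map, ih]
    constructor
    · rintro ⟨a, ha, l, ⟨rfl, hl⟩, rfl⟩
      simpa [ha] using hl
    · rintro ⟨h1, h2⟩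
      obtain _ | ⟨a, l⟩ := l
      · simp at h1
      · exact ⟨a, h2 a (by simp), l, ⟨by simpa using h1, fun b hb => h2 b (by simp [hb])⟩, rfl⟩

/-- The lists of length `n` with entries in `{-2, 0, 2}` and `r` nonzero entries. -/
def sparse : ℕ → ℕ → List (List ℤ)
  | 0, 0 => [[]]
  | 0, _ + 1 => []
  | n + 1, 0 => (sparse n 0).map (0 :: ·)
  | n + 1, r + 1 => (sparse n r).map (-2 :: ·) ++
      ((sparse n (r + 1)).map (0 :: ·) ++ (sparse n r).map (2 :: ·))

lemma mem_sparse {l : List ℤ} (hl : ∀ a ∈ l, a = -2 ∨ a = 0 ∨ a = 2) {r : ℕ}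
    (h : (l.map fun a => a * a).sum = 4 * r) : l ∈ sparse l.length r := by
  induction l generalizing r with
  | nil =>
    obtain rfl : r = 0 := by simpa using h
    simp [sparse]
  | cons a l ih =>
    have ih := fun r => @ih (fun b hb => hl b (by simp [hb])) r
    simp only [List.map_cons, List.sum_cons] at h
    have hnn : 0 ≤ (l.map fun a => a * a).sum := List.sum_nonneg (by simp [mul_self_nonneg])
    obtain rfl | rfl | rfl := hl a (by simp) <;> obtain _ | r := r <;>
      simp only [sparse, List.length_cons, List.mem_append, List.mem_map, List.cons.injEq] <;>
      push_cast at h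
    · omega
    · exact Or.inl ⟨l, ih r (by omega), by simp⟩
    · exact ⟨l, ih 0 (by simpa using h), by simp⟩
    · exact Or.inr (Or.inl ⟨l, ih (r + 1) (by push_cast; omega), by simp⟩)
    · omega
    · exact Or.inr (Or.inr ⟨l, ih r (by omega), by simp⟩)

/-- The images under `basisE` of the roots of the `E₈` lattice. -/
def rootVecs : List (List ℤ) :=
  ((tuples [-1, 1] 8).filter fun l => l.sum % 4 = 0) ++
    sparse 8 2

/-- The inverse of `basisE`. -/
def coordE : List ℤ → Fin 8 → ℤ
  | [a, b, c, d, e, f, g, h] => ![a, (b - a) / 2, (c - a) / 2, (d - a) / 2, (e - a) / 2,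
      (f - a) / 2, (g - a) / 2, (b + c + d + e + f + g + h - 7 * a) / 4]
  | _ => 0

/-- The roots of the `E₈` lattice. -/
def roots : List (Fin 8 → ℤ) := rootVecs.map coordE

lemma basisE_coordE : ∀ l ∈ rootVecs, List.ofFn (basisE *ᵥ coordE l) = l := by decide +kernel

/-- A base 5 encoding of the elements of `rootVecs`. -/
def codeE (l : List ℤ) : ℤ :=
  l.foldl (fun s a => 5 * s + a) 0 + if (l.headD 0) % 2 = 0 then 5 ^ 9 else 0

lemma isChain_codeE : (rootVecs.map codeE).IsChain (· < ·) := by decide +kernel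

lemma nodup_roots : roots.Nodup := by
  have h : rootVecs.Nodup := List.Nodup.of_map codeE
    ((List.isChain_iff_pairwise.mp isChain_codeE).imp ne_of_lt)
  refine h.map_on fun l hl m hm e => ?_
  rw [← basisE_coordE l hl, ← basisE_coordE m hm, e]

lemma sum_basisE (x : Fin 8 → ℤ) : ∑ i, (basisE *ᵥ x) i = 8 * x 0 + 4 * x 7 := by
  simp [basisE, mulVec, dotProduct, Fin.sum_univ_eight]; ring

lemma ofFn_basisE_mem {x : Fin 8 → ℤ} (hx : bE x x = 2) : List.ofFn (basisE *ᵥ x) ∈ rootVecs := by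
  have h4 : ∑ i, (basisE *ᵥ x) i ^ 2 = 8 := by
    have := four_bE x x
    rw [hx, dotProduct] at this
    simp only [pow_two]
    exact this.symm
  have hc := classE_spec x
  have hs := sum_basisE x
  obtain ⟨v, hv⟩ : ∃ v, v = basisE *ᵥ x := ⟨_, rfl⟩
  obtain ⟨m, hm⟩ : ∃ m, m = (classE x).1 := ⟨_, rfl⟩
  rw [← hv] at h4 hc hs ⊢
  rw [← hm] at hc
  rw [rootVecs, List.mem_append, List.mem_filter, mem_tuples]
  simp only [List.length_ofFn, List.mem_ofFn, decide_eq_true_eq, List.sum_ofFn, true_and,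
    forall_exists_index, forall_apply_eq_imp_iff]
  cases h : (classE x).2 <;> rw [h] at hc <;> simp only [cond_true, cond_false] at hc
  · have hl : (List.ofFn v).length = 8 := List.length_ofFn
    have key := mem_sparse (l := List.ofFn v) (r := 2) (fun a ha => ?_) ?_
    · rw [hl] at key
      exact Or.inr key
    swap
    · rw [List.map_ofFn, List.sum_ofFn]
      simp only [Function.comp_apply, ← pow_two]
      rw [h4]
      rfl
    obtain ⟨i, rfl⟩ := List.mem_ofFn.mp ha
    have h2 : ∑ i, m i ^ 2 = 2 := by
      have : ∑ i, v i ^ 2 = 4 * ∑ i, m i ^ 2 := by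
        rw [Finset.mul_sum]
        exact Finset.sum_congr rfl fun i _ => by rw [← hc i]; ring
      omega
    have h3 : m i ^ 2 ≤ 2 := h2 ▸ Finset.single_le_sum (f := fun i => m i ^ 2)
      (fun j _ => sq_nonneg _) (Finset.mem_univ i)
    have h5 : m i < 2 := by nlinarith
    have h6 : -2 < m i := by nlinarith
    have := hc i
    omega
  · refine Or.inl ⟨fun i => ?_, by omega⟩
    have hone : ∀ j, 0 ≤ v j ^ 2 - 1 := fun j => by
      have : v j ≠ 0 := by have := hc j; omega
      have := sq_pos_of_ne_zero this
      omega
    have h3 : v i ^ 2 - 1 ≤ ∑ j, (v j ^ 2 - 1) := Finset.single_le_sum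
      (f := fun i => v i ^ 2 - 1) (fun j _ => hone j) (Finset.mem_univ i)
    rw [Finset.sum_sub_distrib, h4] at h3
    simp only [Finset.sum_const, Finset.card_univ, Fintype.card_fin, nsmul_eq_mul] at h3
    push_cast at h3
    have h5 : v i < 2 := by nlinarith
    have h6 : -2 < v i := by nlinarith
    simp only [List.mem_cons, List.not_mem_nil, or_false]
    have := hc i
    omega

lemma mem_roots {x : Fin 8 → ℤ} : x ∈ roots ↔ bE x x = 2 := by
  constructor
  · intro hx
    obtain ⟨l, hl, rfl⟩ := List.mem_map.mp hx
    have h8 : ∀ l ∈ rootVecs, (l.map fun a => a * a).sum = 8 := by decide +kernel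
    have h := h8 l hl
    rw [← basisE_coordE l hl, List.map_ofFn, List.sum_ofFn] at h
    have h4 := four_bE (coordE l) (coordE l)
    rw [dotProduct] at h4
    simp only [Function.comp_apply] at h
    omega
  · intro hx
    have h := ofFn_basisE_mem hx
    refine List.mem_map.mpr ⟨_, h, ?_⟩
    exact basisE_injective (List.ofFn_injective (basisE_coordE _ h))

/-- For each root of the `E₈` lattice: the reductions of its two coordinates `rhoE` modulo a prime
above 11, and the reductions modulo 4 of the functional `bE (mulOmg *ᵥ x)` and of the
coordinates of `x`, written in base 256. -/
def rootTable : List (ℕ × ℕ × ℕ × ℕ) :=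
  [(3, 7, 3, 216172782113783808), (5, 5, 282574488339200, 216172782113784065),
    (5, 7, 1099528601600, 216172782113849345), (5, 7, 144398870682599680, 216172782113849601),
    (5, 5, 144962924425970176, 216172782130561025), (5, 5, 4295033600, 216172782130561281),
    (5, 7, 844429241876480, 216172782130626561), (7, 5, 1103823373057, 216172782130626818),
    (5, 7, 281487878389760, 216172786408751105), (5, 7, 144679241852780800, 216172786408751361),
    (5, 9, 144397766892782080, 216172786408816641),
    (7, 7, 144680341381120257, 216172786408816898), (5, 7, 3298551726080, 216172786425528321),
    (7, 5, 281474993554177, 216172786425528578), (7, 7, 33554433, 216172786425593858),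
    (7, 7, 144397771187814657, 216172786425594114),
    (5, 7, 144959621646451456, 216173881625411585), (5, 7, 1099562024960, 216173881625411841),
    (5, 9, 845524441760000, 216173881625477121), (7, 7, 2199023255553, 216173881625477378),
    (5, 7, 144681449499394816, 216173881642188801),
    (7, 5, 144959625941221889, 216173881642189058),
    (7, 7, 144678150914376449, 216173881642254338), (7, 7, 845528736792577, 216173881642254594),
    (5, 9, 12884967680, 216173885920378881), (7, 7, 282587373305857, 216173885920379138),
    (7, 9, 1112413307137, 216173885920444418), (7, 9, 144398866387698177, 216173885920444674),
    (7, 7, 144962920130806529, 216173885937156098), (7, 7, 131073, 216173885937156354),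
    (7, 9, 844424946974977, 216173885937221634), (9, 7, 1099528470530, 216173885937221891),
    (5, 4, 144118499546104576, 216454257090494465), (5, 4, 281479322009600, 216454257090494721),
    (5, 6, 4295164160, 216454257090560001), (7, 4, 282578783502337, 216454257090560258),
    (5, 4, 144961812079772416, 216454257107271681),
    (7, 2, 144118486661267969, 216454257107271938),
    (7, 4, 144962911541003009, 216454257107337218), (7, 4, 8589934593, 216454257107337474),
    (5, 6, 284773511594240, 216454261385461761), (7, 4, 562949953421313, 216454261385462018),
    (7, 6, 281474993684737, 216454261385527298), (7, 6, 144679246147682817, 216454261385527554),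
    (7, 4, 144117399984210689, 216454261402238978), (7, 4, 284777806626817, 216454261402239234),
    (7, 6, 3302846628097, 216454261402304514), (9, 4, 281479288455170, 216454261402304771),
    (5, 6, 144962924459524096, 216455356602122241),
    (7, 4, 144115200994509569, 216455356602122498),
    (7, 6, 144959625941352449, 216455356602187778), (7, 6, 1103856926977, 216455356602188034),
    (7, 4, 565157600297473, 216455356618899458), (7, 4, 144962911574426369, 216455356618899714),
    (7, 6, 144681436614688769, 216455356618964994),
    (9, 4, 144959613056516866, 216455356618965251),
    (7, 6, 144118495251202049, 216455360897089538), (7, 6, 281475027108097, 216455360897089794),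
    (7, 8, 513, 216455360897155074), (9, 6, 282574488338690, 216455360897155331),
    (7, 6, 144961824964476929, 216455360913866754),
    (9, 4, 144118499545973506, 216455360913867011),
    (9, 6, 144962924425969666, 216455360913932291), (9, 6, 4295033090, 216455360913932547),
    (2, 5, 12885099266, 72905330438374145), (2, 5, 144397766859227138, 72905330438373377),
    (2, 7, 144116291899228418, 72905330438177537), (4, 5, 144398866387566595, 72905330438176770),
    (2, 5, 847723465016066, 72905330388042497), (4, 3, 515, 72905330388041730),
    (4, 5, 844424947106563, 72905330387845890), (4, 5, 144116296194260995, 72905330387845122),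
    (2, 7, 144396663069409538, 72905317553472257), (4, 5, 144679237557747715, 72905317553471490),
    (4, 7, 144397762597748995, 72905317553275650), (4, 7, 565157600297475, 72905317553274882),
    (4, 5, 3311436563203, 72905317503140610), (4, 5, 144396667364442115, 72905317503139842),
    (4, 7, 144115192404443395, 72905317502944002), (6, 5, 144397766892781568, 72905317502943235),
    (2, 7, 844437865365506, 72902031903490817), (4, 5, 1112446862083, 72902031903490050),
    (4, 7, 845537326858243, 72902031903294210), (4, 7, 144117391394144515, 72902031903293442),
    (4, 5, 144681445204623875, 72902031853159170), (4, 5, 844424980529923, 72902031853158402),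
    (4, 7, 562949953421315, 72902031852962562), (6, 5, 845524441760512, 72902031852961795),
    (4, 7, 8589934595, 72902019018588930), (4, 7, 144397762564325635, 72902019018588162),
    (4, 9, 144116287604326915, 72902019018392322), (6, 7, 144398862092665088, 72902019018391555),
    (4, 7, 847736349982723, 72902018968257282), (6, 5, 12884968192, 72902018968256515),
    (6, 7, 844437831811072, 72902018968060675), (6, 7, 144116291899359488, 72902018968059907),
    (2, 4, 3298585411586, 72060905508242177), (4, 2, 281475027239683, 72060905508241410),
    (4, 4, 131075, 72060905508045570), (4, 4, 144397771154129155, 72060905508044802),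
    (4, 2, 144961824964608515, 72060905457910530), (4, 2, 3302880183043, 72060905457909762),
    (4, 4, 847727760179203, 72060905457713922), (6, 2, 4295164672, 72060905457713155),
    (4, 4, 284786396692483, 72060892623340290), (4, 4, 144678142324310275, 72060892623339522),
    (4, 6, 144396667364311555, 72060892623143682), (6, 4, 144679241852649728, 72060892623142915),
    (4, 4, 2199023255555, 72060892573008642), (6, 2, 284773511594752, 72060892573007875),
    (6, 4, 3298551857152, 72060892572812035), (6, 4, 144396671659344128, 72060892572811267),
    (4, 4, 144962920164492035, 72057606973358850), (4, 4, 33554435, 72057606973358082),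
    (4, 6, 844424980660483, 72057606973162242), (6, 4, 1099562156032, 72057606973161475),
    (4, 4, 144680349971186435, 72057606923027202), (6, 2, 144962924459524608, 72057606923026435),
    (6, 4, 144681449499525888, 72057606922830595), (6, 4, 844429275430912, 72057606922829827),
    (4, 6, 3311470117123, 72057594088456962), (6, 4, 281487911944192, 72057594088456195),
    (6, 6, 12885098752, 72057594088260355), (6, 6, 144397766859227648, 72057594088259587),
    (6, 4, 144961820669707008, 72057594038125315), (6, 4, 3298585280512, 72057594038124547),
    (6, 6, 847723465015552, 72057594037928707), (8, 4, 1, 72057594037927936),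
    (1, 3, 1099528470529, 144116291899293955), (1, 0, 281479288455169, 144396667364376835),
    (1, 0, 144959613056516865, 144397762581037315), (1, 2, 282574488338689, 144397766859227395),
    (1, 0, 144118499545973505, 144397766875939075),
    (1, 2, 144962924425969665, 144397766876004355), (1, 2, 4295033089, 144397766876004611),
    (3, 0, 144115200960955138, 144397766876004608), (3, 0, 282578783371266, 144397766876004864),
    (3, 2, 1103823372546, 144397766876070144), (3, 0, 144962911540871938, 144397766892781824),
    (3, 2, 281474993553666, 144397771170971904), (3, 2, 144959625941221378, 144398866387632384),
    (3, 10, 144118486661267458, 144679241852715264), (9, 1, 144397766892781571, 847723465015299),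
    (9, 1, 845524441760515, 844437815033859), (9, 3, 144398862092665091, 844424980463619),
    (9, 1, 12884968195, 844424930328579), (9, 3, 844437831811075, 844424930132739),
    (9, 3, 144116291899359491, 844424930131971), (0, 1, 1112413307648, 844424930131968),
    (0, 1, 144398866387697664, 844424930132224), (0, 3, 144117391427698944, 844424930197504),
    (0, 1, 844424946975488, 844424946909184), (0, 3, 144397762597880064, 844429225099264),
    (0, 3, 845537326727168, 845524441759744), (9, 9, 4295164675, 3311419785219),
    (9, 0, 144679241852649731, 3298585214979), (9, 9, 284773511594755, 3298535079939),
    (9, 0, 3298551857155, 3298534884099), (9, 0, 144396671659344131, 3298534883331),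
    (0, 9, 281474993685248, 3298534883328), (0, 9, 144679246147682304, 3298534883584),
    (0, 0, 144397771187683584, 3298534948864), (0, 9, 3302846628608, 3298551660544),
    (0, 0, 144678142357864704, 3302829850624), (9, 0, 1099562156035, 12935233539),
    (9, 9, 144962924459524611, 12885098499), (9, 0, 144681449499525891, 12884902659),
    (9, 0, 844429275430915, 12884901891), (0, 9, 144959625941352960, 12884901888),
    (0, 9, 1103856927488, 12884902144), (0, 0, 845528736923648, 12884967424),
    (0, 9, 144681436614689280, 12901679104), (9, 0, 281487911944195, 50528259),
    (9, 2, 12885098755, 50332419), (9, 2, 144397766859227651, 50331651),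
    (0, 0, 282587373436928, 50331648), (0, 0, 144680341347565824, 50331904),
    (0, 2, 144398866387567104, 50397184), (9, 0, 144961820669707011, 197379),
    (9, 0, 3298585280515, 196611), (0, 9, 144118495251202560, 196608),
    (0, 9, 281475027108608, 196864), (9, 2, 847723465015555, 771),
    (0, 0, 144962920130937600, 768), (0, 0, 144397771154260224, 256),
    (2, 9, 282574488339201, 257), (0, 2, 844424947106048, 66304),
    (0, 2, 144116296194261504, 65536), (2, 0, 1099528601601, 65537),
    (2, 0, 144398870682599681, 65793), (0, 9, 144961824964477440, 16973824),
    (0, 0, 144680349937632000, 16777984), (0, 0, 847727760048128, 16777216),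
    (2, 9, 144962924425970177, 16777217), (2, 9, 4295033601, 16777473),
    (2, 0, 844429241876481, 16842753), (0, 2, 144679237557748224, 4345298944),
    (0, 0, 284786396561408, 4295163904), (0, 2, 3311436562688, 4294968064),
    (0, 2, 144396667364442624, 4294967296), (2, 0, 281487878389761, 4294967297),
    (2, 0, 144679241852780801, 4294967553), (2, 2, 144397766892782081, 4295032833),
    (2, 0, 3298551726081, 4311744513), (0, 0, 144678150947930880, 1112396529664),
    (0, 2, 1112446861568, 1099561959424), (0, 0, 144962920164360960, 1099511824384),
    (0, 2, 144681445204623360, 1099511628544), (0, 2, 844424980529408, 1099511627776),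
    (2, 0, 144959621646451457, 1099511627777), (2, 0, 1099562024961, 1099511628033),
    (2, 2, 845524441760001, 1099511693313), (2, 0, 144681449499394817, 1099528404993),
    (2, 2, 12884967681, 1103806595073), (0, 8, 284777806757888, 284773511593984),
    (0, 8, 144962911574557440, 281487861612544), (0, 10, 281475027239168, 281475027042304),
    (0, 8, 144117400017765120, 281474976907264), (0, 10, 144961824964608000, 281474976711424),
    (0, 10, 3302880182528, 281474976710656), (2, 8, 144118499546104577, 281474976710657),
    (2, 8, 281479322009601, 281474976710913), (2, 10, 4295164161, 281474976776193),
    (2, 8, 144961812079772417, 281474993487873), (2, 10, 284773511594241, 281479271677953),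
    (2, 10, 144962924459524097, 282574488338433), (8, 1, 144116287604326402, 144681449499591424),
    (8, 9, 144396667364311042, 144961824964674304), (8, 9, 844424980660994, 144962920181334784),
    (8, 0, 144397762564194562, 144962924459524864), (8, 9, 3311470117634, 144962924476236544),
    (8, 0, 847736350113794, 144962924476301824), (8, 0, 144115192370888962, 144962924476302080),
    (10, 9, 12885099267, 144962924476302081), (10, 9, 144397766859227139, 144962924476301313),
    (10, 0, 144116291899228419, 144962924476105473), (10, 9, 847723465016067, 144962924425970433),
    (10, 0, 144396663069409539, 144962911591400193), (10, 0, 844437865365507, 144959625941418753),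
    (10, 8, 3298585411587, 144118499546170113)]

/-- The entry of `rootTable` belonging to a vector. -/
def rootData (x : Fin 8 → ℤ) : ℕ × ℕ × ℕ × ℕ :=
  (((8 * x 0 + 2 * x 7) % 11).toNat,
    ((4 * x 0 + 10 * x 1 + 2 * (x 2 + x 3 + x 5 - x 7)) % 11).toNat,
    ∑ j : Fin 8, (bE (mulOmg *ᵥ x) (Pi.single j 1) % 4).toNat * 256 ^ (j : ℕ),
    ∑ j : Fin 8, (x j % 4).toNat * 256 ^ (7 - (j : ℕ)))

lemma map_rootData_roots : roots.map rootData = rootTable := by decide +kernel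

/-- The sum of the values of a function on a list. -/
def listSum (f : ℕ × ℕ × ℕ × ℕ → ℕ) (l : List (ℕ × ℕ × ℕ × ℕ)) : ℕ :=
  l.foldr (fun a s => Nat.add (f a) s) 0

/-- The contribution of a pair of roots. -/
def pairTerm (ν m r : ℕ) (x y : ℕ × ℕ × ℕ × ℕ) : ℕ :=
  bif Nat.beq (Nat.mod (Nat.mod (Nat.div (Nat.mul x.2.2.1 y.2.2.2) (256 ^ 7)) 4) m) r then
    Nat.pow (Nat.add (Nat.mul y.2.1 x.1) (Nat.mul 10 (Nat.mul y.1 x.2.1))) ν else 0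

/-- The sum of the contributions of all pairs of roots. -/
def pairSum (ν m r : ℕ) : ℕ := listSum (fun x => listSum (pairTerm ν m r x) rootTable) rootTable

set_option maxRecDepth 100000 in
lemma pairSum_four : Nat.mod (pairSum 4 4 1) 11 = 5 := by decide +kernel
set_option maxRecDepth 100000 in
lemma pairSum_six : Nat.mod (pairSum 6 4 1) 11 = 7 := by decide +kernel
set_option maxRecDepth 100000 in
lemma pairSum_seven : Nat.mod (pairSum 7 4 1) 11 = 8 := by decide +kernel
set_option maxRecDepth 100000 in
lemma pairSum_eight : Nat.mod (pairSum 8 1 0) 11 = 10 := by decide +kernel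

lemma kronecker_dot (g y : Fin 8 → ℕ) (hg : ∀ j, g j < 4) (hy : ∀ j, y j < 4) :
    (∑ j : Fin 8, g j * 256 ^ (j : ℕ)) * (∑ j : Fin 8, y j * 256 ^ (7 - (j : ℕ))) / 256 ^ 7 % 4 =
      (∑ j, g j * y j) % 4 := by
  have hp : ∀ j k, g j * y k ≤ 9 := fun j k =>
    Nat.mul_le_mul (Nat.le_of_lt_succ (hg j)) (Nat.le_of_lt_succ (hy k))
  obtain ⟨L, hL⟩ : ∃ L, L =
    g 0 * y 1 * 256 ^ 6 + g 0 * y 2 * 256 ^ 5 + g 0 * y 3 * 256 ^ 4 + g 0 * y 4 * 256 ^ 3 +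
    g 0 * y 5 * 256 ^ 2 + g 0 * y 6 * 256 + g 0 * y 7 + g 1 * y 2 * 256 ^ 6 +
    g 1 * y 3 * 256 ^ 5 + g 1 * y 4 * 256 ^ 4 + g 1 * y 5 * 256 ^ 3 + g 1 * y 6 * 256 ^ 2 +
    g 1 * y 7 * 256 + g 2 * y 3 * 256 ^ 6 + g 2 * y 4 * 256 ^ 5 + g 2 * y 5 * 256 ^ 4 +
    g 2 * y 6 * 256 ^ 3 + g 2 * y 7 * 256 ^ 2 + g 3 * y 4 * 256 ^ 6 + g 3 * y 5 * 256 ^ 5 +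
    g 3 * y 6 * 256 ^ 4 + g 3 * y 7 * 256 ^ 3 + g 4 * y 5 * 256 ^ 6 + g 4 * y 6 * 256 ^ 5 +
    g 4 * y 7 * 256 ^ 4 + g 5 * y 6 * 256 ^ 6 + g 5 * y 7 * 256 ^ 5 + g 6 * y 7 * 256 ^ 6 := ⟨_, rfl⟩
  obtain ⟨U, hU⟩ : ∃ U, U =
    g 1 * y 0 + g 2 * y 0 * 256 + g 2 * y 1 + g 3 * y 0 * 256 ^ 2 + g 3 * y 1 * 256 +
    g 3 * y 2 + g 4 * y 0 * 256 ^ 3 + g 4 * y 1 * 256 ^ 2 + g 4 * y 2 * 256 + g 4 * y 3 +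
    g 5 * y 0 * 256 ^ 4 + g 5 * y 1 * 256 ^ 3 + g 5 * y 2 * 256 ^ 2 + g 5 * y 3 * 256 +
    g 5 * y 4 + g 6 * y 0 * 256 ^ 5 + g 6 * y 1 * 256 ^ 4 + g 6 * y 2 * 256 ^ 3 +
    g 6 * y 3 * 256 ^ 2 + g 6 * y 4 * 256 + g 6 * y 5 + g 7 * y 0 * 256 ^ 6 +
    g 7 * y 1 * 256 ^ 5 + g 7 * y 2 * 256 ^ 4 + g 7 * y 3 * 256 ^ 3 + g 7 * y 4 * 256 ^ 2 +
    g 7 * y 5 * 256 + g 7 * y 6 := ⟨_, rfl⟩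
  have h : (∑ j : Fin 8, g j * 256 ^ (j : ℕ)) * (∑ j : Fin 8, y j * 256 ^ (7 - (j : ℕ))) =
      L + 256 ^ 7 * ((∑ j, g j * y j) + 256 * U) := by
    rw [hL, hU]
    simp only [Fin.sum_univ_eight, Fin.coe_ofNat_eq_mod]
    norm_num only
    ring
  have hlt : L < 256 ^ 7 := by
    rw [hL]
    linarith [
      hp 0 1, hp 0 2, hp 0 3, hp 0 4, hp 0 5, hp 0 6, hp 0 7, hp 1 2, hp 1 3, hp 1 4, hp 1 5,
      hp 1 6, hp 1 7, hp 2 3, hp 2 4, hp 2 5, hp 2 6, hp 2 7, hp 3 4, hp 3 5, hp 3 6, hp 3 7,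
      hp 4 5, hp 4 6, hp 4 7, hp 5 6, hp 5 7, hp 6 7]
  rw [h, Nat.add_mul_div_left _ _ (by norm_num), Nat.div_eq_of_lt hlt]
  omega

lemma listSum_eq (f : ℕ × ℕ × ℕ × ℕ → ℕ) (l : List (ℕ × ℕ × ℕ × ℕ)) :
    listSum f l = (l.map f).sum := by
  induction l with
  | nil => rfl
  | cons a l ih => rw [List.map_cons, List.sum_cons, ← ih]; rfl

/-- The ring homomorphism to a commutative ring determined by the image of `omg 7`. -/
def quadHom {R : Type*} [CommRing R] (u : R) (hu : u * u = -2 + u) :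
    QuadraticAlgebra ℤ (-2) 1 →+* R :=
  (QuadraticAlgebra.lift ⟨u, by simpa using hu⟩ : QuadraticAlgebra ℤ (-2) 1 →ₐ[ℤ] R).toRingHom

lemma quadHom_apply {R : Type*} [CommRing R] (u : R) (hu : u * u = -2 + u)
    (z : QuadraticAlgebra ℤ (-2) 1) : quadHom u hu z = z.re + z.im * u := by
  simp [quadHom]

/-- The embedding of the ring of integers. -/
def quadC : QuadraticAlgebra ℤ (-2) 1 →+* ℂ :=
  quadHom (omg 7) (by linear_combination omg_sq)

/-- The reduction modulo a prime of norm 11. -/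
def quadZ : QuadraticAlgebra ℤ (-2) 1 →+* ZMod 11 := quadHom 5 (by decide)

lemma quadC_injective : Function.Injective quadC := by
  refine (injective_iff_map_eq_zero _).mpr fun z hz => ?_
  rw [quadC, quadHom_apply] at hz
  have h : z.im = 0 := by
    have := congrArg Complex.im hz
    simpa [omg] using this
  rw [h] at hz
  ext
  · simpa using hz
  · exact h

/-- The analogue of `pE` in the ring of integers. -/
def pQ (x y : Fin 8 → ℤ) : QuadraticAlgebra ℤ (-2) 1 :=
  ⟨-y 0 + 2 * (y 2 + y 3 + y 5 - y 7), y 0 + 2 * y 1⟩ * ⟨3 * x 0 + 2 * x 7, x 0⟩ -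
    ⟨3 * y 0 + 2 * y 7, y 0⟩ * ⟨-x 0 + 2 * (x 2 + x 3 + x 5 - x 7), x 0 + 2 * x 1⟩

lemma quadC_pQ (x y : Fin 8 → ℤ) : quadC (pQ x y) = pE x y := by
  simp only [pQ, quadC, map_sub, map_mul, quadHom_apply, pE, rhoE, cond_true, cond_false]
  push_cast
  ring

lemma quadZ_pQ (x y : Fin 8 → ℤ) : quadZ (pQ x y) =
    (((rootData y).2.1 * (rootData x).1 + 10 * ((rootData y).1 * (rootData x).2.1) : ℕ) : ZMod 11) := by
  have h : ∀ n : ℤ, (((n % 11).toNat : ℕ) : ZMod 11) = n := fun n => by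
    rw [← Int.cast_natCast, Int.toNat_of_nonneg (Int.emod_nonneg _ (by norm_num)),
      (ZMod.intCast_eq_intCast_iff _ _ 11).mpr (Int.mod_modEq n 11)]
  simp only [pQ, quadZ, map_sub, map_mul, quadHom_apply, rootData]
  push_cast
  rw [h, h, h, h]
  push_cast
  have h11 : (11 : ZMod 11) = 0 := by decide
  linear_combination (-(8 * y 0 + 2 * y 7) *
    (4 * x 0 + 10 * x 1 + 2 * (x 2 + x 3 + x 5 - x 7))) * h11

lemma dot_rootData (x y : Fin 8 → ℤ) :
    (((rootData x).2.2.1 * (rootData y).2.2.2 / 256 ^ 7 % 4 : ℕ) : ℤ) = bE (mulOmg *ᵥ x) y % 4 := by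
  have hlt : ∀ n : ℤ, (n % 4).toNat < 4 := fun n => by omega
  rw [rootData, rootData, kronecker_dot (fun j => (bE (mulOmg *ᵥ x) (Pi.single j 1) % 4).toNat)
    (fun j => (y j % 4).toNat) (fun j => hlt _) (fun j => hlt _)]
  have h : bE (mulOmg *ᵥ x) y = ∑ j, bE (mulOmg *ᵥ x) (Pi.single j 1) * y j := by
    simp only [bE, dotProduct_mulVec, dotProduct_single, mul_one]
    rfl
  rw [h]
  push_cast
  simp only [Int.toNat_of_nonneg (Int.emod_nonneg _ (by norm_num : (4 : ℤ) ≠ 0))]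
  rw [Finset.sum_int_mod]
  conv_rhs => rw [Finset.sum_int_mod]
  simp only [Int.mul_emod, Int.emod_emod]

lemma quadZ_term {ν m : ℕ} (hm : m ∣ 4) (r : ℕ) (x y : Fin 8 → ℤ) :
    ((pairTerm ν m r (rootData x) (rootData y) : ℕ) : ZMod 11) =
      if bE (mulOmg *ᵥ x) y % m = r then quadZ (pQ x y ^ ν) else 0 := by
  have h : Nat.beq (((rootData x).2.2.1 * (rootData y).2.2.2 / 256 ^ 7 % 4) % m) r =
      decide (bE (mulOmg *ᵥ x) y % m = r) := by
    rw [Bool.eq_iff_iff, Nat.beq_eq, decide_eq_true_eq, ← Int.natCast_inj, Int.natCast_mod, dot_rootData,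
      Int.emod_emod_of_dvd _ (by exact_mod_cast hm)]
  rw [pairTerm]
  change ((bif Nat.beq (((rootData x).2.2.1 * (rootData y).2.2.2 / 256 ^ 7 % 4) % m) r then
    ((rootData y).2.1 * (rootData x).1 + 10 * ((rootData y).1 * (rootData x).2.1)) ^ ν else 0 : ℕ) :
      ZMod 11) = _
  rw [h, map_pow, quadZ_pQ]
  split_ifs with h0 <;> simp [h0]

lemma sum_pE_ne_zero {ν m r v : ℕ} (hm : m ∣ 4) (h : Nat.mod (pairSum ν m r) 11 = v)
    (hv : 0 < v) : ∑ x ∈ roots.toFinset, ∑ y ∈ roots.toFinset,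
      (if bE (mulOmg *ᵥ x) y % m = r then pE x y ^ ν else 0) ≠ 0 := by
  intro h0
  have h1 : quadC (∑ x ∈ roots.toFinset, ∑ y ∈ roots.toFinset,
      (if bE (mulOmg *ᵥ x) y % m = r then pQ x y ^ ν else 0)) = 0 := by
    rw [← h0]
    simp only [map_sum, apply_ite quadC, map_pow, quadC_pQ, map_zero]
  have h2 := congrArg quadZ ((map_eq_zero_iff _ quadC_injective).mp h1)
  simp only [map_sum, apply_ite quadZ, map_zero, ← quadZ_term hm] at h2
  simp only [List.sum_toFinset _ nodup_roots] at h2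
  have h3 : ((pairSum ν m r : ℕ) : ZMod 11) = 0 := by
    rw [← h2]
    simp only [pairSum, listSum_eq, ← map_rootData_roots, List.map_map, Nat.cast_list_sum,
      Function.comp_def]
  have h4 := (ZMod.natCast_eq_zero_iff _ _).mp h3
  have h5 : pairSum ν m r % 11 = v := h
  omega

section

lemma eC_quarter (n : ℤ) : eC (n * (1 / 4)) = Complex.I ^ (n % 4).toNat := by
  obtain ⟨r, hr⟩ : ∃ r : ℕ, (r : ℤ) = n % 4 := ⟨_, Int.toNat_of_nonneg (Int.emod_nonneg _ (by norm_num))⟩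
  have hI : eC (1 / 4) = Complex.I := by
    rw [eC, show 2 * Real.pi * Complex.I * (1 / 4) = Real.pi / 2 * Complex.I by ring,
      Complex.exp_pi_div_two_mul_I]
  have h : (n : ℂ) = 4 * (n / 4 : ℤ) + r := by
    have := Int.mul_ediv_add_emod n 4
    rw [← hr] at this
    exact_mod_cast this.symm
  rw [h, ← hr, Int.toNat_natCast, ← hI, ← eC_nat_mul, show (4 * ((n / 4 : ℤ) : ℂ) + r) * (1 / 4) =
    (n / 4 : ℤ) + r * (1 / 4) by ring, eC_add, eC_int, one_mul]

/-- A discrete Fourier transform of order 4. -/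
lemma fourier_four (n : ℤ) : eC (n * 0) - Complex.I * eC (n * (1 / 4)) - eC (n * (2 / 4)) +
    Complex.I * eC (n * (3 / 4)) = if n % (4 : ℕ) = (1 : ℕ) then 4 else 0 := by
  have h (k : ℕ) (x : ℂ) (hx : x = k * (1 / 4)) : eC (n * x) = (Complex.I ^ (n % 4).toNat) ^ k := by
    rw [← eC_quarter, ← eC_nat_mul, hx]; congr 1; ring
  rw [h 0 0 (by norm_num), h 1 (1 / 4) (by norm_num), h 2 (2 / 4) (by norm_num),
    h 3 (3 / 4) (by norm_num)]
  have h0 : ((n % 4).toNat : ℤ) = n % 4 := Int.toNat_of_nonneg (Int.emod_nonneg _ (by norm_num))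
  obtain ⟨k, hk⟩ : ∃ k, k = (n % 4).toNat := ⟨_, rfl⟩
  have hk4 : k < 4 := by omega
  rw [← hk] at h0 ⊢
  push_cast
  rw [← h0]
  have hI := Complex.I_sq
  have hI3 : Complex.I ^ 3 = -Complex.I := by rw [pow_succ, hI]; ring
  interval_cases k <;> simp only [hI, hI3, pow_zero, pow_one] <;> norm_num
  linear_combination (1 - Complex.I ^ 2) * hI

attribute [local irreducible] roots

lemma tsum_roots {ν : ℕ} (hν : ν ≠ 0) (f : (Fin 8 → ℤ) × (Fin 8 → ℤ) → ℂ) :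
    (∑' p : (Fin 8 → ℤ) × (Fin 8 → ℤ), if bE p.1 p.1 + bE p.2 p.2 = 4 then
      pE p.1 p.2 ^ ν * f p else 0) =
      ∑ x ∈ roots.toFinset, ∑ y ∈ roots.toFinset, pE x y ^ ν * f (x, y) := by
  rw [tsum_eq_sum (s := roots.toFinset ×ˢ roots.toFinset) fun p hp => ?_, Finset.sum_product]
  · refine Finset.sum_congr rfl fun x hx => Finset.sum_congr rfl fun y hy => if_pos ?_
    rw [mem_roots.mp (List.mem_toFinset.mp hx), mem_roots.mp (List.mem_toFinset.mp hy)]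
    norm_num
  · refine ite_eq_right_iff.mpr fun h => ?_
    by_cases h0 : pE p.1 p.2 = 0
    · rw [h0, zero_pow hν, zero_mul]
    · obtain ⟨h1, h2⟩ := two_le_of_pE_ne_zero h0
      exact absurd (Finset.mem_product.mpr ⟨List.mem_toFinset.mpr (mem_roots.mpr (by omega)),
        List.mem_toFinset.mpr (mem_roots.mpr (by omega))⟩) hp

lemma exists_restr_symThetaE_ne {ν : ℕ} (hν : ν ≠ 0) (s : ℝ)
    (h : ∑ x ∈ roots.toFinset, ∑ y ∈ roots.toFinset, pE x y ^ ν * eC (bE (mulOmg *ᵥ x) y * s) ≠ 0) :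
    ∃ t : ℂ, 0 < t.im ∧ restr (symThetaE ν) t s t ≠ 0 := by
  by_contra! hc
  refine h ?_
  have hlim := tendsto_thetaE (ν := ν) (c := 4) (fun x y hxy => by
    have := two_le_of_pE_ne_zero (ne_zero_pow hν hxy)
    omega) s
  rw [tsum_roots hν (fun p => eC (bE (mulOmg *ᵥ p.1) p.2 * s))] at hlim
  refine tendsto_nhds_unique hlim (tendsto_const_nhds.congr' ?_)
  filter_upwards [eventually_gt_atTop 0] with T hT
  have := hc (T * Complex.I) (by simpa using hT)
  rw [restr_symThetaE_diag, mul_eq_zero, or_iff_right (by norm_num)] at this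
  rw [this, mul_zero]

lemma exists_restr_symThetaE_ne_of_sum {ν : ℕ} (hν : ν ≠ 0)
    (h : ∑ x ∈ roots.toFinset, ∑ y ∈ roots.toFinset,
      (if bE (mulOmg *ᵥ x) y % (4 : ℕ) = (1 : ℕ) then pE x y ^ ν else 0) ≠ 0) :
    ∃ t z : ℂ, dom3 t z t ∧ restr (symThetaE ν) t z t ≠ 0 := by
  by_contra! hc
  have h0 (s : ℝ) : ∑ x ∈ roots.toFinset, ∑ y ∈ roots.toFinset,
      pE x y ^ ν * eC (bE (mulOmg *ᵥ x) y * s) = 0 := by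
    by_contra hs
    obtain ⟨t, ht, hne⟩ := exists_restr_symThetaE_ne hν s hs
    exact hne (hc t s ⟨ht, ht, by simpa using mul_pos ht ht⟩)
  refine h ((mul_eq_zero.mp (?_ : (4 : ℂ) * _ = 0)).resolve_left (by norm_num))
  have e0 := h0 0
  have e1 := h0 (1 / 4)
  have e2 := h0 (2 / 4)
  have e3 := h0 (3 / 4)
  push_cast at e0 e1 e2 e3
  calc _ = ∑ x ∈ roots.toFinset, ∑ y ∈ roots.toFinset, pE x y ^ ν *
        (eC (bE (mulOmg *ᵥ x) y * 0) - Complex.I * eC (bE (mulOmg *ᵥ x) y * (1 / 4)) -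
          eC (bE (mulOmg *ᵥ x) y * (2 / 4)) + Complex.I * eC (bE (mulOmg *ᵥ x) y * (3 / 4))) := by
        rw [Finset.mul_sum]
        refine Finset.sum_congr rfl fun x _ => ?_
        rw [Finset.mul_sum]
        refine Finset.sum_congr rfl fun y _ => ?_
        rw [fourier_four]
        split_ifs <;> ring
    _ = (∑ x ∈ roots.toFinset, ∑ y ∈ roots.toFinset, pE x y ^ ν * eC (bE (mulOmg *ᵥ x) y * 0)) -
        Complex.I * (∑ x ∈ roots.toFinset, ∑ y ∈ roots.toFinset,
          pE x y ^ ν * eC (bE (mulOmg *ᵥ x) y * (1 / 4))) -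
        (∑ x ∈ roots.toFinset, ∑ y ∈ roots.toFinset,
          pE x y ^ ν * eC (bE (mulOmg *ᵥ x) y * (2 / 4))) +
        Complex.I * (∑ x ∈ roots.toFinset, ∑ y ∈ roots.toFinset,
          pE x y ^ ν * eC (bE (mulOmg *ᵥ x) y * (3 / 4))) := by
        simp only [Finset.mul_sum, ← Finset.sum_sub_distrib, ← Finset.sum_add_distrib]
        exact Finset.sum_congr rfl fun x _ => Finset.sum_congr rfl fun y _ => by ring
    _ = 0 := by rw [e0, e1, e2, e3]; ring

lemma exists_restr_symThetaE_four_ne :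
    ∃ t z : ℂ, dom3 t z t ∧ restr (symThetaE 4) t z t ≠ 0 :=
  exists_restr_symThetaE_ne_of_sum (by norm_num)
    (sum_pE_ne_zero (by norm_num) pairSum_four (by norm_num))

lemma exists_restr_symThetaE_six_ne :
    ∃ t z : ℂ, dom3 t z t ∧ restr (symThetaE 6) t z t ≠ 0 :=
  exists_restr_symThetaE_ne_of_sum (by norm_num)
    (sum_pE_ne_zero (by norm_num) pairSum_six (by norm_num))

lemma exists_restr_symThetaE_seven_ne :
    ∃ t z : ℂ, dom3 t z t ∧ restr (symThetaE 7) t z t ≠ 0 :=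
  exists_restr_symThetaE_ne_of_sum (by norm_num)
    (sum_pE_ne_zero (by norm_num) pairSum_seven (by norm_num))

lemma exists_restr_symThetaE_eight_ne :
    ∃ t : ℂ, 0 < t.im ∧ restr (symThetaE 8) t 0 t ≠ 0 := by
  refine exists_restr_symThetaE_ne (by norm_num) 0 ?_
  have h := sum_pE_ne_zero (ν := 8) (by norm_num) pairSum_eight (by norm_num)
  simpa [Int.emod_one] using h

lemma exists_restr_symThetaE_zero_ne :
    ∃ t : ℂ, 0 < t.im ∧ restr (symThetaE 0) t 0 t ≠ 0 := by
  by_contra! hc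
  have hlim := tendsto_thetaE (ν := 0) (c := 0) (fun x y _ =>
    add_nonneg (by exact_mod_cast bE_self_nonneg x) (by exact_mod_cast bE_self_nonneg y)) 0
  rw [tsum_eq_single (0, 0) fun p hp => if_neg fun h => hp ?_] at hlim
  · simp only [Int.cast_zero, mul_zero, zero_mul, Real.exp_zero, Complex.ofReal_one, one_mul,
      Complex.ofReal_zero, pow_zero, eC_zero, bE, zero_dotProduct, add_zero, if_true] at hlim
    refine one_ne_zero (tendsto_nhds_unique hlim (tendsto_const_nhds.congr' ?_))
    filter_upwards [eventually_gt_atTop 0] with T hT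
    have := hc (T * Complex.I) (by simpa using hT)
    rw [restr_symThetaE_diag, mul_eq_zero, or_iff_right (by norm_num), mul_zero, mul_zero] at this
    exact this.symm
  · have h1 : 0 ≤ bE p.1 p.1 := by exact_mod_cast bE_self_nonneg p.1
    have h2 : 0 ≤ bE p.2 p.2 := by exact_mod_cast bE_self_nonneg p.2
    have h4 : bE p.1 p.1 = 0 := by linarith
    have h5 : bE p.2 p.2 = 0 := by linarith
    exact Prod.ext (eq_zero_of_bE_self h4) (eq_zero_of_bE_self h5)

end

/-- The affine form on the upper half-space attached to a vector of signature `(2, 4)`. -/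
def ell (x : Fin 6 → ℝ) (Z : Matrix (Fin 2) (Fin 2) ℂ) : ℂ :=
  x 0 * (Z 0 0 * Z 1 1 - Z 0 1 * Z 1 0) + x 1 * Z 0 0 + x 2 * Z 1 1 +
    (x 4 + x 5 * (starRingEnd ℂ) (omg 7)) * Z 0 1 + (x 4 + x 5 * omg 7) * Z 1 0 + x 3

/-- The quadratic form of signature `(2, 4)`. -/
def isoForm {R : Type*} [CommRing R] (x : Fin 6 → R) : R :=
  x 0 * x 3 - x 1 * x 2 + (x 4 ^ 2 + x 4 * x 5 + 2 * x 5 ^ 2)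

/-- The nonzero isotropic integral vectors. -/
abbrev IsoVec : Type := {v : Fin 6 → ℤ // v ≠ 0 ∧ isoForm v = 0}

/-- The underlying real vector. -/
def IsoVec.real (v : IsoVec) : Fin 6 → ℝ := fun i => (v.1 i : ℝ)

/-- The Eisenstein series of weight six. -/
def eis6 (Z : Matrix (Fin 2) (Fin 2) ℂ) : ℂ := ∑' v : IsoVec, (ell v.real Z)⁻¹ ^ 6

lemma isoForm_real (v : IsoVec) : isoForm v.real = 0 := by
  have h := v.2.2
  unfold isoForm IsoVec.real at *
  exact_mod_cast h

lemma normSq_add_mul_omg (x y : ℝ) :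
    Complex.normSq (x + y * omg 7) = x ^ 2 + x * y + 2 * y ^ 2 := by
  have h : ((Complex.normSq (x + y * omg 7) : ℝ) : ℂ) = ((x ^ 2 + x * y + 2 * y ^ 2 : ℝ) : ℂ) := by
    rw [← Complex.mul_conj, map_add, map_mul, Complex.conj_ofReal, Complex.conj_ofReal, conj_omg]
    push_cast
    linear_combination (-(y : ℂ) ^ 2) * omg_sq
  exact_mod_cast h

lemma det_ne_zero_of_mem {t u v w : ℂ} (h : !![t, u; v, w] ∈ HH2) : t * w - u * v ≠ 0 := by
  intro h0
  obtain ⟨ht, hw, hn⟩ := mk_mem_HH2.1 h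
  have h1 : Complex.normSq (u - (starRingEnd ℂ) v) = ‖u‖ ^ 2 + ‖v‖ ^ 2 - 2 * (t * w).re := by
    rw [sub_eq_zero.1 h0, ← Complex.normSq_eq_norm_sq, ← Complex.normSq_eq_norm_sq]
    simp only [Complex.normSq_apply, Complex.sub_re, Complex.sub_im, Complex.conj_re,
      Complex.conj_im, Complex.mul_re]
    ring
  have h2 : ‖u‖ * ‖v‖ = ‖t‖ * ‖w‖ := by rw [← norm_mul, ← norm_mul, sub_eq_zero.1 h0]
  have h3 := Complex.re_le_norm (t * (starRingEnd ℂ) w)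
  rw [norm_mul, RCLike.norm_conj] at h3
  simp only [Complex.mul_re, Complex.conj_re, Complex.conj_im] at h1 h3
  nlinarith [sq_nonneg (‖u‖ - ‖v‖)]

lemma ell_ne_zero {x : Fin 6 → ℝ} (hx : x ≠ 0) (hQ : isoForm x = 0)
    {Z : Matrix (Fin 2) (Fin 2) ℂ} (hZ : Z ∈ HH2) : ell x Z ≠ 0 := by
  obtain ⟨t, u, v, w, rfl⟩ : ∃ t u v w : ℂ, Z = !![t, u; v, w] := ⟨_, _, _, _, Matrix.eta_fin_two Z⟩
  obtain ⟨ht, hw, hn⟩ := mk_mem_HH2.1 hZ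
  have ec : (x 4 + x 5 * (starRingEnd ℂ) (omg 7)) = (starRingEnd ℂ) (x 4 + x 5 * omg 7) := by
    simp
  have hN := normSq_add_mul_omg (x 4) (x 5)
  unfold isoForm at hQ
  unfold ell
  rw [ec]
  generalize hσ : (x 4 + x 5 * omg 7 : ℂ) = σ at *
  simp only [of_apply, cons_val', cons_val_zero, cons_val_one, cons_val_fin_one]
  by_cases ha : x 0 = 0
  · intro h0
    have hbc : x 1 * x 2 = Complex.normSq σ := by rw [hN]; rw [ha] at hQ; linarith
    have h1 : (x 1 * t.im + x 2 * w.im) ^ 2 ≤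
        Complex.normSq σ * Complex.normSq (u - (starRingEnd ℂ) v) := by
      rw [← Complex.normSq_conj σ, ← Complex.normSq_mul]
      have him := congrArg Complex.im h0
      have e : x 1 * t.im + x 2 * w.im =
          -((starRingEnd ℂ) σ * (u - (starRingEnd ℂ) v)).im := by
        simp [ha] at him ⊢
        linarith
      rw [e, neg_sq, Complex.normSq_apply]
      nlinarith [mul_self_nonneg ((starRingEnd ℂ) σ * (u - (starRingEnd ℂ) v)).re]
    have h2 : Complex.normSq σ = 0 := by
      by_contra h2
      have h3 := mul_lt_mul_of_pos_left hn
        (lt_of_le_of_ne (Complex.normSq_nonneg σ) (Ne.symm h2))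
      rw [← hbc] at h1 h3
      nlinarith [sq_nonneg (x 1 * t.im - x 2 * w.im)]
    rw [h2] at h1 hbc hN
    have h3 : x 1 * t.im + x 2 * w.im = 0 := by
      rw [zero_mul] at h1
      exact pow_eq_zero_iff two_ne_zero |>.1 (le_antisymm h1 (sq_nonneg _))
    have h12 : x 1 = 0 ∧ x 2 = 0 := by
      rcases mul_eq_zero.1 hbc with h | h <;> rw [h] at h3 <;> simpa [h, ht.ne', hw.ne'] using h3
    have h5 : x 5 = 0 := by nlinarith [sq_nonneg (2 * x 4 + x 5), sq_nonneg (x 5)]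
    have h4 : x 4 = 0 := by rw [h5] at hN; nlinarith [sq_nonneg (x 4)]
    rw [Complex.normSq_eq_zero.1 h2, ha, h12.1, h12.2] at h0
    have hd : x 3 = 0 := by simpa using h0
    exact hx (funext fun i => by fin_cases i <;> simp [ha, h12.1, h12.2, hd, h4, h5])
  · have hmem : !![t + ((x 2 / x 0 : ℝ) : ℂ), u - σ / x 0; v - (starRingEnd ℂ) σ / x 0,
        w + ((x 1 / x 0 : ℝ) : ℂ)] ∈ HH2 := by
      rw [mk_mem_HH2]
      refine ⟨by simpa using ht, by simpa using hw, ?_⟩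
      rw [Complex.add_im, Complex.add_im, Complex.ofReal_im, Complex.ofReal_im, add_zero, add_zero]
      convert hn using 2
      simp
    have := det_ne_zero_of_mem hmem
    intro h0
    apply this
    have ha' : (x 0 : ℂ) ≠ 0 := by exact_mod_cast ha
    have hQ' : (x 0 : ℂ) * x 3 - x 1 * x 2 + σ * (starRingEnd ℂ) σ = 0 := by
      rw [Complex.mul_conj, hN]
      exact_mod_cast hQ
    push_cast
    field_simp
    linear_combination x 0 * h0 - hQ'

/-- The matrix with given entries. -/
def matOf (c : Fin 4 → ℂ) : Matrix (Fin 2) (Fin 2) ℂ := !![c 0, c 1; c 2, c 3]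

lemma continuous_matOf : Continuous matOf := by
  refine continuous_matrix fun i j => ?_
  fin_cases i <;> fin_cases j <;> simp [matOf] <;> fun_prop

lemma ell_smul (s : ℝ) (x : Fin 6 → ℝ) (Z : Matrix (Fin 2) (Fin 2) ℂ) :
    ell (s • x) Z = s * ell x Z := by
  simp only [ell, Pi.smul_apply, smul_eq_mul, Complex.ofReal_mul]
  ring

lemma exists_norm_ell_ge {c₀ : Fin 4 → ℂ} (h : matOf c₀ ∈ HH2) : ∃ r > 0, ∃ ε > 0,
    ∀ c ∈ Metric.ball c₀ r, ∀ x : Fin 6 → ℝ, isoForm x = 0 → ε * ‖x‖ ≤ ‖ell x (matOf c)‖ := by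
  obtain ⟨r, hr, hb⟩ := Metric.nhds_basis_closedBall.mem_iff.1
    ((isOpen_HH2.preimage continuous_matOf).mem_nhds h)
  have hQ : Continuous fun x : Fin 6 → ℝ => isoForm x := by unfold isoForm; fun_prop
  have hK : IsCompact (Metric.closedBall c₀ r ×ˢ
      (Metric.sphere (0 : Fin 6 → ℝ) 1 ∩ {x | isoForm x = 0})) :=
    (isCompact_closedBall c₀ r).prod ((isCompact_sphere 0 1).inter_right
      (isClosed_eq hQ continuous_const))
  have hf : Continuous fun p : (Fin 4 → ℂ) × (Fin 6 → ℝ) => ‖ell p.2 (matOf p.1)‖ := by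
    simp only [ell, matOf, of_apply, cons_val', cons_val_zero, cons_val_one, cons_val_fin_one]
    fun_prop
  obtain ⟨ε, hε, hle⟩ := hK.exists_forall_le' hf.continuousOn (a := 0) fun p hp => by
    refine norm_pos_iff.2 (ell_ne_zero ?_ hp.2.2 (hb hp.1))
    intro h0
    have := hp.2.1
    simp [h0] at this
  refine ⟨r, hr, ε, hε, fun c hc x hx => ?_⟩
  by_cases h0 : x = 0
  · simp [h0]
  have hn : 0 < ‖x‖ := norm_pos_iff.2 h0
  have := hle (c, ‖x‖⁻¹ • x) ⟨Metric.ball_subset_closedBall hc, by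
    simp [norm_smul, hn.ne'], by
    have : isoForm (‖x‖⁻¹ • x) = (‖x‖⁻¹) ^ 2 * isoForm x := by
      simp only [isoForm, Pi.smul_apply, smul_eq_mul]; ring
    simp [this, hx]⟩
  simp only [ell_smul, norm_mul] at this
  rw [Complex.norm_real, norm_inv, norm_norm, inv_mul_eq_div, le_div_iff₀ hn] at this
  exact this

lemma one_le_norm_real (v : IsoVec) : 1 ≤ ‖v.real‖ := by
  obtain ⟨i, hi⟩ := Function.ne_iff.1 v.2.1
  refine le_trans ?_ (norm_le_pi_norm _ i)
  simp only [IsoVec.real, Real.norm_eq_abs]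
  exact_mod_cast Int.one_le_abs hi

/-- Coordinates determining an isotropic vector. -/
def isoCoord (v : IsoVec) : (Fin 5 → ℤ) × Bool :=
  (![v.1 0 + v.1 3, v.1 1, v.1 2, v.1 4, v.1 5], decide (v.1 0 ≤ v.1 3))

lemma isoCoord_injective : Function.Injective isoCoord := by
  intro v w h
  obtain ⟨h1, h2⟩ := Prod.mk.inj h
  have e := fun i => congrFun h1 i
  have e0 := e 0; have e1 := e 1; have e2 := e 2; have e3 := e 3; have e4 := e 4
  simp only [cons_val] at e0 e1 e2 e3 e4
  have hv := v.2.2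
  have hw := w.2.2
  unfold isoForm at hv hw
  rw [e1, e2, e3, e4] at hv
  have hm : (v.1 0 - w.1 0) * (v.1 0 - w.1 3) = 0 := by
    have : v.1 3 = w.1 0 + w.1 3 - v.1 0 := by linarith
    rw [this] at hv
    linear_combination -hv + hw
  have h2' : (v.1 0 ≤ v.1 3 ↔ w.1 0 ≤ w.1 3) := by simpa using h2
  have h0 : v.1 0 = w.1 0 := by
    rcases mul_eq_zero.1 hm with h | h <;> omega
  have h3 : v.1 3 = w.1 3 := by omega
  exact Subtype.ext (funext fun i => by fin_cases i <;> assumption)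

lemma summable_max_rpow : Summable fun k : ℤ => (max 1 |(k : ℝ)|) ^ (-(6 / 5) : ℝ) := by
  refine ((Real.summable_abs_int_rpow (b := 6 / 5) (by norm_num)).add
    (summable_of_finite_support (f := fun k : ℤ => if k = 0 then (1 : ℝ) else 0) ?_)).of_nonneg_of_le
      (fun k => by positivity) fun k => ?_
  · exact (Set.finite_singleton (0 : ℤ)).subset fun k hk => by simpa using hk
  · by_cases hk : k = 0
    · simp only [hk]; norm_num
    · have : (1 : ℝ) ≤ |(k : ℝ)| := by exact_mod_cast Int.one_le_abs hk
      rw [max_eq_right this]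
      simp [hk]

lemma summable_norm_real_pow : Summable fun v : IsoVec => (‖v.real‖ ^ 6)⁻¹ := by
  have h1 := (hasSum_prod_fin (n := 5) (fun (_ : Fin 5) (k : ℤ) =>
    (((max 1 |(k : ℝ)|) ^ (-(6 / 5) : ℝ) : ℝ) : ℂ)) fun _ => by
      simpa only [Complex.norm_real] using summable_max_rpow.norm).1
  have h2 : Summable fun p : (Fin 5 → ℤ) × Bool =>
      ‖∏ i, (((max 1 |(p.1 i : ℝ)|) ^ (-(6 / 5) : ℝ) : ℝ) : ℂ)‖ * 1 :=
    h1.mul_of_nonneg (g := fun _ : Bool => (1 : ℝ)) (hasSum_fintype _).summable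
      (fun _ => norm_nonneg _) fun _ => zero_le_one
  refine ((h2.comp_injective isoCoord_injective).mul_left (2 ^ 6)).of_nonneg_of_le
    (fun v => by positivity) fun v => ?_
  have hv := one_le_norm_real v
  have hi : ∀ i, |(v.1 i : ℝ)| ≤ ‖v.real‖ := fun i => norm_le_pi_norm v.real i
  have hb : ∀ i, max 1 |((isoCoord v).1 i : ℝ)| ≤ 2 * ‖v.real‖ := by
    intro i
    refine max_le (by linarith) ?_
    fin_cases i
    · simp only [isoCoord, Fin.zero_eta, cons_val_zero]
      push_cast
      linarith [abs_add_le (v.1 0 : ℝ) (v.1 3), hi 0, hi 3]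
    · exact (hi 1).trans (by linarith)
    · exact (hi 2).trans (by linarith)
    · exact (hi 4).trans (by linarith)
    · exact (hi 5).trans (by linarith)
  have hp : ∏ _i : Fin 5, (2 * ‖v.real‖) ^ (-(6 / 5) : ℝ) ≤
      ∏ i, (max 1 |((isoCoord v).1 i : ℝ)|) ^ (-(6 / 5) : ℝ) :=
    Finset.prod_le_prod (fun _ _ => by positivity) fun i _ =>
      Real.rpow_le_rpow_of_nonpos (by positivity) (hb i) (by norm_num)
  rw [Finset.prod_const, Finset.card_univ, Fintype.card_fin, ← Real.rpow_natCast,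
    ← Real.rpow_mul (by positivity)] at hp
  norm_num at hp
  rw [mul_pow, mul_inv] at hp
  simp only [Function.comp, mul_one]
  rw [← Complex.ofReal_prod, Complex.norm_real, Real.norm_eq_abs, abs_of_nonneg
    (Finset.prod_nonneg fun _ _ => by positivity)]
  have : (‖v.real‖ ^ 6)⁻¹ = 2 ^ 6 * ((2 ^ 6)⁻¹ * (‖v.real‖ ^ 6)⁻¹) := by ring
  rw [this]
  refine mul_le_mul_of_nonneg_left ?_ (by positivity)
  norm_num at hp ⊢
  exact hp

lemma norm_inv_pow_le {ε n : ℝ} {z : ℂ} (hε : 0 < ε) (hn : 0 < n) (h : ε * n ≤ ‖z‖) (k : ℕ) :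
    ‖z⁻¹ ^ k‖ ≤ (ε ^ k)⁻¹ * (n ^ k)⁻¹ := by
  rw [norm_pow, norm_inv, inv_pow, ← mul_inv, ← mul_pow]
  exact inv_anti₀ (by positivity) (pow_le_pow_left₀ (by positivity) h k)

/-- The derivative of the affine form. -/
def ellDeriv (x : Fin 6 → ℝ) (c : Fin 4 → ℂ) : (Fin 4 → ℂ) →L[ℂ] ℂ :=
  (x 0 * c 3 + x 1 : ℂ) • ContinuousLinearMap.proj 0 +
  (-(x 0 * c 2) + (x 4 + x 5 * (starRingEnd ℂ) (omg 7)) : ℂ) • ContinuousLinearMap.proj 1 +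
  (-(x 0 * c 1) + (x 4 + x 5 * omg 7) : ℂ) • ContinuousLinearMap.proj 2 +
  (x 0 * c 0 + x 2 : ℂ) • ContinuousLinearMap.proj 3

lemma hasFDerivAt_ell (x : Fin 6 → ℝ) (c : Fin 4 → ℂ) :
    HasFDerivAt (fun c => ell x (matOf c)) (ellDeriv x c) c := by
  have hp : ∀ i, HasFDerivAt (fun c : Fin 4 → ℂ => c i)
      (ContinuousLinearMap.proj (R := ℂ) (φ := fun _ : Fin 4 => ℂ) i) c := fun i => hasFDerivAt_apply i c
  have h := (((((((hp 0).mul (hp 3)).sub ((hp 1).mul (hp 2))).const_mul (x 0 : ℂ)).add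
    ((hp 0).const_mul (x 1 : ℂ))).add ((hp 3).const_mul (x 2 : ℂ))).add
    ((hp 1).const_mul (x 4 + x 5 * (starRingEnd ℂ) (omg 7) : ℂ))).add
    ((hp 2).const_mul (x 4 + x 5 * omg 7 : ℂ))
  refine (h.add_const (x 3 : ℂ)).congr_fderiv ?_
  ext i
  simp [ellDeriv]
  ring

lemma norm_ellDeriv_le (x : Fin 6 → ℝ) (c : Fin 4 → ℂ) :
    ‖ellDeriv x c‖ ≤ (4 * ‖c‖ + 10) * ‖x‖ := by
  have hx : ∀ i, ‖(x i : ℂ)‖ ≤ ‖x‖ := fun i => by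
    rw [Complex.norm_real]; exact norm_le_pi_norm x i
  have hc : ∀ i, ‖c i‖ ≤ ‖c‖ := norm_le_pi_norm c
  have hx0 := norm_nonneg x
  have hc0 := norm_nonneg c
  have hp : ∀ i, ‖ContinuousLinearMap.proj (R := ℂ) (φ := fun _ : Fin 4 => ℂ) i‖ ≤ 1 := fun i =>
    ContinuousLinearMap.opNorm_le_bound _ zero_le_one fun v => by
      rw [one_mul]; exact norm_le_pi_norm v i
  have ho : ‖omg 7‖ ≤ 2 := by
    have h := omg_mul_conj
    have h2 : ‖omg 7‖ ^ 2 = 2 := by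
      rw [← Complex.normSq_eq_norm_sq]
      rw [Complex.mul_conj] at h
      exact_mod_cast h
    nlinarith [norm_nonneg (omg 7)]
  have hm : ∀ i j, ‖(x i : ℂ) * c j‖ ≤ ‖x‖ * ‖c‖ := fun i j => by
    rw [norm_mul]; exact mul_le_mul (hx i) (hc j) (norm_nonneg _) hx0
  have hs : ∀ (a : ℂ) i, ‖a • ContinuousLinearMap.proj (R := ℂ) (φ := fun _ : Fin 4 => ℂ) i‖ ≤ ‖a‖ :=
    fun a i => by
      rw [norm_smul]; exact mul_le_of_le_one_right (norm_nonneg _) (hp i)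
  have h5 : ‖(x 5 : ℂ) * omg 7‖ ≤ ‖x‖ * 2 := by
    rw [norm_mul]; exact mul_le_mul (hx 5) ho (norm_nonneg _) hx0
  have h5' : ‖(x 5 : ℂ) * (starRingEnd ℂ) (omg 7)‖ ≤ ‖x‖ * 2 := by
    rw [norm_mul, RCLike.norm_conj]; exact mul_le_mul (hx 5) ho (norm_nonneg _) hx0
  unfold ellDeriv
  refine (norm_add_le _ _).trans (le_trans (add_le_add ((norm_add_le _ _).trans (add_le_add
    ((norm_add_le _ _).trans (add_le_add (hs _ _) (hs _ _))) (hs _ _))) (hs _ _)) ?_)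
  have a1 := norm_add_le ((x 0 : ℂ) * c 3) (x 1)
  have a2 := norm_add_le (-((x 0 : ℂ) * c 2)) (x 4 + x 5 * (starRingEnd ℂ) (omg 7))
  have a3 := norm_add_le (-((x 0 : ℂ) * c 1)) (x 4 + x 5 * omg 7)
  have a4 := norm_add_le ((x 0 : ℂ) * c 0) (x 2)
  have a5 := norm_add_le (x 4 : ℂ) (x 5 * (starRingEnd ℂ) (omg 7))
  have a6 := norm_add_le (x 4 : ℂ) (x 5 * omg 7)
  rw [norm_neg] at a2 a3
  linarith [hm 0 0, hm 0 1, hm 0 2, hm 0 3, hx 1, hx 2, hx 4]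

lemma differentiableOn_eis6 : DifferentiableOn ℂ eis6 HH2 := by
  intro Z₀ hZ₀
  let v : Matrix (Fin 2) (Fin 2) ℂ → Fin 4 → ℂ := fun Z => ![Z 0 0, Z 0 1, Z 1 0, Z 1 1]
  have hv : Differentiable ℂ v := by
    refine differentiable_pi.2 fun i => ?_
    fin_cases i <;> simp only [v, Fin.zero_eta, Fin.mk_one, Fin.reduceFinMk, cons_val] <;> fun_prop
  have hgv : ∀ Z, matOf (v Z) = Z := fun Z => (Matrix.eta_fin_two Z).symm
  obtain ⟨r, hr, ε, hε, hb⟩ := exists_norm_ell_ge (c₀ := v Z₀) (by rwa [hgv])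
  have hlow : ∀ c ∈ Metric.ball (v Z₀) r, ∀ w : IsoVec, ε * ‖w.real‖ ≤ ‖ell w.real (matOf c)‖ :=
    fun c hc w => hb c hc _ (isoForm_real w)
  have hpos : ∀ w : IsoVec, 0 < ‖w.real‖ := fun w => one_pos.trans_le (one_le_norm_real w)
  have hne : ∀ c ∈ Metric.ball (v Z₀) r, ∀ w : IsoVec, ell w.real (matOf c) ≠ 0 := fun c hc w =>
    norm_pos_iff.1 ((mul_pos hε (hpos w)).trans_le (hlow c hc w))
  have hd : ∀ (w : IsoVec), ∀ c ∈ Metric.ball (v Z₀) r,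
      HasFDerivAt (fun c => (ell w.real (matOf c))⁻¹ ^ 6)
        ((-6 * (ell w.real (matOf c))⁻¹ ^ 7) • ellDeriv w.real c) c := by
    intro w c hc
    have h1 := (((hasDerivAt_inv (hne c hc w)).pow 6).comp_hasFDerivAt c (hasFDerivAt_ell w.real c))
    refine h1.congr_fderiv ?_
    congr 1
    have := hne c hc w
    simp only [inv_pow]
    push_cast
    field_simp
  have hx : v Z₀ ∈ Metric.ball (v Z₀) r := Metric.mem_ball_self hr
  have hle : ∀ (w : IsoVec), ∀ c ∈ Metric.ball (v Z₀) r,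
      ‖(-6 * (ell w.real (matOf c))⁻¹ ^ 7) • ellDeriv w.real c‖ ≤
        (6 * (ε ^ 7)⁻¹ * (4 * (‖v Z₀‖ + r) + 10)) * (‖w.real‖ ^ 6)⁻¹ := by
    intro w c hc
    have hp := hpos w
    have h1 := norm_inv_pow_le hε hp (hlow c hc w) 7
    have hc' : ‖c‖ ≤ ‖v Z₀‖ + r := by
      have := norm_le_norm_add_norm_sub' c (v Z₀)
      have h3 := (mem_ball_iff_norm.1 hc).le
      linarith
    have h2 : ‖ellDeriv w.real c‖ ≤ (4 * (‖v Z₀‖ + r) + 10) * ‖w.real‖ :=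
      (norm_ellDeriv_le w.real c).trans (mul_le_mul_of_nonneg_right (by linarith) hp.le)
    rw [norm_smul, norm_mul]
    have h6 : ‖(-6 : ℂ)‖ = 6 := by simp
    rw [h6]
    calc _ ≤ 6 * ((ε ^ 7)⁻¹ * (‖w.real‖ ^ 7)⁻¹) * ((4 * (‖v Z₀‖ + r) + 10) * ‖w.real‖) :=
          mul_le_mul (mul_le_mul_of_nonneg_left h1 (by norm_num)) h2 (norm_nonneg _) (by positivity)
      _ = _ := by field_simp
  have hs : Summable fun w : IsoVec => (ell w.real (matOf (v Z₀)))⁻¹ ^ 6 :=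
    Summable.of_norm_bounded (summable_norm_real_pow.mul_left _)
      fun w => norm_inv_pow_le hε (hpos w) (hlow _ hx w) 6
  have key : DifferentiableAt ℂ (fun c => eis6 (matOf c)) (v Z₀) :=
    (hasFDerivAt_tsum_of_isPreconnected (𝕜 := ℂ)
      (f := fun (w : IsoVec) c => (ell w.real (matOf c))⁻¹ ^ 6)
      (summable_norm_real_pow.mul_left _) Metric.isOpen_ball
      (convex_ball (v Z₀) r).isPreconnected hd hle hx hs hx).differentiableAt
  have := key.comp Z₀ (hv Z₀)
  simp only [Function.comp_def, hgv] at this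
  exact this.differentiableWithinAt

lemma eis6_eq_of_bij {Z Z' : Matrix (Fin 2) (Fin 2) ℂ} {j : ℂ} (hj : j ≠ 0)
    (f g : (Fin 6 → ℤ) → Fin 6 → ℤ) (hfg : ∀ v, f (g v) = v) (hgf : ∀ v, g (f v) = v)
    (hf : f 0 = 0) (hg : g 0 = 0) (hQ : ∀ v, isoForm (f v) = isoForm v)
    (h : ∀ v : Fin 6 → ℤ, ell (fun i => (v i : ℝ)) Z' * j = ell (fun i => (f v i : ℝ)) Z) :
    eis6 Z' = j ^ 6 * eis6 Z := by
  let e : IsoVec ≃ IsoVec :=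
    { toFun := fun v => ⟨f v.1, fun h0 => v.2.1 (by rw [← hgf v.1, h0, hg]), by rw [hQ, v.2.2]⟩
      invFun := fun v => ⟨g v.1, fun h0 => v.2.1 (by rw [← hfg v.1, h0, hf]), by
        rw [← hQ, hfg, v.2.2]⟩
      left_inv := fun v => Subtype.ext (hgf v.1)
      right_inv := fun v => Subtype.ext (hfg v.1) }
  unfold eis6
  rw [← e.tsum_eq fun v : IsoVec => (ell v.real Z)⁻¹ ^ 6, ← tsum_mul_left]
  refine tsum_congr fun v => ?_
  have : ell (e v).real Z = ell v.real Z' * j := (h v.1).symm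
  rw [this, mul_inv, mul_pow, inv_pow j]
  field_simp

lemma isHMF_eis6 : IsHMF 7 6 eis6 := by
  refine isHMF_of_generators differentiableOn_eis6 ?_ ?_ ?_ ?_
  · rintro A D _ ⟨p, q, rfl⟩ t u v w -
    let f : ℤ → ℤ → ℤ → ℤ → (Fin 6 → ℤ) → Fin 6 → ℤ := fun A D p q v =>
      ![v 0, v 1 + v 0 * D, v 2 + v 0 * A,
        v 3 + v 1 * A + v 2 * D + (2 * v 4 * p + v 4 * q + v 5 * p + 4 * v 5 * q) +
          v 0 * (A * D - (p ^ 2 + p * q + 2 * q ^ 2)),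
        v 4 - v 0 * p, v 5 - v 0 * q]
    have h := eis6_eq_of_bij (Z := !![t, u; v, w])
      (Z' := !![t + A, u + (p + q * omg 7); v + (starRingEnd ℂ) (p + q * omg 7), w + D])
      one_ne_zero (f A D p q) (f (-A) (-D) (-p) (-q))
      (fun v => by ext i; fin_cases i <;> simp [f] <;> ring)
      (fun v => by ext i; fin_cases i <;> simp [f] <;> ring)
      (by ext i; fin_cases i <;> simp [f]) (by ext i; fin_cases i <;> simp [f])
      (fun v => by simp [f, isoForm]; ring)
      (fun x => by
        simp [f, ell, conj_omg]
        linear_combination (-2 * (x 5 : ℂ) * q + x 0 * q ^ 2) * omg_sq)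
    rwa [one_pow, one_mul] at h
  · rintro _ ⟨p, q, rfl⟩ t u v w -
    let f : ℤ → ℤ → (Fin 6 → ℤ) → Fin 6 → ℤ := fun p q v =>
      ![v 0, v 1, v 2 + v 1 * (p ^ 2 + p * q + 2 * q ^ 2) +
        (2 * v 4 * p + v 4 * q + v 5 * p + 4 * v 5 * q), v 3, v 4 + v 1 * p, v 5 + v 1 * q]
    have h := eis6_eq_of_bij (Z := !![t, u; v, w])
      (Z' := !![t + (p + q * omg 7) * v + (starRingEnd ℂ) (p + q * omg 7) * u +
        (p + q * omg 7) * (starRingEnd ℂ) (p + q * omg 7) * w, u + (p + q * omg 7) * w;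
        v + (starRingEnd ℂ) (p + q * omg 7) * w, w])
      one_ne_zero (f p q) (f (-p) (-q))
      (fun v => by ext i; fin_cases i <;> simp [f] <;> ring)
      (fun v => by ext i; fin_cases i <;> simp [f] <;> ring)
      (by ext i; fin_cases i <;> simp [f]) (by ext i; fin_cases i <;> simp [f])
      (fun v => by simp [f, isoForm]; ring)
      (fun x => by
        simp [f, ell, conj_omg]
        linear_combination (-2 * (x 5 : ℂ) * q - x 1 * q ^ 2) * w * omg_sq)
    rwa [one_pow, one_mul] at h
  · rintro t u v w -
    let f : (Fin 6 → ℤ) → Fin 6 → ℤ := fun v => ![v 0, v 2, v 1, v 3, -(v 4 + v 5), v 5]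
    have hf : ∀ v, f (f v) = v := fun v => by ext i; fin_cases i <;> simp [f]
    have h := eis6_eq_of_bij (Z := !![t, u; v, w]) (Z' := !![w, -v; -u, t])
      one_ne_zero f f hf hf
      (by ext i; fin_cases i <;> simp [f]) (by ext i; fin_cases i <;> simp [f])
      (fun v => by simp [f, isoForm]; ring)
      (fun x => by simp [f, ell, conj_omg]; ring)
    rwa [one_pow, one_mul] at h
  · intro t u v w hZ
    have ht := im_pos_ne_zero (mk_mem_HH2.mp hZ).1
    let f : (Fin 6 → ℤ) → Fin 6 → ℤ := fun v => ![v 2, v 3, -v 0, -v 1, v 4, v 5]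
    let g : (Fin 6 → ℤ) → Fin 6 → ℤ := fun v => ![-v 2, -v 3, v 0, v 1, v 4, v 5]
    exact eis6_eq_of_bij (Z := !![t, u; v, w]) ht f g
      (fun v => by ext i; fin_cases i <;> simp [f, g])
      (fun v => by ext i; fin_cases i <;> simp [f, g])
      (by ext i; fin_cases i <;> simp [f]) (by ext i; fin_cases i <;> simp [g])
      (fun v => by simp [f, isoForm]; ring)
      (fun x => by simp [f, ell, conj_omg]; field_simp; ring)

/-- The vectors orthogonal to the cusp. -/
def IsoVec.IsCusp (v : IsoVec) : Prop :=
  v.1 0 = 0 ∧ v.1 1 = 0 ∧ v.1 2 = 0 ∧ v.1 4 = 0 ∧ v.1 5 = 0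

lemma normSq_ell_diag (v : IsoVec) (y : ℝ) :
    Complex.normSq (ell v.real !![y * Complex.I, 0; 0, y * Complex.I]) =
      (v.1 0 : ℝ) ^ 2 * y ^ 4 + (v.1 3 : ℝ) ^ 2 + y ^ 2 * ((v.1 1 : ℝ) ^ 2 + (v.1 2 : ℝ) ^ 2 +
        (v.1 4 : ℝ) ^ 2 + ((v.1 4 : ℝ) + v.1 5) ^ 2 + 3 * (v.1 5 : ℝ) ^ 2) := by
  have hQ := isoForm_real v
  have e : ell v.real !![y * Complex.I, 0; 0, y * Complex.I] =
      ((v.1 3 - v.1 0 * y ^ 2 : ℝ) : ℂ) + ((y * (v.1 1 + v.1 2) : ℝ) : ℂ) * Complex.I := by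
    simp [ell, IsoVec.real]
    linear_combination (v.1 0 : ℂ) * y ^ 2 * Complex.I_sq
  rw [e, Complex.normSq_add_mul_I]
  unfold isoForm IsoVec.real at hQ
  linear_combination (-2 * y ^ 2) * hQ

lemma norm_real_le_norm_ell {v : IsoVec} {y : ℝ} (hy : 1 ≤ y) :
    ‖v.real‖ ≤ ‖ell v.real !![y * Complex.I, 0; 0, y * Complex.I]‖ := by
  refine (pi_norm_le_iff_of_nonneg (norm_nonneg _)).2 fun i => ?_
  rw [Real.norm_eq_abs]
  refine abs_le_of_sq_le_sq ?_ (norm_nonneg _)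
  rw [← Complex.normSq_eq_norm_sq, normSq_ell_diag]
  have h2 : 1 ≤ y ^ 2 := one_le_pow₀ hy
  have h4 : 1 ≤ y ^ 4 := one_le_pow₀ hy
  have a0 := mul_le_mul_of_nonneg_left h4 (sq_nonneg (v.1 0 : ℝ))
  have a1 := mul_le_mul_of_nonneg_right h2 (sq_nonneg (v.1 1 : ℝ))
  have a2 := mul_le_mul_of_nonneg_right h2 (sq_nonneg (v.1 2 : ℝ))
  have a4 := mul_le_mul_of_nonneg_right h2 (sq_nonneg (v.1 4 : ℝ))
  have a5 := mul_le_mul_of_nonneg_right h2 (sq_nonneg (v.1 5 : ℝ))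
  have a6 := mul_le_mul_of_nonneg_right h2 (sq_nonneg ((v.1 4 : ℝ) + v.1 5))
  have b0 := sq_nonneg (v.1 0 : ℝ)
  have b1 := sq_nonneg (v.1 1 : ℝ)
  have b2 := sq_nonneg (v.1 2 : ℝ)
  have b3 := sq_nonneg (v.1 3 : ℝ)
  have b4 := sq_nonneg (v.1 4 : ℝ)
  have b5 := sq_nonneg (v.1 5 : ℝ)
  have b6 := sq_nonneg ((v.1 4 : ℝ) + v.1 5)
  fin_cases i <;> simp only [IsoVec.real, Fin.zero_eta, Fin.mk_one, Fin.reduceFinMk] <;> linarith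

lemma le_norm_ell {v : IsoVec} (hv : ¬ v.IsCusp) {y : ℝ} (hy : 1 ≤ y) :
    y ≤ ‖ell v.real !![y * Complex.I, 0; 0, y * Complex.I]‖ := by
  refine le_of_sq_le_sq (b := _) ?_ (norm_nonneg _)
  rw [← Complex.normSq_eq_norm_sq, normSq_ell_diag]
  have h2 : 1 ≤ y ^ 2 := one_le_pow₀ hy
  have key : (1 : ℝ) ≤ (v.1 0 : ℝ) ^ 2 + ((v.1 1 : ℝ) ^ 2 + (v.1 2 : ℝ) ^ 2 +
        (v.1 4 : ℝ) ^ 2 + ((v.1 4 : ℝ) + v.1 5) ^ 2 + 3 * (v.1 5 : ℝ) ^ 2) := by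
    have : (1 : ℤ) ≤ (v.1 0) ^ 2 + ((v.1 1) ^ 2 + (v.1 2) ^ 2 +
        (v.1 4) ^ 2 + ((v.1 4) + v.1 5) ^ 2 + 3 * (v.1 5) ^ 2) := by
      by_contra hlt
      push Not at hlt
      have b0 := sq_nonneg (v.1 0)
      have b1 := sq_nonneg (v.1 1)
      have b2 := sq_nonneg (v.1 2)
      have b4 := sq_nonneg (v.1 4)
      have b5 := sq_nonneg (v.1 5)
      have b6 := sq_nonneg (v.1 4 + v.1 5)
      exact hv ⟨pow_eq_zero_iff two_ne_zero |>.1 (by omega), pow_eq_zero_iff two_ne_zero |>.1 (by omega),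
        pow_eq_zero_iff two_ne_zero |>.1 (by omega), pow_eq_zero_iff two_ne_zero |>.1 (by omega),
        pow_eq_zero_iff two_ne_zero |>.1 (by omega)⟩
    exact_mod_cast this
  have k2 := mul_le_mul_of_nonneg_left key (sq_nonneg y)
  have k3 := mul_le_mul_of_nonneg_left h2 (mul_nonneg (sq_nonneg (v.1 0 : ℝ)) (sq_nonneg y))
  nlinarith [sq_nonneg (v.1 3 : ℝ)]

open Classical in
lemma exists_eis6_ne : ∃ y : ℝ, 0 < y ∧ eis6 !![y * Complex.I, 0; 0, y * Complex.I] ≠ 0 := by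
  let L : IsoVec → ℝ := fun v => if v.IsCusp then ((v.1 3 : ℝ)⁻¹) ^ 6 else 0
  have hlim : Tendsto (fun y : ℝ => eis6 !![y * Complex.I, 0; 0, y * Complex.I]) atTop
      (𝓝 (∑' v, (L v : ℂ))) := by
    refine tendsto_tsum_of_dominated_convergence summable_norm_real_pow (fun v => ?_)
      ((eventually_ge_atTop 1).mono fun y hy v => ?_)
    · by_cases hv : v.IsCusp
      · refine tendsto_const_nhds.congr fun y => ?_
        obtain ⟨h0, h1, h2, h4, h5⟩ := id hv
        simp [L, hv, ell, IsoVec.real, h0, h1, h2, h4, h5]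
      · simp only [L, hv, if_false, Complex.ofReal_zero]
        refine squeeze_zero_norm' ((eventually_ge_atTop 1).mono fun y hy =>
          norm_inv_pow_le one_pos (one_pos.trans_le hy) (by rw [one_mul]; exact le_norm_ell hv hy) 6) ?_
        have := (tendsto_pow_atTop (α := ℝ) (n := 6) (by norm_num)).inv_tendsto_atTop
        simpa [Pi.inv_def] using this
    · have := norm_inv_pow_le one_pos (one_pos.trans_le (one_le_norm_real v))
        (by rw [one_mul]; exact norm_real_le_norm_ell hy) 6
      simpa using this
  have hL0 : ∀ v, 0 ≤ L v := fun v => by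
    by_cases hv : v.IsCusp
    · simp only [L, hv, if_true]; positivity
    · simp [L, hv]
  have hLs : Summable L := by
    refine summable_norm_real_pow.of_nonneg_of_le hL0 fun v => ?_
    by_cases hv : v.IsCusp
    · have h := norm_real_le_norm_ell (v := v) le_rfl
      obtain ⟨h0, h1, h2, h4, h5⟩ := id hv
      simp [ell, IsoVec.real, h0, h1, h2, h4, h5] at h
      simp only [L, hv, if_true]
      have hp := one_le_norm_real v
      rw [← Even.pow_abs (by decide : Even 6), abs_inv, inv_pow]
      exact inv_anti₀ (by positivity) (pow_le_pow_left₀ (by positivity) h 6)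
    · simp [L, hv]
  let v₀ : IsoVec := ⟨![0, 0, 0, 1, 0, 0], fun h => by simpa using congrFun h 3, by simp [isoForm]⟩
  have hpos : 0 < ∑' v, L v := hLs.tsum_pos hL0 v₀ (by
    have : v₀.IsCusp := by simp [v₀, IsoVec.IsCusp]
    simp only [L, this, if_true]
    simp [v₀])
  have hne : (∑' v, (L v : ℂ)) ≠ 0 := by
    rw [← Complex.ofReal_tsum]
    exact_mod_cast hpos.ne'
  obtain ⟨y, hy⟩ := ((hlim.eventually_ne hne).and (eventually_gt_atTop 0)).exists
  exact ⟨y, hy.2, hy.1⟩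

lemma symMonos_four_subset :
    symMonos (4 : ℕ) ⊆ {fun t w => ModularForm.E₄ t * ModularForm.E₄ w} := by
  rintro _ ⟨a, b, c, h, rfl⟩
  obtain ⟨rfl, rfl, rfl⟩ : a = 1 ∧ b = 0 ∧ c = 0 := by omega
  simp

lemma symMonos_six_subset :
    symMonos (6 : ℕ) ⊆ {fun t w => ModularForm.E₆ t * ModularForm.E₆ w} := by
  rintro _ ⟨a, b, c, h, rfl⟩
  obtain ⟨rfl, rfl, rfl⟩ : a = 0 ∧ b = 1 ∧ c = 0 := by omega
  simp

/-- The symmetric Eisenstein series of weight six. -/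
def symEis6 (τ : Matrix (Fin 2) (Fin 2) ℂ) : ℂ := eis6 τ + (-1) ^ 6 * eis6 τᵀ

lemma isSymHMF_symEis6 : IsSymHMF 7 6 symEis6 := isHMF_eis6.symmetrize

lemma exists_restr_symEis6_ne : ∃ t : ℂ, 0 < t.im ∧ restr symEis6 t 0 t ≠ 0 := by
  obtain ⟨y, hy, hne⟩ := exists_eis6_ne
  refine ⟨y * Complex.I, by simpa using hy, ?_⟩
  have : restr symEis6 (y * Complex.I) 0 (y * Complex.I) =
      2 * eis6 !![y * Complex.I, 0; 0, y * Complex.I] := by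
    rw [restr, symEis6, transpose_mk, mul_zero, mul_zero]
    ring
  rw [this]
  exact mul_ne_zero two_ne_zero hne

/-- The generators. -/
def gens : Fin 6 → Matrix (Fin 2) (Fin 2) ℂ → ℂ :=
  ![symThetaE 0, symEis6, symThetaE 4, symThetaE 6, symThetaE 7, symThetaE 8]

lemma exists_poly_of_mem_adjoin {ι : Type*} {f : ι → ℂ → ℂ → ℂ → ℂ} {Q : ℂ → ℂ → ℂ → ℂ}
    (hQ : Q ∈ Algebra.adjoin ℂ (Set.range f)) :
    ∃ P : MvPolynomial ι ℂ, ∀ t z w, Q t z w = MvPolynomial.eval (fun i => f i t z w) P := by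
  rw [Algebra.adjoin_range_eq_range_aeval] at hQ
  obtain ⟨P, rfl⟩ := hQ
  refine ⟨P, fun t z w => ?_⟩
  let ev : (ℂ → ℂ → ℂ → ℂ) →ₐ[ℂ] ℂ :=
    ((Pi.evalAlgHom ℂ (fun _ : ℂ => ℂ) w).comp (Pi.evalAlgHom ℂ (fun _ : ℂ => ℂ → ℂ) z)).comp
      (Pi.evalAlgHom ℂ (fun _ : ℂ => ℂ → ℂ → ℂ) t)
  rw [← MvPolynomial.coe_aeval_eq_eval]
  exact MvPolynomial.comp_aeval_apply (f := f) ev P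

lemma exists_poly_restr {k : ℕ} {F : Matrix (Fin 2) (Fin 2) ℂ → ℂ} (hF : IsSymHMF 7 k F) :
    ∃ P : MvPolynomial (Fin 6) ℂ, ∀ t z w, dom3 t z w →
      restr F t z w = MvPolynomial.eval (fun i => restr (gens i) t z w) P := by
  set A := Algebra.adjoin ℂ (Set.range fun i => restr (gens i)) with hA
  have hmem : ∀ i, restr (gens i) ∈ A := fun i => Algebra.subset_adjoin ⟨i, rfl⟩
  obtain ⟨t₀, ht₀, h₀⟩ := exists_restr_symThetaE_zero_ne
  obtain ⟨t₁, ht₁, h₁⟩ := exists_restr_symEis6_ne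
  obtain ⟨t₂, z₂, hd₂, h₂⟩ := exists_restr_symThetaE_four_ne
  obtain ⟨t₃, z₃, hd₃, h₃⟩ := exists_restr_symThetaE_six_ne
  obtain ⟨t₄, z₄, hd₄, h₄⟩ := exists_restr_symThetaE_seven_ne
  obtain ⟨t₅, ht₅, h₅⟩ := exists_restr_symThetaE_eight_ne
  have hR : ∀ ν, RestrLaws (4 + ν) (restr (symThetaE ν)) := fun ν => (isSymHMF_symThetaE ν).restrLaws
  have hG : ∀ ν, GoodH (restr (symThetaE ν)) := fun ν => goodH_restr (isSymHMF_symThetaE ν).1.1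
  have m0 : restr (symThetaE 0) ∈ A := hmem 0
  have m1 : restr symEis6 ∈ A := hmem 1
  have m2 : restr (symThetaE 4) ∈ A := hmem 2
  have m3 : restr (symThetaE 6) ∈ A := hmem 3
  have m4 : restr (symThetaE 7) ∈ A := hmem 4
  have m5 : restr (symThetaE 8) ∈ A := hmem 5
  have l0 := mem_leads_of_unique symMonos_four_subset m0 (hR 0) (hG 0) ht₀ ht₀ h₀
  have l1 := mem_leads_of_unique symMonos_six_subset m1 isSymHMF_symEis6.restrLaws
      (goodH_restr isSymHMF_symEis6.1.1) ht₁ ht₁ h₁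
  have l2 := discriminant_mem_leads_of_cusp (n := 4 + 4) (m := 4) rfl (by decide) m2 (hR 4) (hG 4)
      (symThetaE_cusp (by norm_num)) hd₂ h₂
  have l3 := discriminant_mem_leads_of_cusp (n := 4 + 6) (m := 2) rfl (by decide) m3 (hR 6) (hG 6)
      (symThetaE_cusp (by norm_num)) hd₃ h₃
  have l4 := discriminant_mem_leads_of_cusp (n := 4 + 7) (m := 1) rfl (by decide) m4 (hR 7) (hG 7)
      (symThetaE_cusp (by norm_num)) hd₄ h₄
  have r5 := hR 8
  have c5 := symThetaE_cusp (ν := 8) (by norm_num)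
  rw [show 4 + 8 = 12 from rfl] at r5 c5
  have l5 := discriminant_mem_leads_zero m5 r5 (hG 8) c5 ht₅ ht₅ h₅
  obtain ⟨Q, hQA, hQ⟩ := RestrLaws.exists_mem (A := A) l0 l1 l5 l2 l3 l4
    hF.restrLaws (goodH_restr hF.1.1)
  obtain ⟨P, hP⟩ := exists_poly_of_mem_adjoin hQA
  exact ⟨P, fun t z w h => (hQ t z w h).trans (hP t z w)⟩

lemma dom3_of_symm {τ : Matrix (Fin 2) (Fin 2) ℂ} (h : τ ∈ HH2) (hs : τᵀ = τ) :
    dom3 (τ 0 0) (τ 0 1) (2 * τ 1 1) := by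
  have e : τ 1 0 = τ 0 1 := congrFun (congrFun hs 0) 1
  rw [Matrix.eta_fin_two τ, mk_mem_HH2, e, Complex.sub_conj] at h
  obtain ⟨h1, h2, h3⟩ := h
  refine ⟨h1, by simpa using h2, ?_⟩
  simp [Complex.normSq_apply] at h3 ⊢
  nlinarith

/-- For K = ℚ(√-7) and λ = (1+√-7)/2 (of norm 2), there are symmetric Hermitian
modular forms of weights 4, 6, 8, 10, 11, 12 such that every symmetric Hermitian modular form
agrees with a polynomial in them after subtracting which it vanishes on the Heegner divisor
ℋ₂, i.e. its compositions with φ_λ agree. -/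
theorem reduction_against_H2_seven :
    ∃ g : Fin 6 → (Matrix (Fin 2) (Fin 2) ℂ → ℂ),
      IsSymHMF 7 4 (g 0) ∧ IsSymHMF 7 6 (g 1) ∧ IsSymHMF 7 8 (g 2) ∧
      IsSymHMF 7 10 (g 3) ∧ IsSymHMF 7 11 (g 4) ∧ IsSymHMF 7 12 (g 5) ∧
      ∀ k : ℕ, ∀ F : Matrix (Fin 2) (Fin 2) ℂ → ℂ, IsSymHMF 7 k F →
        ∃ P : MvPolynomial (Fin 6) ℂ,
          ∀ τ ∈ HH2, τᵀ = τ →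
            F (phiLam (omg 7) τ)
              = MvPolynomial.eval (fun i => g i (phiLam (omg 7) τ)) P := by
  refine ⟨gens, isSymHMF_symThetaE 0, isSymHMF_symEis6, isSymHMF_symThetaE 4, isSymHMF_symThetaE 6,
    isSymHMF_symThetaE 7, isSymHMF_symThetaE 8, fun k F hF => ?_⟩
  obtain ⟨P, hP⟩ := exists_poly_restr hF
  refine ⟨P, fun τ hτ hs => ?_⟩
  simp only [restr_phiLam]
  exact hP _ _ _ (dom3_of_symm hτ hs)

end
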